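/- Let M be an n-vertex combinatorial d-manifold whose geometric carrier is an integral homology d-sphere. (a) If n ≤ d + 8 then M is a combinatorial d-sphere. (b) If n = d + 9 and M is not a combinatorial d-sphere, then M does not admit any bistellar i-move for any i < d. -/

import Mathlib

/- Formalization of definitions from:
   B. Bagchi, B. Datta, "Combinatorial triangulations of homology spheres". -/

open Finset

noncomputable section

attribute [local instance] Classical.propDecidable

namespace HomologySpheres

variable {V : Type*} [DecidableEq V] {W : Type*} [DecidableEq W]

/-- The vertex set of a finite family of finite sets. -/
def verts (K : Finset (Finset V)) : Finset V := K.sup id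

/-- An (abstract, finite) simplicial complex: a nonempty collection of nonempty
finite sets closed under taking nonempty subsets. -/
def IsComplex (K : Finset (Finset V)) : Prop :=
  K.Nonempty ∧ ∅ ∉ K ∧ ∀ s ∈ K, ∀ t : Finset V, t ⊆ s → t.Nonempty → t ∈ K

/-- The facets (maximal faces) of `K`. -/
def facets (K : Finset (Finset V)) : Finset (Finset V) :=
  K.filter fun s => ∀ t ∈ K, s ⊆ t → t = s

/-- `K` is pure of dimension `d`: every maximal face has `d + 1` vertices. -/
def IsPure (d : ℕ) (K : Finset (Finset V)) : Prop :=
  ∀ s ∈ facets K, s.card = d + 1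

/-- The link of a face `σ` in `K`. -/
def link (K : Finset (Finset V)) (σ : Finset V) : Finset (Finset V) :=
  K.filter fun τ => Disjoint τ σ ∧ τ ∪ σ ∈ K

/-- `L` is an induced (full) subcomplex of `K`. -/
def IsInduced (K L : Finset (Finset V)) : Prop :=
  L ⊆ K ∧ ∀ s ∈ K, s ⊆ verts L → s ∈ L

/-- The simplicial complement `C(L, K)`: the induced subcomplex of `K` on
`V(K) \ V(L)`. -/
def simpComplement (L K : Finset (Finset V)) : Finset (Finset V) :=
  K.filter fun s => s ⊆ verts K \ verts L

/-- The simplicial neighbourhood `N(L, K)`: the subcomplex of `K` whose maximal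
faces are the maximal faces of `K` meeting `V(L)`. -/
def simpNbhd (L K : Finset (Finset V)) : Finset (Finset V) :=
  K.filter fun s => ∃ t ∈ facets K, s ⊆ t ∧ (t ∩ verts L).Nonempty

/-- `fvec K i` is the number of `i`-dimensional faces of `K`. -/
def fvec (K : Finset (Finset V)) (i : ℕ) : ℕ :=
  (K.filter fun s => s.card = i + 1).card

/-- The number of facets of cardinality `d + 1` containing a given `(d-1)`-face
(the degree of the face in a (weak) pseudomanifold of dimension `d`). -/
def degOf (K : Finset (Finset V)) (d : ℕ) (s : Finset V) : ℕ :=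
  (K.filter fun t => s ⊆ t ∧ t.card = d + 1).card

/-- Simplicial isomorphism (via a vertex bijection carrying faces to faces). -/
def Iso (K : Finset (Finset V)) (L : Finset (Finset W)) : Prop :=
  ∃ f : V → W, Set.InjOn f ↑(verts K) ∧ L = K.image (Finset.image f)

/-- The join of two simplicial complexes (on disjoint vertex sets). -/
def sjoin (K L : Finset (Finset V)) : Finset (Finset V) :=
  K ∪ L ∪ (K ×ˢ L).image fun p => p.1 ∪ p.2

/-- The standard ball on vertex set `A`: all nonempty subsets of `A`. -/
def stdBall (A : Finset V) : Finset (Finset V) := A.powerset.erase ∅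

/-- The standard sphere on vertex set `A`: all nonempty proper subsets of `A`. -/
def stdSphere (A : Finset V) : Finset (Finset V) := (A.powerset.erase ∅).erase A

/-- `τ` is a free face of `K`, with `σ` the unique face properly containing it. -/
def IsFreeFace (K : Finset (Finset V)) (τ σ : Finset V) : Prop :=
  τ ∈ K ∧ σ ∈ K ∧ τ ⊂ σ ∧ ∀ ρ ∈ K, τ ⊂ ρ → ρ = σ

/-- An elementary collapse removes a free face together with the unique face
properly containing it. -/
def ElemCollapse (K K' : Finset (Finset V)) : Prop :=
  ∃ τ σ : Finset V, IsFreeFace K τ σ ∧ K' = (K.erase τ).erase σ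

/-- `K` collapses to `L` by a sequence of elementary collapses. -/
def CollapsesTo (K L : Finset (Finset V)) : Prop :=
  Relation.ReflTransGen ElemCollapse K L

/-- `K` is collapsible: it collapses to a single vertex. -/
def Collapsible (K : Finset (Finset V)) : Prop :=
  ∃ v : V, CollapsesTo K {{v}}

/-! ### Simplicial homology with `ℤ/2` coefficients (augmented chain complex).
A chain of level `n` is a `ZMod 2`-valued function supported on the faces of
cardinality `n` (the empty set, of cardinality `0`, serves as the `(-1)`-simplex
of the augmented complex).  Reduced homology in dimension `q` lives at level
`q + 1`. -/

/-- `c` is a chain of level `n` of `K` (over `ℤ/2`). -/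
def z2chainOK (K : Finset (Finset V)) (n : ℕ) (c : Finset V → ZMod 2) : Prop :=
  ∀ s : Finset V, c s ≠ 0 → s.card = n ∧ (s ∈ K ∨ s = ∅)

/-- The mod-2 boundary operator. -/
def z2bdry (K : Finset (Finset V)) (c : Finset V → ZMod 2) : Finset V → ZMod 2 :=
  fun t => ∑ v ∈ verts K \ t, c (insert v t)

/-- `K` is `ℤ/2`-acyclic: all reduced homology with `ℤ/2` coefficients vanishes,
i.e. in the augmented mod-2 chain complex every cycle is a boundary. -/
def Z2Acyclic (K : Finset (Finset V)) : Prop :=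
  ∀ (n : ℕ) (c : Finset V → ZMod 2), z2chainOK K n c → z2bdry K c = 0 →
    ∃ c', z2chainOK K (n + 1) c' ∧ z2bdry K c' = c

/-- `K` has the reduced `ℤ/2`-homology of the `d`-sphere: reduced homology
vanishes in all dimensions except `d` (level `d + 1`), where it is `ℤ/2`
(there is a cycle `z` which is not a boundary, and modulo boundaries every
cycle is `0` or `z`). -/
def Z2HomologySphere (d : ℕ) (K : Finset (Finset V)) : Prop :=
  (∀ (n : ℕ) (c : Finset V → ZMod 2), n ≠ d + 1 → z2chainOK K n c →
    z2bdry K c = 0 → ∃ c', z2chainOK K (n + 1) c' ∧ z2bdry K c' = c) ∧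
  (∃ z : Finset V → ZMod 2, z2chainOK K (d + 1) z ∧ z2bdry K z = 0 ∧
    (∀ c', z2chainOK K (d + 2) c' → z2bdry K c' ≠ z) ∧
    (∀ z', z2chainOK K (d + 1) z' → z2bdry K z' = 0 →
      (∃ c', z2chainOK K (d + 2) c' ∧ z2bdry K c' = z') ∨
      (∃ c', z2chainOK K (d + 2) c' ∧ z2bdry K c' = z + z')))

/-! ### Integral simplicial homology via ordered chains (Munkres §13: ordered
simplicial homology, allowing repeated vertices, agrees with simplicial
homology). An ordered `m`-tuple chain corresponds to dimension `m - 1`; the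
unique `0`-tuple is the `(-1)`-simplex of the augmented complex. -/

/-- `c` is an ordered chain of `K` over `ℤ`: supported on tuples whose image is
a face (the empty tuple being allowed in level `0`). -/
def zchainOK (K : Finset (Finset V)) {m : ℕ} (c : (Fin m → V) → ℤ) : Prop :=
  ∀ x : Fin m → V, c x ≠ 0 → (Finset.univ.image x ∈ K ∨ m = 0)

/-- The integral boundary operator on ordered chains. -/
def zbdry (K : Finset (Finset V)) {m : ℕ} (c : (Fin (m + 1) → V) → ℤ) :
    (Fin m → V) → ℤ :=
  fun y => ∑ i : Fin (m + 1), (-1 : ℤ) ^ (i : ℕ) * ∑ v ∈ verts K, c (i.insertNth v y)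

/-- `K` has the reduced integral homology of the `d`-sphere: reduced homology
vanishes in all dimensions except `d`, where it is infinite cyclic (there is a
cycle `z` such that every cycle is, modulo boundaries, a unique multiple of `z`). -/
def ZHomologySphere (d : ℕ) (K : Finset (Finset V)) : Prop :=
  (∀ c : (Fin 0 → V) → ℤ, ∃ c' : (Fin 1 → V) → ℤ, zchainOK K c' ∧ zbdry K c' = c) ∧
  (∀ (m : ℕ) (c : (Fin (m + 1) → V) → ℤ), m ≠ d → zchainOK K c → zbdry K c = 0 →
    ∃ c' : (Fin (m + 2) → V) → ℤ, zchainOK K c' ∧ zbdry K c' = c) ∧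
  (∃ z : (Fin (d + 1) → V) → ℤ, zchainOK K z ∧ zbdry K z = 0 ∧
    ∀ z' : (Fin (d + 1) → V) → ℤ, zchainOK K z' → zbdry K z' = 0 →
      ∃! k : ℤ, ∃ c'' : (Fin (d + 2) → V) → ℤ,
        zchainOK K c'' ∧ zbdry K c'' = z' - k • z)

/-- A weak pseudomanifold of dimension `d`: pure, and every `(d-1)`-face is in
exactly two facets. -/
def IsWeakPseudomanifold (d : ℕ) (K : Finset (Finset V)) : Prop :=
  IsComplex K ∧ IsPure d K ∧ ∀ s ∈ K, s.card = d → degOf K d s = 2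

/-- Adjacency of facets along a common `(d-1)`-face. -/
def FacetAdj (d : ℕ) (K : Finset (Finset V)) (s t : Finset V) : Prop :=
  s ∈ K ∧ t ∈ K ∧ s.card = d + 1 ∧ t.card = d + 1 ∧ (s ∩ t).card = d

/-- A pseudomanifold: a weak pseudomanifold in which any two facets are joined
by a chain of facets, consecutive ones sharing a `(d-1)`-face. -/
def IsPseudomanifold (d : ℕ) (K : Finset (Finset V)) : Prop :=
  IsWeakPseudomanifold d K ∧ ∀ s ∈ K, ∀ t ∈ K, s.card = d + 1 → t.card = d + 1 →
    Relation.ReflTransGen (FacetAdj d K) s t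

/-- A weak pseudomanifold with boundary. -/
def IsWeakPseudomanifoldWithBdry (d : ℕ) (K : Finset (Finset V)) : Prop :=
  IsComplex K ∧ IsPure d K ∧
  (∀ s ∈ K, s.card = d → degOf K d s = 1 ∨ degOf K d s = 2) ∧
  (∃ s ∈ K, s.card = d ∧ degOf K d s = 1)

/-- The boundary complex: all faces of degree-one `(d-1)`-faces. -/
def bdryComplex (d : ℕ) (K : Finset (Finset V)) : Finset (Finset V) :=
  K.filter fun t => ∃ s ∈ K, t ⊆ s ∧ s.card = d ∧ degOf K d s = 1

/-- `K` is connected (any two vertices joined by a path of edges). -/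
def SConnected (K : Finset (Finset V)) : Prop :=
  ∀ u ∈ verts K, ∀ v ∈ verts K,
    Relation.ReflTransGen (fun a b : V => ({a, b} : Finset V) ∈ K) u v

/-! ### Geometric realizations, subdivisions and combinatorial equivalence. -/

/-- A geometric simplicial complex in `ℝ^ℕ`: finitely many geometric simplices
(affinely independent vertex sets), closed under faces, any two of which meet
in a common face. -/
structure GComplex where
  faces : Finset (Finset (ℕ → ℝ))
  nonempty : faces.Nonempty
  empty_not_mem : ∅ ∉ faces
  down_closed : ∀ s ∈ faces, ∀ t : Finset (ℕ → ℝ), t ⊆ s → t.Nonempty → t ∈ faces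
  indep : ∀ s ∈ faces,
    AffineIndependent ℝ (fun x : {y : ℕ → ℝ // y ∈ s} => (x : ℕ → ℝ))
  glue : ∀ s ∈ faces, ∀ t ∈ faces,
    convexHull ℝ (s : Set (ℕ → ℝ)) ∩ convexHull ℝ (t : Set (ℕ → ℝ)) =
      convexHull ℝ ((s ∩ t : Finset (ℕ → ℝ)) : Set (ℕ → ℝ))

/-- The geometric carrier (underlying polyhedron) of a geometric complex. -/
def GComplex.carrier (G : GComplex) : Set (ℕ → ℝ) :=
  ⋃ s ∈ G.faces, convexHull ℝ (s : Set (ℕ → ℝ))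

/-- `G` realizes the abstract complex `K` via the vertex map `f`. -/
def RealizesMap (G : GComplex) (K : Finset (Finset V)) (f : V → ℕ → ℝ) : Prop :=
  Set.InjOn f ↑(verts K) ∧ G.faces = K.image (Finset.image f)

/-- `G` is a geometric realization of the abstract complex `K`. -/
def Realizes (G : GComplex) (K : Finset (Finset V)) : Prop :=
  ∃ f : V → ℕ → ℝ, RealizesMap G K f

/-- `G'` is a subdivision of `G`: same carrier, and every simplex of `G'` is
contained in a simplex of `G`. -/
def Subdivides (G' G : GComplex) : Prop :=
  G'.carrier = G.carrier ∧
  ∀ s ∈ G'.faces, ∃ t ∈ G.faces,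
    convexHull ℝ (s : Set (ℕ → ℝ)) ⊆ convexHull ℝ (t : Set (ℕ → ℝ))

/-- Combinatorial equivalence: `K` and `L` admit isomorphic subdivisions. -/
def CombEquiv (K : Finset (Finset V)) (L : Finset (Finset W)) : Prop :=
  ∃ G1 G1' G2 G2' : GComplex, Realizes G1 K ∧ Realizes G2 L ∧
    Subdivides G1' G1 ∧ Subdivides G2' G2 ∧ Iso G1'.faces G2'.faces

/-- A combinatorial `d`-ball: combinatorially equivalent to the standard ball. -/
def IsCombBall (d : ℕ) (K : Finset (Finset V)) : Prop :=
  ∃ A : Finset ℕ, A.card = d + 1 ∧ CombEquiv K (stdBall A)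

/-- A combinatorial `d`-sphere: combinatorially equivalent to the standard sphere. -/
def IsCombSphere (d : ℕ) (K : Finset (Finset V)) : Prop :=
  ∃ A : Finset ℕ, A.card = d + 2 ∧ CombEquiv K (stdSphere A)

/-- A combinatorial `d`-manifold: every vertex link is a combinatorial
`(d-1)`-sphere. -/
def IsCombManifold (d : ℕ) (K : Finset (Finset V)) : Prop :=
  IsComplex K ∧ ∀ v ∈ verts K, IsCombSphere (d - 1) (link K {v})

/-- A combinatorial `d`-manifold with boundary. -/
def IsCombManifoldWithBdry (d : ℕ) (K : Finset (Finset V)) : Prop :=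
  IsComplex K ∧
  (∀ v ∈ verts K, IsCombSphere (d - 1) (link K {v}) ∨
    IsCombBall (d - 1) (link K {v})) ∧
  (∃ v ∈ verts K, IsCombBall (d - 1) (link K {v}))

/-- A pl `k`-ball: a polyhedron carried by some geometric complex whose face
structure is a combinatorial `k`-ball. -/
def IsPLBall (k : ℕ) (P : Set (ℕ → ℝ)) : Prop :=
  ∃ G : GComplex, G.carrier = P ∧ IsCombBall k G.faces

/-- Elementary polyhedral collapse: `P = P' ∪ B` with `B` a pl `k`-ball and
`P' ∩ B` a pl `(k-1)`-ball. -/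
def PolyElemCollapse (P P' : Set (ℕ → ℝ)) : Prop :=
  ∃ k : ℕ, 1 ≤ k ∧ ∃ B : Set (ℕ → ℝ),
    IsPLBall k B ∧ P = P' ∪ B ∧ IsPLBall (k - 1) (P' ∩ B)

/-- Polyhedral collapse. -/
def PolyCollapsesTo (P Q : Set (ℕ → ℝ)) : Prop :=
  Relation.ReflTransGen PolyElemCollapse P Q

/-- Carrier of a subcomplex under a vertex realization map `f`. -/
def subCarrier (f : V → ℕ → ℝ) (L : Finset (Finset V)) : Set (ℕ → ℝ) :=
  ⋃ s ∈ L, convexHull ℝ ((s.image f : Finset (ℕ → ℝ)) : Set (ℕ → ℝ))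

/-! ### Bistellar moves. -/

/-- The core `β = {x ∈ A : A \ {x} ∈ X}` of a `(d+2)`-set `A`. -/
def bcore (X : Finset (Finset V)) (A : Finset V) : Finset V :=
  A.filter fun x => A.erase x ∈ X

/-- `κ_A` is a bistellar `i`-move on the `d`-dimensional complex `X`:
`A` has `d + 2` elements and contains at least one and at most `d + 1` facets
of `X`; with `β` the core of `A` and `α = A \ β` an `i`-face of `X`, one has
`β ∉ X`, and either `α` is a facet of `X` or `Lk_X(α)` has vertex set `β`. -/
def BistellarIMove (d i : ℕ) (X : Finset (Finset V)) (A : Finset V) : Prop :=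
  A.card = d + 2 ∧
  0 < ((facets X).filter fun σ => σ ⊆ A).card ∧
  ((facets X).filter fun σ => σ ⊆ A).card ≤ d + 1 ∧
  bcore X A ∉ X ∧
  A \ bcore X A ∈ X ∧ (A \ bcore X A).card = i + 1 ∧
  (A \ bcore X A ∈ facets X ∨ verts (link X (A \ bcore X A)) = bcore X A)

/-! ### The explicit small complexes of the paper. -/

/-- The complex generated by a list of facets: all nonempty subsets thereof. -/
def genBy (F : Finset (Finset ℕ)) : Finset (Finset ℕ) :=
  F.sup fun s => s.powerset.erase ∅

/-- The standard 2-sphere `S²₄`. -/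
def S24 : Finset (Finset ℕ) := stdSphere {1, 2, 3, 4}

/-- The join `S¹₃ * S⁰₂`. -/
def S13S02 : Finset (Finset ℕ) := sjoin (stdSphere {1, 2, 3}) (stdSphere {4, 5})

/-- The octahedron `S⁰₂ * S⁰₂ * S⁰₂`. -/
def Octa : Finset (Finset ℕ) :=
  sjoin (stdSphere {1, 2}) (sjoin (stdSphere {3, 4}) (stdSphere {5, 6}))

/-- The 6-vertex real projective plane `ℝP²₆`. -/
def RP26 : Finset (Finset ℕ) :=
  genBy {{1, 2, 3}, {1, 2, 4}, {1, 3, 5}, {1, 4, 6}, {1, 5, 6},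
         {2, 3, 6}, {2, 4, 5}, {2, 5, 6}, {3, 4, 5}, {3, 4, 6}}

/-- `Σ₁`: the 6-vertex 2-sphere with a vertex of degree 3 and one of degree 5. -/
def Sigma1 : Finset (Finset ℕ) :=
  genBy {{1, 2, 5}, {1, 2, 6}, {1, 5, 6}, {2, 3, 5},
         {2, 3, 6}, {3, 4, 5}, {3, 4, 6}, {4, 5, 6}}

/-- The double pyramid `S¹₅ * S⁰₂`. -/
def S15S02 : Finset (Finset ℕ) :=
  sjoin (genBy {{1, 2}, {2, 3}, {3, 4}, {4, 5}, {1, 5}}) (stdSphere {6, 7})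

/-- `Σ₂` (7-vertex 2-sphere with 10 triangles). -/
def Sigma2 : Finset (Finset ℕ) :=
  genBy {{1, 2, 6}, {1, 2, 7}, {1, 6, 7}, {2, 3, 6}, {2, 3, 7},
         {3, 4, 6}, {3, 4, 7}, {4, 5, 6}, {4, 5, 7}, {5, 6, 7}}

/-- `Σ₃` (7-vertex 2-sphere with 10 triangles). -/
def Sigma3 : Finset (Finset ℕ) :=
  genBy {{1, 2, 6}, {1, 2, 7}, {1, 6, 7}, {2, 3, 4}, {2, 3, 7},
         {2, 4, 6}, {3, 4, 7}, {4, 5, 6}, {4, 5, 7}, {5, 6, 7}}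

/-- `Σ₄` (7-vertex 2-sphere with 10 triangles). -/
def Sigma4 : Finset (Finset ℕ) :=
  genBy {{1, 2, 4}, {1, 2, 7}, {1, 4, 5}, {1, 5, 6}, {1, 6, 7},
         {2, 3, 4}, {2, 3, 7}, {3, 4, 7}, {4, 5, 7}, {5, 6, 7}}

/-- `Σ₅` (7-vertex 2-sphere with 10 triangles). -/
def Sigma5 : Finset (Finset ℕ) :=
  genBy {{1, 2, 3}, {1, 2, 6}, {1, 3, 5}, {1, 5, 6}, {2, 3, 4},
         {2, 4, 6}, {3, 4, 5}, {4, 5, 7}, {4, 6, 7}, {5, 6, 7}}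

/-- `Υ₁ = S²₄ ∪ S²₄`: two tetrahedral spheres sharing exactly one vertex. -/
def Upsilon1 : Finset (Finset ℕ) :=
  stdSphere {1, 2, 3, 7} ∪ stdSphere {4, 5, 6, 7}

/-- `Υ₂ = S²₄ ∪ (S⁰₂ * S¹₃)`: a tetrahedral sphere and a join, where the two
common vertices span an edge of the `S²₄`. -/
def Upsilon2 : Finset (Finset ℕ) :=
  stdSphere {4, 5, 6, 7} ∪ sjoin (stdSphere {6, 7}) (stdSphere {1, 2, 3})

/-- The complex `R` obtained from `ℝP²₆` by the generalized bistellar 1-move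
`κ_A`, `A = {1, 2, 5, 6}` (all such choices of `A` yield isomorphic complexes). -/
def Rcomplex : Finset (Finset ℕ) :=
  genBy {{1, 2, 3}, {1, 2, 4}, {1, 2, 5}, {1, 2, 6}, {1, 3, 5},
         {1, 4, 6}, {2, 3, 6}, {2, 4, 5}, {3, 4, 5}, {3, 4, 6}}

end HomologySpheres

end

set_option linter.unusedSectionVars false
set_option linter.unusedVariables false
set_option linter.unusedSimpArgs false

namespace HS

section PLcore
variable {E F G E' F' : Type*} [NormedAddCommGroup E] [NormedSpace ℝ E]
  [NormedAddCommGroup F] [NormedSpace ℝ F] [NormedAddCommGroup G] [NormedSpace ℝ G]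
  [NormedAddCommGroup E'] [NormedSpace ℝ E'] [NormedAddCommGroup F'] [NormedSpace ℝ F']

/-- continuous selections of finitely many linear maps -/
def PLOn (X : Set E) (f : E → F) : Prop :=
  ContinuousOn f X ∧ ∃ S : Set (E →L[ℝ] F), S.Finite ∧ ∀ x ∈ X, ∃ A ∈ S, f x = A x

theorem PLOn.clm (X : Set E) (A : E →L[ℝ] F) : PLOn X (fun x => A x) :=
  ⟨A.continuous.continuousOn, {A}, Set.finite_singleton _, fun _ _ => ⟨A, rfl, rfl⟩⟩

theorem PLOn.id (X : Set E) : PLOn X (fun x => x) :=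
  PLOn.clm X (ContinuousLinearMap.id ℝ E)

theorem PLOn.mono {X Y : Set E} {f : E → F} (h : PLOn X f) (hY : Y ⊆ X) : PLOn Y f :=
  ⟨h.1.mono hY, h.2.imp fun _ hS => ⟨hS.1, fun x hx => hS.2 x (hY hx)⟩⟩

theorem PLOn.congr {X : Set E} {f g : E → F} (h : PLOn X f) (hg : ∀ x ∈ X, g x = f x) :
    PLOn X g := by
  refine ⟨h.1.congr hg, ?_⟩
  obtain ⟨S, hS, h2⟩ := h.2
  exact ⟨S, hS, fun x hx => by rw [hg x hx]; exact h2 x hx⟩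

theorem PLOn.comp {X : Set E} {Y : Set F} {f : E → F} {g : F → G} (hg : PLOn Y g)
    (hf : PLOn X f) (h : ∀ x ∈ X, f x ∈ Y) : PLOn X (fun x => g (f x)) := by
  refine ⟨hg.1.comp hf.1 h, ?_⟩
  obtain ⟨S, hS, h2⟩ := hf.2
  obtain ⟨T, hT, h3⟩ := hg.2
  refine ⟨Set.image2 (fun (B : F →L[ℝ] G) (A : E →L[ℝ] F) => B.comp A) T S, hT.image2 _ hS, ?_⟩
  intro x hx
  obtain ⟨A, hA, e1⟩ := h2 x hx
  obtain ⟨B, hB, e2⟩ := h3 _ (h x hx)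
  exact ⟨B.comp A, ⟨B, hB, A, hA, rfl⟩, by dsimp only; rw [e2, e1]; rfl⟩

theorem PLOn.clm_comp {X : Set E} {f : E → F} (B : F →L[ℝ] G) (hf : PLOn X f) :
    PLOn X (fun x => B (f x)) :=
  (PLOn.clm Set.univ B).comp hf (fun _ _ => trivial)

theorem PLOn.prodMk {X : Set E} {f : E → F} {g : E → G} (hf : PLOn X f) (hg : PLOn X g) :
    PLOn X (fun x => (f x, g x)) := by
  refine ⟨hf.1.prodMk hg.1, ?_⟩
  obtain ⟨S, hS, h2⟩ := hf.2
  obtain ⟨T, hT, h3⟩ := hg.2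
  refine ⟨Set.image2 (fun (A : E →L[ℝ] F) (B : E →L[ℝ] G) => A.prod B) S T, hS.image2 _ hT, ?_⟩
  intro x hx
  obtain ⟨A, hA, e1⟩ := h2 x hx
  obtain ⟨B, hB, e2⟩ := h3 x hx
  exact ⟨A.prod B, ⟨A, hA, B, hB, rfl⟩, by simp [e2, e1]⟩

theorem PLOn.fst {X : Set E} {f : E → F × G} (hf : PLOn X f) : PLOn X (fun x => (f x).1) :=
  hf.clm_comp (ContinuousLinearMap.fst ℝ F G)

theorem PLOn.snd {X : Set E} {f : E → F × G} (hf : PLOn X f) : PLOn X (fun x => (f x).2) :=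
  hf.clm_comp (ContinuousLinearMap.snd ℝ F G)

theorem PLOn.add {X : Set E} {f g : E → F} (hf : PLOn X f) (hg : PLOn X g) :
    PLOn X (fun x => f x + g x) :=
  (hf.prodMk hg).clm_comp (ContinuousLinearMap.fst ℝ F F + ContinuousLinearMap.snd ℝ F F)

theorem PLOn.sub {X : Set E} {f g : E → F} (hf : PLOn X f) (hg : PLOn X g) :
    PLOn X (fun x => f x - g x) :=
  (hf.prodMk hg).clm_comp (ContinuousLinearMap.fst ℝ F F - ContinuousLinearMap.snd ℝ F F)

theorem PLOn.neg {X : Set E} {f : E → F} (hf : PLOn X f) :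
    PLOn X (fun x => - f x) :=
  hf.clm_comp (- ContinuousLinearMap.id ℝ F)

theorem PLOn.const_smul {X : Set E} {f : E → F} (r : ℝ) (hf : PLOn X f) :
    PLOn X (fun x => r • f x) :=
  hf.clm_comp (r • ContinuousLinearMap.id ℝ F)

theorem PLOn.const_mul {X : Set E} {f : E → ℝ} (r : ℝ) (hf : PLOn X f) :
    PLOn X (fun x => r * f x) := hf.const_smul r

theorem PLOn.smul_const {X : Set E} {f : E → ℝ} (u : F) (hf : PLOn X f) :
    PLOn X (fun x => f x • u) :=
  hf.clm_comp ((ContinuousLinearMap.id ℝ ℝ).smulRight u)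

theorem PLOn.zero (X : Set E) : PLOn X (fun _ => (0 : F)) :=
  PLOn.clm X (0 : E →L[ℝ] F)

/-- a selection from two PL functions, continuous, is PL -/
theorem PLOn.of_or {X : Set E} {f g h : E → F} (hf : PLOn X f) (hg : PLOn X g)
    (hc : ContinuousOn h X) (hh : ∀ x ∈ X, h x = f x ∨ h x = g x) : PLOn X h := by
  refine ⟨hc, ?_⟩
  obtain ⟨S, hS, h2⟩ := hf.2
  obtain ⟨T, hT, h3⟩ := hg.2
  refine ⟨S ∪ T, hS.union hT, fun x hx => ?_⟩
  rcases hh x hx with e | e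
  · obtain ⟨A, hA, e1⟩ := h2 x hx
    exact ⟨A, Or.inl hA, by rw [e, e1]⟩
  · obtain ⟨A, hA, e1⟩ := h3 x hx
    exact ⟨A, Or.inr hA, by rw [e, e1]⟩

theorem PLOn.max {X : Set E} {f g : E → ℝ} (hf : PLOn X f) (hg : PLOn X g) :
    PLOn X (fun x => max (f x) (g x)) :=
  PLOn.of_or hf hg (hf.1.sup hg.1) fun x _ => by
    rcases le_total (f x) (g x) with h | h
    · right; exact max_eq_right h
    · left; exact max_eq_left h

theorem PLOn.min {X : Set E} {f g : E → ℝ} (hf : PLOn X f) (hg : PLOn X g) :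
    PLOn X (fun x => min (f x) (g x)) :=
  PLOn.of_or hf hg (hf.1.inf hg.1) fun x _ => by
    rcases le_total (f x) (g x) with h | h
    · left; exact min_eq_left h
    · right; exact min_eq_right h

theorem PLOn.abs {X : Set E} {f : E → ℝ} (hf : PLOn X f) :
    PLOn X (fun x => |f x|) := hf.max hf.neg

theorem PLOn.pi {ι : Type*} [Fintype ι] {X : Set E} {f : E → ι → ℝ}
    (h : ∀ i, PLOn X (fun x => f x i)) : PLOn X f := by
  classical
  refine ⟨continuousOn_pi.2 fun i => (h i).1, ?_⟩
  choose S hS h2 using fun i => (h i).2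
  refine ⟨(fun (A : ∀ _ : ι, E →L[ℝ] ℝ) => ContinuousLinearMap.pi A) '' (Set.univ.pi S),
    (Set.Finite.pi' hS |>.subset (by intro A hA i; exact hA i trivial)).image _, ?_⟩
  intro x hx
  choose A hA e using fun i => h2 i x hx
  refine ⟨_, ⟨A, fun i _ => hA i, rfl⟩, ?_⟩
  ext i; simp [e]

theorem PLOn.apply {ι : Type*} [Fintype ι] {X : Set E} {f : E → ι → ℝ}
    (h : PLOn X f) (i : ι) : PLOn X (fun x => f x i) :=
  h.clm_comp (ContinuousLinearMap.proj (R := ℝ) (φ := fun _ : ι => ℝ) i)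

theorem PLOn.norm_pi {ι : Type*} [Fintype ι] {X : Set E} {f : E → ι → ℝ}
    (h : PLOn X f) : PLOn X (fun x => ‖f x‖) := by
  refine ⟨h.1.norm, ?_⟩
  obtain ⟨S, hS, h2⟩ := h.2
  refine ⟨insert 0 (Set.image2 (fun (A : E →L[ℝ] (ι → ℝ)) (p : ι × Bool) =>
    (if p.2 then (1:ℝ) else -1) • (ContinuousLinearMap.proj (R := ℝ) (φ := fun _ : ι => ℝ) p.1).comp A)
      S Set.univ), (hS.image2 _ Set.finite_univ).insert _, ?_⟩
  intro x hx
  obtain ⟨A, hA, e⟩ := h2 x hx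
  rcases isEmpty_or_nonempty ι with hι | hι
  · exact ⟨0, Or.inl rfl, by simp [Subsingleton.elim (f x) 0]⟩
  · obtain ⟨i, hi⟩ : ∃ i, ‖f x i‖ = ‖f x‖ := by
      obtain ⟨i, -, hi⟩ := exists_mem_eq_sup (Finset.univ : Finset ι) univ_nonempty
        (fun i => ‖f x i‖₊)
      refine ⟨i, ?_⟩
      rw [Pi.norm_def, hi]; rfl
    dsimp only
    rw [← hi, Real.norm_eq_abs]
    rcases abs_choice (f x i) with h' | h'
    · exact ⟨_, Or.inr ⟨A, hA, (i, true), trivial, rfl⟩, by rw [h', e]; simp⟩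
    · exact ⟨_, Or.inr ⟨A, hA, (i, false), trivial, rfl⟩, by rw [h', e]; simp⟩

/-- PL functions on two closed pieces glue -/
theorem PLOn.union {X Y : Set E} {f : E → F} (hX : IsClosed X) (hY : IsClosed Y)
    (h1 : PLOn X f) (h2 : PLOn Y f) : PLOn (X ∪ Y) f := by
  refine ⟨h1.1.union_of_isClosed h2.1 hX hY, ?_⟩
  obtain ⟨S, hS, h2⟩ := h1.2
  obtain ⟨T, hT, h3⟩ := ‹PLOn Y f›.2
  refine ⟨S ∪ T, hS.union hT, ?_⟩
  rintro x (hx | hx)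
  · obtain ⟨A, hA, e⟩ := h2 x hx; exact ⟨A, Or.inl hA, e⟩
  · obtain ⟨A, hA, e⟩ := h3 x hx; exact ⟨A, Or.inr hA, e⟩

/-- A PL function to finite values along a preconnected set is constant. -/
theorem const_of_finite {α : Type*} [TopologicalSpace α] {s : Set α} (hs : IsPreconnected s)
    {f : α → F} (hf : ContinuousOn f s) {T : Set F} (hT : T.Finite) (h : ∀ x ∈ s, f x ∈ T)
    {x y : α} (hx : x ∈ s) (hy : y ∈ s) : f x = f y := by
  have h1 : IsPreconnected (f '' s) := hs.image f hf
  have h2 : (f '' s).Finite := hT.subset (by rintro _ ⟨x, hx, rfl⟩; exact h x hx)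
  have h3 : (f '' s).Subsingleton := by
    by_contra hne
    rw [Set.not_subsingleton_iff] at hne
    exact (h1.infinite_of_nontrivial hne) h2
  exact h3 ⟨x, hx, rfl⟩ ⟨y, hy, rfl⟩

theorem PLOn.homog {X : Set E} {f : E → F} (hf : PLOn X f)
    {x : E} (hx : ∀ t : ℝ, 0 < t → t • x ∈ X) {t : ℝ} (ht : 0 < t) : f (t • x) = t • f x := by
  obtain ⟨S, hS, h2⟩ := hf.2
  have key : (fun t : ℝ => t⁻¹ • f (t • x)) t = (fun t : ℝ => t⁻¹ • f (t • x)) 1 := by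
    refine const_of_finite (f := fun t : ℝ => t⁻¹ • f (t • x)) (x := t) (y := 1) (s := Set.Ioi (0:ℝ))
      isPreconnected_Ioi ?_ (hS.image fun A => A x) ?_ ht (Set.mem_Ioi.2 one_pos)
    · refine ContinuousOn.smul (continuousOn_inv₀.mono fun t ht => ?_) ?_
      · exact ne_of_gt ht
      · exact hf.1.comp (by fun_prop) fun t ht => hx t ht
    · intro t ht
      obtain ⟨A, hA, e⟩ := h2 _ (hx t ht)
      refine ⟨A, hA, ?_⟩
      have : t ≠ 0 := ne_of_gt ht
      simp [e, smul_smul, this]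
  simp only [inv_one, one_smul] at key
  rw [← key, smul_smul, mul_inv_cancel₀ ht.ne', one_smul]

/-- PL equivalence -/
structure PLE (X : Set E) (Y : Set F) (f : E → F) (g : F → E) : Prop where
  pf : PLOn X f
  pg : PLOn Y g
  mf : ∀ x ∈ X, f x ∈ Y
  mg : ∀ y ∈ Y, g y ∈ X
  gf : ∀ x ∈ X, g (f x) = x
  fg : ∀ y ∈ Y, f (g y) = y

theorem PLE.refl (X : Set E) : PLE X X (fun x => x) (fun x => x) :=
  ⟨PLOn.id X, PLOn.id X, fun _ h => h, fun _ h => h, fun _ _ => rfl, fun _ _ => rfl⟩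

theorem PLE.symm {X : Set E} {Y : Set F} {f : E → F} {g : F → E} (h : PLE X Y f g) :
    PLE Y X g f := ⟨h.pg, h.pf, h.mg, h.mf, h.fg, h.gf⟩

theorem PLE.trans {X : Set E} {Y : Set F} {Z : Set G} {f : E → F} {g : F → E} {f' : F → G}
    {g' : G → F} (h : PLE X Y f g) (h' : PLE Y Z f' g') :
    PLE X Z (fun x => f' (f x)) (fun z => g (g' z)) :=
  ⟨h'.pf.comp h.pf h.mf, h.pg.comp h'.pg h'.mg, fun x hx => h'.mf _ (h.mf x hx),
   fun z hz => h.mg _ (h'.mg z hz), fun x hx => by rw [h'.gf _ (h.mf x hx), h.gf x hx],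
   fun z hz => by rw [h.fg _ (h'.mg z hz), h'.fg z hz]⟩

theorem PLE.prod {X : Set E} {Y : Set F} {X' : Set E'} {Y' : Set F'} {f : E → F} {g : F → E}
    {f' : E' → F'} {g' : F' → E'} (h : PLE X Y f g) (h' : PLE X' Y' f' g') :
    PLE (X ×ˢ X') (Y ×ˢ Y') (fun p => (f p.1, f' p.2)) (fun p => (g p.1, g' p.2)) := by
  refine ⟨PLOn.prodMk (h.pf.comp (PLOn.id _).fst ?_) (h'.pf.comp (PLOn.id _).snd ?_),
    PLOn.prodMk (h.pg.comp (PLOn.id _).fst ?_) (h'.pg.comp (PLOn.id _).snd ?_), ?_, ?_, ?_, ?_⟩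
  · exact fun x hx => hx.1
  · exact fun x hx => hx.2
  · exact fun x hx => hx.1
  · exact fun x hx => hx.2
  · exact fun x hx => ⟨h.mf _ hx.1, h'.mf _ hx.2⟩
  · exact fun x hx => ⟨h.mg _ hx.1, h'.mg _ hx.2⟩
  · rintro ⟨a, b⟩ hx; simp [h.gf _ hx.1, h'.gf _ hx.2]
  · rintro ⟨a, b⟩ hx; simp [h.fg _ hx.1, h'.fg _ hx.2]

/-- restrict a PL equivalence to a subset -/
theorem PLE.restrict {X X' : Set E} {Y Y' : Set F} {f : E → F} {g : F → E} (h : PLE X Y f g)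
    (hX : X' ⊆ X) (hY : Y' ⊆ Y) (h1 : ∀ x ∈ X', f x ∈ Y') (h2 : ∀ y ∈ Y', g y ∈ X') :
    PLE X' Y' f g :=
  ⟨h.pf.mono hX, h.pg.mono hY, h1, h2, fun x hx => h.gf x (hX hx), fun y hy => h.fg y (hY hy)⟩

open Classical in
/-- gluing two PL equivalences along closed pieces -/
theorem PLE.glue {X1 X2 : Set E} {Y1 Y2 : Set F} {f1 f2 : E → F} {g1 g2 : F → E}
    (h1 : PLE X1 Y1 f1 g1) (h2 : PLE X2 Y2 f2 g2)
    (cX1 : IsClosed X1) (cX2 : IsClosed X2) (cY1 : IsClosed Y1) (cY2 : IsClosed Y2)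
    (hf : ∀ x ∈ X1, x ∈ X2 → f1 x = f2 x) (hg : ∀ y ∈ Y1, y ∈ Y2 → g1 y = g2 y) :
    ∃ f g, PLE (X1 ∪ X2) (Y1 ∪ Y2) f g ∧ (∀ x ∈ X1, f x = f1 x) ∧ (∀ x ∈ X2, f x = f2 x) ∧
      (∀ y ∈ Y1, g y = g1 y) ∧ (∀ y ∈ Y2, g y = g2 y) := by
  have e1 : ∀ x ∈ X1, (if x ∈ X1 then f1 x else f2 x) = f1 x := fun x hx => by simp [hx]
  have e2 : ∀ x ∈ X2, (if x ∈ X1 then f1 x else f2 x) = f2 x := fun x hx => by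
    by_cases h : x ∈ X1
    · simp [h, hf x h hx]
    · simp [h]
  have e3 : ∀ x ∈ Y1, (if x ∈ Y1 then g1 x else g2 x) = g1 x := fun x hx => by simp [hx]
  have e4 : ∀ x ∈ Y2, (if x ∈ Y1 then g1 x else g2 x) = g2 x := fun x hx => by
    by_cases h : x ∈ Y1
    · simp [h, hg x h hx]
    · simp [h]
  refine ⟨fun x => if x ∈ X1 then f1 x else f2 x, fun y => if y ∈ Y1 then g1 y else g2 y,
    ⟨(h1.pf.congr e1).union cX1 cX2 (h2.pf.congr e2),
     (h1.pg.congr e3).union cY1 cY2 (h2.pg.congr e4), ?_, ?_, ?_, ?_⟩, e1, e2, e3, e4⟩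
  · rintro x (hx | hx)
    · rw [e1 x hx]; exact Or.inl (h1.mf x hx)
    · rw [e2 x hx]; exact Or.inr (h2.mf x hx)
  · rintro x (hx | hx)
    · rw [e3 x hx]; exact Or.inl (h1.mg x hx)
    · rw [e4 x hx]; exact Or.inr (h2.mg x hx)
  · rintro x (hx | hx)
    · rw [e1 x hx, e3 _ (h1.mf x hx)]; exact h1.gf x hx
    · rw [e2 x hx, e4 _ (h2.mf x hx)]; exact h2.gf x hx
  · rintro x (hx | hx)
    · rw [e3 x hx, e1 _ (h1.mg x hx)]; exact h1.fg x hx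
    · rw [e4 x hx, e2 _ (h2.mg x hx)]; exact h2.fg x hx

/-- `X` is the cone over `J`, rel `J` -/
def Starr (X J : Set E) : Prop :=
  ∃ f g, PLE X (J ×ˢ Set.Ici (0:ℝ)) f g ∧ (∀ j ∈ J, f j = (j, 0)) ∧ J ⊆ X

end PLcore

section PL2
variable {E F G E' F' : Type*} [NormedAddCommGroup E] [NormedSpace ℝ E]
  [NormedAddCommGroup F] [NormedSpace ℝ F] [NormedAddCommGroup G] [NormedSpace ℝ G]

theorem Starr.transport {X J : Set E} {Y J' : Set F} {f : E → F} {g : F → E}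
    (h : PLE X Y f g) (hs : Starr X J) (h1 : ∀ x ∈ J, f x ∈ J') (h2 : ∀ y ∈ J', g y ∈ J)
    (hJ' : J' ⊆ Y) : Starr Y J' := by
  obtain ⟨k, k', hk, hk0, hJ⟩ := hs
  have hJJ : PLE J J' f g := h.restrict hJ hJ' h1 h2
  refine ⟨_, _, h.symm.trans (hk.trans (hJJ.prod (PLE.refl (Set.Ici (0:ℝ))))), ?_, hJ'⟩
  intro j hj
  rw [hk0 _ (h2 j hj)]
  simp [h.fg j (hJ' hj)]

/-- Reflection of the half line. -/
theorem PLE.negHalf : PLE (Set.Ici (0:ℝ)) (Set.Iic (0:ℝ)) (fun x => -x) (fun x => -x) :=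
  ⟨(PLOn.id _).neg, (PLOn.id _).neg, fun x hx => by simpa using hx, fun x hx => by simpa using hx,
   fun x _ => by simp, fun x _ => by simp⟩

/-- two stars over the same base glue to a product with the line -/
theorem double {P Q J : Set E} (hP : Starr P J) (hQ : Starr Q J) (hPQ : P ∩ Q ⊆ J)
    (cP : IsClosed P) (cQ : IsClosed Q) (cJ : IsClosed J) :
    ∃ f g, PLE (P ∪ Q) (J ×ˢ (Set.univ : Set ℝ)) f g ∧ (∀ j ∈ J, f j = (j, 0)) ∧
      (∀ j ∈ J, g (j, 0) = j) ∧
      (∀ x ∈ P, 0 ≤ (f x).2) ∧ (∀ x ∈ Q, (f x).2 ≤ 0) ∧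
      (∀ j ∈ J, ∀ s, 0 ≤ s → g (j, s) ∈ P) ∧ (∀ j ∈ J, ∀ s, s ≤ 0 → g (j, s) ∈ Q) := by
  obtain ⟨k, k', hk, hk0, hJP⟩ := hP
  obtain ⟨l, l', hl, hl0, hJQ⟩ := hQ
  have hl2 := hl.trans ((PLE.refl J).prod PLE.negHalf)
  obtain ⟨f, g, h, f1, f2, g1, g2⟩ := PLE.glue hk hl2 cP cQ (cJ.prod isClosed_Ici)
    (cJ.prod isClosed_Iic)
    (by
      intro x h1 h2
      have := hPQ ⟨h1, h2⟩
      simp [hk0 x this, hl0 x this])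
    (by
      rintro ⟨j, s⟩ ⟨hj, h1⟩ ⟨_, h2⟩
      have : s = 0 := le_antisymm h2 h1
      subst this
      have e1 := hk.gf j (hJP hj)
      have e2 := hl.gf j (hJQ hj)
      rw [hk0 j hj] at e1
      rw [hl0 j hj] at e2
      simp [e1, e2])
  have hU : (J ×ˢ Set.Ici (0:ℝ)) ∪ (J ×ˢ Set.Iic (0:ℝ)) = J ×ˢ (Set.univ : Set ℝ) := by
    rw [← Set.prod_union]; congr 1
    ext x; simp [le_total]
  rw [hU] at h
  refine ⟨f, g, h, ?_, ?_, ?_, ?_, ?_, ?_⟩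
  · intro j hj; rw [f1 j (hJP hj), hk0 j hj]
  · intro j hj
    have := h.gf j (Or.inl (hJP hj))
    rwa [f1 j (hJP hj), hk0 j hj] at this
  · intro x hx; rw [f1 x hx]; exact (hk.mf x hx).2
  · intro x hx; rw [f2 x hx]; exact (hl2.mf x hx).2
  · intro j hj s hs; rw [g1 (j, s) ⟨hj, hs⟩]; exact hk.mg (j, s) ⟨hj, hs⟩
  · intro j hj s hs; rw [g2 (j, s) ⟨hj, hs⟩]; exact hl2.mg (j, s) ⟨hj, hs⟩

noncomputable def thF (p : ℝ × ℝ) : ℝ × ℝ := (-|p.1| - 2 * max (-p.2) 0, 2 * max p.1 0 + |p.2|)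
noncomputable def thG (p : ℝ × ℝ) : ℝ × ℝ :=
  (min (-p.1) (min (3⁻¹ * (2 * p.2 - (-p.1))) (2 * p.2 - (-p.1))),
   max (-p.2) (max (3⁻¹ * (p.2 - 2 * (-p.1))) (p.2 - 2 * (-p.1))))

theorem theta_ple : PLE {p : ℝ × ℝ | 0 ≤ p.1 ∨ p.2 ≤ 0} {p : ℝ × ℝ | p.1 ≤ 0 ∧ 0 ≤ p.2} thF thG := by
  refine ⟨?_, ?_, ?_, ?_, ?_, ?_⟩
  · have i := PLOn.id {p : ℝ × ℝ | 0 ≤ p.1 ∨ p.2 ≤ 0}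
    exact PLOn.prodMk (i.fst.abs.neg.sub ((i.snd.neg.max (PLOn.zero _)).const_mul 2))
      (((i.fst.max (PLOn.zero _)).const_mul 2).add i.snd.abs)
  · have i := PLOn.id {p : ℝ × ℝ | p.1 ≤ 0 ∧ 0 ≤ p.2}
    exact PLOn.prodMk (i.fst.neg.min ((((i.snd.const_mul 2).sub i.fst.neg).const_mul _).min
       ((i.snd.const_mul 2).sub i.fst.neg)))
      (i.snd.neg.max (((i.snd.sub (i.fst.neg.const_mul 2)).const_mul _).max
        (i.snd.sub (i.fst.neg.const_mul 2))))
  · rintro ⟨r, s⟩ h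
    simp only [thF, Set.mem_ofPred_eq]
    constructor
    · have := abs_nonneg r; have := le_max_right (-s) 0; linarith
    · have := abs_nonneg s; have := le_max_right (r) 0; linarith
  · rintro ⟨r, s⟩ h
    simp only [thG, Set.mem_ofPred_eq] at *
    obtain ⟨h1, h2⟩ := h
    by_cases h3 : 0 ≤ 2 * s - -r
    · left; refine le_min (by linarith) (le_min (by linarith) h3)
    · right; refine max_le (by linarith) (max_le (by linarith) (by linarith))
  · rintro ⟨r, s⟩ h
    simp only [thF, thG, Set.mem_ofPred_eq] at *
    rcases le_total 0 r with hr | hr <;> rcases le_total 0 s with hs | hs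
    · rw [abs_of_nonneg hr, abs_of_nonneg hs, max_eq_left hr, max_eq_right (a := -s) (by linarith)]
      ext <;> simp only
      · rw [min_eq_left (le_min (by linarith) (by linarith))]; ring
      · rw [max_eq_right (a := -(2 * r + s)) (le_max_of_le_right (by linarith)), max_eq_right (by linarith)]; ring
    · rw [abs_of_nonneg hr, abs_of_nonpos hs, max_eq_left hr, max_eq_left (a := -s) (by linarith)]
      ext <;> simp only
      · rw [min_eq_right (min_le_of_left_le (by linarith)), min_eq_left (by linarith)]; ring
      · rw [max_eq_right (a := -(2 * r + -s)) (le_max_of_le_left (by linarith)), max_eq_left (by linarith)]; ring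
    · have : 0 = r ∨ s = 0 := by
        rcases h with h | h
        · left; linarith
        · right; linarith
      rcases this with rfl | rfl
      · simp only [abs_zero, abs_of_nonneg hs, max_self, max_eq_right (a := -s) (b := 0) (by linarith)]
        ext <;> simp only
        · rw [min_eq_left (le_min (by linarith) (by linarith))]; ring
        · rw [max_eq_right (a := -(2 * 0 + s)) (le_max_of_le_right (by linarith)), max_eq_right (by linarith)]; ring
      · simp only [abs_zero, abs_of_nonpos hr, max_eq_right hr, neg_zero, max_self]
        ext <;> simp only
        · rw [min_eq_right (min_le_of_right_le (by linarith)), min_eq_right (by linarith)]; ring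
        · rw [max_eq_left (max_le (by linarith) (by linarith))]; ring
    · rw [abs_of_nonpos hr, abs_of_nonpos hs, max_eq_right hr, max_eq_left (a := -s) (by linarith)]
      ext <;> simp only
      · rw [min_eq_right (min_le_of_right_le (by linarith)), min_eq_right (by linarith)]; ring
      · rw [max_eq_left (max_le (by linarith) (by linarith))]; ring
  · rintro ⟨x, t⟩ h
    simp only [thF, thG, Set.mem_ofPred_eq] at *
    obtain ⟨h1, h2⟩ := h
    rcases le_total (2 * (-x)) t with h3 | h3
    · rw [min_eq_left (a := -x) (le_min (by linarith) (by linarith)), max_eq_right (a := -t) (le_max_of_le_right (by linarith)), max_eq_right (a := 3⁻¹ * (t - 2 * -x)) (by linarith),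
        abs_of_nonneg (a := -x) (by linarith), abs_of_nonneg (a := t - 2 * -x) (by linarith), max_eq_left (a := -x) (by linarith), max_eq_right (a := -(t - 2 * -x)) (by linarith)]
      ext <;> simp only <;> ring
    rcases le_total (-x) (2 * t) with h4 | h4
    · rw [min_eq_right (a := -x) (min_le_of_left_le (by linarith)), min_eq_left (by linarith), max_eq_right (a := -t) (le_max_of_le_left (by linarith)), max_eq_left (a := 3⁻¹ * (t - 2 * -x)) (by linarith),
        abs_of_nonneg (by linarith), abs_of_nonpos (by linarith), max_eq_left (by linarith), max_eq_left (by linarith)]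
      ext <;> simp only <;> ring
    · rw [min_eq_right (a := -x) (min_le_of_right_le (by linarith)), min_eq_right (a := 3⁻¹ * _) (by linarith), max_eq_left (a := -t) (max_le (by linarith) (by linarith)),
        abs_of_nonpos (a := 2 * t - -x) (by linarith), abs_of_nonpos (a := -t) (by linarith), max_eq_right (a := 2 * t - -x) (by linarith), max_eq_left (a := - -t) (by linarith)]
      ext <;> simp only <;> ring

theorem thF_fix1 {s : ℝ} (hs : 0 ≤ s) : thF (0, s) = (0, s) := by
  simp [thF, abs_of_nonneg hs, hs]
theorem thF_fix2 {r : ℝ} (hr : r ≤ 0) : thF (r, 0) = (r, 0) := by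
  simp [thF, abs_of_nonpos hr, hr]

/-- The V lemma. -/
theorem vlemma {X H F F' G' Φ : Set E} (hX : Starr X (F ∪ G')) (hH : Starr H (F ∪ F'))
    (hF : Starr F Φ) (hF' : Starr F' Φ) (hFG : F ∩ G' = Φ) (hFF : F ∩ F' = Φ) (hFG' : F' ∩ G' = Φ)
    (hXH : X ∩ H ⊆ F) (cX : IsClosed X) (cH : IsClosed H) (cF : IsClosed F) (cF' : IsClosed F')
    (cG : IsClosed G') : Starr (X ∪ H) (G' ∪ F') := by
  have cΦ : IsClosed Φ := by rw [← hFF]; exact cF.inter cF'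
  obtain ⟨k, k', hk, hk0, hJX⟩ := hX
  obtain ⟨l, l', hl, hl0, hJH⟩ := hH
  have hl2 := hl.trans ((PLE.refl (F ∪ F')).prod PLE.negHalf)
  obtain ⟨e, e', he, e1, e2, e1', e2'⟩ := PLE.glue hk hl2 cX cH ((cF.union cG).prod isClosed_Ici)
    ((cF.union cF').prod isClosed_Iic)
    (by
      intro x h1 h2
      have := hXH ⟨h1, h2⟩
      simp [hk0 x (Or.inl this), hl0 x (Or.inl this)])
    (by
      rintro ⟨j, s⟩ ⟨hj, h1⟩ ⟨hj', h2⟩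
      have : s = 0 := le_antisymm h2 h1
      subst this
      simp only at hj hj'
      have hjF : j ∈ F := by
        rcases hj with h | h
        · exact h
        rcases hj' with h' | h'
        · exact h'
        have : j ∈ Φ := by rw [← hFG']; exact ⟨h', h⟩
        rw [← hFF] at this; exact this.1
      have e1 := hk.gf j (hJX hj)
      have e2 := hl.gf j (hJH hj')
      rw [hk0 j hj] at e1
      rw [hl0 j hj'] at e2
      simp [e1, e2])
  -- chart of F ∪ F'
  obtain ⟨c, c', hc, hc0, hc0', cp, cn, cp', cn'⟩ := double hF hF' hFF.subset cF cF' cΦ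
  have hΦF : Φ ⊆ F := by rw [← hFF]; exact Set.inter_subset_left
  have hΦF' : Φ ⊆ F' := by rw [← hFF]; exact Set.inter_subset_right
  have hΦG : Φ ⊆ G' := by rw [← hFG]; exact Set.inter_subset_right
  -- T2 → F' × [0,∞)
  let T2 : Set (E × ℝ) := F ×ˢ Set.Ici 0 ∪ (F ∪ F') ×ˢ Set.Iic 0
  have cT2 : IsClosed T2 := (cF.prod isClosed_Ici).union ((cF.union cF').prod isClosed_Iic)
  have a1 : PLE T2 (Φ ×ˢ {p : ℝ × ℝ | 0 ≤ p.1 ∨ p.2 ≤ 0})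
      (fun p => ((c p.1).1, ((c p.1).2, p.2))) (fun q => (c' (q.1, q.2.1), q.2.2)) := by
    have i := PLOn.id T2
    have hT : ∀ x ∈ T2, x.1 ∈ F ∪ F' := by
      rintro x (hx | hx)
      · exact Or.inl hx.1
      · exact hx.1
    have pc := hc.pf.comp i.fst hT
    have i' := PLOn.id (Φ ×ˢ {p : ℝ × ℝ | 0 ≤ p.1 ∨ p.2 ≤ 0})
    refine ⟨pc.fst.prodMk (pc.snd.prodMk i.snd),
      (hc.pg.comp (i'.fst.prodMk i'.snd.fst) ?_).prodMk i'.snd.snd, ?_, ?_, ?_, ?_⟩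
    · exact fun x hx => ⟨hx.1, trivial⟩
    · intro x hx
      refine ⟨(hc.mf _ (hT x hx)).1, ?_⟩
      rcases hx with hx | hx
      · exact Or.inl (cp _ hx.1)
      · exact Or.inr hx.2
    · rintro ⟨φ, r, s⟩ ⟨hφ, h⟩
      simp only [Set.mem_ofPred_eq] at hφ h
      rcases le_total 0 s with hs | hs
      · rcases h with h | h
        · exact Or.inl ⟨cp' φ hφ r h, hs⟩
        · exact Or.inr ⟨hc.mg _ ⟨hφ, trivial⟩, h⟩
      · exact Or.inr ⟨hc.mg _ ⟨hφ, trivial⟩, hs⟩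
    · rintro ⟨x, s⟩ hx
      have := hc.gf x (hT _ hx)
      simp [this]
    · rintro ⟨φ, r, s⟩ ⟨hφ, h⟩
      have := hc.fg (φ, r) ⟨hφ, trivial⟩
      simp [this]
  have a2 := (PLE.refl Φ).prod theta_ple
  have a3 : PLE (Φ ×ˢ {p : ℝ × ℝ | p.1 ≤ 0 ∧ 0 ≤ p.2}) (F' ×ˢ Set.Ici (0:ℝ))
      (fun q => (c' (q.1, q.2.1), q.2.2)) (fun p => ((c p.1).1, ((c p.1).2, p.2))) := by
    have i := PLOn.id (F' ×ˢ Set.Ici (0:ℝ))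
    have hT : ∀ x ∈ F' ×ˢ Set.Ici (0:ℝ), x.1 ∈ F ∪ F' := fun x hx => Or.inr hx.1
    have pc := hc.pf.comp i.fst hT
    have i' := PLOn.id (Φ ×ˢ {p : ℝ × ℝ | p.1 ≤ 0 ∧ 0 ≤ p.2})
    refine ⟨(hc.pg.comp (i'.fst.prodMk i'.snd.fst) ?_).prodMk i'.snd.snd,
      pc.fst.prodMk (pc.snd.prodMk i.snd), ?_, ?_, ?_, ?_⟩
    · exact fun x hx => ⟨hx.1, trivial⟩
    · rintro ⟨φ, r, s⟩ ⟨hφ, h⟩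
      exact ⟨cn' φ hφ r h.1, h.2⟩
    · intro x hx
      exact ⟨(hc.mf _ (hT x hx)).1, cn _ hx.1, hx.2⟩
    · rintro ⟨φ, r, s⟩ ⟨hφ, h⟩
      have := hc.fg (φ, r) ⟨hφ, trivial⟩
      simp [this]
    · rintro ⟨x, s⟩ hx
      have := hc.gf x (hT _ hx)
      simp [this]
  obtain ⟨af, ag, a, fixΦ, fixF'⟩ : ∃ af ag, PLE T2 (F' ×ˢ Set.Ici (0:ℝ)) af ag ∧
      (∀ φ ∈ Φ, ∀ s, 0 ≤ s → af (φ, s) = (φ, s)) ∧ (∀ x ∈ F', af (x, 0) = (x, 0)) := by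
    refine ⟨_, _, a1.trans (a2.trans a3), ?_, ?_⟩
    · intro φ hφ s hs
      simp [hc0 φ hφ, thF_fix1 hs, hc0' φ hφ]
    · intro x hx
      simp [thF_fix2 (cn x hx), hc.gf x (Or.inr hx)]
  obtain ⟨f, f', hf, f1, f2, f1', f2'⟩ := PLE.glue (PLE.refl (G' ×ˢ Set.Ici (0:ℝ))) a
    (cG.prod isClosed_Ici) cT2 (cG.prod isClosed_Ici) (cF'.prod isClosed_Ici)
    (by
      rintro ⟨x, s⟩ ⟨hx, hs⟩ h2
      have hφ : x ∈ Φ := by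
        rcases h2 with ⟨h2, -⟩ | ⟨h2 | h2, -⟩
        · rw [← hFG]; exact ⟨h2, hx⟩
        · rw [← hFG]; exact ⟨h2, hx⟩
        · rw [← hFG']; exact ⟨h2, hx⟩
      exact (fixΦ x hφ s hs).symm)
    (by
      rintro ⟨x, s⟩ ⟨hx, hs⟩ ⟨h2, -⟩
      have hφ : x ∈ Φ := by rw [← hFG']; exact ⟨h2, hx⟩
      have := a.gf (x, s) (Or.inl ⟨hΦF hφ, hs⟩)
      rw [fixΦ x hφ s hs] at this
      exact this.symm)
  have hTT : (F ∪ G') ×ˢ Set.Ici (0:ℝ) ∪ (F ∪ F') ×ˢ Set.Iic (0:ℝ) = G' ×ˢ Set.Ici (0:ℝ) ∪ T2 := by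
    simp only [T2, Set.union_prod]
    ext x; simp only [Set.mem_union]; tauto
  rw [hTT] at he
  have hfin := he.trans hf
  rw [← Set.union_prod] at hfin
  refine ⟨_, _, hfin, ?_, ?_⟩
  · rintro j (hj | hj)
    · show f (e j) = (j, 0)
      rw [e1 j (hJX (Or.inr hj)), hk0 j (Or.inr hj), f1 (j, 0) ⟨hj, le_refl (0:ℝ)⟩]
    · show f (e j) = (j, 0)
      have : e j = (j, 0) := by rw [e2 j (hJH (Or.inr hj)), hl0 j (Or.inr hj)]; simp
      rw [this, f2 (j, 0) (Or.inr ⟨Or.inr hj, le_refl (0:ℝ)⟩)]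
      exact fixF' j hj
  · rintro j (hj | hj)
    · exact Or.inl (hJX (Or.inr hj))
    · exact Or.inr (hJH (Or.inr hj))

end PL2

section Rz
variable {V : Type*} [Fintype V] [DecidableEq V]

/-- complexes (including the empty face) -/
structure CX (K : Set (Finset V)) : Prop where
  emp : ∅ ∈ K
  down : ∀ s ∈ K, ∀ t, t ⊆ s → t ∈ K

/-- the cone realization -/
def rz (K : Set (Finset V)) : Set (V → ℝ) := {c | (∀ v, 0 ≤ c v) ∧ ∃ s ∈ K, ∀ v, v ∉ s → c v = 0}

def Lk (K : Set (Finset V)) (u : V) : Set (Finset V) := {s | u ∉ s ∧ insert u s ∈ K}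

theorem CX.lk {K : Set (Finset V)} (h : CX K) {u : V} (hu : {u} ∈ K) : CX (Lk K u) :=
  ⟨⟨by simp, by simpa using hu⟩, fun s hs t ht => ⟨fun h' => hs.1 (ht h'),
    h.down _ hs.2 _ (insert_subset_insert u ht)⟩⟩

theorem rz_closed (K : Set (Finset V)) : IsClosed (rz K) := by
  have : rz K = (⋂ v, {c : V → ℝ | 0 ≤ c v}) ∩ ⋃ s ∈ K, ⋂ v, {c : V → ℝ | v ∉ s → c v = 0} := by
    ext c; simp [rz]
  rw [this]
  refine (isClosed_iInter fun v => isClosed_le continuous_const (continuous_apply v)).inter ?_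
  refine K.toFinite.isClosed_biUnion fun s _ => isClosed_iInter fun v => ?_
  by_cases h : v ∈ s
  · simp [h]
  · simp only [h, not_false_eq_true, forall_const]
    exact isClosed_eq (continuous_apply v) continuous_const

theorem rz_zero {K : Set (Finset V)} (h : CX K) : (0 : V → ℝ) ∈ rz K :=
  ⟨fun _ => le_refl _, ∅, h.emp, fun _ _ => rfl⟩

theorem rz_smul {K : Set (Finset V)} {c : V → ℝ} (h : c ∈ rz K) {t : ℝ} (ht : 0 ≤ t) : t • c ∈ rz K := by
  obtain ⟨h1, s, hs, h2⟩ := h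
  exact ⟨fun v => mul_nonneg ht (h1 v), s, hs, fun v hv => by simp [h2 v hv]⟩

/-- maximum over a set of labels of a nonnegative vector -/
noncomputable def mx (A : Finset V) (c : V → ℝ) : ℝ := ‖fun v => if v ∈ A then c v else 0‖

theorem mx_nonneg (A : Finset V) (c : V → ℝ) : 0 ≤ mx A c := norm_nonneg _

theorem le_mx {A : Finset V} {c : V → ℝ} {v : V} (hv : v ∈ A) : c v ≤ mx A c := by
  have := norm_le_pi_norm (fun v => if v ∈ A then c v else 0) v
  simp only [hv, if_true] at this
  exact (le_abs_self _).trans this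

theorem mx_le {A : Finset V} {c : V → ℝ} (hc : ∀ v, 0 ≤ c v) {r : ℝ} (hr : 0 ≤ r)
    (h : ∀ v ∈ A, c v ≤ r) : mx A c ≤ r := by
  refine (pi_norm_le_iff_of_nonneg hr).2 fun v => ?_
  by_cases hv : v ∈ A
  · simp [hv, abs_of_nonneg (hc v), h v hv]
  · simp [hv, hr]

theorem mx_zero (A : Finset V) : mx A (0 : V → ℝ) = 0 :=
  le_antisymm (mx_le (fun _ => le_refl _) le_rfl fun _ _ => le_refl _) (mx_nonneg _ _)

theorem mx_congr {A : Finset V} {c c' : V → ℝ} (h : ∀ v ∈ A, c v = c' v) : mx A c = mx A c' := by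
  unfold mx; congr 1; ext v
  by_cases hv : v ∈ A <;> simp [hv, h]

theorem mx_insert {A : Finset V} {c : V → ℝ} (hc : ∀ v, 0 ≤ c v) (u : V) :
    mx (insert u A) c = max (c u) (mx A c) := by
  apply le_antisymm
  · refine mx_le hc (le_max_of_le_left (hc u)) fun v hv => ?_
    rcases mem_insert.1 hv with rfl | hv
    · exact le_max_left _ _
    · exact le_max_of_le_right (le_mx hv)
  · refine max_le (le_mx (by simp)) (mx_le hc (mx_nonneg _ _) fun v hv => le_mx (by simp [hv]))

theorem mx_univ {c : V → ℝ} : mx univ c = ‖c‖ := by simp [mx]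

theorem mx_singleton {c : V → ℝ} (hc : ∀ v, 0 ≤ c v) (u : V) : mx {u} c = c u := by
  apply le_antisymm
  · exact mx_le hc (hc u) (by simp)
  · exact le_mx (by simp)

theorem mx_compl_max {A : Finset V} {c : V → ℝ} (hc : ∀ v, 0 ≤ c v) :
    max (mx A c) (mx Aᶜ c) = ‖c‖ := by
  rw [← mx_univ]
  apply le_antisymm
  · exact max_le (mx_le hc (mx_nonneg _ _) fun v _ => le_mx (by simp))
      (mx_le hc (mx_nonneg _ _) fun v _ => le_mx (by simp))
  · refine mx_le hc (le_max_of_le_left (mx_nonneg _ _)) fun v _ => ?_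
    by_cases hv : v ∈ A
    · exact le_max_of_le_left (le_mx hv)
    · exact le_max_of_le_right (le_mx (by simp [hv]))

theorem mx_cont (A : Finset V) : Continuous (mx A : (V → ℝ) → ℝ) := by
  unfold mx
  refine Continuous.norm (continuous_pi fun v => ?_)
  by_cases h : v ∈ A
  · simpa [h] using continuous_apply v
  · simpa [h] using continuous_const

theorem PLOn.mx {E : Type*} [NormedAddCommGroup E] [NormedSpace ℝ E] {X : Set E} {f : E → V → ℝ}
    (h : PLOn X f) (A : Finset V) : PLOn X (fun x => HS.mx A (f x)) := by
  unfold HS.mx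
  refine PLOn.norm_pi (PLOn.pi fun v => ?_)
  by_cases hv : v ∈ A
  · simpa [hv] using h.apply v
  · simpa [hv] using PLOn.zero X

def Np (S : Set (Finset V)) (A : Finset V) : Set (V → ℝ) := {c | c ∈ rz S ∧ mx Aᶜ c ≤ mx A c}
def JA (S : Set (Finset V)) (A : Finset V) : Set (V → ℝ) := {c | c ∈ rz S ∧ mx A c = mx Aᶜ c}
def Beta (S : Set (Finset V)) (A : Finset V) : Prop := Starr (Np S A) (JA S A)

theorem Np_closed (S : Set (Finset V)) (A : Finset V) : IsClosed (Np S A) :=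
  (rz_closed S).inter (isClosed_le (mx_cont _) (mx_cont _))
theorem JA_closed (S : Set (Finset V)) (A : Finset V) : IsClosed (JA S A) :=
  (rz_closed S).inter (isClosed_eq (mx_cont _) (mx_cont _))
theorem JA_compl (S : Set (Finset V)) (A : Finset V) : JA S Aᶜ = JA S A := by
  ext c; simp [JA, eq_comm]
theorem JA_sub (S : Set (Finset V)) (A : Finset V) : JA S A ⊆ Np S A := fun c hc => ⟨hc.1, hc.2.ge⟩

/-- `ê_u` -/
def eu (u : V) : V → ℝ := Pi.single u 1
theorem eu_same (u : V) : eu u u = 1 := by simp [eu]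
theorem eu_ne {u v : V} (h : v ≠ u) : eu u v = 0 := by simp [eu, h]

theorem add_eu_nonneg {c : V → ℝ} {u : V} {t : ℝ} (hc : ∀ v, 0 ≤ c v) (ht : 0 ≤ c u + t) :
    ∀ v, 0 ≤ (c + t • eu u) v := by
  intro v
  by_cases h : v = u
  · subst h; simpa [eu_same] using ht
  · simpa [eu_ne h] using hc v

theorem mx_add_eu {c : V → ℝ} {u : V} {t : ℝ} {A : Finset V} (hu : u ∉ A) :
    mx A (c + t • eu u) = mx A c := mx_congr fun v hv => by
  have : v ≠ u := fun h => hu (h ▸ hv)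
  simp [eu_ne this]

theorem rz_add_eu {S : Set (Finset V)} (hS : CX S) {c : V → ℝ} {u : V} {t : ℝ} (hc : c ∈ rz S)
    (hu : 0 < c u) (ht : 0 ≤ c u + t) : c + t • eu u ∈ rz S := by
  obtain ⟨h1, s, hs, h2⟩ := hc
  refine ⟨add_eu_nonneg h1 ht, s, hs, fun v hv => ?_⟩
  have : v ≠ u := by rintro rfl; exact hu.ne' (h2 _ hv)
  simp [eu_ne this, h2 v hv]

theorem zero_of_mx {c : V → ℝ} {u : V} (hc : ∀ v, 0 ≤ c v) (h : mx {u}ᶜ c ≤ c u) (h0 : c u = 0) : c = 0 := by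
  ext v
  by_cases hv : v = u
  · rw [hv]; exact h0
  · exact le_antisymm ((le_mx (by simp [hv])).trans (h.trans h0.le)) (hc v)

theorem rz_eu {S : Set (Finset V)} {u : V} (hu : {u} ∈ S) {t : ℝ} (ht : 0 ≤ t) : t • eu u ∈ rz S := by
  refine ⟨fun v => ?_, {u}, hu, fun v hv => ?_⟩
  · by_cases h : v = u
    · subst h; simpa [eu_same] using ht
    · simp [eu_ne h]
  · simp [eu_ne (show v ≠ u by simpa using hv)]

theorem beta_single {S : Set (Finset V)} (hS : CX S) {u : V} (hu : {u} ∈ S) : Beta S {u} := by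
  have i := PLOn.id (Np S {u})
  have i' := PLOn.id ((JA S {u}) ×ˢ Set.Ici (0:ℝ))
  refine ⟨fun c => (c + (mx {u}ᶜ c - c u) • eu u, c u - mx {u}ᶜ c), fun p => p.1 + p.2 • eu u,
    ⟨?_, ?_, ?_, ?_, ?_, ?_⟩, ?_, JA_sub _ _⟩
  · exact (i.add (((i.mx _).sub (i.apply u)).smul_const _)).prodMk ((i.apply u).sub (i.mx _))
  · exact i'.fst.add (i'.snd.smul_const _)
  · rintro c ⟨hc, h⟩
    rw [mx_singleton hc.1] at h
    refine ⟨⟨?_, ?_⟩, by simpa using h⟩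
    · rcases (hc.1 u).lt_or_eq with h0 | h0
      · exact rz_add_eu hS hc h0 (by have := mx_nonneg {u}ᶜ c; linarith)
      · have := zero_of_mx hc.1 h h0.symm
        subst this
        simpa [mx_zero] using rz_zero hS
    · dsimp only
      rw [mx_singleton (add_eu_nonneg hc.1 (by have := mx_nonneg {u}ᶜ c; linarith)),
        mx_add_eu (by simp)]
      simp [eu_same]
  · rintro ⟨c, t⟩ ⟨⟨hc, h⟩, ht⟩
    simp only [Set.mem_Ici] at *
    have hn := add_eu_nonneg (u := u) (t := t) hc.1 (by have := hc.1 u; linarith)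
    rw [mx_singleton hc.1] at h
    refine ⟨?_, ?_⟩
    · rcases (hc.1 u).lt_or_eq with h0 | h0
      · exact rz_add_eu hS hc h0 (by linarith)
      · have := zero_of_mx hc.1 h.ge h0.symm
        subst this
        simpa using rz_eu hu ht
    · rw [mx_singleton hn, mx_add_eu (by simp), ← h]
      simpa [eu_same] using ht
  · rintro c ⟨hc, h⟩
    dsimp only
    rw [add_assoc, ← add_smul]; simp
  · rintro ⟨c, t⟩ ⟨⟨hc, h⟩, ht⟩
    dsimp only at *
    rw [mx_singleton hc.1] at h
    rw [mx_add_eu (by simp), ← h]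
    simp [eu_same, add_assoc, ← add_smul]
  · rintro c ⟨hc, h⟩
    rw [mx_singleton hc.1] at h
    dsimp only
    rw [← h]; simp

/-- `|Lk u|` versus the boundary of the star of `u` -/
theorem lk_ple {S : Set (Finset V)} (hS : CX S) {u : V} (hu : {u} ∈ S) :
    PLE (rz (Lk S u)) (JA S {u}) (fun y => y + ‖y‖ • eu u) (fun c => c - c u • eu u) := by
  have i := PLOn.id (rz (Lk S u))
  have i' := PLOn.id (JA S {u})
  have zu : ∀ y ∈ rz (Lk S u), y u = 0 := by
    rintro y ⟨h1, s, hs, h2⟩; exact h2 u hs.1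
  refine ⟨i.add (i.norm_pi.smul_const _), i'.sub ((i'.apply u).smul_const _), ?_, ?_, ?_, ?_⟩
  · intro y hy
    have hn := add_eu_nonneg (u := u) (t := ‖y‖) hy.1 (by rw [zu y hy]; simp)
    refine ⟨?_, ?_⟩
    · obtain ⟨h1, s, hs, h2⟩ := hy
      refine ⟨hn, _, hs.2, fun v hv => ?_⟩
      simp only [mem_insert, not_or] at hv
      simp [eu_ne hv.1, h2 v hv.2]
    · rw [mx_singleton hn, mx_add_eu (by simp)]
      have := mx_compl_max (A := {u}) hy.1
      rw [mx_singleton hy.1, zu y hy, max_eq_right (mx_nonneg _ _)] at this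
      simp [this, zu y hy, eu_same]
  · rintro c ⟨hc, h⟩
    rw [mx_singleton hc.1] at h
    rcases (hc.1 u).lt_or_eq with h0 | h0
    · obtain ⟨h1, s, hs, h2⟩ := hc
      have hus : u ∈ s := by by_contra h; exact h0.ne' (h2 u h)
      refine ⟨fun v => ?_, s.erase u, ⟨by simp, by rwa [insert_erase hus]⟩, fun v hv => ?_⟩
      · by_cases h : v = u
        · subst h; simp [eu_same]
        · simpa [eu_ne h] using h1 v
      · by_cases h : v = u
        · subst h; simp [eu_same]
        · simp [eu_ne h, h2 v (fun h' => hv (by simp [h, h']))]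
    · have := zero_of_mx hc.1 h.ge h0.symm
      subst this
      simpa using rz_zero (hS.lk hu)
  · intro y hy
    simp [zu y hy, eu_same]
  · rintro c ⟨hc, h⟩
    rw [mx_singleton hc.1] at h
    have hy : ‖c - c u • eu u‖ = c u := by
      have hn : ∀ v, 0 ≤ (c - c u • eu u) v := by
        intro v
        by_cases h : v = u
        · subst h; simp [eu_same]
        · simpa [eu_ne h] using hc.1 v
      rw [← mx_compl_max (A := {u}) hn, mx_singleton hn, max_eq_right, sub_eq_add_neg, ← neg_smul,
        mx_add_eu (by simp), h]
      simp [eu_same, mx_nonneg]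
    rw [hy]; simp

theorem beta_congr {S : Set (Finset V)} {A : Finset V} {u : V} (hu : ∀ c ∈ rz S, c u = 0) (h : Beta S A) :
    Beta S (insert u A) := by
  have key : ∀ c ∈ rz S, mx (insert u A) c = mx A c ∧ mx (insert u A)ᶜ c = mx Aᶜ c := by
    intro c hc
    refine ⟨by rw [mx_insert hc.1, hu c hc, max_eq_right (mx_nonneg _ _)], ?_⟩
    unfold mx; congr 1; ext v
    by_cases hv : v = u
    · subst hv; simp [hu c hc]
    · simp [hv]
  have h1 : Np S (insert u A) = Np S A := by
    ext c; constructor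
    · rintro ⟨hc, h⟩; rw [(key c hc).1, (key c hc).2] at h; exact ⟨hc, h⟩
    · rintro ⟨hc, h⟩; rw [← (key c hc).1, ← (key c hc).2] at h; exact ⟨hc, h⟩
  have h2 : JA S (insert u A) = JA S A := by
    ext c; constructor
    · rintro ⟨hc, h⟩; rw [(key c hc).1, (key c hc).2] at h; exact ⟨hc, h⟩
    · rintro ⟨hc, h⟩; rw [← (key c hc).1, ← (key c hc).2] at h; exact ⟨hc, h⟩
  unfold Beta; rw [h1, h2]; exact h

theorem beta_add {S : Set (Finset V)} (hS : CX S) {A : Finset V} {u : V} (hu : {u} ∈ S) (huA : u ∉ A)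
    (h : Beta S A) (h1 : Beta (Lk S u) A) (h2 : Beta (Lk S u) Aᶜ) : Beta S (insert u A) := by
  set B := (insert u A)ᶜ with hB
  have hAc : Aᶜ = insert u B := by
    rw [hB]; ext v; by_cases hv : v = u <;> simp [hv, huA]
  have huc : ({u} : Finset V)ᶜ = A ∪ B := by
    rw [hB]; ext v; by_cases hv : v = u
    · simp [hv, huA]
    · simp [hv, em]
  have huB : u ∉ B := by simp [hB]
  have mAc : ∀ c : V → ℝ, (∀ v, 0 ≤ c v) → mx Aᶜ c = max (c u) (mx B c) := fun c hc => by
    rw [hAc, mx_insert hc]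
  have muc : ∀ c : V → ℝ, (∀ v, 0 ≤ c v) → mx {u}ᶜ c = max (mx A c) (mx B c) := fun c hc => by
    rw [huc]
    apply le_antisymm
    · refine mx_le hc (le_max_of_le_left (mx_nonneg _ _)) fun v hv => ?_
      rcases mem_union.1 hv with hv | hv
      · exact le_max_of_le_left (le_mx hv)
      · exact le_max_of_le_right (le_mx hv)
    · exact max_le (mx_le hc (mx_nonneg _ _) fun v hv => le_mx (by simp [hv]))
        (mx_le hc (mx_nonneg _ _) fun v hv => le_mx (by simp [hv]))
  let F : Set (V → ℝ) := {c | c ∈ rz S ∧ c u = mx A c ∧ mx B c ≤ mx A c}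
  let F' : Set (V → ℝ) := {c | c ∈ rz S ∧ c u = mx B c ∧ mx A c ≤ mx B c}
  let G' : Set (V → ℝ) := {c | c ∈ rz S ∧ mx A c = mx B c ∧ c u ≤ mx A c}
  let Φ : Set (V → ℝ) := {c | c ∈ rz S ∧ c u = mx A c ∧ c u = mx B c}
  have cu : Continuous fun c : V → ℝ => c u := continuous_apply u
  have cF : IsClosed F := (rz_closed S).inter ((isClosed_eq cu (mx_cont _)).inter
    (isClosed_le (mx_cont _) (mx_cont _)))
  have cF' : IsClosed F' := (rz_closed S).inter ((isClosed_eq cu (mx_cont _)).inter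
    (isClosed_le (mx_cont _) (mx_cont _)))
  have cG' : IsClosed G' := (rz_closed S).inter ((isClosed_eq (mx_cont _) (mx_cont _)).inter
    (isClosed_le cu (mx_cont _)))
  have eJ : JA S A = F ∪ G' := by
    ext c; constructor
    · rintro ⟨hc, h⟩
      rw [mAc c hc.1] at h
      rcases le_total (c u) (mx B c) with h' | h'
      · rw [max_eq_right h'] at h; exact Or.inr ⟨hc, h, by linarith⟩
      · rw [max_eq_left h'] at h; exact Or.inl ⟨hc, h.symm, by linarith⟩
    · rintro (⟨hc, h, h'⟩ | ⟨hc, h, h'⟩)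
      · refine ⟨hc, ?_⟩; rw [mAc c hc.1, max_eq_left] <;> linarith
      · refine ⟨hc, ?_⟩; rw [mAc c hc.1, max_eq_right] <;> linarith
  have eH : JA S {u} = F ∪ F' := by
    ext c; constructor
    · rintro ⟨hc, h⟩
      rw [muc c hc.1, mx_singleton hc.1] at h
      rcases le_total (mx A c) (mx B c) with h' | h'
      · rw [max_eq_right h'] at h; exact Or.inr ⟨hc, h, h'⟩
      · rw [max_eq_left h'] at h; exact Or.inl ⟨hc, h, h'⟩
    · rintro (⟨hc, h, h'⟩ | ⟨hc, h, h'⟩)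
      · refine ⟨hc, ?_⟩; rw [muc c hc.1, mx_singleton hc.1, max_eq_left] <;> linarith
      · refine ⟨hc, ?_⟩; rw [muc c hc.1, mx_singleton hc.1, max_eq_right] <;> linarith
  have eN : JA S (insert u A) = G' ∪ F' := by
    ext c; constructor
    · rintro ⟨hc, h⟩
      rw [mx_insert hc.1, ← hB] at h
      rcases le_total (c u) (mx A c) with h' | h'
      · rw [max_eq_right h'] at h; exact Or.inl ⟨hc, h, h'⟩
      · rw [max_eq_left h'] at h; exact Or.inr ⟨hc, h, by linarith⟩
    · rintro (⟨hc, h, h'⟩ | ⟨hc, h, h'⟩)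
      · refine ⟨hc, ?_⟩; rw [mx_insert hc.1, ← hB, max_eq_right] <;> linarith
      · refine ⟨hc, ?_⟩; rw [mx_insert hc.1, ← hB, max_eq_left] <;> linarith
  have eU : Np S (insert u A) = Np S A ∪ Np S {u} := by
    ext c; constructor
    · rintro ⟨hc, h⟩
      rw [mx_insert hc.1, ← hB] at h
      rcases le_total (c u) (mx A c) with h' | h'
      · left; refine ⟨hc, ?_⟩; rw [mAc c hc.1]; rw [max_eq_right h'] at h; exact max_le h' h
      · right; refine ⟨hc, ?_⟩; rw [muc c hc.1, mx_singleton hc.1]; rw [max_eq_left h'] at h; exact max_le h' h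
    · rintro (⟨hc, h⟩ | ⟨hc, h⟩)
      · rw [mAc c hc.1] at h
        refine ⟨hc, ?_⟩; rw [mx_insert hc.1, ← hB]
        exact le_max_of_le_right ((le_max_right _ _).trans h)
      · rw [muc c hc.1, mx_singleton hc.1] at h
        refine ⟨hc, ?_⟩; rw [mx_insert hc.1, ← hB]
        exact le_max_of_le_left ((le_max_right _ _).trans h)
  have hp := lk_ple hS hu
  have zu : ∀ y ∈ rz (Lk S u), y u = 0 := by
    rintro y ⟨h1, s, hs, h2⟩; exact h2 u hs.1
  -- values on link points
  have hval : ∀ y ∈ rz (Lk S u), mx Aᶜ y = mx B y ∧ ‖y‖ = max (mx A y) (mx B y) := fun y hy => by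
    have : mx Aᶜ y = mx B y := by rw [mAc y hy.1, zu y hy, max_eq_right (mx_nonneg _ _)]
    exact ⟨this, by rw [← mx_compl_max (A := A) hy.1, this]⟩
  have hlift : ∀ y ∈ rz (Lk S u), mx A (y + ‖y‖ • eu u) = mx A y ∧ mx B (y + ‖y‖ • eu u) = mx B y ∧
      (y + ‖y‖ • eu u) u = ‖y‖ := fun y hy =>
    ⟨mx_add_eu huA, mx_add_eu huB, by simp [zu y hy, eu_same]⟩
  have hflat : ∀ c : V → ℝ, mx A (c - c u • eu u) = mx A c ∧ mx B (c - c u • eu u) = mx B c := fun c => by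
    rw [sub_eq_add_neg, ← neg_smul]
    exact ⟨mx_add_eu huA, mx_add_eu huB⟩
  have pF : PLE (Np (Lk S u) A) F (fun y => y + ‖y‖ • eu u) (fun c => c - c u • eu u) := by
    refine hp.restrict (fun y hy => hy.1) (by rw [eH]; exact Set.subset_union_left) ?_ ?_
    · rintro y ⟨hy, h⟩
      rw [(hval y hy).1] at h
      obtain ⟨a, b, c⟩ := hlift y hy
      refine ⟨(hp.mf y hy).1, ?_, ?_⟩
      · rw [a, c, (hval y hy).2, max_eq_left h]
      · rw [a, b]; exact h
    · intro c hc
      have hy := hp.mg c (by rw [eH]; exact Or.inl hc)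
      refine ⟨hy, ?_⟩
      rw [(hval _ hy).1, (hflat c).1, (hflat c).2]; exact hc.2.2
  have pF' : PLE (Np (Lk S u) Aᶜ) F' (fun y => y + ‖y‖ • eu u) (fun c => c - c u • eu u) := by
    refine hp.restrict (fun y hy => hy.1) (by rw [eH]; exact Set.subset_union_right) ?_ ?_
    · rintro y ⟨hy, h⟩
      rw [(hval y hy).1, compl_compl] at h
      obtain ⟨a, b, c⟩ := hlift y hy
      refine ⟨(hp.mf y hy).1, ?_, ?_⟩
      · rw [b, c, (hval y hy).2, max_eq_right h]
      · rw [a, b]; exact h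
    · intro c hc
      have hy := hp.mg c (by rw [eH]; exact Or.inr hc)
      refine ⟨hy, ?_⟩
      rw [compl_compl, (hval _ hy).1, (hflat c).1, (hflat c).2]; exact hc.2.2
  have toΦ : ∀ y ∈ JA (Lk S u) A, y + ‖y‖ • eu u ∈ Φ := by
    rintro y ⟨hy, h⟩
    rw [(hval y hy).1] at h
    obtain ⟨a, b, c⟩ := hlift y hy
    refine ⟨(hp.mf y hy).1, ?_, ?_⟩
    · rw [a, c, (hval y hy).2, h, max_self]
    · rw [b, c, (hval y hy).2, h, max_self]
  have ofΦ : ∀ c ∈ Φ, c - c u • eu u ∈ JA (Lk S u) A := by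
    rintro c ⟨hc, h, h'⟩
    have hy := hp.mg c (by rw [eH]; exact Or.inl ⟨hc, h, by linarith⟩)
    refine ⟨hy, ?_⟩
    rw [(hval _ hy).1, (hflat c).1, (hflat c).2]; linarith
  have sF : Starr F Φ := Starr.transport pF h1 toΦ ofΦ (by rintro c ⟨hc, h, h'⟩; exact ⟨hc, h, by linarith⟩)
  have sF' : Starr F' Φ := by
    refine Starr.transport pF' h2 ?_ ?_ (by rintro c ⟨hc, h, h'⟩; exact ⟨hc, h', by linarith⟩)
    · rw [JA_compl]; exact toΦ
    · rw [JA_compl]; exact ofΦ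
  have sX : Starr (Np S A) (F ∪ G') := by rw [← eJ]; exact h
  have sH : Starr (Np S {u}) (F ∪ F') := by rw [← eH]; exact beta_single hS hu
  unfold Beta; rw [eU, eN]
  refine vlemma sX sH sF sF' ?_ ?_ ?_ ?_ (Np_closed _ _) (Np_closed _ _) cF cF' cG'
  · ext c; constructor
    · rintro ⟨⟨hc, h, h'⟩, ⟨-, k, k'⟩⟩; exact ⟨hc, h, by linarith⟩
    · rintro ⟨hc, h, h'⟩; exact ⟨⟨hc, by linarith, by linarith⟩, ⟨hc, by linarith, by linarith⟩⟩
  · ext c; constructor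
    · rintro ⟨⟨hc, h, h'⟩, ⟨-, k, k'⟩⟩; exact ⟨hc, h, by linarith⟩
    · rintro ⟨hc, h, h'⟩; exact ⟨⟨hc, by linarith, by linarith⟩, ⟨hc, by linarith, by linarith⟩⟩
  · ext c; constructor
    · rintro ⟨⟨hc, h, h'⟩, ⟨-, k, k'⟩⟩; exact ⟨hc, by linarith, by linarith⟩
    · rintro ⟨hc, h, h'⟩; exact ⟨⟨hc, by linarith, by linarith⟩, ⟨hc, by linarith, by linarith⟩⟩
  · rintro c ⟨⟨hc, h⟩, ⟨-, h'⟩⟩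
    rw [mAc c hc.1] at h
    rw [muc c hc.1, mx_singleton hc.1] at h'
    have := (le_max_left _ _).trans h
    have := (le_max_right _ _).trans h
    have := (le_max_left _ _).trans h'
    exact ⟨hc, by linarith, by linarith⟩

end Rz

theorem PLOn.map_zero {E F : Type*} [NormedAddCommGroup E] [NormedSpace ℝ E] [NormedAddCommGroup F]
    [NormedSpace ℝ F] {X : Set E} {f : E → F} (h : PLOn X f) (h0 : (0:E) ∈ X) : f 0 = 0 := by
  obtain ⟨S, hS, h2⟩ := h.2
  obtain ⟨A, hA, e⟩ := h2 0 h0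
  simpa using e

/-- homogeneity for cones including zero -/
theorem PLOn.homog0 {E F : Type*} [NormedAddCommGroup E] [NormedSpace ℝ E] [NormedAddCommGroup F]
    [NormedSpace ℝ F] {X : Set E} {f : E → F} (hf : PLOn X f)
    {x : E} (hx : ∀ t : ℝ, 0 ≤ t → t • x ∈ X) {t : ℝ} (ht : 0 ≤ t) : f (t • x) = t • f x := by
  rcases ht.lt_or_eq with h | h
  · exact hf.homog (fun t ht => hx t ht.le) h
  · subst h
    have := hf.map_zero (by simpa using hx 0 le_rfl)
    simp [this]

section TL
variable {ι κ : Type*} [Fintype ι] [Fintype κ]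

theorem claim1 {J : Set (ι → ℝ)} (hJ : ∀ j ∈ J, ∀ t : ℝ, 0 ≤ t → t • j ∈ J) (h0 : (0 : ι → ℝ) ∈ J)
    {F : (ι → ℝ) × ℝ → (κ → ℝ)} (hF : PLOn (J ×ˢ Set.Ici (0:ℝ)) F) :
    ∃ C : ℝ, 0 < C ∧ ∀ j ∈ J, ∀ s, C * ‖j‖ ≤ s →
      F (j, s) = F (j, C * ‖j‖) + (s - C * ‖j‖) • F (0, 1) := by
  obtain ⟨S, hS, h2⟩ := hF.2
  set u := F (0, 1) with hu
  have mem01 : ((0 : ι → ℝ), (1:ℝ)) ∈ J ×ˢ Set.Ici (0:ℝ) := ⟨h0, by simp⟩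
  have hev : ∀ A ∈ S, A (0, 1) ≠ u → ∀ᶠ p in nhdsWithin ((0 : ι → ℝ), (1:ℝ)) (J ×ˢ Set.Ici (0:ℝ)),
      F p ≠ A p := by
    intro A hA hne
    have h1 : ContinuousWithinAt (fun p => F p - A p) (J ×ˢ Set.Ici (0:ℝ)) (0, 1) :=
      (hF.1 _ mem01).sub A.continuous.continuousWithinAt
    have h3 : (fun p => F p - A p) (0, 1) ≠ 0 := by
      simp only; rw [← hu]; exact sub_ne_zero.2 (Ne.symm hne)
    filter_upwards [h1.eventually_ne h3] with p hp
    exact sub_ne_zero.1 hp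
  have hall : ∀ᶠ p in nhdsWithin ((0 : ι → ℝ), (1:ℝ)) (J ×ˢ Set.Ici (0:ℝ)),
      ∀ A ∈ S, A (0, 1) ≠ u → F p ≠ A p := by
    rw [hS.eventually_all]
    intro A hA
    by_cases h : A (0, 1) = u
    · simp [h]
    · filter_upwards [hev A hA h] with p hp _ using hp
  rw [eventually_nhdsWithin_iff, Metric.eventually_nhds_iff] at hall
  obtain ⟨ε, hε, hall⟩ := hall
  have key : ∀ j ∈ J, ‖j‖ < ε → ∃ A ∈ S, A (0, 1) = u ∧ F (j, 1) = A (j, 1) := by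
    intro j hj hjε
    have hm : (j, (1:ℝ)) ∈ J ×ˢ Set.Ici (0:ℝ) := ⟨hj, by simp⟩
    obtain ⟨A, hA, e⟩ := h2 _ hm
    refine ⟨A, hA, ?_, e⟩
    by_contra hne
    exact hall (by simpa [Prod.dist_eq, hε] using hjε) hm A hA hne e
  refine ⟨2 / ε, by positivity, ?_⟩
  intro j hj s hs
  set r := 2 / ε * ‖j‖ with hr
  have hr0 : 0 ≤ r := by positivity
  have main : (fun s : ℝ => F (j, s) - s • u) s = (fun s : ℝ => F (j, s) - s • u) r := by
    refine const_of_finite (f := fun s : ℝ => F (j, s) - s • u) (s := Set.Ici r) isPreconnected_Ici ?_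
      (T := insert 0 ((fun A : ((ι → ℝ) × ℝ →L[ℝ] (κ → ℝ)) => A (j, 0)) '' S)) ((hS.image _).insert _) ?_
      hs (Set.mem_Ici.2 le_rfl)
    · refine ContinuousOn.sub (hF.1.comp (by fun_prop) ?_) (by fun_prop)
      intro s hs; exact ⟨hj, hr0.trans hs⟩
    · intro s hs
      have hs0 : 0 ≤ s := hr0.trans hs
      rcases hs0.lt_or_eq with hpos | hz
      · right
        obtain ⟨A, hA, e1, e2⟩ := key (s⁻¹ • j) (hJ j hj _ (by positivity)) (by
          rw [norm_smul, Real.norm_eq_abs, abs_of_pos (by positivity)]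
          have : 2 / ε * ‖j‖ ≤ s := hs
          rw [inv_mul_lt_iff₀ hpos]
          rw [div_mul_eq_mul_div, div_le_iff₀ hε] at this
          have h4 : 0 < s * ε := by positivity
          nlinarith [norm_nonneg j])
        refine ⟨A, hA, ?_⟩
        have e3 : F (s • (s⁻¹ • j, (1:ℝ))) = s • F (s⁻¹ • j, 1) := by
          refine hF.homog0 (fun t ht => ?_) hs0
          exact ⟨hJ _ (hJ j hj _ (by positivity)) t ht, by simpa using ht⟩
        have e4 : s • (s⁻¹ • j, (1:ℝ)) = (j, s) := by
          ext1 <;> simp [smul_smul, hpos.ne']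
        rw [e4, e2, ← map_smul, e4] at e3
        have e5 : ((j, s) : (ι → ℝ) × ℝ) = (j, 0) + s • (0, 1) := by simp
        simp only
        rw [e3, e5, map_add, map_smul, e1]; simp
      · left
        subst hz
        have hj0 : j = 0 := by
          have : r ≤ 0 := hs
          have : ‖j‖ ≤ 0 := by
            by_contra h
            push Not at h
            have : 0 < 2 / ε * ‖j‖ := by positivity
            linarith
          simpa using this
        subst hj0
        have := hF.map_zero (show (0 : (ι → ℝ) × ℝ) ∈ J ×ˢ Set.Ici (0:ℝ) from ⟨h0, by simp⟩)
        simp only [zero_smul, sub_zero]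
        exact this
  simp only at main
  rw [sub_eq_iff_eq_add] at main
  rw [main, sub_smul]; abel

theorem tlemma {X P J : Set (ι → ℝ)} {f : (ι → ℝ) → (κ → ℝ)} {g : (κ → ℝ) → (ι → ℝ)}
    (hX : PLE X Set.univ f g) (hPX : P ⊆ X) (hJ : ∀ j ∈ J, ∀ t : ℝ, 0 ≤ t → t • j ∈ J)
    (h0 : (0 : ι → ℝ) ∈ J) {k k'} (hk : PLE P (J ×ˢ Set.Ici (0:ℝ)) k k') (hk0 : ∀ j ∈ J, k j = (j, 0))
    (hJP : J ⊆ P) {O : Set (ι → ℝ)} (hO : IsOpen O) (hOP : O ∩ X = P \ J) :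
    ∃ (C : ℝ) (u : κ → ℝ) (T : (ι → ℝ) × ℝ → (κ → ℝ)) (T' : (κ → ℝ) → (ι → ℝ) × ℝ), 0 < C ∧ u ≠ 0 ∧
      PLE (J ×ˢ (Set.univ : Set ℝ)) Set.univ T T' ∧ (∀ j ∈ J, ∀ s, T (j, s) = T (j, 0) + s • u) ∧
      (∀ j ∈ J, ∀ s, C * ‖j‖ ≤ s → f (k' (j, s)) = T (j, s - C * ‖j‖)) := by
  have hF : PLOn (J ×ˢ Set.Ici (0:ℝ)) (fun p => f (k' p)) := hX.pf.comp hk.pg fun p hp => hPX (hk.mg p hp)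
  obtain ⟨C, hC, hc⟩ := claim1 hJ h0 hF
  set u := f (k' (0, 1)) with hu
  have mem01 : ((0 : ι → ℝ), (1:ℝ)) ∈ J ×ˢ Set.Ici (0:ℝ) := ⟨h0, by simp⟩
  let T : (ι → ℝ) × ℝ → (κ → ℝ) := fun p => f (k' (p.1, C * ‖p.1‖)) + p.2 • u
  have hTF : ∀ j ∈ J, ∀ s, C * ‖j‖ ≤ s → f (k' (j, s)) = T (j, s - C * ‖j‖) := fun j hj s hs => hc j hj s hs
  have hTinj : ∀ j ∈ J, ∀ j' ∈ J, ∀ s s', T (j, s) = T (j', s') → j = j' ∧ s = s' := by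
    intro j hj j' hj' s s' h
    obtain ⟨L, hLdef⟩ : ∃ L, L = |s| + |s'| := ⟨_, rfl⟩
    have hL1 : 0 ≤ s + L := by have := neg_abs_le s; have := abs_nonneg s'; linarith
    have hL2 : 0 ≤ s' + L := by have := neg_abs_le s'; have := abs_nonneg s; linarith
    have e1 := hTF j hj (s + L + C * ‖j‖) (by linarith)
    have e2 := hTF j' hj' (s' + L + C * ‖j'‖) (by linarith)
    have e3 : f (k' (j, s + L + C * ‖j‖)) = f (k' (j', s' + L + C * ‖j'‖)) := by
      rw [e1, e2]
      simp only [T] at h ⊢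
      rw [add_sub_cancel_right, add_sub_cancel_right, add_smul, add_smul, ← add_assoc, ← add_assoc, h]
    have p1 : (j, s + L + C * ‖j‖) ∈ J ×ˢ Set.Ici (0:ℝ) := ⟨hj, by
      have : 0 ≤ C * ‖j‖ := by positivity
      simp only [Set.mem_Ici]; linarith⟩
    have p2 : (j', s' + L + C * ‖j'‖) ∈ J ×ˢ Set.Ici (0:ℝ) := ⟨hj', by
      have : 0 ≤ C * ‖j'‖ := by positivity
      simp only [Set.mem_Ici]; linarith⟩
    have e4 := congrArg g e3
    rw [hX.gf _ (hPX (hk.mg _ p1)), hX.gf _ (hPX (hk.mg _ p2))] at e4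
    have e5 := congrArg k e4
    rw [hk.fg _ p1, hk.fg _ p2, Prod.mk.injEq] at e5
    obtain ⟨rfl, e6⟩ := e5
    exact ⟨rfl, by linarith⟩
  have hT00 : T (0, 0) = 0 := by
    have z1 : k' (0, 0) = 0 := hk.pg.map_zero (show (0 : (ι → ℝ) × ℝ) ∈ _ from ⟨h0, by simp⟩)
    have z2 : f 0 = 0 := hX.pf.map_zero (hPX (hJP h0))
    simp [T, z1, z2]
  -- neighbourhood of u
  have hgu : g u = k' (0, 1) := hX.gf _ (hPX (hk.mg _ mem01))
  have hnb : ∀ᶠ w in nhds u, g w ∈ P ∧ C * ‖(k (g w)).1‖ ≤ (k (g w)).2 := by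
    have gcont : Continuous g := by
      have := hX.pg.1; rwa [← continuousOn_univ]
    have hguP : g u ∈ P \ J := by
      rw [hgu]; refine ⟨hk.mg _ mem01, fun h => ?_⟩
      have := hk.fg _ mem01
      rw [hk0 _ h] at this
      simp at this
    have h1 : ∀ᶠ w in nhds u, g w ∈ O :=
      gcont.continuousAt.eventually_mem (hO.mem_nhds (by rw [← hOP] at hguP; exact hguP.1))
    have h1' : ∀ᶠ w in nhds u, g w ∈ P := h1.mono fun w hw => by
      have : g w ∈ P \ J := by rw [← hOP]; exact ⟨hw, hX.mg w trivial⟩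
      exact this.1
    have h2 : Filter.Tendsto g (nhds u) (nhdsWithin (g u) P) :=
      tendsto_nhdsWithin_iff.2 ⟨gcont.continuousAt, h1'⟩
    have h3 : ContinuousWithinAt (fun x => (k x).2 - C * ‖(k x).1‖) P (g u) := by
      have := hk.pf.1 (g u) hguP.1
      exact this.snd.sub (continuousWithinAt_const.mul this.fst.norm)
    have h4 : 0 < (fun x => (k x).2 - C * ‖(k x).1‖) (g u) := by
      simp only; rw [hgu, hk.fg _ mem01]; simp
    have h5 := h2.eventually (h3.eventually (lt_mem_nhds h4))
    filter_upwards [h1', h5] with w hw hw2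
    exact ⟨hw, by linarith⟩
  rw [Metric.eventually_nhds_iff] at hnb
  obtain ⟨δ, hδ, hnb⟩ := hnb
  -- the scaled statement
  have hfar : ∀ w : κ → ℝ, g (w + (2 / δ * ‖w‖) • u) ∈ P ∧
      C * ‖(k (g (w + (2 / δ * ‖w‖) • u))).1‖ ≤ (k (g (w + (2 / δ * ‖w‖) • u))).2 := by
    intro w
    set l := 2 / δ * ‖w‖ with hl
    rcases eq_or_ne w 0 with rfl | hw
    · have z2 : g 0 = 0 := hX.pg.map_zero trivial
      simp only [norm_zero, mul_zero, hl, zero_smul, add_zero, z2, hk0 0 h0]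
      exact ⟨hJP h0, le_rfl⟩
    · have hwn : 0 < ‖w‖ := norm_pos_iff.2 hw
      have hlp : 0 < l := by positivity
      have e : w + l • u = l • (l⁻¹ • w + u) := by
        rw [smul_add, smul_smul, mul_inv_cancel₀ hlp.ne', one_smul]
      obtain ⟨hp, hq⟩ := hnb (y := l⁻¹ • w + u) (by
        rw [dist_eq_norm, add_sub_cancel_right, norm_smul, norm_inv, Real.norm_eq_abs, abs_of_pos hlp,
          inv_mul_lt_iff₀ hlp, hl, div_mul_eq_mul_div, div_mul_cancel₀ _ hδ.ne']
        linarith)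
      have e2 : g (w + l • u) = l • g (l⁻¹ • w + u) := by
        rw [e]; exact hX.pg.homog0 (fun _ _ => trivial) hlp.le
      set p := k (g (l⁻¹ • w + u)) with hpdef
      have hpm : p ∈ J ×ˢ Set.Ici (0:ℝ) := hk.mf _ hp
      have hcone : ∀ t : ℝ, 0 ≤ t → t • p ∈ J ×ˢ Set.Ici (0:ℝ) := fun t ht =>
        ⟨hJ _ hpm.1 t ht, mul_nonneg ht hpm.2⟩
      have e3 : g (w + l • u) = k' (l • p) := by
        rw [hk.pg.homog0 hcone hlp.le, hpdef, hk.gf _ hp, e2]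
      rw [e3, hk.fg _ (hcone l hlp.le)]
      refine ⟨hk.mg _ (hcone l hlp.le), ?_⟩
      simp only [Prod.smul_fst, Prod.smul_snd, norm_smul, Real.norm_eq_abs, abs_of_pos hlp, smul_eq_mul]
      nlinarith
  let T' : (κ → ℝ) → (ι → ℝ) × ℝ := fun w =>
    ((k (g (w + (2 / δ * ‖w‖) • u))).1, (k (g (w + (2 / δ * ‖w‖) • u))).2 -
      C * ‖(k (g (w + (2 / δ * ‖w‖) • u))).1‖ - 2 / δ * ‖w‖)
  have hTT' : ∀ w, T (T' w) = w := by
    intro w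
    obtain ⟨hp, hq⟩ := hfar w
    have hpm := hk.mf _ hp
    have := hTF _ hpm.1 _ hq
    rw [show ((k (g (w + (2 / δ * ‖w‖) • u))).1, (k (g (w + (2 / δ * ‖w‖) • u))).2) =
      k (g (w + (2 / δ * ‖w‖) • u)) from rfl, hk.gf _ hp, hX.fg _ trivial] at this
    simp only [T, T'] at this ⊢
    rw [sub_smul _ (2 / δ * ‖w‖), ← add_sub_assoc, ← this]; simp
  have hT'm : ∀ w, (T' w).1 ∈ J := fun w => (hk.mf _ (hfar w).1).1
  have i := PLOn.id (J ×ˢ (Set.univ : Set ℝ))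
  have i' := PLOn.id (Set.univ : Set (κ → ℝ))
  have hkg := hk.pf.comp (hX.pg.comp (i'.add ((i'.norm_pi.const_mul (2 / δ)).smul_const u))
    (fun _ _ => trivial)) (fun w _ => (hfar w).1)
  refine ⟨C, u, T, T', hC, ?_, ⟨?_, ?_, ?_, ?_, ?_, ?_⟩, ?_, hTF⟩
  · intro hu0
    have := (hTinj 0 h0 0 h0 0 1 (by simp [T, hu0])).2
    norm_num at this
  · refine PLOn.add (hF.comp (i.fst.prodMk (i.fst.norm_pi.const_mul C)) ?_) (i.snd.smul_const u)
    intro x hx; refine ⟨hx.1, ?_⟩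
    simp only [Set.mem_Ici]; positivity
  · exact hkg.fst.prodMk ((hkg.snd.sub (hkg.fst.norm_pi.const_mul C)).sub (i'.norm_pi.const_mul (2 / δ)))
  · intro _ _; trivial
  · intro w _; exact ⟨hT'm w, trivial⟩
  · rintro ⟨j, s⟩ ⟨hj, -⟩
    have := hTinj _ (hT'm (T (j, s))) j hj _ s (hTT' (T (j, s)))
    exact Prod.ext this.1 this.2
  · intro w _; exact hTT' w
  · intro j hj s; simp [T]

theorem quotient_line {n : ℕ} {J : Set (ι → ℝ)} {u : Fin (n + 1) → ℝ} (hu : u ≠ 0)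
    {T : (ι → ℝ) × ℝ → (Fin (n + 1) → ℝ)} {T' : (Fin (n + 1) → ℝ) → (ι → ℝ) × ℝ}
    (hT : PLE (J ×ˢ (Set.univ : Set ℝ)) Set.univ T T')
    (hTu : ∀ j ∈ J, ∀ s, T (j, s) = T (j, 0) + s • u) :
    ∃ f g, PLE J (Set.univ : Set (Fin n → ℝ)) f g := by
  obtain ⟨i, hi⟩ : ∃ i, u i ≠ 0 := by
    by_contra h; push Not at h; exact hu (funext h)
  let p : (Fin (n+1) → ℝ) → (Fin n → ℝ) := fun w m => w (i.succAbove m) - (u (i.succAbove m) / u i) * w i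
  let q : (Fin n → ℝ) → (Fin (n+1) → ℝ) := fun y => i.insertNth 0 y
  have pp : ∀ {X : Set (ι → ℝ)} {h : (ι → ℝ) → (Fin (n+1) → ℝ)}, PLOn X h → PLOn X (fun x => p (h x)) :=
    fun hh => PLOn.pi fun m => (hh.apply _).sub ((hh.apply i).const_mul _)
  have pq : PLOn (Set.univ : Set (Fin n → ℝ)) q := PLOn.pi fun m => by
    rcases Fin.eq_self_or_eq_succAbove i m with rfl | ⟨m', rfl⟩
    · simpa [q] using PLOn.zero _
    · simpa [q] using (PLOn.id _).apply m'
  have e1 : ∀ y, p (q y) = y := fun y => by ext m; simp [p, q]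
  have e2 : ∀ w, q (p w) = w - (w i / u i) • u := fun w => by
    ext m
    rcases Fin.eq_self_or_eq_succAbove i m with rfl | ⟨m', rfl⟩
    · simp [q, hi]
    · simp [q, p]; ring
  have e3 : ∀ w (s : ℝ), p (w + s • u) = p w := fun w s => by
    ext m; simp only [p, Pi.add_apply, Pi.smul_apply, smul_eq_mul]; field_simp; ring
  have id := PLOn.id J
  refine ⟨fun j => p (T (j, 0)), fun y => (T' (q y)).1, ⟨pp (hT.pf.comp (id.prodMk (PLOn.zero _))
    fun x hx => ⟨hx, trivial⟩), (hT.pg.comp pq fun _ _ => trivial).fst, fun _ _ => trivial,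
    fun y _ => (hT.mg _ trivial).1, ?_, ?_⟩⟩
  · intro j hj
    simp only [e2]
    set r := (T (j, 0)) i / u i
    have : T (j, 0) - r • u = T (j, -r) := by rw [hTu j hj (-r)]; simp [sub_eq_add_neg]
    rw [this, hT.gf _ ⟨hj, trivial⟩]
  · intro y _
    have := hT.fg (q y) trivial
    have h2 := hTu _ (hT.mg (q y) trivial).1 (T' (q y)).2
    rw [show ((T' (q y)).1, (T' (q y)).2) = T' (q y) from rfl, this] at h2
    rw [← e3 _ (T' (q y)).2, ← h2, e1]

end TL

section NW
variable {V : Type*} [Fintype V] [DecidableEq V]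

def Sph (n : ℕ) (S : Set (Finset V)) : Prop := ∃ f g, PLE (rz S) (Set.univ : Set (Fin n → ℝ)) f g

theorem JA_smul {S : Set (Finset V)} {A : Finset V} : ∀ j ∈ JA S A, ∀ t : ℝ, 0 ≤ t → t • j ∈ JA S A := by
  intro j hj t ht
  refine ⟨rz_smul hj.1 ht, ?_⟩
  have key : ∀ B : Finset V, mx B (t • j) = t * mx B j := by
    intro B
    unfold mx
    have : (fun v => if v ∈ B then (t • j) v else 0) = t • (fun v => if v ∈ B then j v else 0) := by
      ext v; by_cases h : v ∈ B <;> simp [h]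
    rw [this, norm_smul, Real.norm_eq_abs, abs_of_nonneg ht]
  rw [key, key, hj.2]

theorem JA_zero {S : Set (Finset V)} (hS : CX S) {A : Finset V} : (0 : V → ℝ) ∈ JA S A :=
  ⟨rz_zero hS, by rw [mx_zero, mx_zero]⟩

theorem sph_T {n : ℕ} {S : Set (Finset V)} (hS : CX S) {A : Finset V} {f g k k'}
    (hX : PLE (rz S) (Set.univ : Set (Fin n → ℝ)) f g)
    (hk : PLE (Np S A) (JA S A ×ˢ Set.Ici (0:ℝ)) k k') (hk0 : ∀ j ∈ JA S A, k j = (j, 0)) :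
    ∃ (C : ℝ) (u : Fin n → ℝ) (T : (V → ℝ) × ℝ → (Fin n → ℝ)) (T' : (Fin n → ℝ) → (V → ℝ) × ℝ), 0 < C ∧ u ≠ 0 ∧
      PLE (JA S A ×ˢ (Set.univ : Set ℝ)) Set.univ T T' ∧ (∀ j ∈ JA S A, ∀ s, T (j, s) = T (j, 0) + s • u) ∧
      (∀ j ∈ JA S A, ∀ s, C * ‖j‖ ≤ s → f (k' (j, s)) = T (j, s - C * ‖j‖)) := by
  refine tlemma hX (fun c hc => hc.1) JA_smul (JA_zero hS) hk hk0 (JA_sub S A)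
    (O := {c | mx Aᶜ c < mx A c}) (isOpen_lt (mx_cont _) (mx_cont _)) ?_
  ext c
  constructor
  · rintro ⟨h1, h2⟩
    exact ⟨⟨h2, le_of_lt h1⟩, fun h => (ne_of_lt h1) h.2.symm⟩
  · rintro ⟨h1, h2⟩
    exact ⟨lt_of_le_of_ne h1.2 fun h => h2 ⟨h1.1, h.symm⟩, h1.1⟩

theorem Sph.lk {n : ℕ} {S : Set (Finset V)} (hS : CX S) (h : Sph (n + 1) S) {u : V} (hu : {u} ∈ S) :
    Sph n (Lk S u) := by
  obtain ⟨f, g, hX⟩ := h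
  obtain ⟨k, k', hk, hk0, -⟩ := beta_single hS hu
  obtain ⟨C, w, T, T', hC, hw, hT, hTw, -⟩ := sph_T hS hX hk hk0
  obtain ⟨a, b, hab⟩ := quotient_line hw hT hTw
  exact ⟨_, _, (lk_ple hS hu).trans hab⟩

theorem Sph.not_zero {S : Set (Finset V)} (h : Sph 0 S) {u : V} (hu : {u} ∈ S) : False := by
  obtain ⟨f, g, hX⟩ := h
  have h1 := rz_eu hu (zero_le_one' ℝ)
  have h2 := rz_eu hu (zero_le_two (α := ℝ))
  have := (hX.gf _ h1).symm.trans ((congrArg g (Subsingleton.elim _ _)).trans (hX.gf _ h2))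
  have := congrFun this u
  simp [eu_same] at this

theorem mx_mono {B : Finset V} {c c' : V → ℝ} (hc : ∀ v, 0 ≤ c v) {φ : ℝ → ℝ} (hφ : Monotone φ) (h0 : φ 0 = 0)
    (h : ∀ v ∈ B, c' v = φ (c v)) : mx B c' = φ (mx B c) := by
  have e : mx B c' = mx B (fun v => φ (c v)) := mx_congr h
  have hn : ∀ v, 0 ≤ (fun v => φ (c v)) v := fun v => by simp only; rw [← h0]; exact hφ (hc v)
  rw [e]
  apply le_antisymm
  · refine mx_le hn (by rw [← h0]; exact hφ (mx_nonneg _ _)) fun v hv => hφ (le_mx hv)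
  · rcases B.eq_empty_or_nonempty with rfl | hB
    · have : mx ∅ c = 0 := le_antisymm (mx_le hc le_rfl (by simp)) (mx_nonneg _ _)
      rw [this, h0]; exact mx_nonneg _ _
    · obtain ⟨v, hv, hm⟩ := B.exists_max_image c hB
      have : mx B c = c v := le_antisymm (mx_le hc (hc v) hm) (le_mx hv)
      rw [this]; exact le_mx (c := fun v => φ (c v)) hv

/-- the collar -/
theorem collar {S : Set (Finset V)} (hS : CX S) (A : Finset V) :
    ∃ f g, PLE {c | c ∈ rz S ∧ mx A c ≤ mx Aᶜ c ∧ mx Aᶜ c ≤ 2 * mx A c}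
      {p : (V → ℝ) × ℝ | p.1 ∈ JA S A ∧ 0 ≤ p.2 ∧ p.2 ≤ ‖p.1‖} f g ∧ (∀ j ∈ JA S A, f j = (j, 0)) ∧
      (∀ j ∈ JA S A, g (j, 0) = j) ∧ (∀ c, c ∈ rz S → mx Aᶜ c = 2 * mx A c → (f c).2 = ‖(f c).1‖) ∧
      (∀ j ∈ JA S A, mx Aᶜ (g (j, ‖j‖)) = 2 * mx A (g (j, ‖j‖))) := by
  have nj : ∀ j ∈ JA S A, ‖j‖ = mx A j ∧ ‖j‖ = mx Aᶜ j := by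
    intro j hj
    have h2 := hj.2
    have := mx_compl_max (A := A) hj.1.1
    rw [← h2, max_self] at this
    exact ⟨this.symm, by rw [← h2]; exact this.symm⟩
  set X := {c | c ∈ rz S ∧ mx A c ≤ mx Aᶜ c ∧ mx Aᶜ c ≤ 2 * mx A c} with hX
  set Y := {p : (V → ℝ) × ℝ | p.1 ∈ JA S A ∧ 0 ≤ p.2 ∧ p.2 ≤ ‖p.1‖} with hY
  let F1 : (V → ℝ) → (V → ℝ) := fun c v => if v ∈ A then c v else max (2⁻¹ * c v) (c v - (mx Aᶜ c - mx A c))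
  let F : (V → ℝ) → (V → ℝ) × ℝ := fun c => (F1 c, mx Aᶜ c - mx A c)
  let G : (V → ℝ) × ℝ → (V → ℝ) := fun p v => if v ∈ A then p.1 v else p.1 v + min (p.1 v) p.2
  have nc : ∀ {v}, v ∈ Aᶜ → v ∉ A := fun h => by simpa using h
  have m1 : ∀ c ∈ X, mx A (F1 c) = mx A c := fun c hc => mx_congr fun v hv => by simp [F1, hv]
  have m2 : ∀ c ∈ X, mx Aᶜ (F1 c) = mx A c := by
    intro c hc
    have := mx_mono (B := Aᶜ) (c := c) (c' := F1 c) hc.1.1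
      (φ := fun x => max (2⁻¹ * x) (x - (mx Aᶜ c - mx A c))) (fun x y h => max_le_max (by linarith) (by linarith))
      (by simp [hc.2.1]) (fun v hv => by simp [F1, nc hv])
    rw [this]
    apply le_antisymm
    · exact max_le (by have := hc.2.2; linarith) (by linarith)
    · exact le_max_of_le_right (by linarith)
  have m3 : ∀ p ∈ Y, mx A (G p) = ‖p.1‖ := fun p hp => by
    rw [(nj _ hp.1).1]; exact mx_congr fun v hv => by simp [G, hv]
  have m4 : ∀ p ∈ Y, mx Aᶜ (G p) = ‖p.1‖ + p.2 := by
    intro p hp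
    have := mx_mono (B := Aᶜ) (c := p.1) (c' := G p) hp.1.1.1
      (φ := fun x => x + min x p.2) (fun x y h => add_le_add h (min_le_min h le_rfl))
      (by simp [hp.2.1]) (fun v hv => by simp [G, nc hv])
    rw [this, ← (nj _ hp.1).2, min_eq_right hp.2.2]
  have i := PLOn.id X
  have i' := PLOn.id Y
  have mf : ∀ c ∈ X, F c ∈ Y := by
    intro c hc
    have hJ : F1 c ∈ JA S A := by
      refine ⟨⟨fun v => ?_, ?_⟩, by rw [m1 c hc, m2 c hc]⟩
      · by_cases hv : v ∈ A
        · simp [F1, hv, hc.1.1 v]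
        · simp only [F1, hv, if_false]; exact le_max_of_le_left (by have := hc.1.1 v; linarith)
      · obtain ⟨s, hs, h⟩ := hc.1.2
        refine ⟨s, hs, fun v hv => ?_⟩
        by_cases hvA : v ∈ A
        · simp [F1, hvA, h v hv]
        · simp [F1, hvA, h v hv, hc.2.1]
    refine ⟨hJ, by simp only [F]; linarith [hc.2.1], ?_⟩
    rw [(nj _ hJ).1]
    simp only [F]; rw [m1 c hc]; linarith [hc.2.2]
  have mg : ∀ p ∈ Y, G p ∈ X := by
    intro p hp
    refine ⟨⟨fun v => ?_, ?_⟩, ?_, ?_⟩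
    · have := hp.1.1.1 v
      by_cases hv : v ∈ A
      · simp [G, hv, this]
      · simp only [G, hv, if_false]; exact add_nonneg this (le_min this hp.2.1)
    · obtain ⟨s, hs, h⟩ := hp.1.1.2
      refine ⟨s, hs, fun v hv => ?_⟩
      by_cases hvA : v ∈ A
      · simp [G, hvA, h v hv]
      · simp [G, hvA, h v hv, hp.2.1]
    · rw [m3 p hp, m4 p hp]; linarith [hp.2.1]
    · rw [m3 p hp, m4 p hp]; linarith [hp.2.2]
  refine ⟨F, G, ⟨?_, ?_, mf, mg, ?_, ?_⟩, ?_, ?_, ?_, ?_⟩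
  · refine PLOn.prodMk (PLOn.pi fun v => ?_) ((i.mx _).sub (i.mx _))
    by_cases hv : v ∈ A
    · simpa [F1, hv] using i.apply v
    · simpa [F1, hv] using ((i.apply v).const_mul 2⁻¹).max ((i.apply v).sub ((i.mx _).sub (i.mx _)))
  · refine PLOn.pi fun v => ?_
    by_cases hv : v ∈ A
    · simpa [G, hv] using i'.fst.apply v
    · simpa [G, hv] using (i'.fst.apply v).add ((i'.fst.apply v).min i'.snd)
  · intro c hc
    ext v
    by_cases hv : v ∈ A
    · simp [G, F, F1, hv]
    · simp only [G, F, F1, hv, if_false]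
      set s := mx Aᶜ c - mx A c
      rcases le_total (2⁻¹ * c v) (c v - s) with h | h
      · rw [max_eq_right h, min_eq_right (by linarith)]; ring
      · rw [max_eq_left h, min_eq_left (by linarith)]; ring
  · intro p hp
    have e : mx Aᶜ (G p) - mx A (G p) = p.2 := by rw [m3 p hp, m4 p hp]; ring
    refine Prod.ext ?_ e
    ext v
    by_cases hv : v ∈ A
    · simp [G, F, F1, hv]
    · simp only [F, F1, hv, if_false]
      rw [e]
      simp only [G, hv, if_false]
      rcases le_total (p.1 v) p.2 with h | h
      · rw [min_eq_left h, max_eq_left (by linarith)]; ring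
      · rw [min_eq_right h, max_eq_right (by linarith)]; ring
  · intro j hj
    have e : mx Aᶜ j - mx A j = 0 := by rw [hj.2]; ring
    refine Prod.ext ?_ e
    ext v
    by_cases hv : v ∈ A
    · simp [F, F1, hv]
    · simp only [F, F1, hv, if_false, e]
      have := hj.1.1 v
      rw [max_eq_right (by linarith)]; ring
  · intro j hj
    ext v
    by_cases hv : v ∈ A
    · simp [G, hv]
    · simp [G, hv, hj.1.1 v]
  · intro c hc h
    have hcX : c ∈ X := ⟨hc, by have := mx_nonneg A c; linarith, h.le⟩
    rw [(nj _ (mf c hcX).1).1]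
    simp only [F]; rw [m1 c hcX]; linarith
  · intro j hj
    have : (j, ‖j‖) ∈ Y := ⟨hj, norm_nonneg _, le_rfl⟩
    rw [m3 _ this, m4 _ this]; ring
end NW

section NW
variable {V : Type*} [Fintype V] [DecidableEq V]

theorem newman {n : ℕ} {S : Set (Finset V)} (hS : CX S) (h : Sph n S) {A : Finset V} (hb : Beta S A) :
    Beta S Aᶜ := by
  obtain ⟨f, g, hX⟩ := h
  obtain ⟨k, k', hk, hk0, hJP⟩ := hb
  obtain ⟨C, w, T, T', hC, -, hT, -, hTk⟩ := sph_T hS hX hk hk0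
  obtain ⟨cf, cg, hc, hcf0, hcg0, hcf1, hcg1⟩ := collar hS A
  set J := JA S A with hJdef
  set P := Np S A with hPdef
  have cJ : IsClosed J := JA_closed S A
  have cP : IsClosed P := Np_closed S A
  set Col := {c | c ∈ rz S ∧ mx A c ≤ mx Aᶜ c ∧ mx Aᶜ c ≤ 2 * mx A c} with hCol
  set Y := {p : (V → ℝ) × ℝ | p.1 ∈ J ∧ 0 ≤ p.2 ∧ p.2 ≤ ‖p.1‖} with hY
  have cCol : IsClosed Col := (rz_closed S).inter ((isClosed_le (mx_cont _) (mx_cont _)).inter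
    (isClosed_le (mx_cont _) ((mx_cont A).const_mul 2)))
  have hPJ : ∀ x ∈ P, mx A x ≤ mx Aᶜ x → x ∈ J := fun x hx h => ⟨hx.1, le_antisymm h hx.2⟩
  have kJ : ∀ x ∈ P, (k x).2 = 0 → x ∈ J := by
    intro x hx h0
    have h1 := hk.mf x hx
    have h2 : k x = ((k x).1, 0) := Prod.ext rfl h0
    have h3 := hk.gf x hx
    have h4 := hk.gf _ (hJP h1.1)
    rw [hk0 _ h1.1, ← h2, h3] at h4
    rw [h4]; exact h1.1
  have k'0 : ∀ j ∈ J, k' (j, 0) = j := fun j hj => by rw [← hk0 j hj, hk.gf _ (hJP hj)]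
  have colJ : ∀ x ∈ Col, (cf x).2 = 0 → x = (cf x).1 := by
    intro x hx h0
    have h1 := hc.mf x hx
    have h2 : cf x = ((cf x).1, 0) := Prod.ext rfl h0
    have h3 := hc.gf x hx
    rw [h2, hcg0 _ h1.1] at h3
    exact h3.symm
  set Kc := {x | x ∈ P ∧ (k x).2 ≤ C * ‖(k x).1‖} with hKc
  have cKc : IsClosed Kc := by
    have h1 : ContinuousOn (fun x => (k x).2 - C * ‖(k x).1‖) P :=
      hk.pf.1.snd.sub (continuousOn_const.mul hk.pf.1.fst.norm)
    have := h1.preimage_isClosed_of_isClosed cP (isClosed_Iic (a := (0:ℝ)))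
    convert this using 1
    ext x; simp [Kc]
  -- the two models
  set D1 := {p : (V → ℝ) × ℝ | p.1 ∈ J ∧ -‖p.1‖ ≤ p.2 ∧ p.2 ≤ 0} with hD1
  set D2 := {p : (V → ℝ) × ℝ | p.1 ∈ J ∧ 0 ≤ p.2 ∧ p.2 ≤ C * ‖p.1‖} with hD2
  have cD1 : IsClosed D1 := by
    have h1 : IsClosed {p : (V → ℝ) × ℝ | -‖p.1‖ ≤ p.2} := isClosed_le (by fun_prop) (by fun_prop)
    have h2 : IsClosed {p : (V → ℝ) × ℝ | p.2 ≤ 0} := isClosed_le (by fun_prop) (by fun_prop)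
    exact (cJ.preimage continuous_fst).inter (h1.inter h2)
  have cD2 : IsClosed D2 := by
    have h1 : IsClosed {p : (V → ℝ) × ℝ | 0 ≤ p.2} := isClosed_le (by fun_prop) (by fun_prop)
    have h2 : IsClosed {p : (V → ℝ) × ℝ | p.2 ≤ C * ‖p.1‖} := isClosed_le (by fun_prop) (by fun_prop)
    exact (cJ.preimage continuous_fst).inter (h1.inter h2)
  have iY := PLOn.id Y
  have i1 := PLOn.id D1
  have hneg : PLE Y D1 (fun p => (p.1, -p.2)) (fun p => (p.1, -p.2)) :=
    ⟨iY.fst.prodMk iY.snd.neg, i1.fst.prodMk i1.snd.neg,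
      fun p hp => ⟨hp.1, by simpa using hp.2.2, by simpa using hp.2.1⟩,
      fun p hp => ⟨hp.1, by simpa using hp.2.2, by have := hp.2.1; simp only; linarith⟩,
      fun p _ => by simp, fun p _ => by simp⟩
  have hc1 := hc.trans hneg
  have hk2 : PLE Kc D2 k k' := hk.restrict (fun x hx => hx.1) (fun p hp => ⟨hp.1, hp.2.1⟩)
    (fun x hx => ⟨(hk.mf x hx.1).1, (hk.mf x hx.1).2, hx.2⟩)
    (fun p hp => ⟨hk.mg _ ⟨hp.1, hp.2.1⟩, by rw [hk.fg _ ⟨hp.1, hp.2.1⟩]; exact hp.2.2⟩)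
  obtain ⟨χ, χ', hχ, hχ1, hχ2, hχ1', hχ2'⟩ := hc1.glue hk2 cCol cKc cD1 cD2
    (fun x h1 h2 => by
      have hxJ := hPJ x h2.1 h1.2.1
      rw [hcf0 x hxJ, hk0 x hxJ]; simp)
    (fun p h1 h2 => by
      have h0 : p.2 = 0 := le_antisymm h1.2.2 h2.2.1
      have : p = (p.1, 0) := Prod.ext rfl h0
      rw [this]; simp only [neg_zero]
      rw [hcg0 _ h1.1, k'0 _ h1.1])
  -- the stretch
  have iD := PLOn.id (D1 ∪ D2)
  have hC1 : (0:ℝ) < 1 + C := by linarith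
  have hst : PLE D1 (D1 ∪ D2) (fun p => (p.1, (1 + C) * (p.2 + ‖p.1‖) - ‖p.1‖))
      (fun p => (p.1, (1 + C)⁻¹ * (p.2 + ‖p.1‖) - ‖p.1‖)) := by
    refine ⟨i1.fst.prodMk (((i1.snd.add i1.fst.norm_pi).const_mul _).sub i1.fst.norm_pi),
      iD.fst.prodMk (((iD.snd.add iD.fst.norm_pi).const_mul _).sub iD.fst.norm_pi), ?_, ?_, ?_, ?_⟩
    · rintro ⟨j, s⟩ ⟨hj, h1, h2⟩
      simp only at h1 h2 hj
      have h3 : -‖j‖ ≤ (1 + C) * (s + ‖j‖) - ‖j‖ := by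
        have : 0 ≤ (1 + C) * (s + ‖j‖) := mul_nonneg hC1.le (by linarith)
        linarith
      have h4 : (1 + C) * (s + ‖j‖) - ‖j‖ ≤ C * ‖j‖ := by nlinarith
      rcases le_total ((1 + C) * (s + ‖j‖) - ‖j‖) 0 with h | h
      · exact Or.inl ⟨hj, h3, h⟩
      · exact Or.inr ⟨hj, h, h4⟩
    · rintro ⟨j, s⟩ hp
      have hh : j ∈ J ∧ -‖j‖ ≤ s ∧ s ≤ C * ‖j‖ := by
        rcases hp with ⟨h0, h1, h2⟩ | ⟨h0, h1, h2⟩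
        · exact ⟨h0, h1, le_trans h2 (by positivity)⟩
        · exact ⟨h0, le_trans (by simp) h1, h2⟩
      obtain ⟨h0, h1, h2⟩ := hh
      refine ⟨h0, ?_, ?_⟩
      · have : 0 ≤ (1 + C)⁻¹ * (s + ‖j‖) := mul_nonneg (by positivity) (by linarith)
        simp only; linarith
      · have : (1 + C)⁻¹ * (s + ‖j‖) ≤ ‖j‖ := by
          rw [inv_mul_le_iff₀ hC1]; linarith
        simp only; linarith
    · rintro ⟨j, s⟩ _
      simp only [Prod.mk.injEq, true_and]; field_simp; ring
    · rintro ⟨j, s⟩ _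
      simp only [Prod.mk.injEq, true_and]; field_simp; ring
  have hψ0 := (hc1.trans hst).trans hχ.symm
  obtain ⟨ψ0, ψ0', hψ0, hψJ, hψe, hψe'⟩ : ∃ a b, PLE Col (Col ∪ Kc) a b ∧ (∀ j ∈ J, a j = k' (j, C * ‖j‖)) ∧
      (∀ c ∈ Col, mx Aᶜ c = 2 * mx A c → a c = c) ∧ (∀ c ∈ Col, mx Aᶜ c = 2 * mx A c → b c = c) := by
    have key : ∀ c ∈ Col, mx Aᶜ c = 2 * mx A c →
        (cf c).2 = ‖(cf c).1‖ := fun c hc' h => hcf1 c hc'.1 h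
    refine ⟨_, _, hψ0, ?_, ?_, ?_⟩
    · intro j hj
      simp only
      rw [hcf0 j hj]
      simp only
      rw [show ((1 + C) * (-0 + ‖j‖) - ‖j‖) = C * ‖j‖ by ring]
      exact hχ2' (j, C * ‖j‖) ⟨hj, by positivity, le_rfl⟩
    · intro c hcc h
      have e := key c hcc h
      simp only
      have hm := hc.mf c hcc
      rw [e, show ((1 + C) * (-‖(cf c).1‖ + ‖(cf c).1‖) - ‖(cf c).1‖) = -‖(cf c).1‖ by ring,
        hχ1' ((cf c).1, -‖(cf c).1‖) ⟨hm.1, le_rfl, by simp⟩]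
      simp only [neg_neg]; rw [← e]
      exact hc.gf c hcc
    · intro c hcc h
      have e := key c hcc h
      simp only
      have hm := hc.mf c hcc
      rw [hχ1 c hcc]
      simp only [e]
      rw [show ((1 + C)⁻¹ * (-‖(cf c).1‖ + ‖(cf c).1‖) - ‖(cf c).1‖) = -‖(cf c).1‖ by ring]
      simp only [neg_neg]; rw [← e]
      exact hc.gf c hcc
  set Q' := {c | c ∈ rz S ∧ 2 * mx A c ≤ mx Aᶜ c} with hQ'
  have cQ' : IsClosed Q' := (rz_closed S).inter (isClosed_le ((mx_cont A).const_mul 2) (mx_cont _))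
  obtain ⟨ψ, ψ', hψ, -, hψ2, -, -⟩ := (PLE.refl Q').glue hψ0 cQ' cCol cQ' (cCol.union cKc)
    (fun x h1 h2 => (hψe x h2 (le_antisymm h2.2.2 h1.2)).symm)
    (fun x h1 h2 => by
      have hx : x ∈ Col := by
        rcases h2 with h2 | h2
        · exact h2
        · have h3 := h2.1.2
          have h4 := h1.2
          have h5 := mx_nonneg A x
          exact ⟨h1.1, by linarith, by linarith⟩
      exact (hψe' x hx (le_antisymm hx.2.2 h1.2)).symm)
  have hQ : Q' ∪ Col = Np S Aᶜ := by
    ext c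
    simp only [Np, compl_compl]
    constructor
    · rintro (h | h)
      · have h5 := mx_nonneg A c
        have := h.2
        exact ⟨h.1, by linarith⟩
      · exact ⟨h.1, h.2.1⟩
    · rintro ⟨h1, h2⟩
      rcases le_total (2 * mx A c) (mx Aᶜ c) with h | h
      · exact Or.inl ⟨h1, h⟩
      · exact Or.inr ⟨h1, h2, h⟩
  rw [hQ] at hψ
  -- the end
  have hE := hX.trans hT.symm
  obtain ⟨e, e', hE, hEk⟩ : ∃ e e', PLE (rz S) (J ×ˢ (Set.univ : Set ℝ)) e e' ∧
      ∀ j ∈ J, ∀ s, C * ‖j‖ ≤ s → e (k' (j, s)) = (j, s - C * ‖j‖) :=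
    ⟨_, _, hE, fun j hj s hs => by
      rw [hTk j hj s hs, hT.gf _ ⟨hj, trivial⟩]⟩
  set Qp := Q' ∪ (Col ∪ Kc) with hQp
  have hQpX : Qp ⊆ rz S := by
    rintro x (h | h | h)
    · exact h.1
    · exact h.1
    · exact h.1.1
  have hiff : ∀ x ∈ rz S, 0 < (e x).2 → x ∉ Qp := by
    intro x hx hpos hxQ
    have hm := hE.mf x hx
    have h1 := hEk _ hm.1 ((e x).2 + C * ‖(e x).1‖) (by linarith)
    have hmem : ((e x).1, (e x).2 + C * ‖(e x).1‖) ∈ J ×ˢ Set.Ici (0:ℝ) :=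
      ⟨hm.1, by
        have : 0 ≤ C * ‖(e x).1‖ := by positivity
        simp only [Set.mem_Ici]; linarith⟩
    have hpos2 : 0 < (e x).2 + C * ‖(e x).1‖ := by
      have : 0 ≤ C * ‖(e x).1‖ := by positivity
      linarith
    rw [add_sub_cancel_right] at h1
    have hxP := hk.mg _ hmem
    have h2 := congrArg e' h1
    rw [hE.gf _ hxP.1, show ((e x).1, (e x).2) = e x from rfl, hE.gf x hx] at h2
    rw [h2] at hxP
    have hkx : k x = ((e x).1, (e x).2 + C * ‖(e x).1‖) := (congrArg k h2).symm.trans (hk.fg _ hmem)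
    have hnJ : x ∉ J := by
      intro hxJ
      have := hk0 x hxJ
      rw [hkx, Prod.mk.injEq] at this
      linarith [this.2]
    rcases hxQ with h | h | h
    · exact hnJ (hPJ x hxP (by have := mx_nonneg A x; have := h.2; linarith))
    · exact hnJ (hPJ x hxP h.2.1)
    · have := h.2
      rw [hkx] at this
      simp only at this
      linarith
  have hconv : ∀ x ∈ rz S, (e x).2 ≤ 0 → x ∈ Qp := by
    intro x hx hle
    by_contra hn
    have hxP : x ∈ P := by
      refine ⟨hx, ?_⟩
      by_contra hlt
      push Not at hlt
      apply hn
      rcases le_total (2 * mx A x) (mx Aᶜ x) with h | h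
      · exact Or.inl ⟨hx, h⟩
      · exact Or.inr (Or.inl ⟨hx, hlt.le, h⟩)
    have h1 : C * ‖(k x).1‖ < (k x).2 := by
      by_contra h; push Not at h
      exact hn (Or.inr (Or.inr ⟨hxP, h⟩))
    have h2 := hEk _ (hk.mf x hxP).1 _ h1.le
    rw [show ((k x).1, (k x).2) = k x from rfl, hk.gf x hxP] at h2
    rw [h2] at hle
    simp only at hle
    linarith
  have hE2 : PLE Qp (J ×ˢ Set.Iic (0:ℝ)) e e' := hE.restrict hQpX (fun p hp => ⟨hp.1, trivial⟩)
    (fun x hx => ⟨(hE.mf x (hQpX hx)).1, by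
      by_contra h
      simp only [Set.mem_Iic, not_le] at h
      exact hiff x (hQpX hx) h hx⟩)
    (fun p hp => hconv _ (hE.mg p ⟨hp.1, trivial⟩) (by rw [hE.fg p ⟨hp.1, trivial⟩]; exact hp.2))
  have hfin := (hψ.trans hE2).trans ((PLE.refl J).prod PLE.negHalf.symm)
  unfold Beta
  rw [JA_compl]
  refine ⟨_, _, hfin, ?_, ?_⟩
  · intro j hj
    have hjc : j ∈ Col := ⟨hj.1, hj.2.le, by have := mx_nonneg A j; have := hj.2; linarith⟩
    rw [hψ2 j hjc, hψJ j hj, hEk j hj _ le_rfl]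
    simp
  · rw [← JA_compl]; exact JA_sub _ _

theorem beta_sdiff {S : Set (Finset V)} {A : Finset V} {u : V} (hu : {u} ∉ S) (hS : CX S) : ∀ c ∈ rz S, c u = 0 := by
  intro c hc
  obtain ⟨h1, s, hs, h2⟩ := hc
  exact h2 u fun h => hu (hS.down s hs _ (by simpa using h))

/-- all vertex links are PL spheres -/
def Mfd (n : ℕ) (S : Set (Finset V)) : Prop := ∀ b, {b} ∈ S → Sph n (Lk S b)

def ConeOn (S : Set (Finset V)) (B : Finset V) (x : V) : Prop := x ∈ B ∧ ∀ s ∈ S, s ⊆ B → insert x s ∈ S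

theorem Sph.mfd {n : ℕ} {S : Set (Finset V)} (hS : CX S) (h : Sph (n + 1) S) : Mfd n S :=
  fun b hb => h.lk hS hb

theorem add_mfd_aux {n : ℕ} {S : Set (Finset V)} (hS : CX S) (hM : Mfd n S)
    (ih : ∀ {b : V} {B : Finset V} {x : V}, {b} ∈ S → ConeOn (Lk S b) B x → Beta (Lk S b) B)
    {A : Finset V} {u : V} (hA : Beta S A) (hu : {u} ∈ S) (huA : u ∉ A)
    (hc : ∃ x, ConeOn (Lk S u) A x ∨ ConeOn (Lk S u) Aᶜ x) : Beta S (insert u A) := by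
  obtain ⟨x, hx | hx⟩ := hc
  · exact beta_add hS hu huA hA (ih hu hx) (newman (hS.lk hu) (hM u hu) (ih hu hx))
  · have h1 := newman (hS.lk hu) (hM u hu) (ih hu hx)
    rw [compl_compl] at h1
    exact beta_add hS hu huA hA h1 (ih hu hx)

theorem cone_beta : ∀ (n : ℕ) {S : Set (Finset V)} (hS : CX S) (hM : Mfd n S) {B : Finset V} {x : V},
    ConeOn S B x → Beta S B := by
  intro n
  induction n with
  | zero =>
    intro S hS hM B
    induction B using Finset.strongInduction with
    | H B IH =>
      intro x hx
      have hxS : {x} ∈ S := by simpa using hx.2 ∅ hS.emp (by simp)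
      by_cases hB : ∃ b ∈ B, b ≠ x
      · obtain ⟨b, hb, hbx⟩ := hB
        have h1 := IH (B.erase b) (erase_ssubset hb) (x := x)
          ⟨by simp [hbx.symm, hx.1], fun s hs h => hx.2 s hs (h.trans (erase_subset _ _))⟩
        rw [← insert_erase hb]
        by_cases hbS : {b} ∈ S
        · exfalso
          refine (hM b hbS).not_zero (u := x) ⟨by simpa using hbx, ?_⟩
          have := hx.2 {b} hbS (by simpa using hb)
          rwa [pair_comm] at this
        · exact beta_congr (beta_sdiff (A := B) hbS hS) h1
      · have : B = {x} := by
          ext y; push Not at hB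
          simp only [mem_singleton]
          exact ⟨hB y, fun h => h ▸ hx.1⟩
        rw [this]; exact beta_single hS hxS
  | succ n ihn =>
    intro S hS hM B
    induction B using Finset.strongInduction with
    | H B IH =>
      intro x hx
      have hxS : {x} ∈ S := by simpa using hx.2 ∅ hS.emp (by simp)
      by_cases hB : ∃ b ∈ B, b ≠ x
      · obtain ⟨b, hb, hbx⟩ := hB
        have h1 := IH (B.erase b) (erase_ssubset hb) (x := x)
          ⟨by simp [hbx.symm, hx.1], fun s hs h => hx.2 s hs (h.trans (erase_subset _ _))⟩
        rw [← insert_erase hb]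
        by_cases hbS : {b} ∈ S
        · refine add_mfd_aux hS hM (fun {b'} {B'} {x'} hb' hc => ihn (hS.lk hb') ((hM b' hb').mfd (hS.lk hb')) hc) h1 hbS
            (by simp) ⟨x, Or.inl ⟨by simp [hbx.symm, hx.1], fun s hs hsB => ?_⟩⟩
          refine ⟨by simp [hbx, hs.1], ?_⟩
          rw [insert_comm]
          refine hx.2 _ hs.2 (insert_subset hb (hsB.trans (erase_subset _ _)))
        · exact beta_congr (beta_sdiff (A := B) hbS hS) h1
      · have : B = {x} := by
          ext y; push Not at hB
          simp only [mem_singleton]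
          exact ⟨hB y, fun h => h ▸ hx.1⟩
        rw [this]; exact beta_single hS hxS

theorem add_mfd {n : ℕ} {S : Set (Finset V)} (hS : CX S) (hM : Mfd n S)
    {A : Finset V} {u : V} (hA : Beta S A) (hu : {u} ∈ S) (huA : u ∉ A)
    (hc : ∃ x, ConeOn (Lk S u) A x ∨ ConeOn (Lk S u) Aᶜ x) : Beta S (insert u A) := by
  refine add_mfd_aux hS hM ?_ hA hu huA hc
  intro b B x hb hcone
  cases n with
  | zero =>
    exact ((hM b hb).not_zero (u := x) (by simpa using hcone.2 ∅ (hS.lk hb).emp (by simp))).elim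
  | succ n => exact cone_beta n (hS.lk hb) ((hM b hb).mfd (hS.lk hb)) hcone

end NW

section LB
variable {W V : Type*} [Fintype W] [DecidableEq W] [Fintype V] [DecidableEq V]

def fcone (s : Finset W) : Set (W → ℝ) := {c | (∀ v, 0 ≤ c v) ∧ ∀ v, v ∉ s → c v = 0}

def fspan (s : Finset W) : Submodule ℝ (W → ℝ) where
  carrier := {c | ∀ v, v ∉ s → c v = 0}
  add_mem' := fun {a b} ha hb v hv => by simp [ha v hv, hb v hv]
  zero_mem' := fun v _ => rfl
  smul_mem' := fun r a ha v hv => by simp [ha v hv]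

theorem fcone_closed (s : Finset W) : IsClosed (fcone s) := by
  have : fcone s = (⋂ v, {c : W → ℝ | 0 ≤ c v}) ∩ ⋂ v, {c : W → ℝ | v ∉ s → c v = 0} := by
    ext c; simp [fcone]
  rw [this]
  refine (isClosed_iInter fun v => isClosed_le continuous_const (continuous_apply v)).inter
    (isClosed_iInter fun v => ?_)
  by_cases hv : v ∈ s
  · simp [hv]
  · simpa [hv] using isClosed_eq (continuous_apply v) continuous_const

theorem mem_rz_iff {K : Set (Finset W)} {c : W → ℝ} : c ∈ rz K ↔ ∃ s ∈ K, c ∈ fcone s :=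
  ⟨fun ⟨h1, s, hs, h2⟩ => ⟨s, hs, h1, h2⟩, fun ⟨s, hs, h1, h2⟩ => ⟨h1, s, hs, h2⟩⟩

theorem face_inv {E : Type*} [NormedAddCommGroup E] [NormedSpace ℝ E] [FiniteDimensional ℝ E]
    (L : (W → ℝ) →ₗ[ℝ] E) (s : Finset W) (hinj : Set.InjOn L (fcone s)) :
    ∃ G : E →L[ℝ] (W → ℝ), ∀ c ∈ fspan s, G (L c) = c := by
  have h1 : Function.Injective (L.domRestrict (fspan s)) := by
    rw [← LinearMap.ker_eq_bot, LinearMap.ker_eq_bot']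
    rintro ⟨c, hc⟩ h0
    have h0 : L c = 0 := h0
    let a : W → ℝ := fun v => max (c v) 0
    let b : W → ℝ := fun v => max (-c v) 0
    have ha : a ∈ fcone s := ⟨fun v => le_max_right _ _, fun v hv => by simp [a, hc v hv]⟩
    have hb : b ∈ fcone s := ⟨fun v => le_max_right _ _, fun v hv => by simp [b, hc v hv]⟩
    have e : c = a - b := by
      ext v; simp only [a, b, Pi.sub_apply]
      rcases le_total 0 (c v) with h | h
      · rw [max_eq_left h, max_eq_right (by linarith)]; ring
      · rw [max_eq_right h, max_eq_left (by linarith)]; ring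
    have : L a = L b := by
      rw [e, map_sub] at h0; exact sub_eq_zero.1 h0
    have := hinj ha hb this
    apply Subtype.ext
    change c = 0; rw [e, this]; simp
  obtain ⟨G, hG⟩ := LinearMap.exists_leftInverse_of_injective _ (LinearMap.ker_eq_bot.2 h1)
  refine ⟨((fspan s).subtype ∘ₗ G).toContinuousLinearMap, fun c hc => ?_⟩
  have := congrArg (fun f => ((f ⟨c, hc⟩ : fspan s) : W → ℝ)) hG
  simpa using this

theorem PLOn.biUnion {E F ι : Type*} [NormedAddCommGroup E] [NormedSpace ℝ E] [NormedAddCommGroup F]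
    [NormedSpace ℝ F] {T : Set ι} (hT : T.Finite) {X : ι → Set E} {f : E → F} (hc : ∀ i ∈ T, IsClosed (X i))
    (h : ∀ i ∈ T, PLOn (X i) f) : PLOn (⋃ i ∈ T, X i) f := by
  induction T, hT using Set.Finite.induction_on with
  | empty =>
    refine ⟨by simp, {0}, by simp, by simp⟩
  | @insert a s ha hs ih =>
    rw [Set.biUnion_insert]
    exact (h a (by simp)).union (hc a (by simp)) (hs.isClosed_biUnion fun i hi => hc i (by simp [hi]))
      (ih (fun i hi => hc i (by simp [hi])) (fun i hi => h i (by simp [hi])))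

theorem linbij {E : Type*} [NormedAddCommGroup E] [NormedSpace ℝ E] [FiniteDimensional ℝ E]
    {K : Set (Finset W)} (L : (W → ℝ) →ₗ[ℝ] E) {Y : Set E} (hinj : Set.InjOn L (rz K))
    (himg : L '' rz K = Y) : ∃ g, PLE (rz K) Y L g := by
  have hsub : ∀ s ∈ K, fcone s ⊆ rz K := fun s hs c hc => mem_rz_iff.2 ⟨s, hs, hc⟩
  have : ∀ s : Finset W, ∃ G : E →L[ℝ] (W → ℝ), s ∈ K → ∀ c ∈ fspan s, G (L c) = c := fun s => by
    by_cases hs : s ∈ K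
    · obtain ⟨G, hG⟩ := face_inv L s (hinj.mono (hsub s hs))
      exact ⟨G, fun _ => hG⟩
    · exact ⟨0, fun h => (hs h).elim⟩
  choose G hG using this
  have hex : ∀ y ∈ Y, ∃ c ∈ rz K, L c = y := fun y hy => by rw [← himg] at hy; exact hy
  have hlc : Continuous L := L.continuous_of_finiteDimensional
  let g : E → (W → ℝ) := fun y => Function.invFunOn L (rz K) y
  have g1 : ∀ y ∈ Y, g y ∈ rz K := fun y hy => Function.invFunOn_mem (hex y hy)
  have g2 : ∀ y ∈ Y, L (g y) = y := fun y hy => Function.invFunOn_eq (hex y hy)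
  have hLY : ∀ c ∈ rz K, L c ∈ Y := fun c hc => himg ▸ ⟨c, hc, rfl⟩
  have g3 : ∀ c ∈ rz K, g (L c) = c := fun c hc => hinj (g1 _ (hLY c hc)) hc (g2 _ (hLY c hc))
  refine ⟨g, (PLOn.clm _ (L.toContinuousLinearMap)), ?_, hLY, g1, g3, g2⟩
  have hYe : Y = ⋃ s ∈ K, L '' fcone s := by
    rw [← himg]; ext y; simp only [Set.mem_iUnion, Set.mem_image, mem_rz_iff]
    constructor
    · rintro ⟨c, ⟨s, hs, hc⟩, e⟩; exact ⟨s, hs, c, hc, e⟩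
    · rintro ⟨s, hs, c, hc, e⟩; exact ⟨c, ⟨s, hs, hc⟩, e⟩
  rw [hYe]
  refine PLOn.biUnion K.toFinite ?_ ?_
  · intro s hs
    have : L '' fcone s = (G s) ⁻¹' fcone s ∩ {y | L (G s y) = y} := by
      ext y; constructor
      · rintro ⟨c, hc, rfl⟩
        have := hG s hs c hc.2
        simp only [Set.mem_inter_iff, Set.mem_preimage, this]
        exact ⟨hc, by change L (G s (L c)) = L c; rw [this]⟩
      · rintro ⟨h1, h2⟩; exact ⟨_, h1, h2⟩
    rw [this]
    exact ((fcone_closed s).preimage (G s).continuous).inter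
      (isClosed_eq (hlc.comp (G s).continuous) continuous_id)
  · intro s hs
    refine (PLOn.clm _ (G s)).congr ?_
    rintro _ ⟨c, hc, rfl⟩
    rw [g3 c (hsub s hs hc), hG s hs c hc.2]

theorem ple_cle {E F : Type*} [NormedAddCommGroup E] [NormedSpace ℝ E] [NormedAddCommGroup F]
    [NormedSpace ℝ F] (e : E ≃L[ℝ] F) : PLE (Set.univ : Set E) (Set.univ : Set F) e e.symm :=
  ⟨PLOn.clm _ (e : E →L[ℝ] F), PLOn.clm _ (e.symm : F →L[ℝ] E), fun _ _ => trivial, fun _ _ => trivial,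
    fun _ _ => by simp, fun _ _ => by simp⟩

theorem ple_rank {E F : Type*} [NormedAddCommGroup E] [NormedSpace ℝ E] [NormedAddCommGroup F]
    [NormedSpace ℝ F] [FiniteDimensional ℝ E] [FiniteDimensional ℝ F]
    (h : Module.finrank ℝ E = Module.finrank ℝ F) :
    ∃ f g, PLE (Set.univ : Set E) (Set.univ : Set F) f g :=
  ⟨_, _, ple_cle (LinearEquiv.ofFinrankEq E F h).toContinuousLinearEquiv⟩

/-! layer cake -/
def suml (t : Finset V → ℝ) (v : V) : ℝ := ∑ σ, if v ∈ σ then t σ else 0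

def Chn (t : Finset V → ℝ) : Prop := (∀ σ, 0 ≤ t σ) ∧ t ∅ = 0 ∧ ∀ σ τ, t σ ≠ 0 → t τ ≠ 0 → σ ⊆ τ ∨ τ ⊆ σ

theorem suml_pos {t : Finset V → ℝ} (ht : Chn t) {v : V} {σ : Finset V} (h : t σ ≠ 0) (hv : v ∈ σ) : suml t v ≠ 0 := by
  have h1 : (if v ∈ σ then t σ else 0) ≤ suml t v :=
    single_le_sum (f := fun σ => if v ∈ σ then t σ else 0) (fun τ _ => by
      by_cases h : v ∈ τ <;> simp [h, ht.1 τ]) (mem_univ σ)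
  rw [if_pos hv] at h1
  have := (ht.1 σ).lt_of_ne' h
  exact (this.trans_le h1).ne'

theorem suml_ne {t : Finset V → ℝ} {v : V} (h : suml t v ≠ 0) : ∃ σ, v ∈ σ ∧ t σ ≠ 0 := by
  obtain ⟨σ, -, hσ⟩ := exists_ne_zero_of_sum_ne_zero h
  by_cases hv : v ∈ σ
  · exact ⟨σ, hv, by simpa [hv] using hσ⟩
  · simp [hv] at hσ

/-- the top element of a chain is the support -/
theorem chn_top {t : Finset V → ℝ} (ht : Chn t) {σ0 : Finset V} (h0 : t σ0 ≠ 0) :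
    t (univ.filter fun v => suml t v ≠ 0) ≠ 0 := by
  obtain ⟨σ, hσ, hm⟩ := (univ.filter fun σ => t σ ≠ 0).exists_max_image Finset.card ⟨σ0, by simpa using h0⟩
  simp only [mem_filter, mem_univ, true_and] at hσ hm
  have : (univ.filter fun v => suml t v ≠ 0) = σ := by
    ext v; simp only [mem_filter, mem_univ, true_and]
    refine ⟨fun h => ?_, fun h => suml_pos ht hσ h⟩
    obtain ⟨τ, hv, hτ⟩ := suml_ne h
    rcases ht.2.2 _ _ hσ hτ with h1 | h1
    · rw [eq_of_subset_of_card_le h1 (hm τ hτ)]; exact hv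
    · exact h1 hv
  rwa [this]

theorem suml_sub (t : Finset V → ℝ) (s : Finset V) (m : ℝ) (v : V) :
    suml (fun σ => t σ - if σ = s then m else 0) v = suml t v - if v ∈ s then m else 0 := by
  unfold suml
  have : ∀ σ : Finset V, (if v ∈ σ then (t σ - if σ = s then m else 0) else 0) =
      (if v ∈ σ then t σ else 0) - (if σ = s then (if v ∈ s then m else 0) else 0) := by
    intro σ
    by_cases h : σ = s
    · subst h; by_cases hv : v ∈ σ <;> simp [hv]
    · by_cases hv : v ∈ σ <;> simp [hv, h]
  simp_rw [this, sum_sub_distrib]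
  simp

theorem chn_inj : ∀ (N : ℕ) {t t' : Finset V → ℝ}, (univ.filter fun σ => t σ ≠ 0).card +
    (univ.filter fun σ => t' σ ≠ 0).card = N → Chn t → Chn t' → (∀ v, suml t v = suml t' v) → t = t' := by
  intro N
  induction N using Nat.strong_induction_on with
  | _ N IH =>
    intro t t' hN ht ht' he
    by_cases h0 : ∃ σ, t σ ≠ 0 ∨ t' σ ≠ 0
    · obtain ⟨s, h1, h2⟩ : ∃ s, t s ≠ 0 ∧ t' s ≠ 0 := by
        refine ⟨univ.filter fun v => suml t v ≠ 0, ?_⟩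
        have hnz : ∀ {r r' : Finset V → ℝ}, Chn r → Chn r' → (∀ v, suml r v = suml r' v) → ∀ σ, r σ ≠ 0 → ∃ σ', r' σ' ≠ 0 := by
          intro r r' hr hr' he σ h
          have : σ.Nonempty := by
            rw [nonempty_iff_ne_empty]; rintro rfl; exact h hr.2.1
          obtain ⟨v, hv⟩ := this
          have := suml_pos hr h hv
          rw [he] at this
          obtain ⟨τ, -, hτ⟩ := suml_ne this
          exact ⟨τ, hτ⟩
        have hfe : (univ.filter fun v => suml t v ≠ 0) = (univ.filter fun v => suml t' v ≠ 0) := by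
          simp_rw [he]
        obtain ⟨σ, h | h⟩ := h0
        · obtain ⟨τ, hτ⟩ := hnz ht ht' he σ h
          exact ⟨chn_top ht h, by rw [hfe]; exact chn_top ht' hτ⟩
        · obtain ⟨τ, hτ⟩ := hnz ht' ht (fun v => (he v).symm) σ h
          exact ⟨chn_top ht hτ, by rw [hfe]; exact chn_top ht' h⟩
      set m := min (t s) (t' s) with hm
      have key : ∀ r : Finset V → ℝ, Chn r → m ≤ r s → r s ≠ 0 → Chn (fun σ => r σ - if σ = s then m else 0) ∧
          (univ.filter fun σ => (fun σ => r σ - if σ = s then m else 0) σ ≠ 0) ⊆ (univ.filter fun σ => r σ ≠ 0) := by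
        intro r hr hmr hrs
        have hs : s ≠ ∅ := by rintro rfl; exact hrs hr.2.1
        have hsub : ∀ σ, r σ - (if σ = s then m else 0) ≠ 0 → r σ ≠ 0 := by
          intro σ h
          by_cases e : σ = s
          · rw [e]; exact hrs
          · simpa [e] using h
        refine ⟨⟨fun σ => ?_, ?_, fun σ τ h1 h2 => hr.2.2 _ _ (hsub _ h1) (hsub _ h2)⟩, ?_⟩
        · by_cases e : σ = s
          · subst e; simpa using hmr
          · simpa [e] using hr.1 σ
        · simp [hr.2.1, hs.symm]
        · intro σ; simp only [mem_filter, mem_univ, true_and]; exact hsub σ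
      obtain ⟨a1, a2⟩ := key t ht (min_le_left _ _) h1
      obtain ⟨b1, b2⟩ := key t' ht' (min_le_right _ _) h2
      have hlt : (univ.filter fun σ => (fun σ => t σ - if σ = s then m else 0) σ ≠ 0).card +
          (univ.filter fun σ => (fun σ => t' σ - if σ = s then m else 0) σ ≠ 0).card < N := by
        rw [← hN]
        rcases min_choice (t s) (t' s) with h | h
        · refine Nat.add_lt_add_of_lt_of_le (card_lt_card ⟨a2, fun hh => ?_⟩) (card_le_card b2)
          have := hh (show s ∈ _ by simpa using h1)
          simp [hm, h] at this
        · refine Nat.add_lt_add_of_le_of_lt (card_le_card a2) (card_lt_card ⟨b2, fun hh => ?_⟩)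
          have := hh (show s ∈ _ by simpa using h2)
          simp [hm, h] at this
      have := IH _ hlt rfl a1 b1 (fun v => by rw [suml_sub, suml_sub, he])
      ext σ
      have := congrFun this σ
      simpa using this
    · push Not at h0
      ext σ; rw [(h0 σ).1, (h0 σ).2]

theorem chn_ex : ∀ (N : ℕ) {c : V → ℝ}, (univ.filter fun v => c v ≠ 0).card = N → (∀ v, 0 ≤ c v) →
    ∃ t, Chn t ∧ (∀ v, suml t v = c v) ∧ ∀ σ, t σ ≠ 0 → σ ⊆ univ.filter fun v => c v ≠ 0 := by
  intro N
  induction N using Nat.strong_induction_on with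
  | _ N IH =>
    intro c hN hc
    set s := univ.filter fun v => c v ≠ 0 with hs
    rcases s.eq_empty_or_nonempty with he | hne
    · refine ⟨0, ⟨fun _ => le_rfl, rfl, fun _ _ h => (h rfl).elim⟩, fun v => ?_, fun _ h => (h rfl).elim⟩
      have : v ∉ s := by simp [he]
      simp only [hs, mem_filter, mem_univ, true_and, not_not] at this
      simp [suml, this]
    · obtain ⟨w, hw, hmin⟩ := s.exists_min_image c hne
      have hwpos : c w ≠ 0 := by simpa [hs] using hw
      have hms : ∀ v, v ∈ s ↔ c v ≠ 0 := fun v => by simp [hs]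
      let c' : V → ℝ := fun v => c v - if v ∈ s then c w else 0
      have hc' : ∀ v, 0 ≤ c' v := fun v => by
        by_cases h : v ∈ s
        · simpa [c', h] using hmin v h
        · simpa [c', h] using hc v
      have hsub : ∀ v, c' v ≠ 0 → v ∈ s := fun v h => by
        by_contra hv
        have := (hms v).not.1 hv
        simp only [not_not] at this
        simp [c', hv, this] at h
      have hlt : (univ.filter fun v => c' v ≠ 0) ⊂ s := by
        refine ⟨fun v hv => hsub v (by simpa using hv), fun h => ?_⟩
        have := h hw
        simp [c', hw] at this
      obtain ⟨t, ht, h1, h2⟩ := IH _ (hN ▸ card_lt_card hlt) rfl hc'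
      refine ⟨fun σ => t σ - if σ = s then -c w else 0, ⟨fun σ => ?_, ?_, ?_⟩, fun v => ?_, ?_⟩
      · by_cases h : σ = s
        · simp [h]; exact add_nonneg (ht.1 _) (hc w)
        · simpa [h] using ht.1 σ
      · simp [ht.2.1, hne.ne_empty.symm]
      · have aux : ∀ σ, t σ - (if σ = s then -c w else 0) ≠ 0 → σ = s ∨ (t σ ≠ 0 ∧ σ ⊆ s) := by
          intro σ h
          by_cases e : σ = s
          · exact Or.inl e
          · simp only [e, if_false, sub_zero] at h
            exact Or.inr ⟨h, (h2 σ h).trans hlt.1⟩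
        intro σ τ hσ hτ
        rcases aux σ hσ with rfl | ⟨a, b⟩ <;> rcases aux τ hτ with rfl | ⟨a', b'⟩
        · exact Or.inl subset_rfl
        · exact Or.inr b'
        · exact Or.inl b
        · exact ht.2.2 _ _ a a'
      · rw [suml_sub, h1]
        by_cases h : v ∈ s <;> simp [c', h]
      · intro σ hσ
        by_cases e : σ = s
        · rw [e]
        · simp only [e, if_false, sub_zero] at hσ
          exact (h2 σ hσ).trans hlt.1
end LB

section DV
variable {V : Type*} [Fintype V] [DecidableEq V]

/-- the derived complex -/
def Dv (S : Set (Finset V)) : Set (Finset (Finset V)) :=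
  {t | (∀ σ ∈ t, σ ∈ S ∧ σ.Nonempty) ∧ ∀ σ ∈ t, ∀ τ ∈ t, σ ⊆ τ ∨ τ ⊆ σ}

theorem Dv.cx (S : Set (Finset V)) : CX (Dv S) :=
  ⟨⟨by simp, by simp⟩, fun s hs t ht => ⟨fun σ h => hs.1 σ (ht h), fun σ h τ h' => hs.2 σ (ht h) τ (ht h')⟩⟩

theorem rz_Dv {S : Set (Finset V)} {t : Finset V → ℝ} :
    t ∈ rz (Dv S) ↔ Chn t ∧ ∀ σ, t σ ≠ 0 → σ ∈ S := by
  constructor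
  · rintro ⟨h0, s, hs, h⟩
    have h' : ∀ σ, t σ ≠ 0 → σ ∈ s := fun σ => not_imp_comm.1 (h σ)
    refine ⟨⟨h0, h _ fun h1 => ?_, fun σ τ h1 h2 => hs.2 _ (h' _ h1) _ (h' _ h2)⟩, fun σ h1 => (hs.1 _ (h' _ h1)).1⟩
    simpa using (hs.1 _ h1).2
  · rintro ⟨⟨h0, h1, h2⟩, h3⟩
    refine ⟨h0, univ.filter fun σ => t σ ≠ 0, ⟨fun σ hσ => ?_, fun σ hσ τ hτ => ?_⟩, fun σ hσ => ?_⟩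
    · simp only [mem_filter, mem_univ, true_and] at hσ
      refine ⟨h3 _ hσ, ?_⟩
      rw [nonempty_iff_ne_empty]; rintro rfl; exact hσ h1
    · simp only [mem_filter, mem_univ, true_and] at hσ hτ
      exact h2 _ _ hσ hτ
    · simpa using hσ

theorem suml_add (t t' : Finset V → ℝ) (v : V) : suml (t + t') v = suml t v + suml t' v := by
  simp only [suml, ← sum_add_distrib]
  exact sum_congr rfl fun σ _ => by split_ifs <;> simp
theorem suml_smul (r : ℝ) (t : Finset V → ℝ) (v : V) : suml (r • t) v = r * suml t v := by
  simp only [suml, mul_sum]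
  exact sum_congr rfl fun σ _ => by split_ifs <;> simp

def sumL : (Finset V → ℝ) →ₗ[ℝ] (V → ℝ) where
  toFun t := suml t
  map_add' t t' := by ext v; exact suml_add t t' v
  map_smul' r t := by ext v; simpa using suml_smul r t v

theorem suml_nonneg {t : Finset V → ℝ} (h : ∀ σ, 0 ≤ t σ) (v : V) : 0 ≤ suml t v :=
  sum_nonneg fun σ _ => by split_ifs; exacts [h σ, le_rfl]

theorem rz_of_supp {S : Set (Finset V)} {c : V → ℝ} (h0 : ∀ v, 0 ≤ c v) (h : (univ.filter fun v => c v ≠ 0) ∈ S) :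
    c ∈ rz S := ⟨h0, _, h, fun v hv => by simpa using hv⟩
theorem supp_of_rz {S : Set (Finset V)} (hS : CX S) {c : V → ℝ} (h : c ∈ rz S) : (univ.filter fun v => c v ≠ 0) ∈ S := by
  obtain ⟨h0, s, hs, h⟩ := h
  refine hS.down s hs _ fun v hv => ?_
  by_contra h'
  simp [h v h'] at hv

theorem dv_ple {S : Set (Finset V)} (hS : CX S) : ∃ f g, PLE (rz (Dv S)) (rz S) f g := by
  suffices h : Set.InjOn (sumL (V := V)) (rz (Dv S)) ∧ (sumL (V := V)) '' rz (Dv S) = rz S by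
    obtain ⟨g, hg⟩ := linbij _ h.1 h.2
    exact ⟨_, g, hg⟩
  constructor
  · intro t ht t' ht' e
    rw [rz_Dv] at ht ht'
    exact chn_inj _ rfl ht.1 ht'.1 fun v => congrFun e v
  · ext c; constructor
    · rintro ⟨t, ht, rfl⟩
      rw [rz_Dv] at ht
      refine rz_of_supp (fun v => suml_nonneg ht.1.1 v) ?_
      by_cases h : ∃ σ, t σ ≠ 0
      · obtain ⟨σ, h⟩ := h
        exact ht.2 _ (chn_top ht.1 h)
      · push Not at h
        have : t = 0 := funext h
        subst this
        simpa using hS.emp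
    · intro hc
      obtain ⟨t, ht, h1, h2⟩ := chn_ex _ rfl (hc.1)
      refine ⟨t, rz_Dv.2 ⟨ht, fun σ hσ => hS.down _ (supp_of_rz hS hc) _ (h2 σ hσ)⟩, funext h1⟩

/-- link of a face -/
def LkF (S : Set (Finset V)) (ρ : Finset V) : Set (Finset V) := {s | Disjoint s ρ ∧ s ∪ ρ ∈ S}
/-- boundary of the star of a face -/
def JL (S : Set (Finset V)) (ρ : Finset V) : Set (Finset V) := {s | ¬ ρ ⊆ s ∧ s ∪ ρ ∈ S}

theorem LkF.cx {S : Set (Finset V)} (hS : CX S) {ρ : Finset V} (h : ρ ∈ S) : CX (LkF S ρ) :=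
  ⟨⟨by simp, by simpa using h⟩, fun s hs t ht => ⟨disjoint_of_subset_left ht hs.1,
    hS.down _ hs.2 _ (union_subset_union_left ht)⟩⟩
theorem LkF_insert (S : Set (Finset V)) (ρ : Finset V) {b : V} (hb : b ∉ ρ) : LkF S (insert b ρ) = Lk (LkF S ρ) b := by
  ext s
  simp only [LkF, Lk, Set.mem_ofPred_eq, disjoint_insert_right, disjoint_insert_left]
  have : s ∪ insert b ρ = insert b s ∪ ρ := by ext; simp
  rw [this]; tauto

theorem LkF_single (S : Set (Finset V)) (b : V) : LkF S {b} = Lk S b := by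
  ext s
  simp only [LkF, Lk, Set.mem_ofPred_eq, disjoint_singleton_right, union_singleton]

theorem sph_LkF {n : ℕ} {S : Set (Finset V)} (hS : CX S) (hM : Mfd n S) : ∀ ρ : Finset V, ρ.Nonempty → ρ ∈ S →
    ∃ m, ρ.card + m = n + 1 ∧ Sph m (LkF S ρ) := by
  intro ρ hne
  induction hne using Finset.Nonempty.cons_induction with
  | singleton a => intro h; exact ⟨n, by simp [add_comm], by rw [LkF_single]; exact hM a h⟩
  | cons b ρ hb hne ih =>
    rw [cons_eq_insert]
    intro h
    have hρ : ρ ∈ S := hS.down _ h _ (by simp)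
    obtain ⟨m, hm, hs⟩ := ih hρ
    have hbL : {b} ∈ LkF S ρ := ⟨by simpa using hb, by simpa using h⟩
    cases m with
    | zero => exact (hs.not_zero hbL).elim
    | succ m =>
      refine ⟨m, by rw [card_insert_of_notMem hb]; omega, ?_⟩
      rw [LkF_insert _ _ hb]
      exact hs.lk (LkF.cx hS hρ) hbL

def jlL (ρ : Finset V) (a : V) : (V → ℝ) →ₗ[ℝ] ((↥(ρ.erase a) → ℝ) × (V → ℝ)) where
  toFun c := (fun v => c v - c a, fun v => if v ∈ ρ then 0 else c v)
  map_add' c c' := by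
    ext v
    · simp; ring
    · simp; split_ifs <;> simp
  map_smul' r c := by
    ext v
    · simp; ring
    · simp

theorem sph_JL {m : ℕ} {S : Set (Finset V)} (hS : CX S) {ρ : Finset V} {a : V} (ha : a ∈ ρ) (h : Sph m (LkF S ρ)) {n : ℕ}
    (hn : ρ.card + m = n + 1) : Sph n (JL S ρ) := by
  obtain ⟨f, g, hfg⟩ := h
  suffices h : Set.InjOn (jlL ρ a) (rz (JL S ρ)) ∧ (jlL ρ a) '' rz (JL S ρ) = Set.univ ×ˢ rz (LkF S ρ) by
    obtain ⟨g1, hg1⟩ := linbij _ h.1 h.2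
    have h2 := hg1.trans ((PLE.refl (Set.univ : Set (↥(ρ.erase a) → ℝ))).prod hfg)
    obtain ⟨f3, g3, h3⟩ := ple_rank (E := (↥(ρ.erase a) → ℝ) × (Fin m → ℝ)) (F := Fin n → ℝ) (by
      have := card_erase_of_mem ha
      have := card_pos.2 ⟨a, ha⟩
      rw [Module.finrank_prod, Module.finrank_pi, Module.finrank_pi, Module.finrank_pi, Fintype.card_coe, Fintype.card_fin,
        Fintype.card_fin]
      omega)
    rw [Set.univ_prod_univ] at h2
    exact ⟨_, _, h2.trans h3⟩
  constructor
  · have key : ∀ c ∈ rz (JL S ρ), ∀ c' ∈ rz (JL S ρ), jlL ρ a c = jlL ρ a c' → c a ≤ c' a := by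
      rintro c ⟨h0, s, ⟨hs, -⟩, h1⟩ c' ⟨h0', -⟩ e
      obtain ⟨v, hv, hvs⟩ := not_subset.1 hs
      have e1 := congrArg Prod.fst e
      by_cases hva : v = a
      · rw [hva] at hvs
        rw [h1 a hvs]; exact h0' a
      · have h3 := congrFun e1 ⟨v, by simp [hva, hv]⟩
        change c v - c a = c' v - c' a at h3
        have := h0' v
        rw [h1 v hvs] at h3
        linarith
    intro c hc c' hc' e
    have ea : c a = c' a := le_antisymm (key c hc c' hc' e) (key c' hc' c hc e.symm)
    ext v
    by_cases hva : v = a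
    · rw [hva, ea]
    by_cases hv : v ∈ ρ
    · have h3 := congrFun (congrArg Prod.fst e) ⟨v, by simp [hva, hv]⟩
      change c v - c a = c' v - c' a at h3
      linarith
    · have h3 := congrFun (congrArg Prod.snd e) v
      simpa [jlL, hv] using h3
  · ext ⟨y, z⟩; constructor
    · rintro ⟨c, ⟨h0, s, ⟨hs, hs'⟩, h1⟩, e⟩
      refine ⟨trivial, ?_⟩
      rw [← e]
      refine ⟨fun v => ?_, s \ ρ, ⟨sdiff_disjoint, by simpa using hs'⟩, fun v hv => ?_⟩
      · change 0 ≤ if v ∈ ρ then 0 else c v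
        split_ifs; exacts [le_rfl, h0 v]
      · change (if v ∈ ρ then 0 else c v) = 0
        split_ifs with h
        · rfl
        · exact h1 v fun h' => hv (by simp [h, h'])
    · rintro ⟨-, h0, s, ⟨hs, hs'⟩, h1⟩
      change ∀ v, 0 ≤ z v at h0
      change ∀ v, v ∉ s → z v = 0 at h1
      let Y : V → ℝ := fun v => if h : v ∈ ρ.erase a then y ⟨v, h⟩ else 0
      obtain ⟨w, hw, hmin⟩ := ρ.exists_min_image Y ⟨a, ha⟩
      have hYa : Y a = 0 := by simp [Y]
      refine ⟨fun v => if v ∈ ρ then Y v - Y w else z v, ⟨fun v => ?_, (s ∪ ρ).erase w, ⟨?_, ?_⟩, fun v hv => ?_⟩, ?_⟩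
      · change 0 ≤ if v ∈ ρ then Y v - Y w else z v
        split_ifs with h
        · linarith [hmin v h]
        · exact h0 v
      · intro h; simpa using h hw
      · refine hS.down _ hs' _ ?_
        exact union_subset (erase_subset _ _) subset_union_right
      · change (if v ∈ ρ then Y v - Y w else z v) = 0
        by_cases h : v = w
        · rw [h, if_pos hw]; ring
        · simp [h] at hv
          rw [if_neg hv.2]; exact h1 v hv.1
      · refine Prod.ext ?_ ?_
        · ext ⟨v, hv⟩
          have hv' : v ∈ ρ := mem_of_mem_erase hv
          change (if v ∈ ρ then Y v - Y w else z v) - (if a ∈ ρ then Y a - Y w else z a) = y ⟨v, hv⟩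
          rw [if_pos hv', if_pos ha, hYa]
          simp only [Y, hv, dif_pos]; ring
        · ext v
          change (if v ∈ ρ then 0 else if v ∈ ρ then Y v - Y w else z v) = z v
          by_cases h : v ∈ ρ
          · rw [if_pos h, h1 v (fun h' => disjoint_left.1 hs h' h)]
          · rw [if_neg h, if_neg h]

def lowp (ρ : Finset V) (t : Finset V → ℝ) (σ : Finset V) : ℝ := if σ ⊆ ρ then t σ else 0
def upp (ρ : Finset V) (t : Finset V → ℝ) (τ : Finset V) : ℝ := if Disjoint τ ρ then t (τ ∪ ρ) else 0

def lkL (ρ : Finset V) : (Finset V → ℝ) →ₗ[ℝ] (V → ℝ) where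
  toFun t v := if v ∈ ρ then suml (lowp ρ t) v else suml (upp ρ t) v
  map_add' t t' := by
    have h1 : lowp ρ (t + t') = lowp ρ t + lowp ρ t' := by
      ext σ; simp only [lowp, Pi.add_apply]; split_ifs <;> simp
    have h2 : upp ρ (t + t') = upp ρ t + upp ρ t' := by
      ext σ; simp only [upp, Pi.add_apply]; split_ifs <;> simp
    ext v; rw [h1, h2, suml_add, suml_add]; simp only [Pi.add_apply]; split_ifs <;> rfl
  map_smul' r t := by
    have h1 : lowp ρ (r • t) = r • lowp ρ t := by
      ext σ; simp only [lowp, Pi.smul_apply]; split_ifs <;> simp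
    have h2 : upp ρ (r • t) = r • upp ρ t := by
      ext σ; simp only [upp, Pi.smul_apply]; split_ifs <;> simp
    ext v; rw [h1, h2, suml_smul, suml_smul]; simp only [Pi.smul_apply, RingHom.id_apply, smul_eq_mul]; split_ifs <;> rfl

theorem rz_lkDv {S : Set (Finset V)} {ρ : Finset V} (hρ : ρ ∈ S) (hne : ρ.Nonempty) {t : Finset V → ℝ} :
    t ∈ rz (Lk (Dv S) ρ) ↔ Chn t ∧ t ρ = 0 ∧ ∀ σ, t σ ≠ 0 → σ ∈ S ∧ (σ ⊆ ρ ∨ ρ ⊆ σ) := by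
  constructor
  · rintro ⟨h0, s, ⟨hs', hs⟩, h⟩
    have h' : ∀ σ, t σ ≠ 0 → σ ∈ insert ρ s := fun σ h1 => mem_insert_of_mem (not_imp_comm.1 (h σ) h1)
    refine ⟨⟨h0, h _ fun h1 => ?_, fun σ τ h1 h2 => hs.2 _ (h' _ h1) _ (h' _ h2)⟩, h _ hs', fun σ h1 =>
      ⟨(hs.1 _ (h' _ h1)).1, hs.2 _ (h' _ h1) _ (mem_insert_self _ _)⟩⟩
    simpa using (hs.1 _ (mem_insert_of_mem h1)).2
  · rintro ⟨⟨h0, h1, h2⟩, h3, h4⟩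
    refine ⟨h0, univ.filter fun σ => t σ ≠ 0, ⟨by simpa using h3, ⟨fun σ hσ => ?_, fun σ hσ τ hτ => ?_⟩⟩, fun σ hσ => ?_⟩
    · simp only [mem_insert, mem_filter, mem_univ, true_and] at hσ
      rcases hσ with rfl | hσ
      · exact ⟨hρ, hne⟩
      refine ⟨(h4 _ hσ).1, ?_⟩
      rw [nonempty_iff_ne_empty]; rintro rfl; exact hσ h1
    · simp only [mem_insert, mem_filter, mem_univ, true_and] at hσ hτ
      rcases hσ with rfl | hσ <;> rcases hτ with rfl | hτ
      · simp
      · exact (h4 _ hτ).2.symm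
      · exact (h4 _ hσ).2
      · exact h2 _ _ hσ hτ
    · simpa using hσ

theorem low_chn {ρ : Finset V} {t : Finset V → ℝ} (h : Chn t) : Chn (lowp ρ t) := by
  refine ⟨fun σ => ?_, by simp [lowp, h.2.1], fun σ τ h1 h2 => h.2.2 σ τ ?_ ?_⟩
  · simp only [lowp]; split_ifs; exacts [h.1 _, le_rfl]
  · intro h'; simp [lowp, h'] at h1
  · intro h'; simp [lowp, h'] at h2
theorem upp_ne {ρ : Finset V} {t : Finset V → ℝ} {τ : Finset V} (h : upp ρ t τ ≠ 0) : Disjoint τ ρ ∧ t (τ ∪ ρ) ≠ 0 := by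
  unfold upp at h; split_ifs at h with h'
  · exact ⟨h', h⟩
  · exact (h rfl).elim
theorem up_chn {ρ : Finset V} {t : Finset V → ℝ} (h : Chn t) (hρ : t ρ = 0) : Chn (upp ρ t) := by
  refine ⟨fun σ => ?_, by simp [upp, hρ], fun σ τ h1 h2 => ?_⟩
  · simp only [upp]; split_ifs; exacts [h.1 _, le_rfl]
  · obtain ⟨a, a'⟩ := upp_ne h1
    obtain ⟨b, b'⟩ := upp_ne h2
    have key : ∀ {x y : Finset V}, Disjoint x ρ → x ∪ ρ ⊆ y ∪ ρ → x ⊆ y := by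
      intro x y hx hxy v hv
      have := hxy (mem_union_left _ hv)
      rcases mem_union.1 this with h | h
      · exact h
      · exact (disjoint_left.1 hx hv h).elim
    exact (h.2.2 _ _ a' b').imp (key a) (key b)

theorem suml_low_off {ρ : Finset V} {t : Finset V → ℝ} {v : V} (hv : v ∉ ρ) : suml (lowp ρ t) v = 0 := by
  by_contra h
  obtain ⟨σ, h1, h2⟩ := suml_ne h
  unfold lowp at h2; split_ifs at h2 with h3
  · exact hv (h3 h1)
  · exact h2 rfl
theorem suml_up_on {ρ : Finset V} {t : Finset V → ℝ} {v : V} (hv : v ∈ ρ) : suml (upp ρ t) v = 0 := by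
  by_contra h
  obtain ⟨σ, h1, h2⟩ := suml_ne h
  exact disjoint_left.1 (upp_ne h2).1 h1 hv

theorem lkdv_ple {S : Set (Finset V)} (hS : CX S) {ρ : Finset V} (hρ : ρ ∈ S) (hne : ρ.Nonempty) :
    ∃ f g, PLE (rz (Lk (Dv S) ρ)) (rz (JL S ρ)) f g := by
  suffices h : Set.InjOn (lkL ρ) (rz (Lk (Dv S) ρ)) ∧ (lkL ρ) '' rz (Lk (Dv S) ρ) = rz (JL S ρ) by
    obtain ⟨g, hg⟩ := linbij _ h.1 h.2
    exact ⟨_, g, hg⟩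
  have val : ∀ t v, lkL ρ t v = if v ∈ ρ then suml (lowp ρ t) v else suml (upp ρ t) v := fun _ _ => rfl
  constructor
  · intro t ht t' ht' e
    rw [rz_lkDv hρ hne] at ht ht'
    have e1 : lowp ρ t = lowp ρ t' := chn_inj _ rfl (low_chn ht.1) (low_chn ht'.1) fun v => by
      by_cases hv : v ∈ ρ
      · have := congrFun e v; rw [val, val, if_pos hv, if_pos hv] at this; exact this
      · rw [suml_low_off hv, suml_low_off hv]
    have e2 : upp ρ t = upp ρ t' := chn_inj _ rfl (up_chn ht.1 ht.2.1) (up_chn ht'.1 ht'.2.1) fun v => by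
      by_cases hv : v ∈ ρ
      · rw [suml_up_on hv, suml_up_on hv]
      · have := congrFun e v; rw [val, val, if_neg hv, if_neg hv] at this; exact this
    ext σ
    by_cases h1 : σ ⊆ ρ
    · have := congrFun e1 σ; simpa [lowp, h1] using this
    by_cases h2 : ρ ⊆ σ
    · have := congrFun e2 (σ \ ρ); rw [upp, upp, if_pos sdiff_disjoint, if_pos sdiff_disjoint, sdiff_union_of_subset h2] at this; exact this
    · have a : t σ = 0 := by
        by_contra h; exact (ht.2.2 σ h).2.elim h1 h2
      have b : t' σ = 0 := by
        by_contra h; exact (ht'.2.2 σ h).2.elim h1 h2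
      rw [a, b]
  · ext c; constructor
    · rintro ⟨t, ht, rfl⟩
      rw [rz_lkDv hρ hne] at ht
      have hl := low_chn (ρ := ρ) ht.1
      have hu := up_chn ht.1 ht.2.1
      refine rz_of_supp (fun v => ?_) ⟨?_, ?_⟩
      · rw [val]; split_ifs; exacts [suml_nonneg hl.1 v, suml_nonneg hu.1 v]
      · intro hsub
        have h1 : ∀ v, v ∈ ρ ↔ suml (lowp ρ t) v ≠ 0 := fun v => by
          constructor
          · intro hv
            have := hsub hv
            simp only [mem_filter, mem_univ, true_and] at this
            rwa [val, if_pos hv] at this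
          · intro h; by_contra h'; exact h (suml_low_off h')
        obtain ⟨v, hv⟩ := hne
        obtain ⟨σ, h3, h4⟩ := suml_ne ((h1 v).1 hv)
        have := chn_top hl h4
        have e : (univ.filter fun v => suml (lowp ρ t) v ≠ 0) = ρ := by ext v; simp [← h1]
        rw [e] at this
        simp [lowp, ht.2.1] at this
      · by_cases h : ∃ σ, upp ρ t σ ≠ 0
        · obtain ⟨σ, h⟩ := h
          have h1 := chn_top hu h
          refine hS.down _ (ht.2.2 _ (upp_ne h1).2).1 _ (union_subset (fun v hv => ?_) subset_union_right)
          by_cases hvρ : v ∈ ρ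
          · exact mem_union_right _ hvρ
          · refine mem_union_left _ ?_
            simp only [mem_filter, mem_univ, true_and] at hv ⊢
            rwa [val, if_neg hvρ] at hv
        · push Not at h
          refine hS.down _ hρ _ (union_subset (fun v hv => ?_) le_rfl)
          by_contra hvρ
          simp only [mem_filter, mem_univ, true_and] at hv
          rw [val, if_neg hvρ] at hv
          obtain ⟨σ, h3, h4⟩ := suml_ne hv
          exact h4 (h σ)
    · rintro ⟨h0, s, ⟨hs, hs'⟩, hc⟩
      obtain ⟨t1, ht1, h11, h12⟩ := chn_ex (c := fun v => if v ∈ ρ then c v else 0) _ rfl (fun v => by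
        split_ifs; exacts [h0 v, le_rfl])
      obtain ⟨t2, ht2, h21, h22⟩ := chn_ex (c := fun v => if v ∈ ρ then 0 else c v) _ rfl (fun v => by
        split_ifs; exacts [le_rfl, h0 v])
      have p1 : ∀ σ, t1 σ ≠ 0 → σ ⊂ ρ := by
        intro σ hσ
        have hsub := h12 σ hσ
        have h3 : ∀ v ∈ σ, v ∈ ρ ∧ c v ≠ 0 := fun v hv => by
          have := hsub hv
          simpa using this
        refine ⟨fun v hv => (h3 v hv).1, fun h => hs fun v hv => ?_⟩
        by_contra h'
        exact (h3 v (h hv)).2 (hc v h')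
      have p2 : ∀ σ, t2 σ ≠ 0 → Disjoint σ ρ ∧ σ ∪ ρ ∈ S := by
        intro σ hσ
        have hsub := h22 σ hσ
        have h3 : ∀ v ∈ σ, v ∉ ρ ∧ c v ≠ 0 := fun v hv => by
          have := hsub hv
          simpa using this
        refine ⟨disjoint_left.2 fun v hv => (h3 v hv).1, hS.down _ hs' _ ?_⟩
        refine union_subset_union_left fun v hv => ?_
        by_contra h'
        exact (h3 v hv).2 (hc v h')
      let t : Finset V → ℝ := fun σ => if σ ⊆ ρ then t1 σ else if ρ ⊆ σ then t2 (σ \ ρ) else 0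
      have ht : ∀ σ, t σ ≠ 0 → (σ ⊂ ρ ∧ t1 σ ≠ 0) ∨ (¬ σ ⊆ ρ ∧ ρ ⊆ σ ∧ t2 (σ \ ρ) ≠ 0) := by
        intro σ h
        simp only [t] at h
        split_ifs at h with h1 h2
        · exact Or.inl ⟨p1 _ h, h⟩
        · exact Or.inr ⟨h1, h2, h⟩
        · exact (h rfl).elim
      have tρ : t ρ = 0 := by
        simp only [t, subset_rfl, if_true]
        by_contra h; exact (p1 _ h).ne rfl
      have l1 : lowp ρ t = t1 := by
        ext σ; by_cases h : σ ⊆ ρ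
        · simp [lowp, t, h]
        · rw [lowp, if_neg h]; by_contra h'; exact h (p1 σ (Ne.symm h')).1
      have l2 : upp ρ t = t2 := by
        ext σ; by_cases h : Disjoint σ ρ
        · rw [upp, if_pos h]
          by_cases h3 : σ ∪ ρ ⊆ ρ
          · have : σ = ∅ := by
              rw [← disjoint_self_iff_empty]
              exact disjoint_of_subset_right (union_subset_left h3) h
            subst this
            rw [empty_union, tρ, ht2.2.1]
          · simp only [t]
            rw [if_neg h3, if_pos subset_union_right]
            congr 1
            rw [union_sdiff_right, sdiff_eq_self_of_disjoint h]
        · rw [upp, if_neg h]; by_contra h'; exact h (p2 σ (Ne.symm h')).1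
      refine ⟨t, (rz_lkDv hρ hne).2 ⟨⟨fun σ => ?_, ?_, fun σ τ h1 h2 => ?_⟩, tρ, fun σ h => ?_⟩, ?_⟩
      · simp only [t]; split_ifs; exacts [ht1.1 _, ht2.1 _, le_rfl]
      · simp [t, ht1.2.1]
      · rcases ht σ h1 with ⟨a, a'⟩ | ⟨a, a', a''⟩ <;> rcases ht τ h2 with ⟨b, b'⟩ | ⟨b, b', b''⟩
        · exact ht1.2.2 _ _ a' b'
        · exact Or.inl (a.1.trans b')
        · exact Or.inr (b.1.trans a')
        · refine (ht2.2.2 _ _ a'' b'').imp ?_ ?_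
          · intro h v hv
            by_cases hvρ : v ∈ ρ
            · exact b' hvρ
            · exact (mem_sdiff.1 (h (mem_sdiff.2 ⟨hv, hvρ⟩))).1
          · intro h v hv
            by_cases hvρ : v ∈ ρ
            · exact a' hvρ
            · exact (mem_sdiff.1 (h (mem_sdiff.2 ⟨hv, hvρ⟩))).1
      · rcases ht σ h with ⟨a, a'⟩ | ⟨a, a', a''⟩
        · exact ⟨hS.down _ hρ _ a.1, Or.inl a.1⟩
        · refine ⟨?_, Or.inr a'⟩
          have := (p2 _ a'').2
          rwa [sdiff_union_of_subset a'] at this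
      · ext v
        rw [val, l1, l2, h11, h21]
        by_cases hv : v ∈ ρ <;> simp [hv]

theorem mfd_Dv {n : ℕ} {S : Set (Finset V)} (hS : CX S) (hM : Mfd n S) : Mfd n (Dv S) := by
  intro ρ hρ
  have h := hρ.1 ρ (by simp)
  obtain ⟨m, hm, hs⟩ := sph_LkF hS hM ρ h.2 h.1
  obtain ⟨a, ha⟩ := h.2
  obtain ⟨f, g, h1⟩ := sph_JL hS ha hs hm
  obtain ⟨f2, g2, h2⟩ := lkdv_ple hS h.1 h.2
  exact ⟨_, _, h2.trans h1⟩

/-- the boundary of a simplex is a sphere -/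
theorem sph_bd {A : Finset V} {n : ℕ} (hA : A.card = n + 1) : Sph n {s : Finset V | s ⊂ A} := by
  obtain ⟨a, ha⟩ : A.Nonempty := card_pos.1 (by omega)
  have hS : CX {s : Finset V | s ⊆ A} := ⟨by simp, fun s hs t ht => ht.trans hs⟩
  have h0 : Sph 0 (LkF {s : Finset V | s ⊆ A} A) := by
    refine ⟨fun _ => 0, fun _ => 0, PLOn.zero _, PLOn.zero _, fun _ _ => trivial, fun _ _ => ?_, ?_, ?_⟩
    · exact rz_zero (LkF.cx hS (by simp))
    · rintro c ⟨-, s, ⟨h1, h2⟩, h3⟩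
      have : s = ∅ := by
        rw [← disjoint_self_iff_empty]
        exact disjoint_of_subset_right (union_subset_left h2) h1
      subst this
      ext v; exact (h3 v (by simp)).symm
    · intro y _; exact Subsingleton.elim _ _
  have := sph_JL hS ha h0 (n := n) (by omega)
  have e : JL {s : Finset V | s ⊆ A} A = {s : Finset V | s ⊂ A} := by
    ext s; simp only [JL, Set.mem_ofPred_eq, Finset.ssubset_iff_subset_ne]
    constructor
    · rintro ⟨h1, h2⟩; exact ⟨union_subset_left h2, fun e => h1 e.ge⟩
    · rintro ⟨h1, h2⟩; exact ⟨fun h => h2 (h1.antisymm h), union_subset h1 le_rfl⟩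
  rwa [e] at this

end DV

section UT
variable {V : Type*} [Fintype V] [DecidableEq V]

/-- collapsibility, read backwards -/
inductive Coll (y : V) : Finset (Finset V) → Prop
  | base : Coll y {{y}}
  | step (K : Finset (Finset V)) (τ σ : Finset V) : Coll y K → τ.Nonempty → τ ⊂ σ → τ ∉ K → σ ∉ K →
      (∀ ρ, ρ ⊂ σ → ρ.Nonempty → ρ ≠ τ → ρ ∈ K) → (∀ ρ ∈ K, ∀ ρ', ρ' ⊆ ρ → ρ'.Nonempty → ρ' ∈ K) →
      Coll y (insert τ (insert σ K))

theorem sing_Dv {S : Set (Finset V)} {σ : Finset V} : {σ} ∈ Dv S ↔ σ ∈ S ∧ σ.Nonempty := by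
  simp [Dv]

theorem dv_cone {S : Set (Finset V)} {σ τ : Finset V} (hτ : τ ∈ S) (hτ' : τ.Nonempty) (hne : τ ≠ σ)
    (hcomp : τ ⊆ σ ∨ σ ⊆ τ) {B : Finset (Finset V)} (hτB : τ ∈ B)
    (h : ∀ ρ ∈ B, ρ ∈ S → ρ.Nonempty → ρ ≠ σ → (ρ ⊆ σ ∨ σ ⊆ ρ) → (ρ ⊆ τ ∨ τ ⊆ ρ)) :
    ConeOn (Lk (Dv S) σ) B τ := by
  refine ⟨hτB, fun s hs hsB => ?_⟩
  obtain ⟨h1, h2, h3⟩ := hs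
  have hσs : ∀ ρ ∈ s, ρ ⊆ τ ∨ τ ⊆ ρ := fun ρ hρ => h ρ (hsB hρ) (h2 ρ (by simp [hρ])).1 (h2 ρ (by simp [hρ])).2
    (fun e => h1 (e ▸ hρ)) (h3 ρ (by simp [hρ]) σ (by simp))
  have hall : ∀ ρ ∈ insert σ s, ρ ⊆ τ ∨ τ ⊆ ρ := by
    intro ρ hρ
    rcases mem_insert.1 hρ with rfl | hρ
    · exact hcomp.symm
    · exact hσs ρ hρ
  refine ⟨by simp [h1, hne.symm], ?_⟩
  rw [insert_comm]
  refine ⟨fun ρ hρ => ?_, fun ρ hρ ρ' hρ' => ?_⟩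
  · rcases mem_insert.1 hρ with rfl | hρ
    · exact ⟨hτ, hτ'⟩
    · exact h2 ρ hρ
  · rcases mem_insert.1 hρ with e | k <;> rcases mem_insert.1 hρ' with e' | k'
    · rw [e, e']; simp
    · rw [e]; exact (hall _ k').symm
    · rw [e']; exact hall _ k
    · exact h3 _ k _ k'

theorem U1 {n : ℕ} {S : Set (Finset V)} (hS : CX S) (hM : Mfd n S) {y : V} {K : Finset (Finset V)} (hK : Coll y K)
    (hKS : ∀ ρ ∈ K, ρ ∈ S) : Beta (Dv S) K := by
  induction hK with
  | base => exact beta_single (Dv.cx S) (sing_Dv.2 ⟨hKS _ (by simp), by simp⟩)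
  | step K τ σ hK hτ hτσ hτK hσK h1 h2 ih =>
    have hτS : τ ∈ S := hKS _ (by simp)
    have hσS : σ ∈ S := hKS _ (by simp)
    have hσn : σ.Nonempty := hτ.mono hτσ.1
    have ih := ih fun ρ hρ => hKS ρ (by simp [hρ])
    have hD := Dv.cx S
    have hMD := mfd_Dv hS hM
    refine add_mfd hD hMD (add_mfd hD hMD ih (sing_Dv.2 ⟨hσS, hσn⟩) hσK ⟨τ, Or.inr ?_⟩) (sing_Dv.2 ⟨hτS, hτ⟩) ?_ ⟨σ, Or.inl ?_⟩
    · refine dv_cone hτS hτ hτσ.ne (Or.inl hτσ.1) (by simpa using hτK) fun ρ hρ hρS hρn hne hc => ?_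
      simp only [mem_compl] at hρ
      rcases hc with hc | hc
      · by_cases e : ρ = τ
        · exact Or.inl e.le
        · exact (hρ (h1 ρ (Finset.ssubset_iff_subset_ne.2 ⟨hc, hne⟩) hρn e)).elim
      · exact Or.inr (hτσ.1.trans hc)
    · simp [hτK, hτσ.ne]
    · refine dv_cone hσS hσn hτσ.ne' (Or.inr hτσ.1) (by simp) fun ρ hρ hρS hρn hne hc => ?_
      rcases hc with hc | hc
      · exact Or.inl (hc.trans hτσ.1)
      · rcases mem_insert.1 hρ with rfl | hρ
        · exact Or.inl le_rfl
        · exact (hτK (h2 ρ hρ τ hc hτ)).elim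

theorem U2 {n : ℕ} {S : Set (Finset V)} (hS : CX S) (hM : Mfd n S) {A0 : Finset V} {K : Finset (Finset V)}
    (hK : ∀ ρ, ρ ∈ K ↔ ρ ∈ S ∧ ρ.Nonempty ∧ Disjoint ρ A0) (hb : Beta (Dv S) K) (T : Finset (Finset V))
    (hT : ∀ ρ, ρ ∈ T ↔ ρ ∈ S ∧ ¬ Disjoint ρ A0 ∧ ¬ ρ ⊆ A0) :
    Beta (Dv S) (K ∪ T) := by
  suffices h : ∀ N : ℕ, ∀ R : Finset (Finset V), R ⊆ T → (T \ R).card = N → Beta (Dv S) (K ∪ R) → Beta (Dv S) (K ∪ T) from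
    h _ ∅ (by simp) rfl (by simpa using hb)
  intro N
  induction N with
  | zero =>
    intro R hR hc hb
    have : T ⊆ R := sdiff_eq_empty_iff_subset.1 (card_eq_zero.1 hc)
    rwa [hR.antisymm this] at hb
  | succ N ih =>
    intro R hR hc hb
    obtain ⟨ρ, hρ, hmin⟩ := (T \ R).exists_min_image Finset.card (card_pos.1 (by omega))
    simp only [mem_sdiff] at hρ hmin
    obtain ⟨hρT, hρR⟩ := hρ
    obtain ⟨hρS, hρ1, hρ2⟩ := (hT ρ).1 hρT
    have hne : (ρ ∩ A0).Nonempty := by rwa [nonempty_iff_ne_empty, Ne, ← disjoint_iff_inter_eq_empty]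
    refine ih (insert ρ R) (insert_subset hρT hR) ?_ ?_
    · rw [sdiff_insert, card_erase_of_mem (by simp [hρT, hρR])]; omega
    · rw [union_insert]
      refine add_mfd (Dv.cx S) (mfd_Dv hS hM) hb (sing_Dv.2 ⟨hρS, hne.mono inter_subset_left⟩) ?_ ⟨ρ ∩ A0, Or.inr ?_⟩
      · simp only [mem_union, hρR, or_false, hK]; tauto
      · refine dv_cone (hS.down _ hρS _ inter_subset_left) hne ?_ (Or.inl inter_subset_left) ?_
          fun ρ' hρ' hρS' hρn' hne' hc' => ?_
        · intro e; exact hρ2 (inter_eq_left.1 e)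
        · simp only [mem_compl, mem_union, not_or]
          refine ⟨fun h => ?_, fun h => ((hT _).1 (hR h)).2.2 inter_subset_right⟩
          exact hne.ne_empty (disjoint_self_iff_empty _ |>.1 (disjoint_of_subset_right inter_subset_right ((hK _).1 h).2.2))
        · simp only [mem_compl, mem_union, not_or] at hρ'
          rcases hc' with h | h
          · left
            refine subset_inter h ?_
            by_contra h3
            have h4 : ¬ Disjoint ρ' A0 := fun h4 => hρ'.1 ((hK _).2 ⟨hρS', hρn', h4⟩)
            have := hmin ρ' ⟨(hT _).2 ⟨hρS', h4, h3⟩, hρ'.2⟩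
            exact hne' (eq_of_subset_of_card_le h this)
          · exact Or.inr (inter_subset_left.trans h)

theorem U3 {n : ℕ} {S : Set (Finset V)} (hS : CX S) (hM : Mfd n S) {A0 : Finset V} {x : V} (hx : ConeOn S A0 x)
    {K : Finset (Finset V)} (hK : ∀ ρ, ρ ∈ K ↔ ρ ∈ S ∧ ρ.Nonempty ∧ ¬ ρ ⊆ A0) (hb : Beta (Dv S) K) (T : Finset (Finset V))
    (hT : ∀ ρ, ρ ∈ T ↔ ρ ∈ S ∧ ρ.Nonempty ∧ ρ ⊆ A0 ∧ x ∉ ρ) :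
    Beta (Dv S) (K ∪ (T ∪ T.image (insert x))) := by
  suffices h : ∀ N : ℕ, ∀ R : Finset (Finset V), R ⊆ T → (∀ ρ1 ∈ R, ∀ ρ2 ∈ T, ρ1 ⊆ ρ2 → ρ2 ∈ R) →
      (T \ R).card = N → Beta (Dv S) (K ∪ (R ∪ R.image (insert x))) → Beta (Dv S) (K ∪ (T ∪ T.image (insert x))) from
    h _ ∅ (by simp) (by simp) rfl (by simpa using hb)
  intro N
  induction N with
  | zero =>
    intro R hR hup hc hb
    have : T ⊆ R := sdiff_eq_empty_iff_subset.1 (card_eq_zero.1 hc)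
    rwa [hR.antisymm this] at hb
  | succ N ih =>
    intro R hR hup hc hb
    obtain ⟨ρ, hρ, hmax⟩ := (T \ R).exists_max_image Finset.card (card_pos.1 (by omega))
    simp only [mem_sdiff] at hρ hmax
    obtain ⟨hρT, hρR⟩ := hρ
    obtain ⟨hρS, hρn, hρA, hxρ⟩ := (hT ρ).1 hρT
    have hins : insert x ρ ∈ S := hx.2 ρ hρS hρA
    have hiA : insert x ρ ⊆ A0 := insert_subset hx.1 hρA
    have hmax' : ∀ ρ' ∈ T, ρ ⊆ ρ' → ρ' ≠ ρ → ρ' ∈ R := by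
      intro ρ' h1 h2 h3
      by_contra h4
      exact h3 (eq_of_subset_of_card_le h2 (hmax ρ' ⟨h1, h4⟩)).symm
    have hinR : ∀ ρ', x ∉ ρ' → ρ' ∈ R ∪ R.image (insert x) → ρ' ∈ R := by
      intro ρ' h1 h2
      rcases mem_union.1 h2 with h | h
      · exact h
      · obtain ⟨r, hr, rfl⟩ := mem_image.1 h
        simp at h1
    have hinR' : ∀ ρ', x ∈ ρ' → ρ' ∈ R ∪ R.image (insert x) → ρ'.erase x ∈ R := by
      intro ρ' h1 h2
      rcases mem_union.1 h2 with h | h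
      · exact (((hT _).1 (hR h)).2.2.2 h1).elim
      · obtain ⟨r, hr, rfl⟩ := mem_image.1 h
        rwa [erase_insert ((hT _).1 (hR hr)).2.2.2]
    refine ih (insert ρ R) (insert_subset hρT hR) ?_ ?_ ?_
    · intro ρ1 h1 ρ2 h2 h3
      rcases mem_insert.1 h1 with rfl | h1
      · by_cases e : ρ2 = ρ1
        · simp [e]
        · exact mem_insert_of_mem (hmax' _ h2 h3 e)
      · exact mem_insert_of_mem (hup _ h1 _ h2 h3)
    · rw [sdiff_insert, card_erase_of_mem (by simp [hρT, hρR])]; omega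
    · have e : K ∪ (insert ρ R ∪ (insert ρ R).image (insert x)) =
          insert (insert x ρ) (insert ρ (K ∪ (R ∪ R.image (insert x)))) := by
        rw [image_insert]; ext z; simp only [mem_union, mem_insert]; tauto
      rw [e]
      have hD := Dv.cx S
      have hMD := mfd_Dv hS hM
      have hne : insert x ρ ≠ ρ := fun e => hxρ (e ▸ mem_insert_self x ρ)
      have hiK : insert x ρ ∉ K := fun h => ((hK _).1 h).2.2 hiA
      have hiR : insert x ρ ∉ R ∪ R.image (insert x) := fun h => by
        have := hinR' _ (by simp) h
        rw [erase_insert hxρ] at this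
        exact hρR this
      refine add_mfd hD hMD (add_mfd hD hMD hb (sing_Dv.2 ⟨hρS, hρn⟩) ?_ ⟨insert x ρ, Or.inr ?_⟩)
        (sing_Dv.2 ⟨hins, by simp⟩) ?_ ⟨ρ, Or.inl ?_⟩
      · intro h
        rcases mem_union.1 h with h | h
        · exact ((hK _).1 h).2.2 hρA
        · exact hρR (hinR ρ hxρ h)
      · refine dv_cone hins (by simp) hne (Or.inr (subset_insert _ _)) ?_ fun ρ' hρ' hρS' hρn' hne' hc' => ?_
        · simp only [mem_compl]
          intro h
          rcases mem_union.1 h with h | h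
          · exact hiK h
          · exact hiR h
        · rcases hc' with h | h
          · exact Or.inl (h.trans (subset_insert _ _))
          · rw [mem_compl, mem_union, not_or] at hρ'
            have hA : ρ' ⊆ A0 := by
              by_contra h3; exact hρ'.1 ((hK _).2 ⟨hρS', hρn', h3⟩)
            by_cases hxx : x ∈ ρ'
            · exact Or.inr (insert_subset hxx h)
            · exact (hρ'.2 (mem_union_left _ (hmax' _ ((hT _).2 ⟨hρS', hρn', hA, hxx⟩) h hne'))).elim
      · rw [mem_insert, mem_union]
        exact fun h => h.elim hne fun h => h.elim hiK hiR
      · refine dv_cone hρS hρn hne.symm (Or.inl (subset_insert _ _)) (by simp) fun ρ' hρ' hρS' hρn' hne' hc' => ?_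
        rcases hc' with h | h
        · rw [mem_insert, mem_union] at hρ'
          rcases hρ' with rfl | h1 | h1
          · exact Or.inl le_rfl
          · exact (((hK _).1 h1).2.2 (h.trans hiA)).elim
          · by_cases hxx : x ∈ ρ'
            · have := hup _ (hinR' _ hxx h1) ρ hρT (fun v hv => by
                rw [mem_erase] at hv
                exact mem_of_mem_insert_of_ne (h hv.2) hv.1)
              exact (hρR this).elim
            · left; intro v hv
              exact mem_of_mem_insert_of_ne (h hv) (fun e => hxx (e ▸ hv))
        · exact Or.inr ((subset_insert _ _).trans h)

theorem sph_end {n : ℕ} {S : Set (Finset V)} (hS : CX S) (hM : Mfd n S) {x : V} (hx : {x} ∈ S)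
    {A : Finset V} (hA : ∀ v, {v} ∈ S → (v ∈ A ↔ v ≠ x)) (hb : Beta S A) : Sph (n + 1) S := by
  have h1 : ∀ B : Finset V, (∀ b ∈ B, {b} ∉ S) → Beta S (A ∪ B) := by
    intro B
    induction B using Finset.induction_on with
    | empty => intro _; simpa using hb
    | insert b B _ ih =>
      intro h
      rw [union_insert]
      exact beta_congr (beta_sdiff (A := A) (h b (by simp)) hS) (ih fun b' hb' => h b' (by simp [hb']))
  classical
  have h2 := h1 (univ.filter fun b => {b} ∉ S) (by simp)
  have e : A ∪ (univ.filter fun b => {b} ∉ S) = {x}ᶜ := by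
    ext v
    simp only [mem_union, mem_filter, mem_univ, true_and, mem_compl, mem_singleton]
    by_cases hv : {v} ∈ S
    · simp [hA v hv, hv]
    · simp only [hv, not_false_eq_true, or_true, true_iff]
      rintro rfl; exact hv hx
  rw [e] at h2
  have h3 := beta_single hS hx
  unfold Beta at h2 h3
  rw [JA_compl] at h2
  obtain ⟨f, g, hfg, -⟩ := double h3 h2 (by
    rintro c ⟨⟨hc, h4⟩, -, h5⟩
    rw [compl_compl] at h5
    exact ⟨hc, le_antisymm h5 h4⟩) (Np_closed _ _) (Np_closed _ _) (JA_closed _ _)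
  have hu : Np S {x} ∪ Np S {x}ᶜ = rz S := by
    ext c; constructor
    · rintro (h | h); exacts [h.1, h.1]
    · intro h
      rcases le_total (mx {x} c) (mx {x}ᶜ c) with h' | h'
      · exact Or.inr ⟨h, by rwa [compl_compl]⟩
      · exact Or.inl ⟨h, h'⟩
  rw [hu] at hfg
  obtain ⟨f1, g1, h4⟩ := hM x hx
  have h5 := hfg.trans (((lk_ple hS hx).symm.trans h4).prod (PLE.refl (Set.univ : Set ℝ)))
  rw [Set.univ_prod_univ] at h5
  obtain ⟨f3, g3, h6⟩ := ple_rank (E := (Fin n → ℝ) × ℝ) (F := Fin (n + 1) → ℝ) (by simp)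
  exact ⟨_, _, h5.trans h6⟩

theorem U_thm {n : ℕ} {S : Set (Finset V)} (hS : CX S) (hM : Mfd n S) {A0 : Finset V} {x : V} (hx : ConeOn S A0 x)
    {y : V} {K : Finset (Finset V)} (hc : Coll y K) (hK : ∀ ρ, ρ ∈ K ↔ ρ ∈ S ∧ ρ.Nonempty ∧ Disjoint ρ A0) :
    Sph (n + 1) S := by
  classical
  have h1 := U1 hS hM hc fun ρ h => ((hK ρ).1 h).1
  have h2 := U2 hS hM hK h1 (univ.filter fun ρ => ρ ∈ S ∧ ¬ Disjoint ρ A0 ∧ ¬ ρ ⊆ A0) (by simp)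
  have h3 := U3 hS hM hx (fun ρ => by
    simp only [mem_union, hK, mem_filter, mem_univ, true_and]
    constructor
    · rintro (⟨h, h', h''⟩ | ⟨h, h', h''⟩)
      · refine ⟨h, h', fun h3 => h'.ne_empty ?_⟩
        exact (disjoint_self_iff_empty _).1 (disjoint_of_subset_right h3 h'')
      · refine ⟨h, ?_, h''⟩
        rw [nonempty_iff_ne_empty]; rintro rfl; simp at h''
    · tauto) h2 (univ.filter fun ρ => ρ ∈ S ∧ ρ.Nonempty ∧ ρ ⊆ A0 ∧ x ∉ ρ) (by simp)
  have hxS : {x} ∈ S := by simpa using hx.2 ∅ hS.emp (by simp)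
  obtain ⟨f, g, h4⟩ := sph_end (Dv.cx S) (mfd_Dv hS hM) (sing_Dv.2 ⟨hxS, by simp⟩) (fun ρ hρ => by
    rw [sing_Dv] at hρ
    simp only [mem_union, hK, mem_filter, mem_univ, true_and, mem_image]
    constructor
    · rintro ((⟨h, h', h''⟩ | ⟨h, h', h''⟩) | (⟨h, h', h'', h3⟩ | ⟨r, ⟨h, h', h'', h3⟩, h4⟩)) rfl
      · simp [hx.1] at h''
      · simp [hx.1] at h''
      · simp at h3
      · obtain ⟨v, hv⟩ := h'
        have : v ∈ ({x} : Finset V) := h4 ▸ mem_insert_of_mem hv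
        rw [mem_singleton] at this
        exact h3 (this ▸ hv)
    · intro hne
      by_cases h1 : Disjoint ρ A0
      · exact Or.inl (Or.inl ⟨hρ.1, hρ.2, h1⟩)
      by_cases h2 : ρ ⊆ A0
      · right
        by_cases h3 : x ∈ ρ
        · right
          refine ⟨ρ.erase x, ⟨hS.down _ hρ.1 _ (erase_subset _ _), ?_, (erase_subset _ _).trans h2, by simp⟩,
            insert_erase h3⟩
          rw [nonempty_iff_ne_empty]; intro e
          rw [erase_eq_empty_iff] at e
          rcases e with rfl | e
          · simp at h3
          · exact hne e
        · exact Or.inl ⟨hρ.1, hρ.2, h2, h3⟩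
      · exact Or.inl (Or.inr ⟨hρ.1, h1, h2⟩)) h3
  obtain ⟨f5, g5, h5⟩ := dv_ple hS
  exact ⟨_, _, h5.symm.trans h4⟩

end UT

section H1
variable {V W X : Type*} [Fintype V] [DecidableEq V] [Fintype W] [DecidableEq W] [Fintype X] [DecidableEq X]

abbrev C (V : Type*) := Finset V → ZMod 2

def sg (s : Finset V) : C V := Pi.single s 1

def On (K : Set (Finset V)) (c : C V) : Prop := ∀ s, c s ≠ 0 → s ∈ K

noncomputable def lin (F : Finset V → C W) : C V →ₗ[ZMod 2] C W := Fintype.linearCombination (ZMod 2) F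

theorem lin_sg (F : Finset V → C W) (s : Finset V) : lin F (sg s) = F s := by
  simp [lin, sg, Fintype.linearCombination_apply_single]

theorem c_eq (c : C V) : c = ∑ s, c s • sg s := by
  ext t
  simp [Finset.sum_apply, sg, Pi.single_apply]

theorem add_self_C (c : C V) : c + c = 0 := CharTwo.add_self_eq_zero c

theorem On.zero (K : Set (Finset V)) : On K (0 : C V) := fun s h => (h rfl).elim
theorem On.add {K : Set (Finset V)} {c c' : C V} (h : On K c) (h' : On K c') : On K (c + c') := by
  intro s hs
  by_cases h1 : c s = 0
  · exact h' s (by simpa [h1] using hs)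
  · exact h s h1
theorem On.smul {K : Set (Finset V)} {c : C V} (h : On K c) (r : ZMod 2) : On K (r • c) := by
  intro s hs
  refine h s fun h0 => hs (by simp [h0])
theorem On.sum {K : Set (Finset V)} {ι : Type*} {A : Finset ι} {f : ι → C V} (h : ∀ i ∈ A, On K (f i)) : On K (∑ i ∈ A, f i) := by
  classical
  induction A using Finset.induction_on with
  | empty => simpa using On.zero K
  | insert a A ha ih =>
    rw [sum_insert ha]
    exact (h a (by simp)).add (ih fun i hi => h i (by simp [hi]))
theorem On.mono {K K' : Set (Finset V)} (h : K ⊆ K') {c : C V} (hc : On K c) : On K' c := fun s hs => h (hc s hs)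
theorem On.sg {K : Set (Finset V)} {s : Finset V} (h : s ∈ K) : On K (sg s) := by
  intro t ht
  have : t = s := by by_contra h'; simp [HS.sg, Pi.single_apply, h'] at ht
  rwa [this]

theorem On.lmap {K : Set (Finset V)} {K' : Set (Finset W)} (L : C V →ₗ[ZMod 2] C W) (h : ∀ s ∈ K, On K' (L (HS.sg s)))
    {c : C V} (hc : On K c) : On K' (L c) := by
  rw [c_eq c, map_sum]
  refine On.sum fun s _ => ?_
  by_cases h0 : c s = 0
  · simp [h0, On.zero]
  · rw [map_smul]; exact (h s (hc s h0)).smul _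

theorem lmap_eq {K : Set (Finset V)} {L L' : C V →ₗ[ZMod 2] C W} (h : ∀ s ∈ K, L (sg s) = L' (sg s)) {c : C V}
    (hc : On K c) : L c = L' c := by
  rw [c_eq c, map_sum, map_sum]
  refine sum_congr rfl fun s _ => ?_
  by_cases h0 : c s = 0
  · simp [h0]
  · rw [map_smul, map_smul, h s (hc s h0)]

theorem On.all (c : C V) : On Set.univ c := fun _ _ => trivial
theorem lmap_ext {L L' : C V →ₗ[ZMod 2] C W} (h : ∀ s, L (sg s) = L' (sg s)) (c : C V) : L c = L' c :=
  lmap_eq (fun s _ => h s) (On.all c)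

noncomputable def bd : C V →ₗ[ZMod 2] C V := lin fun s => ∑ v ∈ s, sg (s.erase v)

theorem bd_sg (s : Finset V) : bd (sg s) = ∑ v ∈ s, sg (s.erase v) := lin_sg _ _

theorem bd_apply (c : C V) (t : Finset V) : bd c t = ∑ v ∈ tᶜ, c (insert v t) := by
  let L : C V →ₗ[ZMod 2] C V :=
    { toFun := fun c t => ∑ v ∈ tᶜ, c (insert v t)
      map_add' := fun c c' => by ext t; simp [sum_add_distrib]
      map_smul' := fun r c => by ext t; simp [mul_sum] }
  have : bd c = L c := by
    refine lmap_ext (fun s => ?_) c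
    rw [bd_sg]; ext t
    change _ = ∑ v ∈ tᶜ, sg s (insert v t)
    rw [Finset.sum_apply]
    simp only [sg, Pi.single_apply]
    rw [← sum_filter, ← sum_filter]
    refine sum_congr ?_ fun _ _ => rfl
    ext v; simp only [mem_filter, mem_compl]
    constructor
    · rintro ⟨h, rfl⟩; exact ⟨by simp, insert_erase h⟩
    · rintro ⟨h, rfl⟩; exact ⟨by simp, (erase_insert h).symm⟩
  rw [this]; rfl

theorem bd_on {K : Set (Finset V)} (hK : CX K) {c : C V} (h : On K c) : On K (bd c) := by
  refine On.lmap bd (fun s hs => ?_) h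
  rw [bd_sg]
  exact On.sum fun v _ => On.sg (hK.down s hs _ (erase_subset _ _))

open Classical in
noncomputable def psh (g : V → W) : C V →ₗ[ZMod 2] C W := lin fun s => if Set.InjOn g s then sg (s.image g) else 0

open Classical in
theorem psh_sg (g : V → W) (s : Finset V) : psh g (sg s) = if Set.InjOn g s then sg (s.image g) else 0 := lin_sg _ _

theorem psh_on {K : Set (Finset V)} {K' : Set (Finset W)} {g : V → W} (h : ∀ s ∈ K, s.image g ∈ K') {c : C V}
    (hc : On K c) : On K' (psh g c) := by
  refine On.lmap _ (fun s hs => ?_) hc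
  rw [psh_sg]; split_ifs
  · exact On.sg (h s hs)
  · exact On.zero _

theorem psh_bd (g : V → W) (c : C V) : psh g (bd c) = bd (psh g c) := by
  refine lmap_ext (L := psh g ∘ₗ bd) (L' := bd ∘ₗ psh g) (fun s => ?_) c
  simp only [LinearMap.comp_apply]
  rw [bd_sg, map_sum, psh_sg]
  by_cases h : Set.InjOn g s
  · rw [if_pos h, bd_sg, sum_image (fun a ha b hb e => h ha hb e)]
    refine sum_congr rfl fun v hv => ?_
    rw [psh_sg, if_pos (h.mono (by simp))]
    congr 1
    ext w; simp only [mem_image, mem_erase]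
    constructor
    · rintro ⟨a, ⟨h1, h2⟩, rfl⟩; exact ⟨fun e => h1 (h h2 hv e), a, h2, rfl⟩
    · rintro ⟨h1, a, h2, rfl⟩; exact ⟨a, ⟨fun e => h1 (by rw [e]), h2⟩, rfl⟩
  · rw [if_neg h, map_zero]
    have h' := h
    simp only [Set.InjOn, not_forall] at h
    obtain ⟨x, hx, y, hy, e, hne⟩ := h
    rw [mem_coe] at hx hy
    have hyx : y ∈ s.erase x := mem_erase.2 ⟨Ne.symm hne, hy⟩
    rw [← add_sum_erase _ _ hx, ← add_sum_erase _ _ hyx, sum_eq_zero, add_zero]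
    · have : psh g (sg (s.erase x)) = psh g (sg (s.erase y)) := by
        rw [psh_sg, psh_sg]
        have key : ∀ {x y}, x ∈ s → y ∈ s → g x = g y → x ≠ y → Set.InjOn g (s.erase x : Finset V) → Set.InjOn g (s.erase y : Finset V) := by
          intro x y hx hy e hne hi a ha b hb eab
          simp only [coe_erase, Set.mem_sdiff, mem_coe, Set.mem_singleton_iff] at ha hb
          have hi' : ∀ a b, a ∈ s → a ≠ x → b ∈ s → b ≠ x → g a = g b → a = b := fun a b h1 h2 h3 h4 h5 =>
            hi (by simp [h1, h2]) (by simp [h3, h4]) h5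
          by_cases hax : a = x
          · by_cases hbx : b = x
            · rw [hax, hbx]
            · exact (hb.2 (hi' b y hb.1 hbx hy hne.symm (by rw [← eab, hax, e]))).elim
          · by_cases hbx : b = x
            · exact (ha.2 (hi' a y ha.1 hax hy hne.symm (by rw [eab, hbx, e]))).elim
            · exact hi' a b ha.1 hax hb.1 hbx eab
        have himg : ∀ {x y}, x ∈ s → y ∈ s → g x = g y → x ≠ y → (s.erase x).image g ⊆ (s.erase y).image g := by
          intro x y hx hy e hne w hw
          simp only [mem_image, mem_erase] at hw ⊢
          obtain ⟨a, ⟨h1, h2⟩, rfl⟩ := hw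
          by_cases hay : a = y
          · exact ⟨x, ⟨hne, hx⟩, by rw [hay, e]⟩
          · exact ⟨a, ⟨hay, h2⟩, rfl⟩
        by_cases hi : Set.InjOn g (s.erase x : Finset V)
        · rw [if_pos hi, if_pos (key hx hy e hne hi), (himg hx hy e hne).antisymm (himg hy hx e.symm (Ne.symm hne))]
        · rw [if_neg hi, if_neg (fun h => hi (key hy hx e.symm (Ne.symm hne) h))]
      rw [this, add_self_C]
    · intro v hv
      simp only [mem_erase] at hv
      rw [psh_sg, if_neg]
      intro hi
      exact hne (hi (by simp [hx, Ne.symm hv.2.1]) (by simp [hy, Ne.symm hv.1]) e)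

def Zc (K : Set (Finset V)) (c : C V) : Prop := On K c ∧ bd c = 0
def Bc (K : Set (Finset V)) (c : C V) : Prop := ∃ e, On K e ∧ bd e = c
def Acy (K : Set (Finset V)) : Prop := ∀ c, Zc K c → Bc K c

theorem Bc.add {K : Set (Finset V)} {c c' : C V} (h : Bc K c) (h' : Bc K c') : Bc K (c + c') := by
  obtain ⟨e, h1, rfl⟩ := h
  obtain ⟨e', h1', rfl⟩ := h'
  exact ⟨e + e', h1.add h1', map_add _ _ _⟩
theorem Zc.add {K : Set (Finset V)} {c c' : C V} (h : Zc K c) (h' : Zc K c') : Zc K (c + c') :=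
  ⟨h.1.add h'.1, by rw [map_add, h.2, h'.2, add_zero]⟩
theorem Zc.mono {K K' : Set (Finset V)} (hK : K ⊆ K') {c : C V} (h : Zc K c) : Zc K' c := ⟨h.1.mono hK, h.2⟩

end H1

section H2
variable {V W X : Type*} [Fintype V] [DecidableEq V] [Fintype W] [DecidableEq W] [Fintype X] [DecidableEq X]

/-- cone operator -/
noncomputable def hh (v : V) : C V →ₗ[ZMod 2] C V := lin fun s => if v ∈ s then 0 else sg (insert v s)
/-- contraction operator -/
noncomputable def ee (v : V) : C V →ₗ[ZMod 2] C V := lin fun s => if v ∈ s then sg (s.erase v) else 0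

theorem hh_sg (v : V) (s : Finset V) : hh v (sg s) = if v ∈ s then 0 else sg (insert v s) := lin_sg _ _
theorem ee_sg (v : V) (s : Finset V) : ee v (sg s) = if v ∈ s then sg (s.erase v) else 0 := lin_sg _ _

theorem bd_hh (v : V) (c : C V) : bd (hh v c) = hh v (bd c) + c := by
  refine lmap_ext (L := bd ∘ₗ hh v) (L' := hh v ∘ₗ bd + LinearMap.id) (fun s => ?_) c
  simp only [LinearMap.comp_apply, LinearMap.add_apply, LinearMap.id_apply]
  rw [hh_sg, bd_sg, map_sum]
  by_cases h : v ∈ s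
  · rw [if_pos h, map_zero, ← add_sum_erase _ _ h, hh_sg, if_neg (by simp), insert_erase h,
      sum_eq_zero, add_zero, add_self_C]
    intro w hw
    rw [hh_sg, if_pos (by simp [h, (mem_erase.1 hw).1.symm])]
  · rw [if_neg h, bd_sg, sum_insert h, erase_insert h, add_comm]
    congr 1
    refine sum_congr rfl fun w hw => ?_
    have hwv : v ≠ w := fun e => h (e ▸ hw)
    rw [hh_sg, if_neg (by simp [h]), erase_insert_of_ne hwv]

theorem bd_ee (v : V) (c : C V) : bd (ee v c) = ee v (bd c) := by
  refine lmap_ext (L := bd ∘ₗ ee v) (L' := ee v ∘ₗ bd) (fun s => ?_) c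
  simp only [LinearMap.comp_apply]
  rw [ee_sg, bd_sg, map_sum]
  by_cases h : v ∈ s
  · rw [if_pos h, bd_sg, ← add_sum_erase _ _ h, ee_sg, if_neg (by simp), zero_add]
    refine sum_congr rfl fun w hw => ?_
    rw [ee_sg, if_pos (by simp [h, (mem_erase.1 hw).1.symm]), erase_right_comm]
  · rw [if_neg h, map_zero, sum_eq_zero]
    intro w hw
    rw [ee_sg, if_neg (by simp [h])]

theorem bd_bd (c : C V) : bd (bd c) = 0 := by
  refine lmap_ext (L := bd ∘ₗ bd) (L' := 0) (fun s => ?_) c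
  simp only [LinearMap.comp_apply, LinearMap.zero_apply]
  induction s using Finset.induction_on with
  | empty => simp [bd_sg]
  | insert v s hv ih =>
    have : sg (insert v s) = hh v (sg s) := by rw [hh_sg, if_neg hv]
    rw [this, bd_hh, map_add, bd_hh, ih, map_zero, zero_add, add_self_C]

/-- join with the boundary of a triangle, after contracting an edge -/
noncomputable def tri (x y z : V) : C V →ₗ[ZMod 2] C V :=
  (hh x ∘ₗ hh y + hh z ∘ₗ hh x + hh z ∘ₗ hh y) ∘ₗ (ee x ∘ₗ ee y)

theorem tri_bd (x y z : V) (c : C V) : bd (tri x y z c) = tri x y z (bd c) := by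
  simp only [tri, LinearMap.comp_apply, LinearMap.add_apply, map_add, bd_hh, bd_ee]
  generalize ee x (ee y c) = d
  generalize ee x (ee y (bd c)) = d'
  have h1 := add_self_C (hh x d)
  have h2 := add_self_C (hh y d)
  have h3 := add_self_C (hh z d)
  have : ∀ A B C' a b c' : C V, a + a = 0 → b + b = 0 → c' + c' = 0 →
    A + b + a + (B + a + c') + (C' + b + c') = A + B + C' := by
    intro A B C' a b c' h1 h2 h3
    calc _ = A + B + C' + (a + a) + (b + b) + (c' + c') := by abel
      _ = _ := by rw [h1, h2, h3]; abel
  convert this (hh x (hh y d')) (hh z (hh x d')) (hh z (hh y d')) (hh x d) (hh y d) (hh z d) h1 h2 h3 using 1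
  abel

/-- subdivision operator of an edge cut -/
noncomputable def sop (x y : W) : C W →ₗ[ZMod 2] C (Option W) :=
  (LinearMap.id + tri (some x) (some y) none) ∘ₗ psh some

theorem sop_bd (x y : W) (c : C W) : sop x y (bd c) = bd (sop x y c) := by
  simp only [sop, LinearMap.comp_apply, LinearMap.add_apply, LinearMap.id_apply, psh_bd, map_add, tri_bd]

noncomputable def gop (x : W) : C (Option W) →ₗ[ZMod 2] C W := psh fun o => o.getD x

noncomputable def Dop (x y : W) : C (Option W) →ₗ[ZMod 2] C (Option W) :=
  hh (some x) ∘ₗ hh none ∘ₗ ee none ∘ₗ ee (some y) ∘ₗ hh (some y)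

theorem sop_sg1 {x y : W} (hxy : x ≠ y) {s : Finset W} (h : ¬ (x ∈ s ∧ y ∈ s)) : sop x y (sg s) = sg (s.image some) := by
  simp only [sop, tri, LinearMap.comp_apply, LinearMap.add_apply, LinearMap.id_apply]
  rw [psh_sg, if_pos ((Option.some_injective _).injOn), ee_sg]
  by_cases hy : y ∈ s
  · have hx : x ∉ s := fun h' => h ⟨h', hy⟩
    rw [if_pos (by simp [hy]), ee_sg, if_neg (by simp [hx])]; simp
  · rw [if_neg (by simp [hy])]; simp

theorem sop_sg2 {x y : W} (hxy : x ≠ y) {s : Finset W} (hx : x ∈ s) (hy : y ∈ s) : sop x y (sg s) =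
    sg (insert none ((s.erase x).image some)) + sg (insert none ((s.erase y).image some)) := by
  simp only [sop, tri, LinearMap.comp_apply, LinearMap.add_apply, LinearMap.id_apply]
  rw [psh_sg, if_pos ((Option.some_injective _).injOn), ee_sg, if_pos (by simp [hy]), ee_sg, if_pos (by simp [hx, hxy]),
    hh_sg, if_neg (by simp), hh_sg, if_neg (by simp [hxy]), hh_sg, if_neg (by simp), hh_sg, if_neg (by simp), hh_sg,
    if_neg (by simp)]
  have e1 : insert (some x) (insert (some y) (((s.image some).erase (some y)).erase (some x))) = s.image some := by
    ext o; cases o <;> simp <;> grind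
  have e2 : insert none (insert (some x) (((s.image some).erase (some y)).erase (some x))) = insert none ((s.erase y).image some) := by
    ext o; cases o <;> simp <;> grind
  have e3 : insert none (insert (some y) (((s.image some).erase (some y)).erase (some x))) = insert none ((s.erase x).image some) := by
    ext o; cases o <;> simp <;> grind
  rw [e1, e2, e3, ← add_assoc, ← add_assoc, add_self_C, zero_add, add_comm]

theorem Dop_bd (x y : W) (c : C (Option W)) : bd (Dop x y c) + Dop x y (bd c) =
    hh none (ee none (ee (some y) (hh (some y) c))) + hh (some x) (ee none (ee (some y) (hh (some y) c)))
     + hh (some x) (hh none (ee none (ee (some y) c))) := by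
  simp only [Dop, LinearMap.comp_apply, bd_hh, bd_ee, map_add]
  generalize hh (some x) (hh none (ee none (ee (some y) (hh (some y) (bd c))))) = A
  generalize hh (some x) (hh none (ee none (ee (some y) c))) = B
  generalize hh (some x) (ee none (ee (some y) (hh (some y) c))) = D
  generalize hh none (ee none (ee (some y) (hh (some y) c))) = E
  calc _ = E + D + B + (A + A) := by abel
    _ = _ := by rw [add_self_C, add_zero]

theorem Dop_eq {x y : W} (hxy : x ≠ y) {t : Finset (Option W)} (ht : ¬ (some x ∈ t ∧ some y ∈ t)) :
    bd (Dop x y (sg t)) + Dop x y (bd (sg t)) = sop x y (gop x (sg t)) + sg t := by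
  rw [Dop_bd]
  have hxyo : some x ≠ some y := fun h => hxy (Option.some_injective _ h)
  have e0 : ee (some y) (hh (some y) (sg t)) = if some y ∈ t then 0 else sg t := by
    rw [hh_sg]; split_ifs with h
    · simp
    · rw [ee_sg, if_pos (by simp), erase_insert h]
  rw [e0, gop, psh_sg]
  by_cases hn : none ∈ t
  · by_cases hx : some x ∈ t
    · -- none, x ∈ t
      have hy : some y ∉ t := fun h => ht ⟨hx, h⟩
      rw [if_neg hy, if_neg, map_zero, zero_add, ee_sg, if_pos hn, hh_sg, if_neg (by simp), hh_sg, if_pos (by simp [hx]),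
        ee_sg, if_neg hy, insert_erase hn]
      · simp
      · intro h; have := h hn hx (by simp); simp at this
    · have hinj : Set.InjOn (fun o : Option W => o.getD x) t := by
        intro a ha b hb e
        cases a <;> cases b
        · rfl
        · simp at e; subst e; exact (hx hb).elim
        · simp at e; subst e; exact (hx ha).elim
        · simpa using e
      rw [if_pos hinj]
      by_cases hy : some y ∈ t
      · have hyi : y ∈ t.image (fun o : Option W => o.getD x) := mem_image.2 ⟨some y, hy, rfl⟩
        have hxi : x ∈ t.image (fun o : Option W => o.getD x) := mem_image.2 ⟨none, hn, rfl⟩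
        rw [if_pos hy, sop_sg2 hxy hxi hyi, ee_sg, if_pos hy, ee_sg, if_pos (by simp [hn]), hh_sg, if_neg (by simp), hh_sg,
          if_neg (by simp [hx])]
        have e1 : insert none ((((t.image fun o : Option W => o.getD x)).erase x).image some) = t := by
          ext o; cases o
          · simp [hn]
          · rename_i w; simp only [mem_insert, mem_image, mem_erase]
            constructor
            · rintro (h | ⟨a, ⟨h1, b, hb, e⟩, e'⟩)
              · simp at h
              · cases b with
                | none => exact (h1 e.symm).elim
                | some b => simp at e e'; rw [← e', ← e]; exact hb
            · intro h; exact Or.inr ⟨w, ⟨fun e => hx (e ▸ h), some w, h, rfl⟩, rfl⟩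
        have e2 : insert none ((((t.image fun o : Option W => o.getD x)).erase y).image some) =
           insert (some x) (insert none ((t.erase (some y)).erase none)) := by
          ext o; cases o
          · simp [hn]
          · rename_i w; simp only [mem_insert, mem_image, mem_erase]
            constructor
            · rintro (h | ⟨a, ⟨h1, b, hb, e⟩, e'⟩)
              · simp at h
              · cases b with
                | none => simp at e e'; left; rw [← e', ← e]
                | some b => simp at e e'; right; right; rw [← e', ← e]; refine ⟨by simp, ?_, hb⟩; intro h; simp at h; exact h1 (e ▸ h)
            · rintro (h | h | ⟨h1, h2, h3⟩)
              · simp at h; exact Or.inr ⟨w, ⟨h ▸ hxy, none, hn, h.symm⟩, rfl⟩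
              · simp at h
              · exact Or.inr ⟨w, ⟨by simpa using h2, some w, h3, rfl⟩, rfl⟩
        rw [e1, e2]
        simp only [map_zero, zero_add]
        rw [add_comm (sg t), add_assoc, add_self_C, add_zero]
      · rw [if_neg hy, sop_sg1 hxy, ee_sg, if_pos hn, hh_sg, if_neg (by simp), hh_sg, if_neg (by simp [hx]), ee_sg, if_neg hy,
          insert_erase hn]
        · have e1 : insert (some x) (t.erase none) = (t.image fun o : Option W => o.getD x).image some := by
            ext o; cases o
            · simp
            · rename_i w; simp only [mem_insert, mem_image, mem_erase]
              constructor
              · rintro (h | ⟨h1, h2⟩)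
                · simp at h; exact ⟨w, ⟨none, hn, h.symm⟩, rfl⟩
                · exact ⟨w, ⟨some w, h2, rfl⟩, rfl⟩
              · rintro ⟨a, ⟨b, hb, e⟩, e'⟩
                cases b with
                | none => simp at e e'; left; rw [← e', ← e]
                | some b => simp at e e'; right; rw [← e', ← e]; exact ⟨by simp, hb⟩
          rw [e1]; simp [add_comm]
        · rintro ⟨-, h⟩
          obtain ⟨b, hb, e⟩ := mem_image.1 h
          cases b with
          | none => exact hxy e
          | some b => simp at e; subst e; exact hy hb
  · have hinj : Set.InjOn (fun o : Option W => o.getD x) t := by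
      intro a ha b hb e
      cases a <;> cases b
      · rfl
      · exact (hn ha).elim
      · exact (hn hb).elim
      · simpa using e
    have him : ∀ w, w ∈ (t.image fun o : Option W => o.getD x) ↔ some w ∈ t := by
      intro w; rw [mem_image]; constructor
      · rintro ⟨b, hb, e⟩
        cases b with
        | none => exact (hn hb).elim
        | some b => simp at e; subst e; exact hb
      · intro h; exact ⟨_, h, rfl⟩
    rw [if_pos hinj, sop_sg1 hxy (by rw [him, him]; exact ht)]
    have e1 : (t.image fun o : Option W => o.getD x).image some = t := by
      ext o; cases o
      · simp [hn]
      · rw [mem_image]; constructor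
        · rintro ⟨a, ha, e⟩; rw [← e]; exact (him a).1 ha
        · intro h; exact ⟨_, (him _).2 h, rfl⟩
    rw [e1, add_self_C]
    have e2 : ∀ s : Finset (Option W), none ∉ s → ee none (sg s) = 0 := fun s hs => by rw [ee_sg, if_neg hs]
    have e3 : ee none (ee (some y) (sg t)) = 0 := by
      rw [ee_sg]; split_ifs
      · exact e2 _ (by simp [hn])
      · simp
    rw [e3]
    split_ifs
    · simp
    · rw [e2 _ hn]; simp

end H2

section H3
variable {V W X : Type*} [Fintype V] [DecidableEq V] [Fintype W] [DecidableEq W] [Fintype X] [DecidableEq X]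

/-- unit vectors -/
def eb (w : W) : W → ℝ := Pi.single w 1

theorem eb_mem {U : Set (Finset W)} {w : W} (h : {w} ∈ U) : eb w ∈ rz U := by
  refine ⟨fun v => ?_, {w}, h, fun v hv => ?_⟩
  · by_cases e : v = w
    · subst e; simp [eb]
    · simp [eb, Pi.single_apply, e]
  · simp [eb, Pi.single_apply, by simpa using hv]

theorem eb_fcone {s : Finset W} {w : W} (h : w ∈ s) : eb w ∈ fcone s := by
  refine ⟨fun v => ?_, fun v hv => ?_⟩
  · by_cases e : v = w
    · subst e; simp [eb]
    · simp [eb, Pi.single_apply, e]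
  · have : v ≠ w := fun e => hv (e ▸ h)
    simp [eb, Pi.single_apply, this]

theorem eb_ne (w : W) : eb w ≠ 0 := fun h => by
  have := congrFun h w; simp [eb] at this

theorem lin_eb {E : Type*} [AddCommGroup E] [Module ℝ E] (L : (W → ℝ) →ₗ[ℝ] E) (c : W → ℝ) : L c = ∑ w, c w • L (eb w) := by
  conv_lhs => rw [show c = ∑ w, c w • eb w by ext v; simp [eb, Finset.sum_apply, Pi.single_apply]]
  rw [map_sum]; simp

theorem fcone_lin {s : Finset W} {σ : Finset V} {L : (W → ℝ) →ₗ[ℝ] (V → ℝ)} (h : ∀ w ∈ s, L (eb w) ∈ fcone σ)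
    {c : W → ℝ} (hc : c ∈ fcone s) : L c ∈ fcone σ := by
  rw [lin_eb L c]
  refine ⟨fun v => ?_, fun v hv => ?_⟩
  · rw [Finset.sum_apply]
    refine sum_nonneg fun w _ => ?_
    by_cases hw : w ∈ s
    · exact mul_nonneg (hc.1 w) ((h w hw).1 v)
    · simp [hc.2 w hw]
  · rw [Finset.sum_apply]
    refine sum_eq_zero fun w _ => ?_
    by_cases hw : w ∈ s
    · simp [(h w hw).2 v hv]
    · simp [hc.2 w hw]

/-- subdivision data with chain operators -/
structure ES (S : Set (Finset V)) (U : Set (Finset W)) (φ : (W → ℝ) →ₗ[ℝ] (V → ℝ)) (s : C V →ₗ[ZMod 2] C W)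
    (g : C W →ₗ[ZMod 2] C V) : Prop where
  cx : CX U
  inj : Set.InjOn φ (rz U)
  img : φ '' rz U = rz S
  sbd : ∀ c, s (bd c) = bd (s c)
  ssup : ∀ σ ∈ S, On {τ | τ ∈ U ∧ τ.card = σ.card ∧ ∀ w ∈ τ, φ (eb w) ∈ fcone σ} (s (sg σ))
  s0 : s (sg ∅) = sg ∅
  gbd : ∀ c, g (bd c) = bd (g c)
  gon : ∀ c, On U c → On S (g c)
  gg : ∀ c, Zc U c → Bc U (s (g c) + c)

theorem ES.son {S : Set (Finset V)} {U : Set (Finset W)} {φ s g} (h : ES S U φ s g) {c : C V} (hc : On S c) : On U (s c) :=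
  On.lmap s (fun σ hσ => (h.ssup σ hσ).mono fun τ hτ => hτ.1) hc

theorem ES.refl {S : Set (Finset V)} (hS : CX S) : ES S S LinearMap.id LinearMap.id LinearMap.id where
  cx := hS
  inj := fun a _ b _ e => e
  img := by simp
  sbd := fun _ => rfl
  ssup := fun σ hσ => On.sg ⟨hσ, rfl, fun w hw => eb_fcone hw⟩
  s0 := rfl
  gbd := fun _ => rfl
  gon := fun _ h => h
  gg := fun c hc => ⟨0, On.zero _, by simp [add_self_C]⟩

theorem ES.trans {S : Set (Finset V)} {U : Set (Finset W)} {U' : Set (Finset X)} {φ s g φ' s' g'} (h : ES S U φ s g)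
    (h' : ES U U' φ' s' g') : ES S U' (φ ∘ₗ φ') (s' ∘ₗ s) (g ∘ₗ g') where
  cx := h'.cx
  inj := by
    intro a ha b hb e
    exact h'.inj ha hb (h.inj (h'.img ▸ ⟨a, ha, rfl⟩) (h'.img ▸ ⟨b, hb, rfl⟩) e)
  img := by
    rw [← h.img, ← h'.img, Set.image_image]; rfl
  sbd := fun c => by simp [h.sbd, h'.sbd]
  ssup := fun σ hσ => by
    refine On.lmap s' (fun τ hτ => ?_) (h.ssup σ hσ)
    refine (h'.ssup τ hτ.1).mono ?_
    rintro ρ ⟨h1, h2, h3⟩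
    exact ⟨h1, h2.trans hτ.2.1, fun w hw => fcone_lin hτ.2.2 (h3 w hw)⟩
  s0 := by simp [h.s0, h'.s0]
  gbd := fun c => by simp [h.gbd, h'.gbd]
  gon := fun c hc => h.gon _ (h'.gon _ hc)
  gg := fun c hc => by
    obtain ⟨e', h1, h2⟩ := h'.gg c hc
    obtain ⟨e, h3, h4⟩ := h.gg (g' c) ⟨h'.gon _ hc.1, by rw [← h'.gbd, hc.2, map_zero]⟩
    refine ⟨s' e + e', (h'.son h3).add h1, ?_⟩
    rw [map_add, ← h'.sbd, h4, h2, map_add, LinearMap.comp_apply, LinearMap.comp_apply, add_assoc, ← add_assoc (s' (g' c)),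
      add_self_C, zero_add]

/-- edge cut -/
def EC (U : Set (Finset W)) (x y : W) : Set (Finset (Option W)) :=
  {t | ¬ (some x ∈ t ∧ some y ∈ t) ∧ Finset.eraseNone t ∈ U ∧ (none ∈ t → insert x (insert y (Finset.eraseNone t)) ∈ U)}

noncomputable def cphi (x y : W) (p q : ℝ) : (Option W → ℝ) →ₗ[ℝ] (W → ℝ) where
  toFun c v := c (some v) + c none * ((if v = x then p else 0) + if v = y then q else 0)
  map_add' a b := by ext v; simp; ring
  map_smul' r a := by ext v; simp; ring

theorem cphi_apply (x y : W) (p q : ℝ) (c : Option W → ℝ) (v : W) : cphi x y p q c v =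
  c (some v) + c none * ((if v = x then p else 0) + if v = y then q else 0) := rfl

theorem cphi_x {x y : W} (h : x ≠ y) (p q : ℝ) (c : Option W → ℝ) : cphi x y p q c x = c (some x) + c none * p := by
  simp [cphi_apply, h]
theorem cphi_y {x y : W} (h : x ≠ y) (p q : ℝ) (c : Option W → ℝ) : cphi x y p q c y = c (some y) + c none * q := by
  simp [cphi_apply, h.symm]
theorem cphi_o {x y v : W} (hx : v ≠ x) (hy : v ≠ y) (p q : ℝ) (c : Option W → ℝ) : cphi x y p q c v = c (some v) := by
  simp [cphi_apply, hx, hy]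
theorem cphi_some (x y : W) (p q : ℝ) (w : W) : cphi x y p q (eb (some w)) = eb w := by
  ext v; rw [cphi_apply]; simp [eb, Pi.single_apply]
theorem cphi_none (x y : W) (p q : ℝ) : cphi x y p q (eb none) = p • eb x + q • eb y := by
  ext v; rw [cphi_apply]; simp [eb, Pi.single_apply]

theorem EC.cx {U : Set (Finset W)} (hU : CX U) (x y : W) : CX (EC U x y) := by
  refine ⟨⟨by simp, by simpa using hU.emp, by simp⟩, ?_⟩
  rintro t ⟨h1, h2, h3⟩ t' ht
  have : Finset.eraseNone t' ⊆ Finset.eraseNone t := fun v hv => by simp at hv ⊢; exact ht hv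
  exact ⟨fun h => h1 ⟨ht h.1, ht h.2⟩, hU.down _ h2 _ this, fun h => hU.down _ (h3 (ht h)) _
    (insert_subset_insert _ (insert_subset_insert _ this))⟩

theorem EC.inj {U : Set (Finset W)} {x y : W} (hxy : x ≠ y) {p q : ℝ} (hp : 0 < p) (hq : 0 < q) :
    Set.InjOn (cphi x y p q) (rz (EC U x y)) := by
  have key : ∀ c ∈ rz (EC U x y), c none = min (cphi x y p q c x / p) (cphi x y p q c y / q) := by
    rintro c ⟨h0, t, ⟨h1, -⟩, h2⟩
    rw [cphi_x hxy, cphi_y hxy, add_div, add_div, mul_div_cancel_right₀ _ hp.ne', mul_div_cancel_right₀ _ hq.ne']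
    have a1 := div_nonneg (h0 (some x)) hp.le
    have a2 := div_nonneg (h0 (some y)) hq.le
    by_cases hx : some x ∈ t
    · rw [h2 (some y) (fun h => h1 ⟨hx, h⟩), min_eq_right] <;> simp [a1]
    · rw [h2 (some x) hx, min_eq_left] <;> simp [a2]
  intro a ha b hb e
  have hn : a none = b none := by rw [key a ha, key b hb, e]
  ext o
  cases o with
  | none => exact hn
  | some v =>
    have := congrFun e v
    rw [cphi_apply, cphi_apply, hn] at this
    linarith

theorem EC.img {U : Set (Finset W)} (hU : CX U) {x y : W} (hxy : x ≠ y) (he : {x, y} ∈ U) {p q : ℝ} (hp : 0 < p) (hq : 0 < q) :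
    cphi x y p q '' (rz (EC U x y)) = rz U := by
  ext u; constructor
  · rintro ⟨c, ⟨h0, t, ⟨h1, h2, h3⟩, h4⟩, rfl⟩
    have hnn : ∀ v, 0 ≤ cphi x y p q c v := fun v => by
      rw [cphi_apply]
      have : 0 ≤ (if v = x then p else 0) + if v = y then q else 0 := by
        split_ifs <;> linarith
      have := mul_nonneg (h0 none) this
      linarith [h0 (some v)]
    by_cases hn : none ∈ t
    · refine ⟨hnn, _, h3 hn, fun v hv => ?_⟩
      simp only [mem_insert, mem_eraseNone, not_or] at hv
      rw [cphi_o hv.1 hv.2.1, h4 _ hv.2.2]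
    · refine ⟨hnn, _, h2, fun v hv => ?_⟩
      simp only [mem_eraseNone] at hv
      rw [cphi_apply, h4 _ hv, h4 _ hn]; simp
  · intro hu
    have hs := supp_of_rz hU hu
    obtain ⟨h0, -⟩ := hu
    set s := univ.filter fun v => u v ≠ 0 with hsd
    set m := min (u x / p) (u y / q) with hm
    have hm0 : 0 ≤ m := le_min (div_nonneg (h0 x) hp.le) (div_nonneg (h0 y) hq.le)
    have hmx : m * p ≤ u x := by rw [← le_div_iff₀ hp]; exact min_le_left _ _
    have hmy : m * q ≤ u y := by rw [← le_div_iff₀ hq]; exact min_le_right _ _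
    let c : Option W → ℝ := fun o => o.elim m fun v => u v - m * ((if v = x then p else 0) + if v = y then q else 0)
    have cn : c none = m := rfl
    have cs : ∀ v, c (some v) = u v - m * ((if v = x then p else 0) + if v = y then q else 0) := fun v => rfl
    have hcs : ∀ v, 0 ≤ c (some v) := fun v => by
      rw [cs]
      by_cases hx : v = x
      · subst hx; simp [hxy, hmx]
      · by_cases hy : v = y
        · subst hy; simp [hx, hmy]
        · simp [hx, hy, h0]
    refine ⟨c, rz_of_supp ?_ ⟨?_, ?_, ?_⟩, ?_⟩
    · intro o; cases o with
      | none => exact hm0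
      | some v => exact hcs v
    · simp only [mem_filter, mem_univ, true_and]
      rintro ⟨h1, h2⟩
      rw [cs] at h1 h2
      rcases le_total (u x / p) (u y / q) with h | h
      · apply h1; rw [hm, min_eq_left h]; simp [hxy]; field_simp; simp
      · apply h2; rw [hm, min_eq_right h]; simp [hxy.symm]; field_simp; simp
    · refine hU.down _ hs _ fun v hv => ?_
      simp only [mem_eraseNone, mem_filter, mem_univ, true_and] at hv
      have := (hcs v).lt_of_ne' hv
      rw [cs] at this
      simp only [hsd, mem_filter, mem_univ, true_and]
      have h2 : 0 ≤ m * ((if v = x then p else 0) + if v = y then q else 0) := mul_nonneg hm0 (by split_ifs <;> linarith)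
      linarith
    · intro hn
      simp only [mem_filter, mem_univ, true_and, cn] at hn
      have hmp := hm0.lt_of_ne' hn
      refine hU.down _ hs _ fun v hv => ?_
      simp only [mem_insert, mem_eraseNone, mem_filter, mem_univ, true_and] at hv
      simp only [hsd, mem_filter, mem_univ, true_and]
      rcases hv with rfl | rfl | hv
      · nlinarith
      · nlinarith
      · have := (hcs v).lt_of_ne' hv
        rw [cs] at this
        have h2 : 0 ≤ m * ((if v = x then p else 0) + if v = y then q else 0) := mul_nonneg hm0 (by split_ifs <;> linarith)
        linarith
    · ext v; rw [cphi_apply, cn, cs]; ring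

theorem EC.es {U : Set (Finset W)} (hU : CX U) {x y : W} (hxy : x ≠ y) (he : {x, y} ∈ U) {p q : ℝ} (hp : 0 < p) (hq : 0 < q) :
    ES U (EC U x y) (cphi x y p q) (sop x y) (gop x) where
  cx := EC.cx hU x y
  inj := EC.inj hxy hp hq
  img := EC.img hU hxy he hp hq
  sbd := sop_bd x y
  ssup := by
    intro σ hσ
    by_cases h : x ∈ σ ∧ y ∈ σ
    · have key : ∀ z, z = x ∨ z = y → On {τ | τ ∈ EC U x y ∧ τ.card = σ.card ∧ ∀ w ∈ τ, cphi x y p q (eb w) ∈ fcone σ}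
          (sg (insert none ((σ.erase z).image some))) := by
        intro z hz
        have hzs : z ∈ σ := by rcases hz with rfl | rfl; exacts [h.1, h.2]
        have e1 : Finset.eraseNone (insert none ((σ.erase z).image some)) = σ.erase z := by ext v; simp
        refine On.sg ⟨⟨?_, ?_, ?_⟩, ?_, ?_⟩
        · rintro ⟨h1, h2⟩; simp at h1 h2; rcases hz with rfl | rfl; exacts [h1.1 rfl, h2.1 rfl]
        · rw [e1]; exact hU.down _ hσ _ (erase_subset _ _)
        · intro _; rw [e1]; refine hU.down _ hσ _ ?_
          exact insert_subset h.1 (insert_subset h.2 (erase_subset _ _))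
        · rw [card_insert_of_notMem (by simp), card_image_of_injective _ (Option.some_injective _),
            card_erase_add_one hzs]
        · intro w hw
          cases w with
          | none =>
            rw [cphi_none]
            have a := eb_fcone h.1
            have b := eb_fcone h.2
            refine ⟨fun v => ?_, fun v hv => ?_⟩
            · exact add_nonneg (mul_nonneg hp.le (a.1 v)) (mul_nonneg hq.le (b.1 v))
            · simp [a.2 v hv, b.2 v hv]
          | some w =>
            rw [cphi_some]; simp at hw; exact eb_fcone hw.2
      rw [sop_sg2 hxy h.1 h.2]
      exact (key x (Or.inl rfl)).add (key y (Or.inr rfl))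
    · rw [sop_sg1 hxy h]
      have e1 : Finset.eraseNone (σ.image some) = σ := by ext v; simp
      refine On.sg ⟨⟨by simpa using h, by rwa [e1], by simp⟩, card_image_of_injective _ (Option.some_injective _), ?_⟩
      intro w hw
      obtain ⟨v, hv, rfl⟩ := mem_image.1 hw
      rw [cphi_some]; exact eb_fcone hv
  s0 := by rw [sop_sg1 hxy (by simp)]; simp
  gbd := psh_bd _
  gon := by
    intro c hc
    refine psh_on (K := EC U x y) ?_ hc
    rintro t ⟨h1, h2, h3⟩
    by_cases hn : none ∈ t
    · refine hU.down _ (h3 hn) _ fun v hv => ?_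
      obtain ⟨o, ho, e⟩ := mem_image.1 hv
      cases o with
      | none => simp at e; simp [e]
      | some w => simp at e; subst e; simp [ho]
    · refine hU.down _ h2 _ fun v hv => ?_
      obtain ⟨o, ho, e⟩ := mem_image.1 hv
      cases o with
      | none => exact (hn ho).elim
      | some w => simp at e; subst e; simp [ho]
  gg := by
    intro c hc
    refine ⟨Dop x y c, ?_, ?_⟩
    · refine On.lmap _ (fun t ht => ?_) hc.1
      have hxyo : some x ≠ some y := fun h => hxy (Option.some_injective _ h)
      simp only [Dop, LinearMap.comp_apply]
      rw [hh_sg]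
      by_cases hy : some y ∈ t
      · simp [hy, On.zero]
      rw [if_neg hy, ee_sg, if_pos (by simp), erase_insert hy, ee_sg]
      by_cases hn : none ∈ t
      · rw [if_pos hn, hh_sg, if_neg (by simp), insert_erase hn, hh_sg]
        by_cases hx : some x ∈ t
        · simp [hx, On.zero]
        · rw [if_neg hx]
          have h3 := ht.2.2 hn
          have e1 : Finset.eraseNone (insert (some x) t) = insert x (Finset.eraseNone t) := by ext v; simp
          refine On.sg ⟨by simp [hy, hxy.symm], ?_, fun _ => ?_⟩
          · rw [e1]; refine hU.down _ h3 _ (insert_subset_insert _ (subset_insert _ _))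
          · rw [e1]; refine hU.down _ h3 _ ?_
            intro v; simp; tauto
      · rw [if_neg hn]; simp [On.zero]
    · have := lmap_eq (L := bd ∘ₗ Dop x y + Dop x y ∘ₗ bd) (L' := sop x y ∘ₗ gop x + LinearMap.id)
        (fun t (ht : t ∈ EC U x y) => Dop_eq hxy ht.1) hc.1
      simpa [hc.2] using this

end H3

/-- bundled subdivision -/
structure SD {V : Type} [Fintype V] [DecidableEq V] (S : Set (Finset V)) where
  W : Type
  ft : Fintype W
  de : DecidableEq W
  U : Set (Finset W)
  φ : (W → ℝ) →ₗ[ℝ] (V → ℝ)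
  s : C V →ₗ[ZMod 2] C W
  g : C W →ₗ[ZMod 2] C V
  es : ES S U φ s g

attribute [instance] SD.ft SD.de

section H4
variable {V X : Type} [Fintype V] [DecidableEq V] [Fintype X] [DecidableEq X]

def NoCross {S : Set (Finset V)} (D : SD S) (a : (V → ℝ) →ₗ[ℝ] ℝ) : Prop :=
  ∀ v w : D.W, {v, w} ∈ D.U → ¬ (a (D.φ (eb v)) < 0 ∧ 0 < a (D.φ (eb w)))

open Classical in
noncomputable def crs {S : Set (Finset V)} (D : SD S) (a : (V → ℝ) →ₗ[ℝ] ℝ) : Finset (D.W × D.W) :=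
  univ.filter fun p => {p.1, p.2} ∈ D.U ∧ a (D.φ (eb p.1)) < 0 ∧ 0 < a (D.φ (eb p.2))

theorem nocross1 {S : Set (Finset V)} (a : (V → ℝ) →ₗ[ℝ] ℝ) : ∀ (n : ℕ) (D : SD S), (crs D a).card = n →
    ∃ D' : SD S, NoCross D' a ∧ ∀ b, NoCross D b → NoCross D' b := by
  intro n
  induction n using Nat.strong_induction_on with
  | _ n ih =>
  intro D hD
  by_cases hN : NoCross D a
  · exact ⟨D, hN, fun b hb => hb⟩
  simp only [NoCross, not_forall, not_not] at hN
  obtain ⟨x, y, he, hx, hy⟩ := hN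
  have hxy : x ≠ y := fun e => by rw [e] at hx; linarith
  set p := a (D.φ (eb y)) with hp
  set q := - a (D.φ (eb x)) with hq
  have hq0 : 0 < q := by simp [hq, hx]
  have es' := D.es.trans (EC.es D.es.cx hxy he hy hq0)
  let D1 : SD S := ⟨Option D.W, inferInstance, inferInstance, EC D.U x y, _, _, _, es'⟩
  have fs : ∀ w : D.W, D1.φ (eb (some w : Option D.W)) = D.φ (eb w) := fun w => by
    change D.φ (cphi x y p q (eb (some w))) = _; rw [cphi_some]
  have fn : D1.φ (eb (none : Option D.W)) = p • D.φ (eb x) + q • D.φ (eb y) := by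
    change D.φ (cphi x y p q (eb none)) = _; rw [cphi_none, map_add, map_smul, map_smul]
  have an : a (D1.φ (eb (none : Option D.W))) = 0 := by
    rw [fn, map_add, map_smul, map_smul, ← hp, smul_eq_mul, smul_eq_mul, hq]; ring
  have hpair : ∀ v w : D.W, ({some v, some w} : Finset (Option D.W)) ∈ EC D.U x y → {v, w} ∈ D.U := by
    rintro v w ⟨-, h, -⟩
    have : Finset.eraseNone ({some v, some w} : Finset (Option D.W)) = {v, w} := by ext; simp
    rwa [this] at h
  have hlt : (crs D1 a).card < n := by
    rw [← hD]
    refine lt_of_lt_of_le (b := ((crs D a).erase (x, y)).card + 1) ?_ ?_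
    · rw [Nat.lt_succ_iff]
      have : crs D1 a ⊆ ((crs D a).erase (x, y)).image fun p => ((some p.1, some p.2) : Option D.W × Option D.W) := by
        rintro ⟨v, w⟩ h
        simp only [crs, mem_filter, mem_univ, true_and] at h
        obtain ⟨h1, h2, h3⟩ := h
        change Option D.W at v; change Option D.W at w
        cases v with
        | none => rw [an] at h2; exact (lt_irrefl _ h2).elim
        | some v =>
          cases w with
          | none => rw [an] at h3; exact (lt_irrefl _ h3).elim
          | some w =>
            rw [fs] at h2 h3
            refine mem_image.2 ⟨(v, w), ?_, rfl⟩
            simp only [crs, mem_erase, mem_filter, mem_univ, true_and]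
            refine ⟨?_, hpair v w h1, h2, h3⟩
            rintro e; simp only [Prod.mk.injEq] at e
            obtain ⟨rfl, rfl⟩ := e
            exact h1.1 ⟨mem_insert_self _ _, mem_insert_of_mem (mem_singleton_self _)⟩
      exact (card_le_card this).trans card_image_le
    · rw [card_erase_add_one]
      simp only [crs, mem_filter, mem_univ, true_and]
      exact ⟨he, hx, hy⟩
  obtain ⟨D', h1, h2⟩ := ih _ hlt D1 rfl
  refine ⟨D', h1, fun b hb => h2 b ?_⟩
  have htri : ∀ t : Finset (Option D.W), t ∈ EC D.U x y → none ∈ t → ∀ w, some w ∈ t → {x, w} ∈ D.U ∧ {y, w} ∈ D.U := by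
    rintro t ⟨-, -, h⟩ hn w hw
    have h := h hn
    constructor <;> refine D.es.cx.down _ h _ ?_ <;> intro v <;> simp <;> rintro (rfl | rfl) <;> simp [hw]
  intro v w hvw
  change Option D.W at v; change Option D.W at w
  have hvw : ({v, w} : Finset (Option D.W)) ∈ EC D.U x y := hvw
  have bn : b (D1.φ (eb (none : Option D.W))) = p * b (D.φ (eb x)) + q * b (D.φ (eb y)) := by
    rw [fn, map_add, map_smul, map_smul, smul_eq_mul, smul_eq_mul]
  rintro ⟨b1, b2⟩
  cases v with
  | none =>
    cases w with
    | none => linarith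
    | some w =>
      obtain ⟨c1, c2⟩ := htri _ hvw (by simp) w (by simp)
      rw [fs] at b2; rw [bn] at b1
      have d1 := hb x w c1
      have d2 := hb y w c2
      have d1 : 0 ≤ b (D.φ (eb x)) := by by_contra h; exact d1 ⟨not_le.1 h, b2⟩
      have d2 : 0 ≤ b (D.φ (eb y)) := by by_contra h; exact d2 ⟨not_le.1 h, b2⟩
      have := mul_nonneg hy.le d1
      have := mul_nonneg hq0.le d2
      linarith
  | some v =>
    cases w with
    | none =>
      obtain ⟨c1, c2⟩ := htri _ hvw (by simp) v (by simp)
      rw [fs] at b1; rw [bn] at b2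
      have d1 := hb v x (by rwa [pair_comm])
      have d2 := hb v y (by rwa [pair_comm])
      have d1 : b (D.φ (eb x)) ≤ 0 := by by_contra h; exact d1 ⟨b1, not_le.1 h⟩
      have d2 : b (D.φ (eb y)) ≤ 0 := by by_contra h; exact d2 ⟨b1, not_le.1 h⟩
      have := mul_nonneg hy.le (neg_nonneg.2 d1)
      have := mul_nonneg hq0.le (neg_nonneg.2 d2)
      linarith
    | some w => rw [fs] at b1 b2; exact hb v w (hpair v w hvw) ⟨b1, b2⟩

theorem nocross_all {S : Set (Finset V)} (hS : CX S) {A : Set ((V → ℝ) →ₗ[ℝ] ℝ)} (hA : A.Finite) :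
    ∃ D : SD S, ∀ a ∈ A, NoCross D a := by
  induction A, hA using Set.Finite.induction_on with
  | empty => exact ⟨⟨V, inferInstance, inferInstance, S, _, _, _, ES.refl hS⟩, by simp⟩
  | @insert a A _ _ ih =>
    obtain ⟨D, hD⟩ := ih
    obtain ⟨D', h1, h2⟩ := nocross1 a _ D rfl
    refine ⟨D', ?_⟩
    rintro b (rfl | hb)
    · exact h1
    · exact h2 b (hD b hb)

theorem nc_zero {S : Set (Finset V)} {D : SD S} {a : (V → ℝ) →ₗ[ℝ] ℝ} (h : NoCross D a) {s : Finset D.W} (hs : s ∈ D.U)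
    {c : D.W → ℝ} (hc : ∀ w ∈ s, 0 < c w) (hc' : ∀ w, w ∉ s → c w = 0) (h0 : a (D.φ c) = 0) {c' : D.W → ℝ} (hc1 : ∀ w, w ∉ s → c' w = 0) :
    a (D.φ c') = 0 := by
  have key : ∀ w ∈ s, a (D.φ (eb w)) = 0 := by
    rw [lin_eb D.φ c, map_sum] at h0
    simp only [map_smul, smul_eq_mul] at h0
    rw [← sum_subset (subset_univ s) (fun w _ hw => by rw [hc' w hw, zero_mul])] at h0
    have hp : ∀ v ∈ s, ∀ w ∈ s, {v, w} ∈ D.U := fun v hv w hw => D.es.cx.down _ hs _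
      (insert_subset hv (singleton_subset_iff.2 hw))
    by_cases hneg : ∃ v ∈ s, a (D.φ (eb v)) < 0
    · obtain ⟨v, hv, hv0⟩ := hneg
      have hle : ∀ w ∈ s, a (D.φ (eb w)) ≤ 0 := fun w hw => by
        by_contra h'; exact h v w (hp v hv w hw) ⟨hv0, not_le.1 h'⟩
      have := (sum_eq_zero_iff_of_nonpos (fun w hw => mul_nonpos_of_nonneg_of_nonpos (hc w hw).le (hle w hw))).1 h0
      intro w hw
      exact (mul_eq_zero.1 (this w hw)).resolve_left (hc w hw).ne'
    · push Not at hneg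
      have := (sum_eq_zero_iff_of_nonneg (fun w hw => mul_nonneg (hc w hw).le (hneg w hw))).1 h0
      intro w hw
      exact (mul_eq_zero.1 (this w hw)).resolve_left (hc w hw).ne'
  rw [lin_eb D.φ c', map_sum]
  refine sum_eq_zero fun w _ => ?_
  by_cases hw : w ∈ s
  · rw [map_smul, key w hw, smul_zero]
  · rw [hc1 w hw, zero_smul, map_zero]

/-- linearizing a PL map by subdivision -/
theorem linz {S : Set (Finset V)} (hS : CX S) {f : (V → ℝ) → (X → ℝ)} (hf : PLOn (rz S) f) :
    ∃ (D : SD S) (ψ : (D.W → ℝ) →ₗ[ℝ] (X → ℝ)), ∀ c ∈ rz D.U, f (D.φ c) = ψ c := by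
  obtain ⟨hcont, P, hP, hfP⟩ := hf
  obtain ⟨D, hD⟩ := nocross_all hS (A := (fun q : ((V → ℝ) →L[ℝ] (X → ℝ)) × ((V → ℝ) →L[ℝ] (X → ℝ)) × X =>
      (LinearMap.proj q.2.2 ∘ₗ (q.1 - q.2.1 : (V → ℝ) →L[ℝ] (X → ℝ)).toLinearMap : (V → ℝ) →ₗ[ℝ] ℝ)) '' (P ×ˢ P ×ˢ Set.univ))
    ((hP.prod (hP.prod Set.finite_univ)).image _)
  have hD : ∀ A ∈ P, ∀ B ∈ P, ∀ k, NoCross D (LinearMap.proj k ∘ₗ (A - B : (V → ℝ) →L[ℝ] (X → ℝ)).toLinearMap) :=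
    fun A hA B hB k => hD _ ⟨(A, B, k), ⟨hA, hB, trivial⟩, rfl⟩
  have hmem : ∀ c ∈ rz D.U, D.φ c ∈ rz S := fun c hc => D.es.img ▸ ⟨c, hc, rfl⟩
  have hface : ∀ s ∈ D.U, ∃ A ∈ P, ∀ c ∈ fcone s, f (D.φ c) = A (D.φ c) := by
    intro s hs
    have hsub : fcone s ⊆ rz D.U := fun c hc => mem_rz_iff.2 ⟨s, hs, hc⟩
    have hφ : Continuous D.φ := D.φ.continuous_of_finiteDimensional
    have hc1 : ContinuousOn (fun c => f (D.φ c)) (fcone s) := hcont.comp hφ.continuousOn fun c hc => hmem c (hsub hc)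
    let Q : ((V → ℝ) →L[ℝ] (X → ℝ)) → Set (D.W → ℝ) := fun A => {c | c ∈ fcone s ∧ f (D.φ c) = A (D.φ c)}
    have hQ : ∀ A, IsClosed (Q A) := fun A => by
      have h2 : ContinuousOn (fun c => f (D.φ c) - A (D.φ c)) (fcone s) := hc1.sub (A.continuous.comp hφ).continuousOn
      have := h2.preimage_isClosed_of_isClosed (fcone_closed s) (isClosed_singleton (x := (0 : X → ℝ)))
      convert this using 1
      ext c; simp [Q, sub_eq_zero]
    let O : Set (D.W → ℝ) := {c | (∀ w ∈ s, 0 < c w) ∧ ∀ w, w ∉ s → c w = 0}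
    have hO : O ⊆ fcone s := fun c hc => ⟨fun v => by
      by_cases hv : v ∈ s
      · exact (hc.1 v hv).le
      · exact (hc.2 v hv).ge, hc.2⟩
    have hOc : Convex ℝ O := by
      intro a ha b hb r t hr ht hrt
      refine ⟨fun w hw => ?_, fun w hw => by simp [ha.2 w hw, hb.2 w hw]⟩
      have h1 := ha.1 w hw
      have h2 := hb.1 w hw
      simp only [Pi.add_apply, Pi.smul_apply, smul_eq_mul]
      rcases hr.eq_or_lt with h | h
      · have : t = 1 := by linarith
        rw [← h, this]; simpa using h2
      · have := mul_pos h h1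
        have := mul_nonneg ht h2.le
        linarith
    let c0 : D.W → ℝ := fun w => if w ∈ s then 1 else 0
    have hc0 : c0 ∈ O := ⟨fun w hw => by simp [c0, hw], fun w hw => by simp [c0, hw]⟩
    obtain ⟨A, hA, hA0⟩ := hfP _ (hmem _ (hsub (hO hc0)))
    have heq : ∀ B ∈ P, ∀ c ∈ O, f (D.φ c) = A (D.φ c) → f (D.φ c) = B (D.φ c) → ∀ c' ∈ fcone s, A (D.φ c') = B (D.φ c') := by
      intro B hB c hc h1 h2 c' hc'
      ext k
      have := nc_zero (hD A hA B hB k) hs hc.1 hc.2 (by simp [← h1, ← h2]) hc'.2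
      simpa [sub_eq_zero] using this
    have hOA : O ⊆ Q A := by
      by_contra hne
      obtain ⟨c, hc, hcn⟩ := Set.not_subset.1 hne
      have hpre := isPreconnected_closed_iff.1 hOc.isPreconnected (Q A) (⋃ B ∈ {B ∈ P | ∃ c' ∈ fcone s, A (D.φ c') ≠ B (D.φ c')}, Q B) (hQ A)
        ((hP.subset fun B hB => hB.1).isClosed_biUnion fun B _ => hQ B) ?_ ⟨c0, hc0, hO hc0, hA0⟩ ?_
      · obtain ⟨e, heO, h1, h2⟩ := hpre
        simp only [Set.mem_iUnion] at h2
        obtain ⟨B, hB, h2⟩ := h2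
        obtain ⟨c', hc', hn⟩ := hB.2
        exact hn (heq B hB.1 e heO h1.2 h2.2 c' hc')
      · intro e he
        obtain ⟨B, hB, h⟩ := hfP _ (hmem _ (hsub (hO he)))
        by_cases h' : ∃ c' ∈ fcone s, A (D.φ c') ≠ B (D.φ c')
        · right; exact Set.mem_biUnion (show B ∈ {B ∈ P | ∃ c' ∈ fcone s, A (D.φ c') ≠ B (D.φ c')} from ⟨hB, h'⟩) ⟨hO he, h⟩
        · push Not at h'
          left; exact ⟨hO he, by rw [h, h' e (hO he)]⟩
      · obtain ⟨B, hB, h⟩ := hfP _ (hmem _ (hsub (hO hc)))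
        refine ⟨c, hc, Set.mem_biUnion (show B ∈ {B ∈ P | ∃ c' ∈ fcone s, A (D.φ c') ≠ B (D.φ c')} from ⟨hB, c, hO hc, fun h' => hcn ⟨hO hc, ?_⟩⟩) ⟨hO hc, h⟩⟩
        rw [h, h']
    refine ⟨A, hA, fun c hc => ?_⟩
    have : c ∈ closure O := by
      have ht : Filter.Tendsto (fun r : ℝ => c + r • c0) (nhdsWithin 0 (Set.Ioi 0)) (nhds (c + (0:ℝ) • c0)) :=
        ((continuous_const.add (continuous_id.smul continuous_const)).tendsto 0).mono_left nhdsWithin_le_nhds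
      rw [zero_smul, add_zero] at ht
      refine mem_closure_of_tendsto ht ?_
      filter_upwards [self_mem_nhdsWithin] with r hr
      have hr : 0 < r := hr
      refine ⟨fun w hw => ?_, fun w hw => ?_⟩
      · simp [c0, hw]; linarith [hc.1 w]
      · simp [c0, hw, hc.2 w hw]
    exact ((hQ A).closure_subset_iff.2 hOA this).2
  let ψ : (D.W → ℝ) →ₗ[ℝ] (X → ℝ) := Fintype.linearCombination ℝ fun w => f (D.φ (eb w))
  refine ⟨D, ψ, fun c hc => ?_⟩
  obtain ⟨s, hs, hc⟩ := mem_rz_iff.1 hc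
  obtain ⟨A, hA, h⟩ := hface s hs
  rw [h c hc, show A (D.φ c) = (A.toLinearMap ∘ₗ D.φ) c from rfl, lin_eb (A.toLinearMap ∘ₗ D.φ) c]
  simp only [ψ, Fintype.linearCombination_apply]
  refine sum_congr rfl fun w _ => ?_
  by_cases hw : w ∈ s
  · rw [h _ (eb_fcone hw)]; rfl
  · rw [hc.2 w hw, zero_smul, zero_smul]

end H4

section H5
variable {V X : Type} [Fintype V] [DecidableEq V] [Fintype X] [DecidableEq X]

/-- common subdivision -/
theorem common {S : Set (Finset V)} {T : Set (Finset X)} (hS : CX S) {f g} (h : PLE (rz S) (rz T) f g) :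
    ∃ (D : SD S) (ψ : (D.W → ℝ) →ₗ[ℝ] (X → ℝ)), Set.InjOn ψ (rz D.U) ∧ ψ '' rz D.U = rz T ∧
      ∀ c ∈ rz D.U, f (D.φ c) = ψ c := by
  obtain ⟨D, ψ, hψ⟩ := linz hS h.pf
  have hmem : ∀ c ∈ rz D.U, D.φ c ∈ rz S := fun c hc => D.es.img ▸ ⟨c, hc, rfl⟩
  refine ⟨D, ψ, ?_, ?_, hψ⟩
  · intro a ha b hb e
    rw [← hψ a ha, ← hψ b hb] at e
    apply D.es.inj ha hb
    rw [← h.gf _ (hmem a ha), ← h.gf _ (hmem b hb), e]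
  · ext y; constructor
    · rintro ⟨a, ha, rfl⟩; rw [← hψ a ha]; exact h.mf _ (hmem a ha)
    · intro hy
      have := h.mg y hy
      rw [← D.es.img] at this
      obtain ⟨a, ha, e⟩ := this
      exact ⟨a, ha, by rw [← hψ a ha, e, h.fg y hy]⟩

theorem face_to {W : Type*} [Fintype W] [DecidableEq W] {U : Set (Finset W)} {T : Set (Finset X)} (hT : CX T) {ψ : (W → ℝ) →ₗ[ℝ] (X → ℝ)}
    (hU : CX U) (hm : ∀ c ∈ rz U, ψ c ∈ rz T) {s : Finset W} (hs : s ∈ U) : ∃ t ∈ T, ∀ w ∈ s, ψ (eb w) ∈ fcone t := by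
  let c0 : W → ℝ := fun w => if w ∈ s then 1 else 0
  have hc0 : c0 ∈ rz U := mem_rz_iff.2 ⟨s, hs, fun v => by simp only [c0]; split_ifs <;> norm_num, fun v hv => by simp [c0, hv]⟩
  obtain ⟨t, ht, h⟩ := mem_rz_iff.1 (hm _ hc0)
  refine ⟨t, ht, fun w hw => ?_⟩
  have hnn : ∀ w ∈ s, ∀ v, 0 ≤ ψ (eb w) v := fun w hw =>
    (hm _ (eb_mem (hU.down _ hs _ (singleton_subset_iff.2 hw)))).1
  refine ⟨hnn w hw, fun v hv => ?_⟩
  have h2 := h.2 v hv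
  rw [lin_eb ψ c0, Finset.sum_apply] at h2
  rw [← sum_subset (subset_univ s) (fun w _ hw => by simp [c0, hw])] at h2
  have := (sum_eq_zero_iff_of_nonneg (fun w hw => by simp [c0, hw, hnn w hw v])).1 h2 w hw
  simpa [c0, hw] using this

/-- a simplicial approximation of a linear map -/
theorem approx {W : Type*} [Fintype W] [DecidableEq W] {U : Set (Finset W)} {T : Set (Finset X)} (hT : CX T) {ψ : (W → ℝ) →ₗ[ℝ] (X → ℝ)}
    (hU : CX U) (hm : ∀ c ∈ rz U, ψ c ∈ rz T) (hne : ∀ w, {w} ∈ U → ψ (eb w) ≠ 0) (hd : U ≠ {∅}) : ∃ k : W → X, (∀ w, {w} ∈ U → ψ (eb w) (k w) ≠ 0) ∧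
    ∀ s ∈ U, s.image k ∈ T := by
  have : ∃ w, {w} ∈ U := by
    by_contra hcon; push Not at hcon
    apply hd; ext s; constructor
    · intro hs; rcases s.eq_empty_or_nonempty with rfl | ⟨w, hw⟩
      · rfl
      · exact (hcon w (hU.down _ hs _ (singleton_subset_iff.2 hw))).elim
    · rintro rfl; exact hU.emp
  obtain ⟨w0, hw0⟩ := this
  have hx : ∀ w, {w} ∈ U → ∃ x, ψ (eb w) x ≠ 0 := fun w hw => by
    by_contra hcon; push Not at hcon; exact hne w hw (funext hcon)
  have hx' : ∀ w, ∃ x, {w} ∈ U → ψ (eb w) x ≠ 0 := fun w => by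
    by_cases hw : {w} ∈ U
    · obtain ⟨x, hx⟩ := hx w hw; exact ⟨x, fun _ => hx⟩
    · obtain ⟨x, -⟩ := hx w0 hw0; exact ⟨x, fun h => (hw h).elim⟩
  choose k hk using hx'
  refine ⟨k, hk, fun s hs => ?_⟩
  obtain ⟨t, ht, h⟩ := face_to hT hU hm hs
  refine hT.down _ ht _ fun v hv => ?_
  obtain ⟨w, hw, rfl⟩ := mem_image.1 hv
  by_contra hn
  exact hk w (hU.down _ hs _ (singleton_subset_iff.2 hw)) ((h w hw).2 _ hn)

/-- carrier-preserving chain maps are the identity -/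
theorem carrier_id {T : Set (Finset X)} (hT : CX T) (θ : C X →ₗ[ZMod 2] C X) (hbd : ∀ c, θ (bd c) = bd (θ c))
    (h0 : θ (sg ∅) = sg ∅) (hc : ∀ σ ∈ T, On {τ | τ ⊆ σ ∧ τ.card = σ.card} (θ (sg σ))) :
    ∀ σ ∈ T, θ (sg σ) = sg σ := by
  have hl : ∀ σ ∈ T, θ (sg σ) = (θ (sg σ) σ) • sg σ := by
    intro σ hσ; ext τ
    by_cases h : τ = σ
    · subst h; simp [sg]
    · have : θ (sg σ) τ = 0 := by
        by_contra h'
        obtain ⟨h1, h2⟩ := hc σ hσ τ h'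
        exact h (eq_of_subset_of_card_le h1 h2.ge)
      rw [this]; simp [sg, Pi.single_apply, h]
  intro σ
  induction σ using Finset.strongInduction with
  | _ σ ih =>
  intro hσ
  rcases σ.eq_empty_or_nonempty with rfl | ⟨v, hv⟩
  · exact h0
  have e := hl σ hσ
  have h1 : θ (bd (sg σ)) = bd (sg σ) := by
    rw [bd_sg, map_sum]
    refine sum_congr rfl fun w hw => ih _ (erase_ssubset hw) (hT.down _ hσ _ (erase_subset _ _))
  rw [hbd, e, map_smul] at h1
  have h2 := congrFun h1 (σ.erase v)
  have h3 : bd (sg σ) (σ.erase v) = 1 := by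
    rw [bd_sg, Finset.sum_apply, sum_eq_single v]
    · simp [sg]
    · intro w hw hwv
      have : σ.erase v ≠ σ.erase w := fun e => by
        have : w ∈ σ.erase v := by simp [hw, hwv]
        rw [e] at this; simp at this
      simp [sg, Pi.single_apply, this]
    · intro h; exact (h hv).elim
  rw [Pi.smul_apply, h3, smul_eq_mul, mul_one] at h2
  rw [e, h2, one_smul]

theorem rz_emp_iff {K : Set (Finset X)} (hK : CX K) : K = {∅} ↔ rz K = {0} := by
  constructor
  · rintro rfl
    ext c; constructor
    · rintro ⟨_, s, rfl, h⟩; ext v; exact h v (by simp)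
    · rintro rfl; exact rz_zero hK
  · intro h; ext s; constructor
    · intro hs; rcases s.eq_empty_or_nonempty with rfl | ⟨w, hw⟩
      · rfl
      · have := eb_mem (hK.down _ hs _ (singleton_subset_iff.2 hw))
        rw [h] at this; exact (eb_ne w this).elim
    · rintro rfl; exact hK.emp

theorem hom_retract {S : Set (Finset V)} {T : Set (Finset X)} (hS : CX S) (hT : CX T) (hT0 : T ≠ {∅}) {f g} (h : PLE (rz S) (rz T) f g) :
    ∃ (I : C X →ₗ[ZMod 2] C V) (R : C V →ₗ[ZMod 2] C X), (∀ c, I (bd c) = bd (I c)) ∧ (∀ c, R (bd c) = bd (R c)) ∧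
      (∀ c, On T c → On S (I c)) ∧ (∀ c, On S c → On T (R c)) ∧ ∀ c, Zc T c → Bc T (R (I c) + c) := by
  obtain ⟨D, ψ, hinj, himg, hψ⟩ := common hS h
  obtain ⟨g', hg'⟩ := linbij ψ hinj himg
  obtain ⟨D', χ, hinj', himg', hχ⟩ := common hT hg'.symm
  have hψχ : ∀ c ∈ rz D'.U, ψ (χ c) = D'.φ c := fun c hc => by
    rw [← hχ c hc, hg'.fg]; exact D'.es.img ▸ ⟨c, hc, rfl⟩
  have hU0 : D.U ≠ {∅} := fun e => hT0 ((rz_emp_iff hT).2 (by rw [← himg, (rz_emp_iff D.es.cx).1 e]; simp))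
  have hU0' : D'.U ≠ {∅} := fun e => hU0 ((rz_emp_iff D.es.cx).2 (by rw [← himg', (rz_emp_iff D'.es.cx).1 e]; simp))
  have hne : ∀ w, {w} ∈ D.U → ψ (eb w) ≠ 0 := fun w hw h0 =>
    eb_ne w (hinj (eb_mem hw) (rz_zero D.es.cx) (by rw [h0, map_zero]))
  have hne' : ∀ w, {w} ∈ D'.U → χ (eb w) ≠ 0 := fun w hw h0 =>
    eb_ne w (hinj' (eb_mem hw) (rz_zero D'.es.cx) (by rw [h0, map_zero]))
  obtain ⟨k, hk, hkT⟩ := approx hT D.es.cx (fun c hc => himg ▸ ⟨c, hc, rfl⟩) hne hU0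
  have hmχ : ∀ c ∈ rz D'.U, χ c ∈ rz D.U := fun c hc => himg' ▸ ⟨c, hc, rfl⟩
  obtain ⟨k', hk', hkU⟩ := approx D.es.cx D'.es.cx hmχ hne' hU0'
  let θ : C X →ₗ[ZMod 2] C X := psh k ∘ₗ psh k' ∘ₗ D'.s
  have hθ : ∀ σ ∈ T, θ (sg σ) = sg σ := by
    refine carrier_id hT θ ?_ ?_ ?_
    · intro c; simp [θ, D'.es.sbd, psh_bd]
    · simp [θ, D'.es.s0, psh_sg]
    · intro σ hσ
      refine On.lmap (K := {τ | τ ∈ D.U ∧ τ.card = σ.card ∧ ∀ w ∈ τ, ψ (eb w) ∈ fcone σ}) (psh k) ?_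
        (On.lmap (psh k') ?_ (D'.es.ssup σ hσ))
      · rintro τ ⟨h1, h2, h3⟩
        rw [psh_sg]; split_ifs with hi
        · refine On.sg ⟨fun v hv => ?_, by rw [card_image_of_injOn hi, h2]⟩
          obtain ⟨w, hw, rfl⟩ := mem_image.1 hv
          by_contra hn
          exact hk w (D.es.cx.down _ h1 _ (singleton_subset_iff.2 hw)) ((h3 w hw).2 _ hn)
        · exact On.zero _
      · rintro τ ⟨h1, h2, h3⟩
        rw [psh_sg]; split_ifs with hi
        · refine On.sg ⟨hkU _ h1, by rw [card_image_of_injOn hi, h2], fun v hv => ?_⟩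
          obtain ⟨w, hw, rfl⟩ := mem_image.1 hv
          have hwU := D'.es.cx.down _ h1 _ (singleton_subset_iff.2 hw)
          have h4 := h3 w hw
          rw [← hψχ _ (eb_mem hwU), lin_eb ψ] at h4
          obtain ⟨u, hu, hu2⟩ := mem_rz_iff.1 (hmχ _ (eb_mem hwU))
          have hnn : ∀ u' , χ (eb w) u' ≠ 0 → ∀ v, 0 ≤ ψ (eb u') v := by
            intro u' hu' v
            have hm : u' ∈ u := by by_contra hn; exact hu' (hu2.2 _ hn)
            have : ψ (eb u') ∈ rz T := himg ▸ ⟨_, eb_mem (D.es.cx.down _ hu _ (singleton_subset_iff.2 hm)), rfl⟩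
            exact this.1 v
          refine ⟨hnn _ (hk' w hwU), fun v hv => ?_⟩
          have h5 := h4.2 v hv
          rw [Finset.sum_apply] at h5
          have := (sum_eq_zero_iff_of_nonneg (fun u' _ => ?_)).1 h5 (k' w) (mem_univ _)
          · exact (mul_eq_zero.1 this).resolve_left (hk' w hwU)
          · by_cases h0 : χ (eb w) u' = 0
            · simp [h0]
            · exact mul_nonneg (hu2.1 u') (hnn u' h0 v)
        · exact On.zero _
  refine ⟨D.g ∘ₗ psh k' ∘ₗ D'.s, psh k ∘ₗ D.s, ?_, ?_, ?_, ?_, ?_⟩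
  · intro c; simp [D'.es.sbd, psh_bd, D.es.gbd]
  · intro c; simp [D.es.sbd, psh_bd]
  · intro c hc; exact D.es.gon _ (psh_on hkU (D'.es.son hc))
  · intro c hc; exact psh_on hkT (D.es.son hc)
  · intro c hc
    obtain ⟨e, h1, h2⟩ := D.es.gg (psh k' (D'.s c)) ⟨psh_on hkU (D'.es.son hc.1), by
      rw [← psh_bd, ← D'.es.sbd, hc.2, map_zero, map_zero]⟩
    refine ⟨psh k e, psh_on hkT h1, ?_⟩
    rw [← psh_bd, h2, map_add]
    have : θ c = c := lmap_eq (L' := LinearMap.id) (fun σ hσ => hθ σ hσ) hc.1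
    change _ + θ c = _
    rw [this]; rfl

end H5

section H6
variable {V : Type*} [Fintype V] [DecidableEq V]

open Classical in
noncomputable def FF (n : ℕ) (K : Set (Finset V)) : C V := fun s => if s ∈ K ∧ s.card = n then 1 else 0

def FS (n : ℕ) (K : Set (Finset V)) : Prop := bd (FF n K) = 0 ∧ ¬ Bc K (FF n K) ∧ ∀ c, Zc K c → Bc K c ∨ Bc K (c + FF n K)

def HG : ℕ → Set (Finset V) → Prop
  | 0, K => K = {∅}
  | n + 1, K => FS (n + 1) K ∧ ∀ b, {b} ∈ K → HG n (Lk K b)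

def O2 (K : Set (Finset V)) : Prop := ∀ c c', Zc K c → Zc K c' → Bc K c ∨ Bc K c' ∨ Bc K (c + c')

theorem FF_on (n : ℕ) (K : Set (Finset V)) : On K (FF n K) := fun s hs => by
  by_contra h; simp [FF, h] at hs

theorem ee_apply (b : V) (c : C V) (t : Finset V) : ee b c t = if b ∈ t then 0 else c (insert b t) := by
  let L : C V →ₗ[ZMod 2] C V :=
    { toFun := fun c t => if b ∈ t then 0 else c (insert b t)
      map_add' := fun c c' => by ext t; by_cases h : b ∈ t <;> simp [h]
      map_smul' := fun r c => by ext t; by_cases h : b ∈ t <;> simp [h] }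
  have : ee b c = L c := by
    refine lmap_ext (fun s => ?_) c
    rw [ee_sg]; ext t
    change _ = if b ∈ t then 0 else sg s (insert b t)
    by_cases hs : b ∈ s
    · rw [if_pos hs]
      by_cases ht : b ∈ t
      · have : t ≠ s.erase b := fun e => by rw [e] at ht; simp at ht
        simp [ht, sg, Pi.single_apply, this]
      · have : t = s.erase b ↔ insert b t = s := by
          constructor
          · rintro rfl; exact insert_erase hs
          · rintro rfl; exact (erase_insert ht).symm
        simp [ht, sg, Pi.single_apply, this]
    · rw [if_neg hs]
      have : insert b t ≠ s := fun e => hs (e ▸ mem_insert_self _ _)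
      simp [sg, Pi.single_apply, this]
  rw [this]; rfl

theorem ee_on {K : Set (Finset V)} {b : V} {c : C V} (h : On K c) : On (Lk K b) (ee b c) := by
  intro t ht
  rw [ee_apply] at ht
  by_cases hb : b ∈ t
  · simp [hb] at ht
  · rw [if_neg hb] at ht; exact ⟨hb, h _ ht⟩

theorem zmod2_cases : ∀ r : ZMod 2, r = 0 ∨ r = 1 := by decide

theorem ee_FF (n : ℕ) (K : Set (Finset V)) (b : V) : ee b (FF (n+1) K) = FF n (Lk K b) := by
  ext t; rw [ee_apply]
  by_cases hb : b ∈ t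
  · have : t ∉ Lk K b := fun h => h.1 hb
    simp [hb, FF, this]
  · rw [if_neg hb]
    have e : (insert b t ∈ K ∧ (insert b t).card = n + 1) ↔ (t ∈ Lk K b ∧ t.card = n) := by
      rw [card_insert_of_notMem hb, Nat.add_right_cancel_iff]
      exact ⟨fun h => ⟨⟨hb, h.1⟩, h.2⟩, fun h => ⟨h.1.2, h.2⟩⟩
    unfold FF; split_ifs with h1 h2 h2 <;> first | rfl | (exfalso; tauto)

theorem HG.fs : ∀ {n : ℕ} {K : Set (Finset V)}, HG n K → FS n K
  | 0, K, h => by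
    have h : K = {∅} := h
    subst h
    have e : FF 0 ({∅} : Set (Finset V)) = sg ∅ := by
      ext t; by_cases ht : t = ∅ <;> simp [FF, sg, Pi.single_apply, ht]
    have hc : ∀ c : C V, On {∅} c → c = c ∅ • sg ∅ := by
      intro c hc; ext t
      by_cases ht : t = ∅
      · simp [ht, sg]
      · have : c t = 0 := by by_contra h; exact ht (hc t h)
        simp [this, sg, Pi.single_apply, ht]
    rw [FS, e]
    refine ⟨by simp [bd_sg], ?_, ?_⟩
    · rintro ⟨e, h1, h2⟩
      rw [hc e h1, map_smul, bd_sg] at h2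
      have := congrFun h2 ∅; simp [sg] at this
    · intro c hc'
      have := hc c hc'.1
      generalize c ∅ = r at this
      rw [this]
      rcases zmod2_cases r with rfl | rfl
      · left; exact ⟨0, On.zero _, by simp⟩
      · right; exact ⟨0, On.zero _, by simp [add_self_C]⟩
  | n + 1, K, h => h.1

theorem FF_not {n : ℕ} {K : Set (Finset V)} {b : V} (h : HG n (Lk K b)) : ¬ Bc K (FF (n+1) K) := by
  rintro ⟨e, h1, h2⟩
  refine h.fs.2.1 ⟨ee b e, ee_on h1, ?_⟩
  rw [bd_ee, h2, ee_FF]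

theorem FF_cyc {n : ℕ} {K : Set (Finset V)} (hK : CX K) (h : ∀ b, {b} ∈ K → HG (n+1) (Lk K b)) : bd (FF (n+2) K) = 0 := by
  ext t
  by_contra hne
  have h0 : bd (FF (n+2) K) t ≠ 0 := hne
  obtain ⟨v, hv, hv2⟩ := exists_ne_zero_of_sum_ne_zero (bd_apply (FF (n+2) K) t ▸ h0)
  have htK := FF_on _ _ _ hv2
  have hcard : (insert v t).card = n + 2 := by by_contra h'; simp [FF, h'] at hv2
  have hvt : v ∉ t := by simpa using hv
  rw [card_insert_of_notMem hvt] at hcard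
  obtain ⟨b, hb⟩ : t.Nonempty := card_pos.1 (by omega)
  have hbK : {b} ∈ K := hK.down _ htK _ (by simp [hb])
  have := congrFun (h b hbK).fs.1 (t.erase b)
  rw [← ee_FF, bd_ee, ee_apply, if_neg (by simp), insert_erase hb] at this
  exact h0 this

theorem hg_step {n : ℕ} {K : Set (Finset V)} (hK : CX K) (hne : ∃ b, {b} ∈ K) (h2 : O2 K) (h : ∀ b, {b} ∈ K → HG n (Lk K b))
    (h0 : n = 0 → bd (FF 1 K) = 0) : HG (n + 1) K := by
  obtain ⟨b, hb⟩ := hne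
  have hcyc : bd (FF (n+1) K) = 0 := by
    cases n with
    | zero => exact h0 rfl
    | succ n => exact FF_cyc hK h
  have hnb := FF_not (h b hb)
  refine ⟨⟨hcyc, hnb, fun c hc => ?_⟩, h⟩
  rcases h2 c _ hc ⟨FF_on _ _, hcyc⟩ with h | h | h
  · exact Or.inl h
  · exact (hnb h).elim
  · exact Or.inr h

/-- vertex deletion -/
def del (K : Set (Finset V)) (b : V) : Set (Finset V) := {s | s ∈ K ∧ b ∉ s}

theorem del_core {K : Set (Finset V)} (hK : CX K) {x : V} {c e : C V} (he : On K e) (hc : On (del K x) c) (hec : bd e = c)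
    (hb : Bc (Lk K x) (ee x e)) : Bc (del K x) c := by
  obtain ⟨u, hu, hu2⟩ := hb
  have hLd : Lk K x ⊆ del K x := fun s hs => ⟨hK.down _ hs.2 _ (subset_insert _ _), hs.1⟩
  have hec0 : ee x c = 0 := by
    ext t; rw [ee_apply]; split_ifs
    · rfl
    · by_contra h; exact (hc _ h).2 (mem_insert_self _ _)
  refine ⟨e + hh x (ee x e) + u, ?_, ?_⟩
  · refine On.add ?_ (hu.mono hLd)
    have := On.lmap (K' := del K x) (LinearMap.id + hh x ∘ₗ ee x) (fun s hs => ?_) he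
    · exact this
    · simp only [LinearMap.add_apply, LinearMap.id_apply, LinearMap.comp_apply]
      rw [ee_sg]
      by_cases hx : x ∈ s
      · rw [if_pos hx, hh_sg, if_neg (by simp), insert_erase hx, add_self_C]; exact On.zero _
      · rw [if_neg hx, map_zero, add_zero]; exact On.sg ⟨hs, hx⟩
  · rw [map_add, map_add, bd_hh, bd_ee, hec, hec0, map_zero, zero_add, hu2, add_assoc, add_self_C, add_zero]

theorem del_acy {K : Set (Finset V)} (hK : CX K) {x : V} (h1 : Acy K) (h2 : Acy (Lk K x)) : Acy (del K x) := by
  rintro c ⟨hc, hc0⟩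
  obtain ⟨e, he, hec⟩ := h1 c ⟨hc.mono fun s hs => hs.1, hc0⟩
  refine del_core hK he hc hec (h2 _ ⟨ee_on he, ?_⟩)
  rw [bd_ee, hec]
  ext t; rw [ee_apply]; split_ifs
  · rfl
  · by_contra h; exact (hc _ h).2 (mem_insert_self _ _)

theorem top_acy {n : ℕ} {K : Set (Finset V)} (hK : CX K) {x : V} (hx : {x} ∈ K) (h : HG (n+1) K) : Acy (del K x) := by
  rintro c ⟨hc, hc0⟩
  have hl := (h.2 x hx).fs
  have hec0 : ee x c = 0 := by
    ext t; rw [ee_apply]; split_ifs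
    · rfl
    · by_contra h; exact (hc _ h).2 (mem_insert_self _ _)
  rcases h.1.2.2 c ⟨hc.mono fun s hs => hs.1, hc0⟩ with ⟨e, he, hec⟩ | ⟨e, he, hec⟩
  · have hz : Zc (Lk K x) (ee x e) := ⟨ee_on he, by rw [bd_ee, hec, hec0]⟩
    rcases hl.2.2 _ hz with hb | hb
    · exact del_core hK he hc hec hb
    · refine del_core hK (he.add (FF_on (n+1) K)) hc ?_ ?_
      · rw [map_add, h.1.1, hec, add_zero]
      · rw [map_add, ee_FF]; exact hb
  · refine (hl.2.1 ⟨ee x e, ee_on he, ?_⟩).elim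
    rw [bd_ee, hec, map_add, hec0, ee_FF, zero_add]

theorem cone_acy : ∀ (n : ℕ) {K : Set (Finset V)} {A : Finset V} {x : V}, CX K → HG n K → ConeOn K A x → Acy {s | s ∈ K ∧ Disjoint s A}
  | 0, K, A, x, hK, h, hA => by
    have h : K = {∅} := h
    have := hA.2 ∅ hK.emp (empty_subset _)
    rw [h] at this; simp at this
  | n + 1, K, A, x, hK, h, hA => by
    suffices H : ∀ B : Finset V, x ∉ B → insert x B ⊆ A → Acy {s | s ∈ K ∧ Disjoint s (insert x B)} by
      have := H (A.erase x) (by simp) (by rw [insert_erase hA.1])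
      rwa [insert_erase hA.1] at this
    have hx : {x} ∈ K := by simpa using hA.2 ∅ hK.emp (empty_subset _)
    intro B
    induction B using Finset.induction_on with
    | empty =>
      intro _ _
      have : {s | s ∈ K ∧ Disjoint s (insert x ∅)} = del K x := by ext s; simp [del]
      rw [this]; exact top_acy hK hx h
    | insert b B hb ih =>
      intro hxB hBA
      simp only [mem_insert, not_or] at hxB
      have hsub : insert x B ⊆ A := fun v hv => hBA (by simp at hv ⊢; tauto)
      have ih := ih hxB.2 hsub
      set K' := {s | s ∈ K ∧ Disjoint s (insert x B)} with hK'
      have e : {s | s ∈ K ∧ Disjoint s (insert x (insert b B))} = del K' b := by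
        ext s; simp only [del, hK', Set.mem_ofPred_eq, disjoint_insert_right]; tauto
      have hcx : CX K' := ⟨⟨hK.emp, by simp⟩, fun s hs t ht => ⟨hK.down _ hs.1 _ ht, disjoint_of_subset_left ht hs.2⟩⟩
      rw [e]
      by_cases hbK : {b} ∈ K
      · refine del_acy hcx ih ?_
        have e2 : Lk K' b = {s | s ∈ Lk K b ∧ Disjoint s (insert x B)} := by
          ext s; simp only [Lk, hK', Set.mem_ofPred_eq, disjoint_insert_left, mem_insert]
          constructor
          · rintro ⟨h1, h2, h3, h4⟩; exact ⟨⟨h1, h2⟩, h4⟩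
          · rintro ⟨⟨h1, h2⟩, h4⟩; exact ⟨h1, h2, by rintro (h | h); exacts [hxB.1 h.symm, hb h], h4⟩
        rw [e2]
        refine cone_acy n (hK.lk hbK) (h.2 b hbK) (A := insert x B) (x := x) ⟨by simp, ?_⟩
        rintro s ⟨h1, h2⟩ h3
        refine ⟨?_, ?_⟩
        · simp only [mem_insert, not_or]; exact ⟨fun h => hxB.1 h.symm, h1⟩
        · rw [insert_comm]
          refine hA.2 _ h2 ?_
          intro v hv
          rcases mem_insert.1 hv with rfl | hv
          · exact hBA (by simp)
          · exact hsub (h3 hv)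
      · have : del K' b = K' := by
          ext s; constructor
          · exact fun h => h.1
          · intro hs; refine ⟨hs, fun hbs => hbK (hK.down _ hs.1 _ (by simp [hbs]))⟩
        rw [this]; exact ih

/-- boundary of a simplex -/
theorem bdry_O2 {A : Finset V} (hA : A.Nonempty) : O2 {s : Finset V | s ⊂ A} := by
  obtain ⟨v, hv⟩ := hA
  have key : ∀ c, Zc {s : Finset V | s ⊂ A} c → ∃ e r, On {s : Finset V | s ⊂ A} e ∧ c = bd e + (r : ZMod 2) • bd (sg A) := by
    rintro c ⟨hc, hc0⟩
    have h1 : bd (hh v c) = c := by rw [bd_hh, hc0, map_zero, zero_add]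
    have h2 : On {s : Finset V | s ⊆ A} (hh v c) := by
      refine On.lmap _ (fun s hs => ?_) hc
      rw [hh_sg]; split_ifs
      · exact On.zero _
      · exact On.sg (insert_subset hv hs.1)
    refine ⟨hh v c + (hh v c A) • sg A, hh v c A, ?_, ?_⟩
    · intro s hs
      rw [Set.mem_ofPred_eq, Finset.ssubset_iff_subset_ne]
      constructor
      · exact (h2.add ((On.sg (show A ∈ {s : Finset V | s ⊆ A} from Finset.Subset.refl _)).smul _)) s hs
      · rintro rfl; apply hs; simp [sg, CharTwo.add_self_eq_zero]
    · rw [map_add, map_smul, h1, add_assoc, add_self_C, add_zero]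
  intro c c' hc hc'
  obtain ⟨e, r, he, h⟩ := key c hc
  obtain ⟨e', r', he', h'⟩ := key c' hc'
  rcases zmod2_cases r with rfl | rfl
  · left; exact ⟨e, he, by simpa using h.symm⟩
  · rcases zmod2_cases r' with rfl | rfl
    · right; left; exact ⟨e', he', by simpa using h'.symm⟩
    · right; right
      refine ⟨e + e', he.add he', ?_⟩
      rw [h, h', map_add]
      have h2 := add_self_C (bd (sg A))
      calc bd e + bd e' = bd e + bd e' + (1:ZMod 2) • (bd (sg A) + bd (sg A)) := by rw [h2]; simp
        _ = _ := by rw [smul_add]; exact add_add_add_comm _ _ _ _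

end H6

section H6b
variable {V X : Type} [Fintype V] [DecidableEq V] [Fintype X] [DecidableEq X]

theorem O2_ple {S : Set (Finset V)} {T : Set (Finset X)} (hS : CX S) (hT : CX T) (hT0 : T ≠ {∅}) {f g} (h : PLE (rz S) (rz T) f g)
    (hO : O2 S) : O2 T := by
  obtain ⟨I, R, hI, hR, hI', hR', hz⟩ := hom_retract hS hT hT0 h
  have key : ∀ c, Zc T c → Bc S (I c) → Bc T c := by
    intro c hc ⟨e, he, hec⟩
    have h1 : Bc T (R (I c)) := ⟨R e, hR' _ he, by rw [← hR, hec]⟩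
    have := h1.add (hz c hc)
    rwa [← add_assoc, add_self_C, zero_add] at this
  have hZ : ∀ c, Zc T c → Zc S (I c) := fun c hc => ⟨hI' _ hc.1, by rw [← hI, hc.2, map_zero]⟩
  intro c c' hc hc'
  rcases hO _ _ (hZ c hc) (hZ c' hc') with h | h | h
  · exact Or.inl (key c hc h)
  · exact Or.inr (Or.inl (key c' hc' h))
  · rw [← map_add] at h
    exact Or.inr (Or.inr (key _ (hc.add hc') h))

theorem acy_ple {S : Set (Finset V)} {T : Set (Finset X)} (hS : CX S) (hT : CX T) (hT0 : T ≠ {∅}) {f g} (h : PLE (rz S) (rz T) f g)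
    (hO : Acy S) : Acy T := by
  obtain ⟨I, R, hI, hR, hI', hR', hz⟩ := hom_retract hS hT hT0 h
  intro c hc
  obtain ⟨e, he, hec⟩ := hO (I c) ⟨hI' _ hc.1, by rw [← hI, hc.2, map_zero]⟩
  have h1 : Bc T (R (I c)) := ⟨R e, hR' _ he, by rw [← hR, hec]⟩
  have := h1.add (hz c hc)
  rwa [← add_assoc, add_self_C, zero_add] at this

end H6b

section H7
variable {V : Type} [Fintype V] [DecidableEq V]

theorem bc_zero {K : Set (Finset V)} (h : ∀ s ∈ K, s.card ≤ 1) {c : C V} (hc : Bc K c) (x : V) : c {x} = 0 := by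
  obtain ⟨e, he, rfl⟩ := hc
  rw [bd_apply]
  refine sum_eq_zero fun v hv => ?_
  by_contra h0
  have h1 := h _ (he _ h0)
  rw [card_insert_of_notMem (by simpa using hv)] at h1
  simp at h1

theorem sg_single (u x : V) : sg ({u} : Finset V) {x} = if x = u then 1 else 0 := by
  simp [sg, Pi.single_apply]

theorem cyc_pair {K : Set (Finset V)} {u v : V} (hu : {u} ∈ K) (hv : {v} ∈ K) : Zc K (sg {u} + sg {v}) := by
  refine ⟨(On.sg hu).add (On.sg hv), ?_⟩
  rw [map_add, bd_sg, bd_sg]; simp [add_self_C]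

theorem cx_bdry (A : Finset V) (hA : A.Nonempty) : CX {s : Finset V | s ⊂ A} :=
  ⟨empty_ssubset.2 hA, fun s hs t ht => lt_of_le_of_lt ht hs⟩

theorem sph_vertex {n : ℕ} {S : Set (Finset V)} (hS : CX S) (h : Sph (n + 1) S) : ∃ b, {b} ∈ S := by
  by_contra hb
  push Not at hb
  have e : S = {∅} := by
    ext s; constructor
    · intro hs
      rcases s.eq_empty_or_nonempty with rfl | ⟨a, ha⟩
      · rfl
      · exact absurd (hS.down _ hs _ (singleton_subset_iff.2 ha)) (hb a)
    · rintro rfl; exact hS.emp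
  have h0 := (rz_emp_iff hS).1 e
  obtain ⟨f, g, hfg⟩ := h
  have hg : ∀ y, g y = 0 := fun y => by
    have := hfg.mg y (Set.mem_univ y); rw [h0] at this; exact this
  have := hfg.fg _ (Set.mem_univ (0 : Fin (n+1) → ℝ))
  have h2 := hfg.fg _ (Set.mem_univ (1 : Fin (n+1) → ℝ))
  rw [hg] at this h2
  have := congrFun (this.symm.trans h2) 0
  simp at this

theorem sph_O2 {n : ℕ} {S : Set (Finset V)} (hS : CX S) (h : Sph (n + 1) S) : O2 S := by
  have hA : (Finset.univ : Finset (Fin (n+2))).card = (n+1) + 1 := by simp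
  obtain ⟨f, g, hfg⟩ := sph_bd hA
  obtain ⟨f', g', hfg'⟩ := h
  refine O2_ple (cx_bdry _ ⟨0, by simp⟩) hS ?_ (hfg.trans hfg'.symm) (bdry_O2 ⟨0, by simp⟩)
  obtain ⟨b, hb⟩ := sph_vertex hS ⟨f', g', hfg'⟩
  rintro rfl
  simp at hb

theorem sph_even {S : Set (Finset V)} (hS : CX S) (h : Sph 1 S) (hl : ∀ s ∈ S, s.card ≤ 1) : bd (FF 1 S) = 0 := by
  classical
  have hO := sph_O2 hS h
  obtain ⟨u, hu⟩ := sph_vertex hS h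
  have h2 : ∃ v, v ≠ u ∧ {v} ∈ S := by
    by_contra hcon
    push Not at hcon
    have hac : Acy S := by
      intro c hc
      refine ⟨c ∅ • sg {u}, (On.sg hu).smul _, ?_⟩
      rw [map_smul, bd_sg]
      ext t
      have h1 := congrFun hc.2 ∅
      rw [bd_apply] at h1
      rw [sum_eq_single u] at h1
      rotate_left
      · intro b _ hb
        by_contra h0
        exact hcon b hb (by simpa using hc.1 _ h0)
      · simp
      by_cases ht : t = ∅
      · subst ht; simp [sg]
      · simp [sg, Pi.single_apply, ht]
        by_contra h0
        have h3 := hc.1 t (fun e => h0 e.symm)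
        obtain ⟨a, ha⟩ := card_eq_one.1 (le_antisymm (hl t h3) (card_pos.2 (nonempty_iff_ne_empty.2 ht)))
        subst ha
        by_cases hau : a = u
        · subst hau; exact h0 (by simpa using h1.symm)
        · exact hcon a hau h3
    have hA : (Finset.univ : Finset (Fin 2)).card = 1 + 1 := by simp
    obtain ⟨f, g, hfg⟩ := sph_bd hA
    obtain ⟨f', g', hfg'⟩ := h
    have h0 : ({0} : Finset (Fin 2)) ∈ {s : Finset (Fin 2) | s ⊂ Finset.univ} := by
      rw [Set.mem_ofPred_eq]; decide
    have h1 : ({1} : Finset (Fin 2)) ∈ {s : Finset (Fin 2) | s ⊂ Finset.univ} := by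
      rw [Set.mem_ofPred_eq]; decide
    have := acy_ple hS (cx_bdry (Finset.univ : Finset (Fin 2)) ⟨0, by simp⟩) (by
      intro e; rw [e] at h0; simp at h0) (hfg'.trans hfg.symm) hac
    have := bc_zero (fun s hs => by have := card_lt_card hs; simp at this; omega) (this _ (cyc_pair h0 h1)) 0
    simp [sg_single] at this
  obtain ⟨v, hvu, hv⟩ := h2
  ext t
  rw [bd_apply]
  by_cases ht : t = ∅
  · subst ht
    have h3 : ∀ w, {w} ∈ S → w = u ∨ w = v := by
      intro w hw
      by_contra hcon
      push Not at hcon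
      rcases hO _ _ (cyc_pair hu hv) (cyc_pair hu hw) with h | h | h
      · have := bc_zero hl h v; simp [sg_single, hvu] at this
      · have := bc_zero hl h w; simp [sg_single, hcon] at this
      · have := bc_zero hl h w; simp [sg_single, hcon] at this
    have : ∀ w, FF 1 S (insert w ∅) = if w ∈ ({u, v} : Finset V) then 1 else 0 := by
      intro w
      have e : ({w} ∈ S) ↔ (w = u ∨ w = v) := ⟨h3 w, by rintro (rfl | rfl) <;> assumption⟩
      simp only [FF, mem_insert, mem_singleton, insert_empty_eq, card_singleton, and_true, e]
    simp only [this]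
    rw [sum_ite_mem]
    simp [hvu.symm]
    decide
  · refine sum_eq_zero fun w hw => ?_
    have : (insert w t).card ≠ 1 := by
      rw [card_insert_of_notMem (by simpa using hw)]
      have := card_pos.2 (nonempty_iff_ne_empty.2 ht); omega
    simp [FF, this]

theorem sph_hg : ∀ {n : ℕ} {S : Set (Finset V)}, CX S → Sph n S → HG n S
  | 0, S, hS, h => by
    change S = {∅}
    ext s; constructor
    · intro hs
      rcases s.eq_empty_or_nonempty with rfl | ⟨a, ha⟩
      · rfl
      · exact absurd (hS.down _ hs _ (singleton_subset_iff.2 ha)) (fun hb => h.not_zero hb)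
    · rintro rfl; exact hS.emp
  | n + 1, S, hS, h => by
    have hl : ∀ b, {b} ∈ S → HG n (Lk S b) := fun b hb => sph_hg (hS.lk hb) (h.lk hS hb)
    refine hg_step hS (sph_vertex hS h) (sph_O2 hS h) hl ?_
    rintro rfl
    refine sph_even hS h fun s hs => ?_
    rcases s.eq_empty_or_nonempty with rfl | ⟨a, ha⟩
    · simp
    · have h1 : Lk S a = {∅} := hl a (hS.down _ hs _ (singleton_subset_iff.2 ha))
      have h2 : s.erase a ∈ Lk S a := ⟨by simp, by rwa [insert_erase ha]⟩
      rw [h1] at h2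
      have : s.erase a = ∅ := h2
      have := card_erase_of_mem ha
      simp_all; omega

end H7

section C7

/-- forces evaluation of a natural number in the kernel -/
def fz {α : Type} (n : Nat) (k : Nat → α) : α := Nat.rec (k 0) (fun m _ => k (Nat.succ m)) n

theorem fz_eq {α : Type} (n : Nat) (k : Nat → α) : fz n k = k n := by cases n <;> rfl

/-- reduce a vector by a basis -/
def redv (B : List Nat) (v : Nat) : Nat :=
  List.rec (motive := fun _ => Nat) v
    (fun b _ ih => fz ih (fun w => fz (Nat.xor w b) (fun u => Bool.rec w u (Nat.ble u w)))) B

def red (B : List Nat) (v : Nat) (k : Nat → Bool) : Bool :=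
  fz (redv B v) k

abbrev F7 := Finset (Fin 7)

/-- code of a face: bit mask of the complement -/
def code (f : F7) : ℕ := ∑ v ∈ fᶜ, 2 ^ (v : ℕ)

/-- rank of a code among codes of the same weight, one byte each -/
def rktab : ℕ := 16512785419016643261848920279747134206703646133043048018095608357149711607676339595489044873212850098384273250461033669017824797130565487346670182477310409981217384752328145667665544154727658911857701777077899178308737104479899528071475509788027193352627911224560270198848071386263983458575174739098140672

def rk (f : F7) : ℕ := Nat.land (Nat.shiftRight rktab (Nat.mul 8 (code f))) 255

def bm (f : F7) : ℕ := ∑ v ∈ f, 2 ^ rk (f.erase v)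

/-- inverse of the rank -/
def utab : ℕ := 970200607403741565125322211202698375265903801599659251450218093422727513650984006559259960269162802064659520293430485163876479661713695413602431361817306544600406660883370067226650030494451248197908930730847434761258554044092704286920320641807539603092913172144572291665657989195456740444043564238203338234120811662430757263964965142825406291509228217832580790268450793988465460269127510728738473913317518476028178221137571479467191580520464273308517959205753227029144833477868670761764095843596209046378454261070871658623

/-- table of cofaces (rank and boundary mask) of ridges -/
def tab2 : ℕ := 18370091126954406472498563845877176687328849434339333791009209488248643303635267234576641321252916641350991371081617683124186003056149872526572680454703018494107778289915812188964071609649970682306555054622656007612830400863783020029832343323468787852125284593655360314163543449877165162121835319350253712253780219923614480718940385367934586920830857651032001361689033024633100022189873184222775609881579538396926076032183017934440264913623277098289891559268280114202229531229520672017962359050111068540537887530374918774059943330486188942727813359715607926480105892121502749058838630589153803548393209859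
def tab3 : ℕ := 644566606613803782567775600605012599824444657712693969067529050294627718382768675617613118033626257908696746692729396808086970828949311466667032736383827332725425921993324971981045427411919883317045549963536711074896083944121531474173278697812958300016072065406526765346977313808339164180632175213368590890551303132062553550230931439732768372752463865359380279504848514929516148204912635318310441561493943653325258408346303527073378898039079481730368497379133507071914505030732447977648512222608957290081800653436451119694301195443227199278683884938638392619028949404121521478719973408245072944578323225222246978133684796617770531320985425310129615708756399011205561663540815858527580287152881619013160412849221097425123312519643692225969353152844779968281579407439614981421424321387147303772378659044856470813323589820667783443980242746017101786926712487059495417764947033163451234253210956166598243384778526329750151217742623017138942111404128514982272151012510327054000831275435748557715916714675377771033448832836832201204549051883677256219764764615214314952536132389438692601989421465606287486201188574292956913302139875412829061539853614954016785210811342638539274020495547306038621493433189620504414368004036885652558019071263737624881852609624923182557683594019661464211433398251392847502954498906868464027313600449686669830915349448022861562452183597987868188125815140282105830649333181678762185203754990313653109223734705128581562031565667695932240792458799331644413756677859314697095366813822027183423555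
def tab4 : ℕ := 3560186455013575751375263456476263321128723195515428848285393769286664224883405066378162576651956749118199496063453624148320794520161014969281064271481663154794850400739524097798572537198858918677025132596668092276847262208608827317986633774371153119142725518187938527453420517774229384651053121097888482459577249556776830726319891925855003443109359598617257955927050612784035379228127834573443707665165346790424945519668128860767123317146007871684087936969504836198692623345551570042352356924062778462810564850157445922238714152844311429407105195483165484943728629688114424308865315651276791626146562903671848614606522202776777300755153422745672035474862430144800319382762090302148283295415689629306083954374676680011249195410092683638161626434737163646824709700318359200126049571566709978148734706542698150597565082405555439707479002197818344513968579813002501295411251178674301738459099063591767690396447725618845473520465905605325643300810326593171272977243749522884220526491389633467613727959576238474629246219383496764103096312557427142495143433865081701365638746295129019788384278356519948253673492708032484484404386115184949882278734474206999310149474535238982892892303361730635447214002506803351432394991920039136994395543472660038806796212426398061171974723155696450530068600738832153435569413914717766696976862321534765124985816349967913302074396423168782053811972018878282893224834162535279978758404475318585331639586242082075014633145028090811651377102519826639524107138730145634312946192782913135554499218308032376957585763293474157661718544773961342664959895256433064620955215707545506028834092378961507653221207097310742497313291373465429253954538337107040268049883308209246511750199868612742691499567209784489822016391087326693377217664791187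1385470699465841539735148075194899593912145222317770181942603378408118800794500396592915374386982433818974368873449871834138430237203258275231068506443513456678468767668666226335925335055614168337829816083290359596727319626913834462536462489106128029215436603427
def tab5 : ℕ := 3975216118379034209774254005718295962393247303341506203920953920004533586748672852922242905196362271262774735000189991008642883431267214923678357374390447162222581812193906363146076386089995303876547451963651994934562544536118615486418626880488920859896110034784727404571012834625130334914411241345399130265158465883898051937979411505548164333195864562383965027799149029610282610186754934902991917889969600950829455438261145116839591088034963295984165766127610610622171586572787764189640233253361380900007466709510557596272787720466228645238605802504505782625531260948416421151452212597472376306700714517881734150986405529033132032995129412262444515727965507601721172947074364137799890116551300966530253823895693776489818599916013246733910025883954849491135871519816715248370574476271494805214500422415726927241895913537996678203146814250754536834129293128108538244970363642631365016076290797033898640006529407932691285745607952027679384402932249077003132612910091364056025605316082427277310572150538216284477461355511622594357314857863068380911498473432292648642817156718453808813935276089940977121078701863435980627813099586791516858831950480762588901580996840339041928308126971817835543124807915846046467606115491095449568264416008767615239702452710209680529479949970151561631803929226484712568481981059970262729028604096391681605069858408418460545345928460141469797218419512469172120974160156843866714226400906602258338792833297992294969938914195872034140631109535501192523502081902707677768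78107947850496214035
def tab6 : ℕ := 5511082522431338451982125645632764203969498996705148175757953589925219980949185163198156417259263251439500249594028794383470505815576090376569143732985231380011044695087834262873182753996578115009049343412944454830213057160423543974045800205397504932101900732709530162369944139070455226364644554458810651187573689248166300135044725498821062612173868253363756344100368189579110224765409702462511908061848040369361796920794576408513940630629520412743595194432544810839303475190629272689887874908119054087822363387148834785624046189892935565230982901624829464413872260865936028102134875167072778427708769355

def ent (T i : ℕ) : ℕ := Nat.land (Nat.shiftRight T (Nat.mul 48 i)) 281474976710655

def loop (T g1 g2 : ℕ) (B : List ℕ) (rec : ℕ → ℕ → ℕ → List ℕ → Bool) (base : ℕ) (nc : ℕ) : ℕ → Bool :=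
  Nat.rec (motive := fun _ => ℕ → Bool) (fun _ => true)
    (fun j ih X => fz (ent T (Nat.add base j)) fun P => fz (Nat.shiftLeft 1 (Nat.shiftRight P 35)) fun fb =>
      Bool.rec (ih X)
        (fz (Nat.land P 34359738367) fun b => fz (Nat.lor X fb) fun X' => red B b fun w => Bool.rec
          (Bool.rec false (ih X') (fz (Nat.lor g1 b) fun g1' => fz (Nat.lor g2 (Nat.land g1 b)) fun g2' => rec g1' g2' X' (List.cons w B)))
          (ih X') (Nat.beq w 0))
        (Nat.beq (Nat.land X fb) 0)) nc

def srch (T nc fuel : ℕ) : ℕ → ℕ → ℕ → List ℕ → Bool :=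
  Nat.rec (motive := fun _ => ℕ → ℕ → ℕ → List ℕ → Bool) (fun _ _ _ _ => false)
   (fun _ ih g1 g2 X B =>
     fz (Nat.xor g1 g2) fun fr => Bool.rec
       (fz (Nat.mul nc (Nat.log2 fr)) fun base => loop T g1 g2 B ih base nc X)
       false (Nat.beq fr 0)) fuel

/-- start with the faces in a list (given by rank and boundary) -/
def start (T nc : ℕ) (L : List F7) : ℕ → ℕ → ℕ → List ℕ → Bool :=
  List.rec (motive := fun _ => ℕ → ℕ → ℕ → List ℕ → Bool) (fun g1 g2 X B => srch T nc 30 g1 g2 X B)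
   (fun f _ ih g1 g2 X B =>
      fz (bm f) fun b => fz (Nat.lor X (Nat.shiftLeft 1 (rk f))) fun X' => red B b fun w => Bool.rec
        (fz (Nat.lor g1 b) fun g1' => fz (Nat.lor g2 (Nat.land g1 b)) fun g2' => ih g1' g2' X' (List.cons w B))
        true (Nat.beq w 0)) L

def go (T nc : ℕ) (L : List F7) : Bool := start T nc L 0 0 0 []

theorem code_land : ∀ (f : F7) (v : Fin 7), (Nat.land (code f) (2 ^ (v:ℕ)) = 0) ↔ v ∈ f := by decide +kernel
theorem utab_spec : ∀ f : F7, Nat.land (Nat.shiftRight utab (Nat.mul 8 (35 * f.card + rk f))) 255 = code f := by decide +kernel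

/-- correctness of the tables -/
def tabOK (T nc k : ℕ) : Prop := ∀ r : F7, r.card + 1 = k →
  (List.range nc).map (fun j => (Nat.land (ent T (Nat.add (Nat.mul nc (rk r)) j)) 34359738367, Nat.shiftRight (ent T (Nat.add (Nat.mul nc (rk r)) j)) 35))
  = (((List.finRange 7).filter (fun v => v ∉ r)).reverse).map (fun v => (bm (insert v r), rk (insert v r)))

theorem tab2_ok : tabOK tab2 6 2 := by unfold tabOK; decide +kernel
theorem tab3_ok : tabOK tab3 5 3 := by unfold tabOK; decide +kernel
theorem tab4_ok : tabOK tab4 4 4 := by unfold tabOK; decide +kernel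
theorem tab5_ok : tabOK tab5 3 5 := by unfold tabOK; decide +kernel
theorem tab6_ok : tabOK tab6 2 6 := by unfold tabOK; decide +kernel

theorem code_inj {f g : F7} (h : code f = code g) : f = g := by
  ext v; rw [← code_land f v, ← code_land g v, h]

theorem rk_inj {f g : F7} (hc : f.card = g.card) (h : rk f = rk g) : f = g := by
  apply code_inj; rw [← utab_spec f, ← utab_spec g, hc, h]

theorem testBit_sum {ι : Type*} [DecidableEq ι] (s : Finset ι) (e : ι → ℕ) (he : Set.InjOn e s) (t : ℕ) :
    (∑ i ∈ s, 2 ^ e i).testBit t = true ↔ ∃ i ∈ s, e i = t := by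
  rw [← Nat.mem_bitIndices, ← List.mem_toFinset, ← sum_image (f := fun n => 2 ^ n) he, toFinset_bitIndices_sum_two_pow]
  simp

theorem bm_bit (f : F7) (t : ℕ) : (bm f).testBit t = true ↔ ∃ v ∈ f, rk (f.erase v) = t := by
  refine testBit_sum f (fun v => rk (f.erase v)) (fun v hv w hw h => ?_) t
  have := rk_inj (by rw [card_erase_of_mem hv, card_erase_of_mem hw]) h
  by_contra hne
  have h1 : w ∈ f.erase v := mem_erase.2 ⟨fun e => hne e.symm, hw⟩
  rw [this] at h1; simp at h1

/-- a set of `k`-faces without free ridges and without cycles -/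
structure Bad (k : ℕ) (T : Finset F7) : Prop where
  card : ∀ f ∈ T, f.card = k
  free : ∀ f ∈ T, ∀ v ∈ f, ∃ g ∈ T, g ≠ f ∧ f.erase v ⊆ g
  ind : ∀ f ∈ T, bd (sg f) ∉ Submodule.span (ZMod 2) ((fun g => bd (sg g)) '' {g | g ∈ T ∧ g ≠ f})

noncomputable def psi (k n : ℕ) : C (Fin 7) := fun t => if t.card + 1 = k ∧ n.testBit (rk t) = true then 1 else 0

theorem psi_xor (k a b : ℕ) : psi k (Nat.xor a b) = psi k a + psi k b := by
  ext t
  have : (Nat.xor a b).testBit (rk t) = (a.testBit (rk t) ^^ b.testBit (rk t)) := Nat.testBit_xor _ _ _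
  simp only [psi, Pi.add_apply, this]
  by_cases h : t.card + 1 = k <;> cases a.testBit (rk t) <;> cases b.testBit (rk t) <;> simp [h] <;> decide

theorem psi_zero (k : ℕ) : psi k 0 = 0 := by ext t; simp [psi]

theorem psi_bm {k : ℕ} {f : F7} (hf : f.card = k) : psi k (bm f) = bd (sg f) := by
  ext t
  rw [bd_apply]
  simp only [psi, bm_bit]
  by_cases h : ∃ v ∈ f, f.erase v = t
  · obtain ⟨v, hv, rfl⟩ := h
    rw [if_pos ⟨by rw [card_erase_add_one hv, hf], v, hv, rfl⟩, sum_eq_single v]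
    · simp [sg, insert_erase hv]
    · intro w hw hne
      have : insert w (f.erase v) ≠ f := fun e => by
        rw [← e] at hv; simp [hne.symm] at hv
      simp [sg, Pi.single_apply, this]
    · simp
  · rw [if_neg, sum_eq_zero]
    · intro w hw
      have : insert w t ≠ f := fun e => h ⟨w, by simp [← e], by rw [← e, erase_insert (by simpa using hw)]⟩
      simp [sg, Pi.single_apply, this]
    · rintro ⟨hc, v, hv, hr⟩
      exact h ⟨v, hv, rk_inj (by rw [← Nat.add_right_cancel_iff (n := 1), card_erase_add_one hv, hf, hc]) hr⟩

theorem redv_cons (b : ℕ) (B : List ℕ) (v : ℕ) :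
    redv (b :: B) v = fz (redv B v) (fun w => fz (Nat.xor w b) (fun u => Bool.rec w u (Nat.ble u w))) := rfl

theorem loop_succ (T g1 g2 : ℕ) (B : List ℕ) (rec : ℕ → ℕ → ℕ → List ℕ → Bool) (base j X : ℕ) :
    loop T g1 g2 B rec base (j + 1) X = fz (ent T (Nat.add base j)) fun P => fz (Nat.shiftLeft 1 (Nat.shiftRight P 35)) fun fb =>
      Bool.rec (loop T g1 g2 B rec base j X)
        (fz (Nat.land P 34359738367) fun b => fz (Nat.lor X fb) fun X' => red B b fun w => Bool.rec
          (Bool.rec false (loop T g1 g2 B rec base j X') (fz (Nat.lor g1 b) fun g1' => fz (Nat.lor g2 (Nat.land g1 b)) fun g2' => rec g1' g2' X' (List.cons w B)))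
          (loop T g1 g2 B rec base j X') (Nat.beq w 0))
        (Nat.beq (Nat.land X fb) 0) := rfl

theorem srch_succ (T nc fuel g1 g2 X : ℕ) (B : List ℕ) :
    srch T nc (fuel + 1) g1 g2 X B = fz (Nat.xor g1 g2) fun fr => Bool.rec
       (fz (Nat.mul nc (Nat.log2 fr)) fun base => loop T g1 g2 B (srch T nc fuel) base nc X)
       false (Nat.beq fr 0) := rfl

theorem start_cons (T nc : ℕ) (f : F7) (L : List F7) (g1 g2 X : ℕ) (B : List ℕ) :
    start T nc (f :: L) g1 g2 X B = fz (bm f) fun b => fz (Nat.lor X (Nat.shiftLeft 1 (rk f))) fun X' => red B b fun w => Bool.rec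
        (fz (Nat.lor g1 b) fun g1' => fz (Nat.lor g2 (Nat.land g1 b)) fun g2' => start T nc L g1' g2' X' (List.cons w B))
        true (Nat.beq w 0) := rfl

theorem nbeq {a b : ℕ} : Nat.beq a b = true ↔ a = b := by rw [Nat.beq_eq]

theorem red_eq (B : List ℕ) (v : ℕ) (k : ℕ → Bool) : red B v k = k (redv B v) := fz_eq _ _

theorem redv_spec (k : ℕ) (S : Submodule (ZMod 2) (C (Fin 7))) (v : ℕ) : ∀ B : List ℕ, (∀ b ∈ B, psi k b ∈ S) →
    psi k (redv B v) + psi k v ∈ S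
  | [], _ => by
    change psi k v + psi k v ∈ S
    rw [add_self_C]; exact S.zero_mem
  | b :: B, h => by
    have ih := redv_spec k S v B (fun b hb => h b (List.mem_cons_of_mem _ hb))
    have e : redv (b :: B) v = Bool.rec (redv B v) (Nat.xor (redv B v) b) (Nat.ble (Nat.xor (redv B v) b) (redv B v)) := by
      rw [redv_cons, fz_eq, fz_eq]
    rw [e]
    cases Nat.ble (Nat.xor (redv B v) b) (redv B v)
    · exact ih
    · change psi k (Nat.xor (redv B v) b) + psi k v ∈ S
      rw [psi_xor, add_right_comm]
      exact S.add_mem ih (h b List.mem_cons_self)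

/-- invariant of the search -/
structure Inv (k : ℕ) (T I : Finset F7) (g1 g2 X : ℕ) (B : List ℕ) : Prop where
  sub : I ⊆ T
  h1 : ∀ t, g1.testBit t = true ↔ ∃ f ∈ I, (bm f).testBit t = true
  h2 : ∀ t, g2.testBit t = true ↔ ∃ f ∈ I, ∃ g ∈ I, f ≠ g ∧ (bm f).testBit t = true ∧ (bm g).testBit t = true
  hX : ∀ f ∈ T, X.testBit (rk f) = true → f ∈ I
  hB : ∀ b ∈ B, psi k b ∈ Submodule.span (ZMod 2) ((fun g => bd (sg g)) '' {g | g ∈ I})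

theorem Inv.dep {k : ℕ} {T I : Finset F7} {g1 g2 X : ℕ} {B : List ℕ} (hT : Bad k T) (h : Inv k T I g1 g2 X B) {f : F7}
    (hf : f ∈ T) (hfI : f ∉ I) : redv B (bm f) ≠ 0 := by
  intro h0
  have := redv_spec k _ (bm f) B h.hB
  rw [h0, psi_zero, zero_add, psi_bm (hT.card f hf)] at this
  have hsub : {g | g ∈ I} ⊆ {g | g ∈ T ∧ g ≠ f} := fun g hg => ⟨h.sub hg, fun e => hfI (e ▸ hg)⟩
  exact hT.ind f hf (Submodule.span_mono (Set.image_mono hsub) this)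

theorem Inv.step {k : ℕ} {T I : Finset F7} {g1 g2 X : ℕ} {B : List ℕ} (hT : Bad k T) (h : Inv k T I g1 g2 X B) {f : F7}
    (hf : f ∈ T) (hfI : f ∉ I) : Inv k T (insert f I) (Nat.lor g1 (bm f)) (Nat.lor g2 (Nat.land g1 (bm f)))
      (Nat.lor X (Nat.shiftLeft 1 (rk f))) (redv B (bm f) :: B) := by
  have t1 : ∀ a b t, (Nat.lor a b).testBit t = (a.testBit t || b.testBit t) := fun a b t => Nat.testBit_or a b t
  have t2 : ∀ a b t, (Nat.land a b).testBit t = (a.testBit t && b.testBit t) := fun a b t => Nat.testBit_and a b t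
  have hI : Submodule.span (ZMod 2) ((fun g => bd (sg g)) '' {g | g ∈ I}) ≤ Submodule.span (ZMod 2) ((fun g => bd (sg g)) '' {g | g ∈ insert f I}) :=
    Submodule.span_mono (Set.image_mono fun g hg => mem_insert_of_mem hg)
  refine ⟨insert_subset hf h.sub, fun t => ?_, fun t => ?_, fun g hg => ?_, fun b hb => ?_⟩
  · rw [t1, Bool.or_eq_true, h.h1]
    constructor
    · rintro (⟨g, hg, hgt⟩ | h)
      · exact ⟨g, mem_insert_of_mem hg, hgt⟩
      · exact ⟨f, mem_insert_self _ _, h⟩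
    · rintro ⟨g, hg, hgt⟩
      rcases mem_insert.1 hg with rfl | hg
      · exact Or.inr hgt
      · exact Or.inl ⟨g, hg, hgt⟩
  · rw [t1, t2, Bool.or_eq_true, Bool.and_eq_true, h.h1, h.h2]
    constructor
    · rintro (⟨g, hg, g', hg', hne, ha⟩ | ⟨⟨g, hg, hgt⟩, h⟩)
      · exact ⟨g, mem_insert_of_mem hg, g', mem_insert_of_mem hg', hne, ha⟩
      · exact ⟨f, mem_insert_self _ _, g, mem_insert_of_mem hg, by rintro rfl; exact hfI hg, h, hgt⟩
    · rintro ⟨g, hg, g', hg', hne, ha, hb⟩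
      rcases mem_insert.1 hg with hg1 | hg1
      · rcases mem_insert.1 hg' with hg2 | hg2
        · exact absurd (hg1.trans hg2.symm) hne
        · exact Or.inr ⟨⟨g', hg2, hb⟩, hg1 ▸ ha⟩
      · rcases mem_insert.1 hg' with hg2 | hg2
        · exact Or.inr ⟨⟨g, hg1, ha⟩, hg2 ▸ hb⟩
        · exact Or.inl ⟨g, hg1, g', hg2, hne, ha, hb⟩
  · rw [t1, Bool.or_eq_true]
    rintro (h' | h')
    · exact mem_insert_of_mem (h.hX g hg h')
    · have h' : (1 <<< rk f).testBit (rk g) = true := h'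
      rw [Nat.shiftLeft_eq, one_mul, Nat.testBit_two_pow] at h'
      have := rk_inj (by rw [hT.card f hf, hT.card g hg]) (of_decide_eq_true h')
      simp [this]
  · rcases List.mem_cons.1 hb with rfl | hb
    · have h1 := hI (redv_spec k _ (bm f) B h.hB)
      have h2 : psi k (bm f) ∈ Submodule.span (ZMod 2) ((fun g => bd (sg g)) '' {g | g ∈ insert f I}) := by
        rw [psi_bm (hT.card f hf)]
        exact Submodule.subset_span ⟨f, mem_insert_self _ _, rfl⟩
      have := Submodule.add_mem _ h1 h2
      rwa [add_assoc, add_self_C, add_zero] at this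
    · exact hI (h.hB b hb)

theorem Inv.setX {k : ℕ} {T I : Finset F7} {g1 g2 X X' : ℕ} {B : List ℕ} (h : Inv k T I g1 g2 X B)
    (hX : ∀ f ∈ T, X'.testBit (rk f) = true → f ∈ I) : Inv k T I g1 g2 X' B := ⟨h.sub, h.h1, h.h2, hX, h.hB⟩

theorem loop_sound {k : ℕ} {T I : Finset F7} {g1 g2 : ℕ} {B : List ℕ} {tb base : ℕ} (hT : Bad k T)
    (rec : ℕ → ℕ → ℕ → List ℕ → Bool)
    (hrec : ∀ I g1 g2 X B, Inv k T I g1 g2 X B → rec g1 g2 X B = true → False) (F : ℕ → F7) : ∀ (nc : ℕ)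
    (hF : ∀ j < nc, (F j).card = k ∧ Nat.land (ent tb (Nat.add base j)) 34359738367 = bm (F j) ∧ Nat.shiftRight (ent tb (Nat.add base j)) 35 = rk (F j))
    (X : ℕ) (h : Inv k T I g1 g2 X B) (hl : loop tb g1 g2 B rec base nc X = true) (j : ℕ) (hj : j < nc) (hjT : F j ∈ T), F j ∈ I
  | 0, _, _, _, _, j, hj, _ => absurd hj (Nat.not_lt_zero _)
  | nc + 1, hF, X, h, hl, j, hj, hjT => by
    obtain ⟨hc, h1, h2⟩ := hF nc (Nat.lt_succ_self _)
    have ih := loop_sound (I := I) (g1 := g1) (g2 := g2) (B := B) (tb := tb) (base := base) hT rec hrec F nc (fun j hj => hF j (Nat.lt_succ_of_lt hj))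
    have e : loop tb g1 g2 B rec base (nc + 1) X = Bool.rec (loop tb g1 g2 B rec base nc X)
        (Bool.rec
          (Bool.rec false (loop tb g1 g2 B rec base nc (Nat.lor X (Nat.shiftLeft 1 (rk (F nc)))))
            (rec (Nat.lor g1 (bm (F nc))) (Nat.lor g2 (Nat.land g1 (bm (F nc)))) (Nat.lor X (Nat.shiftLeft 1 (rk (F nc)))) (redv B (bm (F nc)) :: B)))
          (loop tb g1 g2 B rec base nc (Nat.lor X (Nat.shiftLeft 1 (rk (F nc))))) (Nat.beq (redv B (bm (F nc))) 0))
        (Nat.beq (Nat.land X (Nat.shiftLeft 1 (rk (F nc)))) 0) := by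
      rw [loop_succ]
      simp only [fz_eq, red_eq, h1, h2]
    rw [e] at hl
    have hnew : (F nc ∈ T → F nc ∈ I) → loop tb g1 g2 B rec base nc (Nat.lor X (Nat.shiftLeft 1 (rk (F nc)))) = true → F j ∈ I := by
      intro hn hl
      rcases Nat.lt_succ_iff_lt_or_eq.1 hj with hj | rfl
      · refine ih _ (h.setX fun f hf hb => ?_) hl j hj hjT
        have hb : (X ||| (1 <<< rk (F nc))).testBit (rk f) = true := hb
        rw [Nat.testBit_or, Bool.or_eq_true] at hb
        rcases hb with hb | hb
        · exact h.hX f hf hb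
        · rw [Nat.shiftLeft_eq, one_mul, Nat.testBit_two_pow] at hb
          have := rk_inj (by rw [hc, hT.card f hf]) (of_decide_eq_true hb)
          subst this; exact hn hf
      · exact hn hjT
    rcases hx : Nat.beq (Nat.land X (Nat.shiftLeft 1 (rk (F nc)))) 0 with _ | _
    · rw [hx] at hl
      rcases Nat.lt_succ_iff_lt_or_eq.1 hj with hj | rfl
      · exact ih X h hl j hj hjT
      · refine h.hX _ hjT ?_
        by_contra hb
        have : X &&& (1 <<< rk (F j)) = 0 := by
          rw [Nat.shiftLeft_eq, one_mul, Nat.and_two_pow, Bool.eq_false_iff.2 hb]; simp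
        have h3 : Nat.beq (Nat.land X (Nat.shiftLeft 1 (rk (F j)))) 0 = true := nbeq.2 this
        rw [hx] at h3; cases h3
    · rw [hx] at hl
      rcases hw : Nat.beq (redv B (bm (F nc))) 0 with _ | _
      · rw [hw] at hl
        rcases hr : rec (Nat.lor g1 (bm (F nc))) (Nat.lor g2 (Nat.land g1 (bm (F nc)))) (Nat.lor X (Nat.shiftLeft 1 (rk (F nc)))) (redv B (bm (F nc)) :: B) with _ | _
        · rw [hr] at hl; cases hl
        · rw [hr] at hl
          refine hnew (fun hn => ?_) hl
          by_contra hni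
          exact hrec _ _ _ _ _ (h.step hT hn hni) hr
      · rw [hw] at hl
        refine hnew (fun hn => ?_) hl
        by_contra hni
        exact h.dep hT hn hni (nbeq.1 hw)

theorem srch_sound {k : ℕ} {T : Finset F7} {tb nc : ℕ} (hT : Bad k T) (htb : tabOK tb nc k) : ∀ (fuel : ℕ) (I : Finset F7) (g1 g2 X : ℕ)
    (B : List ℕ), Inv k T I g1 g2 X B → srch tb nc fuel g1 g2 X B = true → False
  | 0, _, _, _, _, _, _, h => by cases h
  | fuel + 1, I, g1, g2, X, B, hI, h => by
    have ih := srch_sound hT htb fuel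
    have e : srch tb nc (fuel + 1) g1 g2 X B = Bool.rec (loop tb g1 g2 B (srch tb nc fuel) (Nat.mul nc (Nat.log2 (Nat.xor g1 g2))) nc X)
        false (Nat.beq (Nat.xor g1 g2) 0) := by
      rw [srch_succ]
      simp only [fz_eq]
    rw [e] at h
    rcases hx : Nat.beq (Nat.xor g1 g2) 0 with _ | _
    · rw [hx] at h
      have hne : Nat.xor g1 g2 ≠ 0 := fun e => by rw [nbeq.2 e] at hx; cases hx
      have hbit : (g1 ^^^ g2).testBit (Nat.log2 (Nat.xor g1 g2)) = true := Nat.testBit_log2 hne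
      generalize Nat.log2 (Nat.xor g1 g2) = r at h hbit
      rw [Nat.testBit_xor] at hbit
      have hg2 : ¬ (g2.testBit r = true) := by
        intro h2
        obtain ⟨f, hf, _, _, _, hfr, _⟩ := (hI.h2 r).1 h2
        rw [h2, (hI.h1 r).2 ⟨f, hf, hfr⟩] at hbit; cases hbit
      have hg1 : g1.testBit r = true := by
        simpa [Bool.eq_false_iff.2 hg2] using hbit
      obtain ⟨f, hf, hfr⟩ := (hI.h1 r).1 hg1
      obtain ⟨v, hv, hr⟩ := (bm_bit f r).1 hfr
      have hfT := hI.sub hf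
      obtain ⟨g, hg, hgf, hsub⟩ := hT.free f hfT v hv
      have hρ : (f.erase v).card + 1 = k := by rw [card_erase_add_one hv, hT.card f hfT]
      obtain ⟨w, hw, hgw⟩ : ∃ w, w ∉ f.erase v ∧ insert w (f.erase v) = g := by
        have hlt : (g \ f.erase v).card = 1 := by
          rw [card_sdiff_of_subset hsub, hT.card g hg]; omega
        obtain ⟨w, hw⟩ := card_eq_one.1 hlt
        have hw' : w ∈ g \ f.erase v := by simp [hw]
        refine ⟨w, (mem_sdiff.1 hw').2, ?_⟩
        rw [insert_eq, ← hw, sdiff_union_of_subset hsub]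
      have hL := htb _ hρ
      set L := ((List.finRange 7).filter (fun v' => v' ∉ f.erase v)).reverse with hLd
      have hlen : L.length = nc := by
        have := congrArg List.length hL; simpa using this.symm
      have hmem : ∀ v', v' ∈ L ↔ v' ∉ f.erase v := by intro v'; rw [hLd]; simp [-mem_erase]
      have hF : ∀ j < nc, (insert (L.getD j 0) (f.erase v)).card = k ∧ Nat.land (ent tb (Nat.add (Nat.mul nc r) j)) 34359738367 = bm (insert (L.getD j 0) (f.erase v)) ∧ Nat.shiftRight (ent tb (Nat.add (Nat.mul nc r) j)) 35 = rk (insert (L.getD j 0) (f.erase v)) := by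
        intro j hj
        have hjL : j < L.length := by rw [hlen]; exact hj
        have h1 : L.getD j 0 = L[j] := by simp [hjL]
        have h2 : L[j] ∉ f.erase v := (hmem _).1 (List.getElem_mem hjL)
        refine ⟨by rw [h1, card_insert_of_notMem h2, hρ], ?_⟩
        have h3 := congrArg (fun l : List (ℕ × ℕ) => l[j]?) hL
        simp only [List.getElem?_map, List.getElem?_range hj, List.getElem?_eq_getElem hjL, Option.map_some, Option.some.injEq, Prod.mk.injEq, hr] at h3
        rw [h1]; exact h3
      have key := loop_sound (I := I) hT (srch tb nc fuel) ih (fun j => insert (L.getD j 0) (f.erase v)) nc hF X hI h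
      obtain ⟨j, hj, hjw⟩ := List.getElem_of_mem ((hmem w).2 hw)
      have h1 : L.getD j 0 = w := by simp [hj, hjw]
      have h4 := key j (hlen ▸ hj) (by simp only [h1, hgw]; exact hg)
      simp only [h1, hgw] at h4
      refine hg2 ((hI.h2 r).2 ⟨f, hf, g, h4, hgf.symm, hfr, (bm_bit g r).2 ⟨w, by simp [← hgw], ?_⟩⟩)
      rw [← hgw, erase_insert hw, hr]
    · rw [hx] at h; cases h

theorem start_sound {k : ℕ} {T : Finset F7} {tb nc : ℕ} (hT : Bad k T) (htb : tabOK tb nc k) : ∀ (L : List F7) (I : Finset F7) (g1 g2 X : ℕ)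
    (B : List ℕ), L.Nodup → (∀ f ∈ L, f ∈ T ∧ f ∉ I) → Inv k T I g1 g2 X B → start tb nc L g1 g2 X B = true → False
  | [], I, g1, g2, X, B, _, _, hI, h => srch_sound hT htb 30 I g1 g2 X B hI h
  | f :: L, I, g1, g2, X, B, hnd, hL, hI, h => by
    rw [start_cons] at h
    simp only [fz_eq, red_eq] at h
    obtain ⟨hf, hfI⟩ := hL f List.mem_cons_self
    have hw : Nat.beq (redv B (bm f)) 0 = false := by
      rw [Bool.eq_false_iff]; exact fun e => hI.dep hT hf hfI (nbeq.1 e)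
    rw [hw] at h
    refine start_sound hT htb L _ _ _ _ _ (List.nodup_cons.1 hnd).2 (fun g hg => ⟨(hL g (List.mem_cons_of_mem _ hg)).1, fun hgi => ?_⟩) (hI.step hT hf hfI) h
    rcases mem_insert.1 hgi with rfl | hgi
    · exact (List.nodup_cons.1 hnd).1 hg
    · exact (hL g (List.mem_cons_of_mem _ hg)).2 hgi

/-- no bad set contains `I` -/
def NB (k : ℕ) (I : Finset F7) : Prop := ∀ T, Bad k T → ¬ I ⊆ T

theorem go_sound {k tb nc : ℕ} (htb : tabOK tb nc k) (L : List F7) (hnd : L.Nodup) (h : go tb nc L = true) : NB k L.toFinset := by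
  intro T hT hL
  refine start_sound hT htb L ∅ 0 0 0 [] hnd (fun f hf => ⟨hL (by simpa using hf), by simp⟩) ⟨by simp, by simp, by simp, by simp, by simp⟩ h

theorem NB.step {k : ℕ} {I : Finset F7} (f : F7) (v : Fin 7) (hf : f ∈ I) (hv : v ∈ f)
    (h : ∀ w, w ∉ f → NB k (insert (insert w (f.erase v)) I)) : NB k I := by
  intro T hT hI
  have hfT := hI hf
  obtain ⟨g, hg, hgf, hsub⟩ := hT.free f hfT v hv
  obtain ⟨w, hw, hgw⟩ : ∃ w, w ∉ f.erase v ∧ insert w (f.erase v) = g := by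
    have hlt : (g \ f.erase v).card = 1 := by
      rw [card_sdiff_of_subset hsub, hT.card g hg, card_erase_of_mem hv, hT.card f hfT]
      have := card_pos.2 ⟨v, hv⟩
      rw [hT.card f hfT] at this; omega
    obtain ⟨w, hw⟩ := card_eq_one.1 hlt
    have hw' : w ∈ g \ f.erase v := by simp [hw]
    refine ⟨w, (mem_sdiff.1 hw').2, ?_⟩
    rw [insert_eq, ← hw, sdiff_union_of_subset hsub]
  have hwf : w ∉ f := by
    intro hwf
    have : w = v := by by_contra hne; exact hw (mem_erase.2 ⟨hne, hwf⟩)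
    subst this
    rw [insert_erase hv] at hgw; exact hgf hgw.symm
  exact h w hwf T hT (insert_subset (hgw ▸ hg) hI)

theorem Bad.perm {k : ℕ} {T : Finset F7} (hT : Bad k T) (π : Equiv.Perm (Fin 7)) : Bad k (T.image (Finset.image π)) := by
  have hinj : Function.Injective (Finset.image π : F7 → F7) := image_injective π.injective
  have hcan : ∀ f : F7, (f.image π).image π.symm = f := fun f => by simp [image_image]
  refine ⟨fun f hf => ?_, fun f hf v hv => ?_, fun f hf h => ?_⟩
  · obtain ⟨g, hg, rfl⟩ := mem_image.1 hf
    rw [card_image_of_injective _ π.injective, hT.card g hg]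
  · obtain ⟨g, hg, rfl⟩ := mem_image.1 hf
    obtain ⟨u, hu, rfl⟩ := mem_image.1 hv
    obtain ⟨g', hg', hne, hs⟩ := hT.free g hg u hu
    refine ⟨g'.image π, mem_image_of_mem _ hg', fun e => hne (hinj e), ?_⟩
    rw [← image_erase π.injective]
    exact image_subset_image hs
  · obtain ⟨g, hg, rfl⟩ := mem_image.1 hf
    have hp : ∀ f : F7, psh π.symm (bd (sg (f.image π))) = bd (sg f) := fun f => by
      rw [psh_bd, psh_sg, if_pos π.symm.injective.injOn, hcan]
    refine hT.ind g hg ?_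
    have := Submodule.mem_map_of_mem (f := psh π.symm) h
    rw [hp, Submodule.map_span] at this
    refine Submodule.span_mono ?_ this
    rintro _ ⟨_, ⟨e, ⟨he, hne⟩, rfl⟩, rfl⟩
    obtain ⟨e, he', rfl⟩ := mem_image.1 he
    exact ⟨e, ⟨he', fun h => hne (by rw [h])⟩, (hp e).symm⟩

theorem NB.perm {k : ℕ} {I J : Finset F7} (h : NB k J) (g : Fin 7 → Fin 7) (hg : Function.Injective g := by decide)
    (hJ : ∀ f ∈ J, f.image g ∈ I := by decide +kernel) : NB k I := by
  intro T hT hI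
  let π : Equiv.Perm (Fin 7) := Equiv.ofBijective g (Finite.injective_iff_bijective.1 hg)
  refine h _ (hT.perm π.symm) fun f hf => mem_image.2 ⟨f.image g, hI (hJ f hf), ?_⟩
  rw [image_image]
  have : (π.symm : Fin 7 → Fin 7) ∘ g = id := by
    ext x; exact congrArg _ (π.symm_apply_apply x)
  rw [this, image_id]

end C7

section C8

set_option maxRecDepth 100000

theorem nb3_fin0 : NB 3 ([{0, 1, 3}, {0, 1, 5}, {0, 2, 5}, {1, 2, 5}] : List F7).toFinset :=
  go_sound tab3_ok _ (by decide) (by decide +kernel)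

theorem nb3_fin1 : NB 3 ([{1, 2, 4}, {0, 3, 4}, {2, 3, 4}, {2, 3, 5}] : List F7).toFinset :=
  go_sound tab3_ok _ (by decide) (by decide +kernel)

theorem nb3_2_0 : NB 3 ({{0, 1, 2}, {0, 1, 3}, {0, 2, 3}} : Finset F7) := by
  refine NB.step {0, 1, 2} 0 (by decide) (by decide) fun w hw => ?_
  fin_cases w
  iterate 3 exact absurd (by decide) hw
  · exact (go_sound tab3_ok [{0, 1, 3}, {0, 2, 3}, {0, 1, 2}, {1, 2, 3}] (by decide) (by decide +kernel)).perm id Function.injective_id (by decide +kernel)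
  · exact nb3_fin0.perm ![1, 2, 3, 4, 5, 0, 6]
  · exact nb3_fin0.perm ![1, 2, 3, 5, 4, 0, 6]
  · exact nb3_fin0.perm ![1, 2, 3, 6, 4, 0, 5]

theorem nb3_2_1 : NB 3 ({{0, 1, 2}, {0, 1, 3}, {0, 2, 4}} : Finset F7) := by
  refine NB.step {0, 1, 2} 0 (by decide) (by decide) fun w hw => ?_
  fin_cases w
  iterate 3 exact absurd (by decide) hw
  · exact nb3_fin0.perm ![0, 2, 3, 4, 5, 1, 6]
  · exact nb3_fin0.perm ![0, 1, 4, 3, 5, 2, 6]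
  · exact nb3_fin1.perm ![3, 4, 2, 1, 0, 5, 6]
  · exact nb3_fin1.perm ![3, 4, 2, 1, 0, 6, 5]

theorem nb3_1_0 : NB 3 ({{0, 1, 2}, {0, 1, 3}} : Finset F7) := by
  refine NB.step {0, 1, 2} 1 (by decide) (by decide) fun w hw => ?_
  fin_cases w
  iterate 3 exact absurd (by decide) hw
  · exact nb3_2_0.perm ![0, 1, 2, 3, 4, 5, 6]
  · exact nb3_2_1.perm ![0, 1, 2, 3, 4, 5, 6]
  · exact nb3_2_1.perm ![0, 1, 2, 3, 5, 4, 6]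
  · exact nb3_2_1.perm ![0, 1, 2, 3, 6, 4, 5]

theorem nb3_0_0 : NB 3 ({{0, 1, 2}} : Finset F7) := by
  refine NB.step {0, 1, 2} 2 (by decide) (by decide) fun w hw => ?_
  fin_cases w
  iterate 3 exact absurd (by decide) hw
  · exact nb3_1_0.perm ![0, 1, 2, 3, 4, 5, 6]
  · exact nb3_1_0.perm ![0, 1, 2, 4, 3, 5, 6]
  · exact nb3_1_0.perm ![0, 1, 2, 5, 3, 4, 6]
  · exact nb3_1_0.perm ![0, 1, 2, 6, 3, 4, 5]

theorem nb4_fin0 : NB 4 ([{1, 2, 3, 4}, {0, 2, 3, 6}, {0, 2, 4, 6}, {0, 3, 4, 6}, {2, 3, 4, 6}] : List F7).toFinset :=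
  go_sound tab4_ok _ (by decide) (by decide +kernel)

theorem nb4_fin1 : NB 4 ([{0, 1, 2, 4}, {0, 1, 2, 5}, {0, 1, 4, 5}, {0, 3, 4, 5}, {1, 3, 4, 5}] : List F7).toFinset :=
  go_sound tab4_ok _ (by decide) (by decide +kernel)

theorem nb4_fin2 : NB 4 ([{1, 2, 3, 5}, {0, 1, 4, 5}, {0, 3, 4, 5}, {1, 3, 4, 5}, {1, 3, 4, 6}] : List F7).toFinset :=
  go_sound tab4_ok _ (by decide) (by decide +kernel)

theorem nb4_3_0 : NB 4 ({{0, 1, 2, 3}, {0, 1, 2, 4}, {0, 1, 3, 4}, {0, 2, 3, 4}} : Finset F7) := by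
  refine NB.step {0, 1, 2, 3} 0 (by decide) (by decide) fun w hw => ?_
  fin_cases w
  iterate 4 exact absurd (by decide) hw
  · exact (go_sound tab4_ok [{0, 2, 3, 4}, {0, 1, 2, 4}, {0, 1, 2, 3}, {0, 1, 3, 4}, {1, 2, 3, 4}] (by decide) (by decide +kernel)).perm id Function.injective_id (by decide +kernel)
  · exact nb4_fin0.perm ![4, 5, 1, 2, 3, 6, 0]
  · exact nb4_fin0.perm ![4, 6, 1, 2, 3, 5, 0]

theorem nb4_3_1 : NB 4 ({{0, 1, 2, 3}, {0, 1, 2, 4}, {0, 1, 3, 4}, {0, 2, 3, 5}} : Finset F7) := by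
  refine NB.step {0, 1, 2, 3} 0 (by decide) (by decide) fun w hw => ?_
  fin_cases w
  iterate 4 exact absurd (by decide) hw
  · exact nb4_fin0.perm ![4, 5, 0, 2, 3, 6, 1]
  · exact nb4_fin1.perm ![0, 1, 4, 5, 2, 3, 6]
  · exact nb4_fin2.perm ![4, 2, 5, 3, 1, 0, 6]

theorem nb4_3_2 : NB 4 ({{0, 1, 2, 3}, {0, 1, 2, 4}, {0, 1, 3, 5}, {0, 2, 3, 6}} : Finset F7) := by
  refine NB.step {0, 1, 2, 3} 0 (by decide) (by decide) fun w hw => ?_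
  fin_cases w
  iterate 4 exact absurd (by decide) hw
  · exact nb4_fin2.perm ![4, 0, 5, 3, 2, 1, 6]
  · exact nb4_fin2.perm ![5, 0, 4, 2, 3, 1, 6]
  · exact nb4_fin2.perm ![6, 0, 4, 1, 3, 2, 5]

theorem nb4_2_0 : NB 4 ({{0, 1, 2, 3}, {0, 1, 2, 4}, {0, 1, 3, 4}} : Finset F7) := by
  refine NB.step {0, 1, 2, 3} 1 (by decide) (by decide) fun w hw => ?_
  fin_cases w
  iterate 4 exact absurd (by decide) hw
  · exact nb4_3_0.perm ![0, 1, 2, 3, 4, 5, 6]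
  · exact nb4_3_1.perm ![0, 1, 2, 3, 4, 5, 6]
  · exact nb4_3_1.perm ![0, 1, 2, 3, 4, 6, 5]

theorem nb4_2_1 : NB 4 ({{0, 1, 2, 3}, {0, 1, 2, 4}, {0, 1, 3, 5}} : Finset F7) := by
  refine NB.step {0, 1, 2, 3} 1 (by decide) (by decide) fun w hw => ?_
  fin_cases w
  iterate 4 exact absurd (by decide) hw
  · exact nb4_3_1.perm ![0, 2, 1, 3, 4, 5, 6]
  · exact nb4_3_1.perm ![0, 3, 1, 2, 5, 4, 6]
  · exact nb4_3_2.perm ![0, 1, 2, 3, 4, 5, 6]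

theorem nb4_1_0 : NB 4 ({{0, 1, 2, 3}, {0, 1, 2, 4}} : Finset F7) := by
  refine NB.step {0, 1, 2, 3} 2 (by decide) (by decide) fun w hw => ?_
  fin_cases w
  iterate 4 exact absurd (by decide) hw
  · exact nb4_2_0.perm ![0, 1, 2, 3, 4, 5, 6]
  · exact nb4_2_1.perm ![0, 1, 2, 3, 4, 5, 6]
  · exact nb4_2_1.perm ![0, 1, 2, 3, 4, 6, 5]

theorem nb4_0_0 : NB 4 ({{0, 1, 2, 3}} : Finset F7) := by
  refine NB.step {0, 1, 2, 3} 3 (by decide) (by decide) fun w hw => ?_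
  fin_cases w
  iterate 4 exact absurd (by decide) hw
  · exact nb4_1_0.perm ![0, 1, 2, 3, 4, 5, 6]
  · exact nb4_1_0.perm ![0, 1, 2, 3, 5, 4, 6]
  · exact nb4_1_0.perm ![0, 1, 2, 3, 6, 4, 5]

theorem nb2_0_0 : NB 2 ([{0, 1}] : List F7).toFinset :=
  go_sound tab2_ok _ (by decide) (by decide +kernel)

theorem nb5_0_0 : NB 5 ([{0, 1, 2, 3, 4}] : List F7).toFinset :=
  go_sound tab5_ok _ (by decide) (by decide +kernel)

theorem nb6_0_0 : NB 6 ([{0, 1, 2, 3, 4, 5}] : List F7).toFinset :=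
  go_sound tab6_ok _ (by decide) (by decide +kernel)

end C8

section C9

theorem exists_move {a f : F7} (h : a.card = f.card) : ∃ g : Fin 7 → Fin 7, Function.Injective g ∧ a.image g = f := by
  let e : {x // x ∈ a} ≃ {x // x ∈ f} := Fintype.equivOfCardEq (by simpa using h)
  let p : Equiv.Perm (Fin 7) := e.extendSubtype
  refine ⟨p, p.injective, eq_of_subset_of_card_le (fun x hx => ?_) ?_⟩
  · obtain ⟨y, hy, rfl⟩ := mem_image.1 hx
    exact e.extendSubtype_mem y hy
  · rw [card_image_of_injective _ p.injective, h]

theorem no_bad {k : ℕ} {T : Finset F7} (hT : Bad k T) (hne : T.Nonempty) (hk : 2 ≤ k) : False := by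
  obtain ⟨f, hf⟩ := hne
  have hc := hT.card f hf
  have key : ∀ a : F7, a.card = k → NB k {a} → False := fun a ha h => by
    obtain ⟨g, hg, hgf⟩ := exists_move (ha.trans hc.symm)
    exact h.perm (I := {f}) g hg (by simp [hgf]) T hT (by simpa using hf)
  have hle : k ≤ 7 := by rw [← hc]; exact (card_le_univ f).trans (by simp)
  interval_cases k
  · exact key {0, 1} (by decide) (by simpa using nb2_0_0)
  · exact key {0, 1, 2} (by decide) (by simpa using nb3_0_0)
  · exact key {0, 1, 2, 3} (by decide) (by simpa using nb4_0_0)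
  · exact key {0, 1, 2, 3, 4} (by decide) (by simpa using nb5_0_0)
  · exact key {0, 1, 2, 3, 4, 5} (by decide) (by simpa using nb6_0_0)
  · have hu : ∀ g ∈ T, g = univ := fun g hg => eq_univ_of_card _ (by rw [hT.card g hg]; simp)
    obtain ⟨g, hg, hgf, _⟩ := hT.free f hf 0 (by rw [hu f hf]; simp)
    exact hgf ((hu g hg).trans (hu f hf).symm)

variable {V : Type*} [Fintype V] [DecidableEq V]

theorem bd_top {K : Finset (Finset V)} {e : C V} (he : On (K : Set (Finset V)) e) {f : Finset V} (hf : ∀ s ∈ K, s.card ≤ f.card) :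
    bd e f = 0 := by
  rw [bd_apply]
  refine sum_eq_zero fun v hv => ?_
  by_contra h
  have := hf _ (he _ h)
  rw [card_insert_of_notMem (by simpa using hv)] at this
  omega

theorem bd_sg_erase {f : Finset V} {v : V} (hv : v ∈ f) : bd (sg f) (f.erase v) = 1 := by
  rw [bd_apply, sum_eq_single v]
  · simp [sg, insert_erase hv]
  · intro w hw hne
    have : insert w (f.erase v) ≠ f := fun e => by
      rw [← e] at hv; simp [hne.symm] at hv
    simp [sg, Pi.single_apply, this]
  · simp

theorem bd_sg_self (f : Finset V) : bd (sg f) f = 0 := by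
  rw [bd_apply]
  refine sum_eq_zero fun v hv => ?_
  have : insert v f ≠ f := fun e => by simp at hv; exact hv (e ▸ mem_insert_self _ _)
  simp [sg, Pi.single_apply, this]

/-- either a free ridge or a cycle on the top faces -/
theorem top_alt {K : Finset (Finset V)} {W : Finset V} {e : V → Fin 7} (he : Set.InjOn e W) (hW : ∀ s ∈ K, s ⊆ W) {k : ℕ} (hk : 2 ≤ k)
    {f0 : Finset V} (hf0 : f0 ∈ K) (hfk : f0.card = k) (hmax : ∀ s ∈ K, s.card ≤ k) (hA : Acy (K : Set (Finset V))) :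
    ∃ f ∈ K, f.card = k ∧ ∃ v ∈ f, ∀ g ∈ K, f.erase v ⊆ g → g.card = k → g = f := by
  by_contra hno
  push Not at hno
  have hV : Nonempty V := by
    obtain ⟨v, hv⟩ := card_pos.1 (show 0 < f0.card by omega); exact ⟨v⟩
  let e' : Fin 7 → V := Function.invFunOn e W
  have hee : ∀ s ∈ K, (s.image e).image e' = s := fun s hs => by
    rw [image_image]
    refine (image_congr fun v hv => ?_).trans image_id
    exact he.leftInvOn_invFunOn (hW s hs hv)
  have hinj : ∀ s ∈ K, Set.InjOn e s := fun s hs => he.mono (hW s hs)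
  have hp : ∀ s ∈ K, psh e' (bd (sg (s.image e))) = bd (sg s) := fun s hs => by
    rw [psh_bd, psh_sg, if_pos, hee s hs]
    intro a ha b hb hab
    obtain ⟨x, hx, rfl⟩ := mem_image.1 (mem_coe.1 ha)
    obtain ⟨y, hy, rfl⟩ := mem_image.1 (mem_coe.1 hb)
    have h1 : e' (e x) = x := he.leftInvOn_invFunOn (hW s hs hx)
    have h2 : e' (e y) = y := he.leftInvOn_invFunOn (hW s hs hy)
    rw [h1, h2] at hab; rw [hab]
  set T := K.filter fun s => s.card = k with hTd
  have hTK : ∀ s, s ∈ T ↔ s ∈ K ∧ s.card = k := fun s => by simp [hTd]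
  refine no_bad (k := k) (T := T.image (Finset.image e)) ⟨fun f hf => ?_, fun f hf v hv => ?_, fun f hf h => ?_⟩
    ⟨_, mem_image_of_mem _ ((hTK f0).2 ⟨hf0, hfk⟩)⟩ hk
  · obtain ⟨g, hg, rfl⟩ := mem_image.1 hf
    rw [card_image_of_injOn (hinj g ((hTK g).1 hg).1), ((hTK g).1 hg).2]
  · obtain ⟨g, hg, rfl⟩ := mem_image.1 hf
    obtain ⟨u, hu, rfl⟩ := mem_image.1 hv
    obtain ⟨g', hg', hs, hc, hne⟩ := hno g ((hTK g).1 hg).1 ((hTK g).1 hg).2 u hu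
    refine ⟨g'.image e, mem_image_of_mem _ ((hTK g').2 ⟨hg', hc⟩), fun h => hne ?_, fun a ha => ?_⟩
    · rw [← hee g' hg', h, hee g ((hTK g).1 hg).1]
    · obtain ⟨h1, h2⟩ := mem_erase.1 ha
      obtain ⟨y, hy, rfl⟩ := mem_image.1 h2
      exact mem_image_of_mem _ (hs (mem_erase.2 ⟨fun h => h1 (by rw [h]), hy⟩))
  · obtain ⟨g, hg, rfl⟩ := mem_image.1 hf
    have hgK := ((hTK g).1 hg).1
    have := Submodule.mem_map_of_mem (f := psh e') h
    rw [hp g hgK, Submodule.map_span] at this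
    let S : Submodule (ZMod 2) (C V) :=
      { carrier := {c | On (K : Set (Finset V)) c ∧ c g = 0}
        add_mem' := fun {a b} ha hb => ⟨ha.1.add hb.1, by rw [Pi.add_apply, ha.2, hb.2, add_zero]⟩
        zero_mem' := ⟨On.zero _, rfl⟩
        smul_mem' := fun r a ha => ⟨ha.1.smul r, by rw [Pi.smul_apply, ha.2, smul_zero]⟩ }
    have hle : Submodule.span (ZMod 2) (psh e' '' ((fun g => bd (sg g)) '' {g' | g' ∈ T.image (Finset.image e) ∧ g' ≠ g.image e})) ≤ S.map bd := by
      rw [Submodule.span_le]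
      rintro _ ⟨_, ⟨a, ⟨ha, hne⟩, rfl⟩, rfl⟩
      obtain ⟨a, ha', rfl⟩ := mem_image.1 ha
      have haK := ((hTK a).1 ha').1
      refine ⟨sg a, ⟨On.sg haK, ?_⟩, (hp a haK).symm⟩
      have : g ≠ a := fun h => hne (by rw [h])
      simp [sg, Pi.single_apply, this]
    obtain ⟨c, ⟨hc1, hc2⟩, hc3⟩ := hle this
    obtain ⟨d, hd, hdb⟩ := hA (c + sg g) ⟨hc1.add (On.sg hgK), by rw [map_add, hc3, add_self_C]⟩
    have h1 := bd_top hd (f := g) (by rw [((hTK g).1 hg).2]; exact hmax)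
    rw [hdb, Pi.add_apply, hc2, zero_add] at h1
    simp [sg] at h1

theorem coll_acy {W : Finset V} {e : V → Fin 7} (he : Set.InjOn e W) : ∀ (N : ℕ) (K : Finset (Finset V)), K.card = N →
    CX (K : Set (Finset V)) → (∀ s ∈ K, s ⊆ W) → Acy (K : Set (Finset V)) → ∃ y, Coll y (K.erase ∅) := by
  intro N
  induction N using Nat.strong_induction_on with
  | _ N ih =>
  intro K hN hK hW hA
  have hE : ∅ ∈ K := hK.emp
  obtain ⟨v0, hv0⟩ : ∃ v, {v} ∈ K := by
    obtain ⟨d, hd, hdb⟩ := hA (sg ∅) ⟨On.sg hE, by rw [bd_sg]; simp⟩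
    have h1 : bd d ∅ = 1 := by rw [hdb]; simp [sg]
    rw [bd_apply] at h1
    obtain ⟨v, _, hv⟩ := exists_ne_zero_of_sum_ne_zero (by rw [h1]; decide : ∑ v ∈ (∅ : Finset V)ᶜ, d (insert v ∅) ≠ 0)
    exact ⟨v, hd _ hv⟩
  obtain ⟨f0, hf0, hmax⟩ := exists_max_image K Finset.card ⟨_, hE⟩
  have h1 : 1 ≤ f0.card := by simpa using hmax _ hv0
  rcases Nat.lt_or_ge f0.card 2 with hk | hk
  · refine ⟨v0, ?_⟩
    have : K.erase ∅ = {{v0}} := by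
      ext s
      rw [mem_erase, mem_singleton]
      constructor
      · rintro ⟨hs0, hs⟩
        have hc : s.card = 1 := by
          have := hmax s hs; have := card_pos.2 (nonempty_iff_ne_empty.2 hs0); omega
        obtain ⟨w, rfl⟩ := card_eq_one.1 hc
        by_contra hne
        have hcyc : bd (sg {v0} + sg {w}) = (0 : C V) := by
          rw [map_add, bd_sg, bd_sg]; simp [add_self_C]
        obtain ⟨d, hd, hdb⟩ := hA _ ⟨(On.sg hv0).add (On.sg hs), hcyc⟩
        have h2 := bd_top hd (f := {v0}) (fun s hs => by have := hmax s hs; simp; omega)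
        rw [hdb, Pi.add_apply] at h2
        have hne' : v0 ≠ w := fun h => hne (by rw [h])
        simp [sg, Pi.single_apply, hne'] at h2
      · rintro rfl; exact ⟨by simp, hv0⟩
    rw [this]; exact Coll.base
  · obtain ⟨σ, hσ, hσk, v, hv, hfree⟩ := top_alt he hW hk hf0 rfl hmax hA
    have hτK : σ.erase v ∈ K := hK.down σ hσ _ (erase_subset _ _)
    have hτc : (σ.erase v).card + 1 = f0.card := by rw [card_erase_add_one hv, hσk]
    have hne : σ.erase v ≠ σ := fun h => by rw [h] at hτc; omega
    have hfree' : ∀ g ∈ K, σ.erase v ⊆ g → g = σ.erase v ∨ g = σ := by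
      intro g hg hs
      by_cases h : g.card = f0.card
      · exact Or.inr (hfree g hg hs h)
      · refine Or.inl (eq_of_subset_of_card_le hs ?_).symm
        have := hmax g hg; omega
    set K' := (K.erase σ).erase (σ.erase v) with hK'
    have hm : ∀ s, s ∈ K' ↔ s ∈ K ∧ s ≠ σ ∧ s ≠ σ.erase v := fun s => by
      rw [hK']; simp only [mem_erase]; tauto
    have hτ0 : (σ.erase v).Nonempty := card_pos.1 (by omega)
    have hCX : CX (K' : Set (Finset V)) := by
      refine ⟨(hm _).2 ⟨hE, fun h => by rw [← h] at hv; simp at hv, hτ0.ne_empty.symm⟩, fun s hs t ht => ?_⟩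
      obtain ⟨h1, h2, h3⟩ := (hm s).1 hs
      refine (hm t).2 ⟨hK.down s h1 t ht, fun h => ?_, fun h => ?_⟩
      · subst h
        rcases hfree' s h1 ((erase_subset _ _).trans ht) with h | h
        · exact h3 h
        · exact h2 h
      · subst h
        rcases hfree' s h1 ht with h | h
        · exact h3 h
        · exact h2 h
    have hA' : Acy (K' : Set (Finset V)) := by
      intro c hc
      have hK'K : (K' : Set (Finset V)) ⊆ K := fun s hs => ((hm s).1 hs).1
      have hcτ : c (σ.erase v) = 0 := by
        by_contra h; exact ((hm _).1 (hc.1 _ h)).2.2 rfl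
      obtain ⟨d, hd, hdb⟩ := hA c (hc.mono hK'K)
      have hdσ : d σ = 0 := by
        rw [← hdb, bd_apply, sum_eq_single v] at hcτ
        · rwa [insert_erase hv] at hcτ
        · intro w hw hwv
          by_contra h
          have hw : w ∉ σ.erase v := by simpa only [mem_compl] using hw
          rcases hfree' _ (hd _ h) (subset_insert _ _) with h | h
          · exact hw (h ▸ mem_insert_self _ _)
          · exact hw (mem_erase.2 ⟨hwv, h ▸ mem_insert_self _ _⟩)
        · simp
      have fin : ∀ d' : C V, On (K : Set (Finset V)) d' → d' σ = 0 → d' (σ.erase v) = 0 → On (K' : Set (Finset V)) d' :=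
        fun d' h1 h2 h3 s hs => (hm s).2 ⟨h1 s hs, fun h => hs (h ▸ h2), fun h => hs (h ▸ h3)⟩
      rcases zmod2_cases (d (σ.erase v)) with h | h
      · exact ⟨d, fin d hd hdσ h, hdb⟩
      · refine ⟨d + bd (sg σ), fin _ (hd.add (bd_on hK (On.sg hσ))) ?_ ?_, ?_⟩
        · rw [Pi.add_apply, hdσ, bd_sg_self, add_zero]
        · rw [Pi.add_apply, h, bd_sg_erase hv]; decide
        · rw [map_add, bd_bd, add_zero, hdb]
    have hlt : K'.card < N := by
      rw [← hN]
      exact card_lt_card ⟨fun s hs => ((hm s).1 hs).1, fun h => ((hm σ).1 (h hσ)).2.1 rfl⟩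
    obtain ⟨y, hy⟩ := ih _ hlt K' rfl hCX (fun s hs => hW s ((hm s).1 hs).1) hA'
    refine ⟨y, ?_⟩
    have := Coll.step _ (σ.erase v) σ hy hτ0 ((erase_subset _ _).ssubset_of_ne hne)
      (fun h => ((hm _).1 (mem_erase.1 h).2).2.2 rfl) (fun h => ((hm _).1 (mem_erase.1 h).2).2.1 rfl)
      (fun ρ h1 h2 h3 => mem_erase.2 ⟨h2.ne_empty, (hm ρ).2 ⟨hK.down σ hσ ρ h1.1, h1.ne, h3⟩⟩)
      (fun ρ h1 ρ' h2 h3 => mem_erase.2 ⟨h3.ne_empty, hCX.down ρ (mem_erase.1 h1).2 ρ' h2⟩)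
    convert this using 1
    ext s
    simp only [mem_erase, mem_insert, hm]
    constructor
    · rintro ⟨h1, h2⟩; tauto
    · rintro (rfl | rfl | ⟨h1, h2, _⟩)
      · exact ⟨hτ0.ne_empty, hτK⟩
      · exact ⟨fun h => by rw [h] at hv; simp at hv, hσ⟩
      · exact ⟨h1, h2⟩

end C9

section HZ

variable {V : Type*} [Fintype V] [DecidableEq V]

/-- integral ordered chains -/
abbrev Zt (V : Type*) (m : ℕ) := (Fin m → V) → ℤ

noncomputable def zb {m : ℕ} : Zt V (m + 1) →ₗ[ℤ] Zt V m :=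
  Fintype.linearCombination ℤ fun x => ∑ i : Fin (m + 1), (-1 : ℤ) ^ (i : ℕ) • Pi.single (i.removeNth x) (1 : ℤ)

noncomputable def zs {m : ℕ} (x : Fin m → V) : Zt V m := Pi.single x 1

theorem zb_zs {m : ℕ} (x : Fin (m + 1) → V) : zb (zs x) = ∑ i : Fin (m + 1), (-1 : ℤ) ^ (i : ℕ) • zs (i.removeNth x) := by
  rw [zb, zs, Fintype.linearCombination_apply_single, one_smul]; rfl

theorem zt_eq {m : ℕ} (c : Zt V m) : c = ∑ x, c x • zs x := by
  ext y; simp [Finset.sum_apply, zs, Pi.single_apply]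

theorem zt_ext {m : ℕ} {A : Type*} [AddCommGroup A] {L L' : Zt V m →ₗ[ℤ] A} (h : ∀ x, L (zs x) = L' (zs x)) (c : Zt V m) : L c = L' c := by
  rw [zt_eq c, map_sum, map_sum]
  exact sum_congr rfl fun x _ => by rw [map_smul, map_smul, h]

theorem zb_apply {m : ℕ} (c : Zt V (m + 1)) (y : Fin m → V) :
    zb c y = ∑ i : Fin (m + 1), (-1 : ℤ) ^ (i : ℕ) * ∑ v, c (i.insertNth v y) := by
  let L : Zt V (m + 1) →ₗ[ℤ] ℤ :=
    { toFun := fun c => ∑ i : Fin (m + 1), (-1 : ℤ) ^ (i : ℕ) * ∑ v, c (i.insertNth v y)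
      map_add' := fun c c' => by simp [sum_add_distrib, mul_add]
      map_smul' := fun r c => by
        simp only [Pi.smul_apply, smul_eq_mul, ← mul_sum, RingHom.id_apply]
        rw [mul_sum]; exact sum_congr rfl fun i _ => by ring }
  refine zt_ext (L := (LinearMap.proj y) ∘ₗ zb) (L' := L) (fun x => ?_) c
  rw [LinearMap.comp_apply, zb_zs]
  change (∑ i : Fin (m + 1), (-1 : ℤ) ^ (i : ℕ) • zs (i.removeNth x)) y = ∑ i : Fin (m + 1), (-1 : ℤ) ^ (i : ℕ) * ∑ v, zs x (i.insertNth v y)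
  rw [Finset.sum_apply]
  refine sum_congr rfl fun i _ => ?_
  rw [Pi.smul_apply, smul_eq_mul]
  congr 1
  by_cases h : i.removeNth x = y
  · rw [sum_eq_single (x i)]
    · subst h; simp [zs]
    · intro v _ hv
      have : i.insertNth v y ≠ x := fun e => hv (by rw [← e]; simp)
      simp [zs, Pi.single_apply, this]
    · simp
  · rw [sum_eq_zero]
    · have h' : ¬ y = i.removeNth x := fun e => h e.symm
      simp [zs, Pi.single_apply, h']
    · intro v _
      have : i.insertNth v y ≠ x := fun e => h (by rw [← e]; simp)
      simp [zs, Pi.single_apply, this]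

/-- prepend a vertex -/
noncomputable def zh {m : ℕ} (v : V) : Zt V m →ₗ[ℤ] Zt V (m + 1) :=
  Fintype.linearCombination ℤ fun x => zs (Fin.cons v x)

theorem zh_zs {m : ℕ} (v : V) (x : Fin m → V) : zh v (zs x) = zs (Fin.cons v x : Fin (m + 1) → V) := by
  rw [zh, zs, Fintype.linearCombination_apply_single, one_smul]

theorem zb_zh0 (v : V) (c : Zt V 0) : zb (zh v c) = c := by
  refine zt_ext (L := zb ∘ₗ zh v) (L' := LinearMap.id) (fun x => ?_) c
  simp only [LinearMap.comp_apply, LinearMap.id_apply, zh_zs, zb_zs]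
  simp [Subsingleton.elim (Fin.removeNth 0 (Fin.cons v x : Fin 1 → V)) x]

theorem zb_zh {m : ℕ} (v : V) (c : Zt V (m + 1)) : zb (zh v c) = c - zh v (zb c) := by
  refine zt_ext (L := zb ∘ₗ zh v) (L' := LinearMap.id - zh v ∘ₗ zb) (fun x => ?_) c
  simp only [LinearMap.comp_apply, LinearMap.sub_apply, LinearMap.id_apply, zh_zs, zb_zs, map_sum]
  rw [Fin.sum_univ_succ, sub_eq_add_neg, ← sum_neg_distrib]
  congr 1
  · simp [Fin.removeNth_zero]
  · refine sum_congr rfl fun i _ => ?_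
    rw [map_smul, zh_zs, Fin.val_succ, pow_succ, mul_neg_one, neg_smul]
    congr 3
    ext j
    refine Fin.cases ?_ (fun j => ?_) j
    · simp [Fin.removeNth]
    · simp [Fin.removeNth]

theorem zb_zb : ∀ {m : ℕ} (c : Zt V (m + 2)), zb (zb c) = 0
  | 0, c => by
    refine zt_ext (L := zb ∘ₗ zb) (L' := 0) (fun x => ?_) c
    simp only [LinearMap.comp_apply, LinearMap.zero_apply]
    rw [← Fin.cons_self_tail x, ← zh_zs, zb_zh, map_sub, zb_zh0, sub_self]
  | m + 1, c => by
    refine zt_ext (L := zb ∘ₗ zb) (L' := 0) (fun x => ?_) c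
    simp only [LinearMap.comp_apply, LinearMap.zero_apply]
    rw [← Fin.cons_self_tail x, ← zh_zs, zb_zh, map_sub, zb_zh, zb_zb, map_zero, sub_zero, sub_self]

/-- projection to mod two chains -/
def pt {m : ℕ} (x : Fin m → V) : C V := if (univ.image x).card = m then sg (univ.image x) else 0

def zpi {m : ℕ} (c : Zt V m) : C V := ∑ x, (c x : ZMod 2) • pt x

theorem zpi_add {m : ℕ} (c c' : Zt V m) : zpi (c + c') = zpi c + zpi c' := by
  simp [zpi, sum_add_distrib, add_smul]

theorem zpi_zs {m : ℕ} (x : Fin m → V) : zpi (zs x) = pt x := by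
  rw [zpi, sum_eq_single x] <;> simp +contextual [zs, Pi.single_apply]

theorem zpi_smul {m : ℕ} (k : ℤ) (c : Zt V m) : zpi (k • c) = (k : ZMod 2) • zpi c := by
  simp [zpi, smul_sum, mul_smul]

theorem zpi_two {m : ℕ} (c : Zt V m) : zpi ((2 : ℤ) • c) = 0 := by
  rw [zpi_smul]
  have : ((2 : ℤ) : ZMod 2) = 0 := by decide
  rw [this, zero_smul]

noncomputable def zpiL {m : ℕ} : Zt V m →+ C V := AddMonoidHom.mk' zpi zpi_add

theorem pt_bd {m : ℕ} (x : Fin (m + 1) → V) : ∑ i : Fin (m + 1), pt (i.removeNth x) = bd (pt x) := by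
  have himg : ∀ i : Fin (m + 1), insert (x i) (univ.image (i.removeNth x)) = univ.image x := by
    intro i; ext v
    simp only [mem_insert, mem_image, mem_univ, true_and]
    constructor
    · rintro (rfl | ⟨j, rfl⟩)
      · exact ⟨i, rfl⟩
      · exact ⟨_, rfl⟩
    · rintro ⟨j, rfl⟩
      by_cases h : j = i
      · left; rw [h]
      · obtain ⟨k, rfl⟩ := Fin.exists_succAbove_eq h
        right; exact ⟨k, rfl⟩
  by_cases hx : Function.Injective x
  · have hc : (univ.image x).card = m + 1 := by rw [card_image_of_injective _ hx]; simp
    rw [pt, if_pos hc, bd_sg, sum_image hx.injOn]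
    refine sum_congr rfl fun i _ => ?_
    have hi : x i ∉ univ.image (i.removeNth x) := by
      intro h
      obtain ⟨j, _, hj⟩ := mem_image.1 h
      exact Fin.succAbove_ne i j (hx hj)
    have he : (univ.image x).erase (x i) = univ.image (i.removeNth x) := by
      rw [← himg i, erase_insert hi]
    rw [he, pt, if_pos]
    rw [← he, card_erase_of_mem (mem_image_of_mem _ (mem_univ _)), hc]; rfl
  · have hc : (univ.image x).card ≠ m + 1 := by
      intro h
      apply hx
      have : (univ.image x).card = (univ : Finset (Fin (m + 1))).card := by simpa using h
      exact fun a b hab => (card_image_iff.1 this) (by simp) (by simp) hab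
    rw [pt, if_neg hc, map_zero]
    have : ∃ a b, x a = x b ∧ a ≠ b := by
      simpa [Function.Injective] using hx
    obtain ⟨a, b, hab, hne⟩ := this
    have h0 : ∀ i, i ≠ a → i ≠ b → pt (i.removeNth x) = 0 := by
      intro i ha hb
      rw [pt, if_neg]
      intro h
      have h' : (univ.image (i.removeNth x)).card = (univ : Finset (Fin m)).card := by simpa using h
      have hinj := card_image_iff.1 h'
      obtain ⟨a', rfl⟩ := Fin.exists_succAbove_eq ha.symm
      obtain ⟨b', rfl⟩ := Fin.exists_succAbove_eq hb.symm
      have : a' = b' := hinj (by simp) (by simp) hab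
      exact hne (by rw [this])
    have hmem : ∀ a b, x a = x b → a ≠ b → univ.image (a.removeNth x) = univ.image x := by
      intro a b hab hne
      rw [← himg a, insert_eq_of_mem]
      obtain ⟨b', rfl⟩ := Fin.exists_succAbove_eq hne.symm
      exact mem_image.2 ⟨b', mem_univ _, hab.symm⟩
    rw [← sum_subset (subset_univ {a, b}), sum_pair hne]
    · have : pt (a.removeNth x) = pt (b.removeNth x) := by
        rw [pt, pt, hmem a b hab hne, hmem b a hab.symm hne.symm]
      rw [this, add_self_C]
    · intro i _ hi
      simp only [mem_insert, mem_singleton, not_or] at hi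
      exact h0 i hi.1 hi.2

theorem zpi_zb {m : ℕ} (c : Zt V (m + 1)) : zpi (zb c) = bd (zpi c) := by
  refine zt_ext (L := (zpiL.comp (zb (V := V) (m := m)).toAddMonoidHom).toIntLinearMap)
    (L' := ((bd (V := V)).toAddMonoidHom.comp (zpiL (m := m + 1))).toIntLinearMap) (fun x => ?_) c
  change zpi (zb (zs x)) = bd (zpi (zs x))
  rw [zb_zs, zpi_zs, ← pt_bd]
  change zpiL _ = _
  rw [map_sum]
  refine sum_congr rfl fun i _ => ?_
  change zpi _ = _
  rw [zpi_smul, zpi_zs]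
  have : (((-1 : ℤ) ^ (i : ℕ) : ℤ) : ZMod 2) = 1 := by
    push_cast
    have : (-1 : ZMod 2) = 1 := by decide
    rw [this, one_pow]
  rw [this, one_smul]

def zOn (K : Set (Finset V)) {m : ℕ} (c : Zt V m) : Prop := ∀ x, c x ≠ 0 → univ.image x ∈ K

theorem zpi_on {K : Set (Finset V)} {m : ℕ} {c : Zt V m} (h : zOn K c) : On K (zpi c) := by
  refine On.sum fun x _ => ?_
  by_cases hx : c x = 0
  · rw [hx]; simp; exact On.zero K
  · refine On.smul ?_ _
    rw [pt]; split_ifs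
    · exact On.sg (h x hx)
    · exact On.zero K

/-- the integral homology hypothesis -/
structure ZS (d : ℕ) (K : Set (Finset V)) : Prop where
  h0 : ∀ c : Zt V 0, ∃ c' : Zt V 1, zOn K c' ∧ zb c' = c
  h1 : ∀ (m : ℕ) (c : Zt V (m + 1)), m ≠ d → zOn K c → zb c = 0 → ∃ c' : Zt V (m + 2), zOn K c' ∧ zb c' = c
  h2 : ∃ z : Zt V (d + 1), zOn K z ∧ zb z = 0 ∧ (∀ z' : Zt V (d + 1), zOn K z' → zb z' = 0 →
    ∃ k : ℤ, ∃ c : Zt V (d + 2), zOn K c ∧ zb c = z' - k • z) ∧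
    ∀ k : ℤ, (∃ c : Zt V (d + 2), zOn K c ∧ zb c = k • z) → k = 0

end HZ

section HZ2

variable {V : Type*} [Fintype V] [DecidableEq V] [LinearOrder V]

theorem ins_mono {m : ℕ} {y : Fin m → V} (hy : StrictMono y) {v : V} (hv : v ∉ univ.image y) :
    ∃ i : Fin (m + 1), ∀ j : Fin (m + 1), StrictMono (j.insertNth v y : Fin (m + 1) → V) ↔ j = i := by
  have hc : (insert v (univ.image y)).card = m + 1 := by
    rw [card_insert_of_notMem hv, card_image_of_injective _ hy.injective]; simp
  let x := (insert v (univ.image y)).orderEmbOfFin hc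
  have hx : ∀ z : Fin (m + 1) → V, StrictMono z → (∀ i, z i ∈ insert v (univ.image y)) → z = x := fun z h1 h2 =>
    orderEmbOfFin_unique hc h2 h1
  obtain ⟨i, hi⟩ : ∃ i, x i = v := by
    have : v ∈ Set.range x := by rw [range_orderEmbOfFin]; simp
    exact this
  have hxs : StrictMono x := x.strictMono
  have hrem : i.removeNth x = y := by
    have hyc : (univ.image y).card = m := by rw [card_image_of_injective _ hy.injective]; simp
    have e1 := orderEmbOfFin_unique hyc (f := y) (fun i => mem_image_of_mem _ (mem_univ _)) hy
    have e2 := orderEmbOfFin_unique hyc (f := i.removeNth x) (fun j => ?_) (hxs.comp (Fin.strictMono_succAbove i))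
    · rw [e1, e2]
    · have h1 : x (i.succAbove j) ∈ insert v (univ.image y) := orderEmbOfFin_mem _ _ _
      rcases mem_insert.1 h1 with h | h
      · exact absurd (hxs.injective (h.trans hi.symm)) (Fin.succAbove_ne i j)
      · exact h
  have hins : (i.insertNth v y : Fin (m + 1) → V) = x := by
    rw [← hrem, ← hi]; exact Fin.insertNth_self_removeNth i x
  refine ⟨i, fun j => ⟨fun h => ?_, fun h => ?_⟩⟩
  · have := hx _ h (fun k => by
      by_cases hk : k = j
      · subst hk; simp
      · obtain ⟨k', rfl⟩ := Fin.exists_succAbove_eq hk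
        rw [Fin.insertNth_apply_succAbove]; simp)
    have h1 : x j = v := by rw [← this]; simp
    exact hxs.injective (h1.trans hi.symm)
  · subst h; rw [hins]; exact hxs

open Classical in
/-- lift of a mod two chain -/
noncomputable def lft (m : ℕ) (c : C V) : Zt V m := fun x => if StrictMono x then ((c (univ.image x)).val : ℤ) else 0

theorem lft_on {K : Set (Finset V)} {c : C V} (h : On K c) (m : ℕ) : zOn K (lft m c) := by
  intro x hx
  refine h _ fun h0 => hx ?_
  simp [lft, h0]

theorem lft_zpi {m : ℕ} {c : C V} (hc : ∀ s, c s ≠ 0 → s.card = m) : zpi (lft m c) = c := by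
  ext s
  rw [zpi, Finset.sum_apply]
  by_cases hs : s.card = m
  · rw [sum_eq_single (s.orderEmbOfFin hs : Fin m → V)]
    · have : univ.image (s.orderEmbOfFin hs : Fin m → V) = s := by
        rw [← coe_inj, coe_image, coe_univ, Set.image_univ, range_orderEmbOfFin]
      simp [lft, pt, this, hs, sg, (s.orderEmbOfFin hs).strictMono]
    · intro x _ hx
      by_cases h1 : StrictMono x
      · have : univ.image x ≠ s := fun e => hx (orderEmbOfFin_unique hs (fun i => by simp [← e]) h1)
        rw [Pi.smul_apply, pt]
        split_ifs
        · simp [sg, Pi.single_apply, this.symm]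
        · simp
      · simp [lft, h1]
    · simp
  · have : c s = 0 := by by_contra h; exact hs (hc s h)
    rw [this]
    refine sum_eq_zero fun x _ => ?_
    rw [Pi.smul_apply, pt]
    split_ifs with h
    · have : s ≠ univ.image x := fun e => hs (e ▸ h)
      simp [sg, Pi.single_apply, this]
    · simp

theorem lft_zb {m : ℕ} {c : C V} (h : bd c = 0) : ∃ e : Zt V m, zb (lft (m + 1) c) = (2 : ℤ) • e := by
  have key : ∀ y, ((zb (lft (m + 1) c) y : ℤ) : ZMod 2) = 0 := by
    intro y
    have hneg : (-1 : ZMod 2) = 1 := by decide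
    rw [zb_apply]
    push_cast
    simp only [hneg, one_pow, one_mul]
    have hterm : ∀ (i : Fin (m + 1)) (v : V), ((lft (m + 1) c (i.insertNth v y) : ℤ) : ZMod 2) =
        open Classical in if StrictMono (i.insertNth v y : Fin (m + 1) → V) then c (insert v (univ.image y)) else 0 := by
      intro i v
      have himg : univ.image (i.insertNth v y : Fin (m + 1) → V) = insert v (univ.image y) := by
        ext w
        simp only [mem_insert, mem_image, mem_univ, true_and]
        constructor
        · rintro ⟨k, rfl⟩
          by_cases hk : k = i
          · subst hk; simp
          · obtain ⟨k', rfl⟩ := Fin.exists_succAbove_eq hk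
            right; exact ⟨k', by simp⟩
        · rintro (rfl | ⟨k, rfl⟩)
          · exact ⟨i, by simp⟩
          · exact ⟨i.succAbove k, by simp⟩
      rw [lft, himg]
      split_ifs <;> simp
    simp only [hterm]
    rw [sum_comm]
    by_cases hy : StrictMono y
    · have hb := congrFun h (univ.image y)
      rw [bd_apply, Pi.zero_apply] at hb
      rw [← sum_subset (subset_univ (univ.image y)ᶜ)]
      · refine Eq.trans (sum_congr rfl fun v hv => ?_) hb
        obtain ⟨i, hi⟩ := ins_mono hy (by simpa only [mem_compl] using hv)
        simp [hi]
      · intro v _ hv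
        refine sum_eq_zero fun i _ => if_neg fun hs => ?_
        have hv : v ∈ univ.image y := by simpa only [mem_compl, not_not] using hv
        obtain ⟨j, _, hj⟩ := mem_image.1 hv
        have : (i.insertNth v y : Fin (m + 1) → V) (i.succAbove j) = (i.insertNth v y : Fin (m + 1) → V) i := by simp [hj]
        exact Fin.succAbove_ne i j (hs.injective this)
    · refine sum_eq_zero fun v _ => sum_eq_zero fun i _ => if_neg fun hs => hy ?_
      have := hs.comp (Fin.strictMono_succAbove i)
      have e : (i.insertNth v y : Fin (m + 1) → V) ∘ i.succAbove = y := by ext j; simp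
      rwa [e] at this
  have : ∀ y, ∃ k : ℤ, zb (lft (m + 1) c) y = 2 * k := fun y => by
    have := (ZMod.intCast_zmod_eq_zero_iff_dvd _ 2).1 (key y)
    exact_mod_cast this
  choose e he using this
  exact ⟨e, by ext y; simp [he]⟩

theorem zOn.sub {K : Set (Finset V)} {m : ℕ} {c c' : Zt V m} (h : zOn K c) (h' : zOn K c') : zOn K (c - c') := by
  intro x hx
  by_contra hn
  have h1 : c x = 0 := by by_contra h1; exact hn (h x h1)
  have h2 : c' x = 0 := by by_contra h1; exact hn (h' x h1)
  simp [h1, h2] at hx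

theorem zOn.smul {K : Set (Finset V)} {m : ℕ} {c : Zt V m} (h : zOn K c) (k : ℤ) : zOn K (k • c) := by
  intro x hx; refine h x fun h0 => hx ?_; simp [h0]

theorem zb_on {K : Set (Finset V)} (hK : CX K) {m : ℕ} {c : Zt V (m + 1)} (h : zOn K c) : zOn K (zb c) := by
  intro y hy
  rw [zb_apply] at hy
  obtain ⟨i, _, hi⟩ := exists_ne_zero_of_sum_ne_zero hy
  obtain ⟨v, _, hv⟩ := exists_ne_zero_of_sum_ne_zero (right_ne_zero_of_mul hi)
  refine hK.down _ (h _ hv) _ fun w hw => ?_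
  obtain ⟨j, _, rfl⟩ := mem_image.1 hw
  exact mem_image.2 ⟨i.succAbove j, mem_univ _, by simp⟩

theorem zpi_sub2 {m : ℕ} (a b : Zt V m) : zpi (a - (2 : ℤ) • b) = zpi a := by
  have h := zpi_add (a - (2 : ℤ) • b) ((2 : ℤ) • b)
  rw [sub_add_cancel, zpi_two, add_zero] at h
  exact h.symm

/-- integral cycle lifting a mod two cycle -/
theorem lift_cyc {d : ℕ} {K : Set (Finset V)} (hK : CX K) (hZ : ZS d K) {m : ℕ} {c : C V} (hc : Zc K c) (hm : ∀ s, c s ≠ 0 → s.card = m + 1) :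
    ∃ u : Zt V (m + 1), zOn K u ∧ zb u = 0 ∧ zpi u = c := by
  suffices H : ∃ e' : Zt V (m + 1), zOn K e' ∧ zb (lft (m + 1) c) = (2 : ℤ) • zb e' by
    obtain ⟨e', h1, h2⟩ := H
    refine ⟨lft (m + 1) c - (2 : ℤ) • e', (lft_on hc.1 _).sub (h1.smul 2), by rw [map_sub, map_smul, h2, sub_self], ?_⟩
    rw [zpi_sub2, lft_zpi hm]
  obtain ⟨e, he⟩ := lft_zb (m := m) hc.2
  have heK : zOn K e := by
    intro y hy
    refine zb_on hK (lft_on hc.1 _) y ?_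
    rw [he]; simpa using hy
  cases m with
  | zero =>
    obtain ⟨e', h1, h2⟩ := hZ.h0 e
    exact ⟨e', h1, by rw [he, h2]⟩
  | succ m =>
    have hz : zb e = 0 := by
      have h1 : (2 : ℤ) • zb e = 0 := by rw [← map_smul, ← he, zb_zb]
      ext y
      have := congrFun h1 y
      simpa using this
    by_cases hmd : m = d
    · subst hmd
      obtain ⟨z, hz1, hz2, hz3, hz4⟩ := hZ.h2
      obtain ⟨k, e', h1, h2⟩ := hz3 e heK hz
      have : 2 * k = 0 := hz4 _ ⟨lft (m + 2) c - (2 : ℤ) • e', (lft_on hc.1 _).sub (h1.smul 2), by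
        rw [map_sub, map_smul, he, h2, smul_sub, sub_sub_cancel, smul_smul]⟩
      have hk : k = 0 := by omega
      rw [hk, zero_smul, sub_zero] at h2
      exact ⟨e', h1, by rw [he, h2]⟩
    · obtain ⟨e', h1, h2⟩ := hZ.h1 m e hmd heK hz
      exact ⟨e', h1, by rw [he, h2]⟩

theorem graded_bd {d : ℕ} {K : Set (Finset V)} (hK : CX K) (hZ : ZS d K) {m : ℕ} (hmd : m ≠ d + 1) {c : C V} (hc : Zc K c)
    (hm : ∀ s, c s ≠ 0 → s.card = m) : Bc K c := by
  cases m with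
  | zero =>
    obtain ⟨e, h1, h2⟩ := hZ.h0 (lft 0 c)
    exact ⟨zpi e, zpi_on h1, by rw [← zpi_zb, h2, lft_zpi hm]⟩
  | succ m =>
    obtain ⟨u, h1, h2, h3⟩ := lift_cyc hK hZ hc hm
    obtain ⟨e, h4, h5⟩ := hZ.h1 m u (by omega) h1 h2
    exact ⟨zpi e, zpi_on h4, by rw [← zpi_zb, h5, h3]⟩

theorem graded_top {d : ℕ} {K : Set (Finset V)} (hK : CX K) (hZ : ZS d K) : ∃ z : C V, ∀ c : C V, Zc K c →
    (∀ s, c s ≠ 0 → s.card = d + 1) → Bc K c ∨ Bc K (c + z) := by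
  obtain ⟨z, hz1, hz2, hz3, _⟩ := hZ.h2
  refine ⟨zpi z, fun c hc hm => ?_⟩
  obtain ⟨u, h1, h2, h3⟩ := lift_cyc hK hZ hc hm
  obtain ⟨k, e, h4, h5⟩ := hz3 u h1 h2
  have h6 : bd (zpi e) = c + (k : ZMod 2) • zpi z := by
    rw [← zpi_zb, h5, ← h3]
    have := zpi_add (u - k • z) (k • z)
    rw [sub_add_cancel, zpi_smul] at this
    rw [this, add_assoc, add_self_C, add_zero]
  rcases zmod2_cases (k : ZMod 2) with h | h
  · left; exact ⟨zpi e, zpi_on h4, by rw [h6, h, zero_smul, add_zero]⟩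
  · right; exact ⟨zpi e, zpi_on h4, by rw [h6, h, one_smul]⟩

def gr (m : ℕ) (c : C V) : C V := fun s => if s.card = m then c s else 0

theorem gr_cyc {K : Set (Finset V)} {c : C V} (hc : Zc K c) (m : ℕ) : Zc K (gr m c) := by
  refine ⟨fun s hs => hc.1 s fun h => hs (by simp [gr, h]), ?_⟩
  ext t
  rw [bd_apply, Pi.zero_apply]
  have hb := congrFun hc.2 t
  rw [bd_apply, Pi.zero_apply] at hb
  by_cases ht : t.card + 1 = m
  · rw [← hb]
    refine sum_congr rfl fun v hv => ?_
    rw [gr, if_pos]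
    rw [card_insert_of_notMem (by simpa using hv), ht]
  · refine sum_eq_zero fun v hv => ?_
    rw [gr, if_neg]
    rw [card_insert_of_notMem (by simpa using hv)]; exact ht

theorem Bc.sum {K : Set (Finset V)} {ι : Type*} (A : Finset ι) (f : ι → C V) (h : ∀ i ∈ A, Bc K (f i)) : Bc K (∑ i ∈ A, f i) := by
  classical
  induction A using Finset.induction_on with
  | empty => exact ⟨0, On.zero K, by simp⟩
  | insert a A ha ih =>
    rw [sum_insert ha]
    exact (h a (mem_insert_self _ _)).add (ih fun i hi => h i (mem_insert_of_mem hi))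

theorem zs_O2 {d : ℕ} {K : Set (Finset V)} (hK : CX K) (hZ : ZS d K) : O2 K := by
  obtain ⟨z, hz⟩ := graded_top hK hZ
  have hg : ∀ (c : C V) m s, gr m c s ≠ 0 → s.card = m := fun c m s hs => by
    by_contra h; exact hs (by simp [gr, h])
  have key : ∀ c, Zc K c → Bc K c ∨ Bc K (c + z) := by
    intro c hc
    have h1 : Bc K (c + gr (d + 1) c) := by
      have : c + gr (d + 1) c = ∑ m ∈ Finset.range (Fintype.card V + 1), if m = d + 1 then 0 else gr m c := by
        ext s
        rw [Finset.sum_apply, Pi.add_apply, sum_eq_single s.card]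
        · by_cases h : s.card = d + 1
          · simp [h, gr]; rcases zmod2_cases (c s) with h | h <;> rw [h] <;> decide
          · simp [h, gr]
        · intro m _ hm; split_ifs <;> simp [gr, hm.symm]
        · intro h; exact absurd (mem_range.2 (Nat.lt_succ_of_le (card_le_univ s))) h
      rw [this]
      refine Bc.sum _ _ fun m _ => ?_
      split_ifs with h
      · exact ⟨0, On.zero K, by simp⟩
      · exact graded_bd hK hZ h (gr_cyc hc m) (hg c m)
    rcases hz _ (gr_cyc hc (d + 1)) (hg c _) with h | h
    · left
      have := h1.add h
      rwa [add_assoc, add_self_C, add_zero] at this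
    · right
      have := h1.add h
      rwa [add_assoc, ← add_assoc (gr (d + 1) c), add_self_C, zero_add] at this
  intro c c' hc hc'
  rcases key c hc with h | h
  · exact Or.inl h
  · rcases key c' hc' with h' | h'
    · exact Or.inr (Or.inl h')
    · right; right
      have := h.add h'
      have e : c + z + (c' + z) = c + c' := by
        rw [add_add_add_comm, add_self_C, add_zero]
      rwa [e] at this

end HZ2

open HomologySpheres

section CE1

/-- a labelled copy of a finite complex, with the empty face added -/
structure Lab {ι V : Type*} [DecidableEq V] (K : Finset (Finset V)) (K0 : Set (Finset ι)) (lab : ι → V) : Prop where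
  inj : Function.Injective lab
  emp : ∅ ∈ K0
  iff : ∀ s : Finset ι, s.Nonempty → (s ∈ K0 ↔ s.image lab ∈ K)
  cov : ∀ t ∈ K, ∃ s : Finset ι, s.image lab = t

theorem mem_verts {V : Type*} [DecidableEq V] {K : Finset (Finset V)} {v : V} : v ∈ verts K ↔ ∃ t ∈ K, v ∈ t := by
  simp [verts, mem_sup]

def cp {V : Type*} [DecidableEq V] (K : Finset (Finset V)) : Set (Finset {x // x ∈ verts K}) :=
  {s : Finset {x // x ∈ verts K} | s = ∅ ∨ s.image Subtype.val ∈ K}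

theorem Lab.sub {V : Type*} [DecidableEq V] (K : Finset (Finset V)) : Lab K (cp K) Subtype.val where
  inj := Subtype.val_injective
  emp := Or.inl rfl
  iff := fun s hs => ⟨fun h => h.resolve_left hs.ne_empty, Or.inr⟩
  cov := fun t ht => ⟨t.subtype _, by
    ext x; simp only [mem_image, mem_subtype, Subtype.exists, exists_and_left, exists_prop, exists_eq_right_right]
    exact ⟨fun h => h.1, fun h => ⟨h, mem_verts.2 ⟨t, ht, h⟩⟩⟩⟩

theorem Lab.vert {ι V : Type*} [DecidableEq V] {K : Finset (Finset V)} {K0 : Set (Finset ι)} {lab : ι → V} (h : Lab K K0 lab)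
    {s : Finset ι} (hs : s ∈ K0) {i : ι} (hi : i ∈ s) : lab i ∈ verts K :=
  mem_verts.2 ⟨_, (h.iff s ⟨i, hi⟩).1 hs, mem_image_of_mem _ hi⟩

theorem lab_ple {ι κ V W : Type*} [DecidableEq V] [DecidableEq W] [Fintype ι] [Fintype κ] [DecidableEq ι] [DecidableEq κ]
    {K : Finset (Finset V)} {K0 : Set (Finset ι)} {lab : ι → V} (h : Lab K K0 lab)
    {L : Finset (Finset W)} {L0 : Set (Finset κ)} {lab' : κ → W} (h' : Lab L L0 lab') (hI : Iso K L) :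
    ∃ f g, PLE (rz K0) (rz L0) f g := by
  obtain ⟨f, hf, rfl⟩ := hI
  let T : (ι → ℝ) →ₗ[ℝ] (κ → ℝ) :=
    { toFun := fun c j => ∑ i, if f (lab i) = lab' j then c i else 0
      map_add' := fun a b => by
        ext j; simp only [Pi.add_apply]; rw [← sum_add_distrib]
        exact sum_congr rfl fun i _ => by split_ifs <;> simp
      map_smul' := fun r a => by
        ext j; simp only [Pi.smul_apply, smul_eq_mul, RingHom.id_apply]; rw [mul_sum]
        exact sum_congr rfl fun i _ => by split_ifs <;> simp }
  have T_apply : ∀ c j, T c j = ∑ i, if f (lab i) = lab' j then c i else 0 := fun _ _ => rfl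
  have key3 : ∀ c ∈ rz K0, ∀ i, c i ≠ 0 → lab i ∈ verts K := fun c hc i hi => by
    obtain ⟨s, hs, hcs⟩ := mem_rz_iff.1 hc
    exact h.vert hs (by by_contra hn; exact hi (hcs.2 i hn))
  have key1 : ∀ c ∈ rz K0, ∀ i j, lab i ∈ verts K → f (lab i) = lab' j → T c j = c i := fun c hc i j hi hj => by
    rw [T_apply, sum_eq_single i]
    · simp [hj]
    · intro i' _ hne
      split_ifs with e
      · by_contra h0
        exact hne (h.inj (hf (key3 c hc i' h0) hi (e.trans hj.symm)))
      · rfl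
    · simp
  have key2 : ∀ i, lab i ∈ verts K → ∃ j, f (lab i) = lab' j := fun i hi => by
    obtain ⟨t, ht, hit⟩ := mem_verts.1 hi
    obtain ⟨s', hs'⟩ := h'.cov (t.image f) (mem_image_of_mem _ ht)
    have : f (lab i) ∈ s'.image lab' := by rw [hs']; exact mem_image_of_mem _ hit
    obtain ⟨j, _, hj⟩ := mem_image.1 this
    exact ⟨j, hj.symm⟩
  have hinj : Set.InjOn T (rz K0) := by
    intro c hc c' hc' e
    ext i
    by_cases hi : lab i ∈ verts K
    · obtain ⟨j, hj⟩ := key2 i hi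
      rw [← key1 c hc i j hi hj, e, key1 c' hc' i j hi hj]
    · have h1 : c i = 0 := by by_contra h0; exact hi (key3 c hc i h0)
      have h2 : c' i = 0 := by by_contra h0; exact hi (key3 c' hc' i h0)
      rw [h1, h2]
  have himg : T '' rz K0 = rz L0 := by
    ext y; constructor
    · rintro ⟨c, hc, rfl⟩
      obtain ⟨s, hs, hcs⟩ := mem_rz_iff.1 hc
      have hnn : ∀ j, 0 ≤ T c j := fun j => sum_nonneg fun i _ => by split_ifs; exacts [hcs.1 i, le_rfl]
      rcases s.eq_empty_or_nonempty with rfl | hne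
      · refine mem_rz_iff.2 ⟨∅, h'.emp, hnn, fun j _ => sum_eq_zero fun i _ => ?_⟩
        split_ifs; exacts [hcs.2 i (by simp), rfl]
      · have hm : (s.image lab).image f ∈ K.image (Finset.image f) := mem_image_of_mem _ ((h.iff s hne).1 hs)
        obtain ⟨s', hs'⟩ := h'.cov _ hm
        have hne' : s'.Nonempty := by
          rw [← image_nonempty (f := lab'), hs']; exact (hne.image _).image _
        refine mem_rz_iff.2 ⟨s', (h'.iff s' hne').2 (hs' ▸ hm), hnn, fun j hj => sum_eq_zero fun i _ => ?_⟩
        split_ifs with e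
        · by_contra h0
          have hi : i ∈ s := by by_contra hn; exact h0 (hcs.2 i hn)
          have : lab' j ∈ s'.image lab' := by
            rw [hs', ← e]; exact mem_image_of_mem _ (mem_image_of_mem _ hi)
          obtain ⟨j', hj', ej⟩ := mem_image.1 this
          exact hj (h'.inj ej ▸ hj')
        · rfl
    · intro hy
      obtain ⟨s', hs', hc⟩ := mem_rz_iff.1 hy
      rcases s'.eq_empty_or_nonempty with rfl | hne
      · refine ⟨0, mem_rz_iff.2 ⟨∅, h.emp, fun _ => le_rfl, fun _ _ => rfl⟩, ?_⟩
        rw [map_zero]; ext j; exact (hc.2 j (by simp)).symm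
      · obtain ⟨t, ht, e⟩ := mem_image.1 ((h'.iff s' hne).1 hs')
        obtain ⟨s, rfl⟩ := h.cov t ht
        have hsne : s.Nonempty := by
          rw [← image_nonempty (f := lab), ← image_nonempty (f := f), e]; exact hne.image _
        have hs : s ∈ K0 := (h.iff s hsne).2 ht
        let c0 : ι → ℝ := fun i => if i ∈ s then ∑ j, if lab' j = f (lab i) then y j else 0 else 0
        have hc0s : c0 ∈ fcone s := ⟨fun i => by
          simp only [c0]; split_ifs
          · exact sum_nonneg fun j _ => by split_ifs; exacts [hc.1 j, le_rfl]
          · exact le_rfl, fun i hi => by simp [c0, hi]⟩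
        have hc0 : c0 ∈ rz K0 := mem_rz_iff.2 ⟨s, hs, hc0s⟩
        refine ⟨c0, hc0, ?_⟩
        ext j
        by_cases hj : j ∈ s'
        · have : lab' j ∈ (s.image lab).image f := by rw [e]; exact mem_image_of_mem _ hj
          obtain ⟨v, hv, e1⟩ := mem_image.1 this
          obtain ⟨i, hi, rfl⟩ := mem_image.1 hv
          rw [key1 c0 hc0 i j (h.vert hs hi) e1]
          simp only [c0, hi, if_true]
          rw [sum_eq_single j]
          · simp [e1]
          · intro j' _ hne; rw [if_neg]; rw [e1]; exact fun e => hne (h'.inj e)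
          · simp
        · rw [hc.2 j hj, T_apply]
          refine sum_eq_zero fun i _ => ?_
          split_ifs with e1
          · by_contra h0
            have hi : i ∈ s := by by_contra hn; exact h0 (hc0s.2 i hn)
            have : lab' j ∈ s'.image lab' := by
              rw [← e, ← e1]; exact mem_image_of_mem _ (mem_image_of_mem _ hi)
            obtain ⟨j', hj', ej⟩ := mem_image.1 this
            exact hj (h'.inj ej ▸ hj')
          · rfl
  obtain ⟨g, hg⟩ := linbij T hinj himg
  exact ⟨_, g, hg⟩

variable {W : Type*} [Fintype W] [DecidableEq W] {E : Type*} [AddCommGroup E] [Module ℝ E]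

theorem fsum_eq {F : Type*} [AddCommMonoid F] {s : Finset W} {g : W → F} (h : ∀ w, w ∉ s → g w = 0) : ∑ w, g w = ∑ w ∈ s, g w :=
  (sum_subset (subset_univ s) fun w _ hw => h w hw).symm

open Classical in
theorem mem_hull {p : W → E} {s : Finset W} {x : E} : x ∈ convexHull ℝ ((s.image p : Finset E) : Set E) ↔
    ∃ c ∈ fcone s, ∑ w, c w = 1 ∧ ∑ w, c w • p w = x := by
  constructor
  · intro hx
    have : convexHull ℝ ((s.image p : Finset E) : Set E) ⊆ {x | ∃ c ∈ fcone s, ∑ w, c w = 1 ∧ ∑ w, c w • p w = x} := by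
      refine convexHull_min ?_ ?_
      · intro y hy
        obtain ⟨w, hw, rfl⟩ := mem_image.1 (mem_coe.1 hy)
        refine ⟨eb w, eb_fcone hw, by simp [eb], ?_⟩
        simp [eb, Pi.single_apply, ite_smul]
      · rintro _ ⟨c, hc, h1, rfl⟩ _ ⟨c', hc', h1', rfl⟩ a b ha hb hab
        refine ⟨a • c + b • c', ⟨fun v => ?_, fun v hv => ?_⟩, ?_, ?_⟩
        · have := hc.1 v; have := hc'.1 v; simp; positivity
        · simp [hc.2 v hv, hc'.2 v hv]
        · simp [sum_add_distrib, ← mul_sum, h1, h1', hab]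
        · simp [sum_add_distrib, add_smul, mul_smul, smul_sum]
    exact this hx
  · rintro ⟨c, hc, h1, rfl⟩
    rw [fsum_eq (s := s) fun w hw => by simp [hc.2 w hw]]
    rw [fsum_eq (s := s) fun w hw => hc.2 w hw] at h1
    exact (convex_convexHull ℝ _).sum_mem (fun w _ => hc.1 w) h1
      fun w hw => subset_convexHull ℝ _ (mem_coe.2 (mem_image_of_mem _ hw))

open Classical in
theorem aff_iff {p : W → E} {s : Finset W} (hp : Set.InjOn p s) :
    AffineIndependent ℝ (fun x : {y : E // y ∈ s.image p} => (x : E)) ↔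
    ∀ c ∈ fspan s, ∑ w, c w = 0 → ∑ w, c w • p w = 0 → c = 0 := by
  have h1 : AffineIndependent ℝ (fun x : {y : E // y ∈ s.image p} => (x : E)) ↔ AffineIndependent ℝ (fun w : s => p w) := by
    constructor
    · intro h
      exact h.comp_embedding ⟨fun w : s => (⟨p w, mem_image_of_mem _ w.2⟩ : {y : E // y ∈ s.image p}), fun a b e =>
        Subtype.ext (hp a.2 b.2 (congrArg Subtype.val e))⟩
    · intro h
      exact h.range.comp_embedding ⟨fun y : {y : E // y ∈ s.image p} => (⟨y.1, by
        obtain ⟨w, hw, e⟩ := mem_image.1 y.2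
        exact ⟨⟨w, hw⟩, e⟩⟩ : Set.range fun w : s => p w), fun a b e => Subtype.ext (congrArg (Subtype.val (p := fun y => y ∈ Set.range fun w : s => p w)) e)⟩
  rw [h1, affineIndependent_iff]
  constructor
  · intro h c hc h0 hp0
    have := h univ (fun w => c w) (by rw [sum_coe_sort s c, ← fsum_eq hc, h0])
      (by rw [sum_coe_sort s (fun w => c w • p w), ← fsum_eq (fun w hw => by simp [hc w hw]), hp0])
    ext w
    by_cases hw : w ∈ s
    · exact this ⟨w, hw⟩ (mem_univ _)
    · exact hc w hw
  · intro h u a h0 hp0 e he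
    have hsu : s.attach ∩ u = u := inter_eq_right.2 fun x _ => mem_attach _ _
    have hc := h (fun v => if hv : v ∈ s then (if ⟨v, hv⟩ ∈ u then a ⟨v, hv⟩ else 0) else 0) (fun v hv => by simp [hv]) ?_ ?_
    · have := congrFun hc e
      simpa [he] using this
    · rw [fsum_eq (s := s) (fun v hv => by simp [hv]), ← sum_coe_sort]
      simpa [hsu] using h0
    · rw [fsum_eq (s := s) (fun v hv => by simp [hv]), ← sum_coe_sort]
      simpa [ite_smul, hsu] using hp0

end CE1

section CE2
open Classical

theorem fc_zero {W : Type*} [Fintype W] {c : W → ℝ} (h : ∀ w, 0 ≤ c w) (h0 : ∑ w, c w = 0) : c = 0 := by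
  ext w; exact (sum_eq_zero_iff_of_nonneg fun w _ => h w).1 h0 w (mem_univ w)

theorem smul_sum1 {W : Type*} [Fintype W] (r : ℝ) (c : W → ℝ) : ∑ w, (r • c) w = r * ∑ w, c w := by
  simp only [Pi.smul_apply, smul_eq_mul, mul_sum]

theorem g_uniq (G : GComplex) {c c' : {x // x ∈ verts G.faces} → ℝ} (hc : c ∈ rz (cp G.faces)) (hc' : c' ∈ rz (cp G.faces))
    (h1 : ∑ w, c w = ∑ w, c' w) (h2 : ∑ w, c w • w.1 = ∑ w, c' w • w.1) : c = c' := by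
  obtain ⟨s, hs, hcs⟩ := mem_rz_iff.1 hc
  obtain ⟨t, ht, hct⟩ := mem_rz_iff.1 hc'
  by_cases h0 : ∑ w, c w = 0
  · rw [fc_zero hcs.1 h0, fc_zero hct.1 (h1 ▸ h0)]
  have hne : ∀ {s : Finset {x // x ∈ verts G.faces}} {c : {x // x ∈ verts G.faces} → ℝ}, c ∈ fcone s → ∑ w, c w ≠ 0 → s ≠ ∅ := by
    rintro s c hc h rfl
    exact h (sum_eq_zero fun w _ => hc.2 w (by simp))
  have hs' := hs.resolve_left (hne hcs h0)
  have ht' := ht.resolve_left (hne hct (h1 ▸ h0))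
  set r := ∑ w, c w with hr
  have hrp : 0 ≤ r⁻¹ := inv_nonneg.2 (sum_nonneg fun w _ => hcs.1 w)
  have hd : r⁻¹ • c ∈ fcone s := ⟨fun v => mul_nonneg hrp (hcs.1 v), fun v hv => by simp [hcs.2 v hv]⟩
  have hd' : r⁻¹ • c' ∈ fcone t := ⟨fun v => mul_nonneg hrp (hct.1 v), fun v hv => by simp [hct.2 v hv]⟩
  have e1 : ∑ w, (r⁻¹ • c) w = 1 := by rw [smul_sum1, ← hr, inv_mul_cancel₀ h0]
  have e1' : ∑ w, (r⁻¹ • c') w = 1 := by rw [smul_sum1, ← h1, inv_mul_cancel₀ h0]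
  have e2 : ∑ w, (r⁻¹ • c) w • w.1 = ∑ w, (r⁻¹ • c') w • w.1 := by
    simp only [Pi.smul_apply, smul_assoc, ← smul_sum, h2]
  have hx : ∑ w, (r⁻¹ • c) w • w.1 ∈ convexHull ℝ ((s.image Subtype.val : Finset (ℕ → ℝ)) : Set (ℕ → ℝ)) ∩
      convexHull ℝ ((t.image Subtype.val : Finset (ℕ → ℝ)) : Set (ℕ → ℝ)) :=
    ⟨mem_hull.2 ⟨_, hd, e1, rfl⟩, mem_hull.2 ⟨_, hd', e1', e2.symm⟩⟩
  rw [G.glue _ hs' _ ht', ← image_inter _ _ Subtype.val_injective] at hx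
  obtain ⟨ν, hν, n1, n2⟩ := mem_hull.1 hx
  have a1 := (aff_iff (Subtype.val_injective.injOn)).1 (G.indep _ hs') (r⁻¹ • c - ν)
    (fun v hv => by simp [hcs.2 v hv, hν.2 v (by simp [hv])]) (by simp only [Pi.sub_apply, sum_sub_distrib, e1, n1, sub_self])
    (by simp only [Pi.sub_apply, sub_smul, sum_sub_distrib]; rw [n2, sub_self])
  have a2 := (aff_iff (Subtype.val_injective.injOn)).1 (G.indep _ ht') (r⁻¹ • c' - ν)
    (fun v hv => by simp [hct.2 v hv, hν.2 v (by simp [hv])]) (by simp only [Pi.sub_apply, sum_sub_distrib, e1', n1, sub_self])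
    (by simp only [Pi.sub_apply, sub_smul, sum_sub_distrib]; rw [n2, e2, sub_self])
  have := (sub_eq_zero.1 a1).trans (sub_eq_zero.1 a2).symm
  exact smul_right_injective _ (inv_ne_zero h0) this

theorem g_hull (G : GComplex) {t : Finset (ℕ → ℝ)} (ht : t ∈ G.faces) : ∃ s ∈ cp G.faces, s.image Subtype.val = t := by
  obtain ⟨s, rfl⟩ := (Lab.sub G.faces).cov t ht
  exact ⟨s, Or.inr ht, rfl⟩

theorem sub_ple {G' G : GComplex} (h : Subdivides G' G) : ∃ f g, PLE (rz (cp G'.faces)) (rz (cp G.faces)) f g := by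
  obtain ⟨hcar, hsub⟩ := h
  have hcoord : ∀ (G : GComplex) (x : ℕ → ℝ), x ∈ G.carrier →
      ∃ c ∈ rz (cp G.faces), ∑ w, c w = 1 ∧ ∑ w, c w • w.1 = x := fun G x hx => by
    simp only [GComplex.carrier, Set.mem_iUnion] at hx
    obtain ⟨t, ht, hx⟩ := hx
    obtain ⟨s, hs, rfl⟩ := g_hull G ht
    obtain ⟨c, hc, h⟩ := mem_hull.1 hx
    exact ⟨c, mem_rz_iff.2 ⟨s, hs, hc⟩, h⟩
  have hβ : ∀ w : {x // x ∈ verts G'.faces}, ∃ c ∈ rz (cp G.faces), ∑ v, c v = 1 ∧ ∑ v, c v • v.1 = w.1 := fun w => by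
    refine hcoord G _ ?_
    rw [← hcar]
    obtain ⟨t, ht, hw⟩ := mem_verts.1 w.2
    simp only [GComplex.carrier, Set.mem_iUnion]
    exact ⟨t, ht, subset_convexHull ℝ _ (mem_coe.2 hw)⟩
  choose β b1 b2 b3 using hβ
  let φ : ({x // x ∈ verts G'.faces} → ℝ) →ₗ[ℝ] ({x // x ∈ verts G.faces} → ℝ) := Fintype.linearCombination ℝ β
  have hφ : ∀ c v, φ c v = ∑ w, c w * β w v := fun c v => by
    simp [φ, Fintype.linearCombination_apply, Finset.sum_apply]
  have hφe : ∀ w, φ (eb w) = β w := fun w => by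
    ext v; rw [hφ]; simp [eb, Pi.single_apply]
  have s1 : ∀ c, ∑ v, φ c v = ∑ w, c w := fun c => by
    simp only [hφ]; rw [sum_comm]; simp only [← mul_sum, b2, mul_one]
  have s2 : ∀ c, ∑ v, φ c v • v.1 = ∑ w, c w • w.1 := fun c => by
    simp only [hφ, sum_smul]; rw [sum_comm]
    refine sum_congr rfl fun w _ => ?_
    rw [← b3 w, smul_sum]
    simp only [mul_smul]
  have hm : ∀ c ∈ rz (cp G'.faces), φ c ∈ rz (cp G.faces) := fun c hc => by
    obtain ⟨s, hs, hcs⟩ := mem_rz_iff.1 hc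
    rcases hs with rfl | hs
    · have : c = 0 := by ext w; exact hcs.2 w (by simp)
      rw [this, map_zero]
      exact mem_rz_iff.2 ⟨∅, Or.inl rfl, fun _ => le_rfl, fun _ _ => rfl⟩
    · obtain ⟨t, ht, hst⟩ := hsub _ hs
      obtain ⟨t, ht', rfl⟩ := g_hull G ht
      refine mem_rz_iff.2 ⟨t, ht', fcone_lin (fun w hw => ?_) hcs⟩
      rw [hφe]
      have : w.1 ∈ convexHull ℝ ((t.image Subtype.val : Finset (ℕ → ℝ)) : Set (ℕ → ℝ)) :=
        hst (subset_convexHull ℝ _ (mem_coe.2 (mem_image_of_mem _ hw)))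
      obtain ⟨c', hc', h1, h2⟩ := mem_hull.1 this
      rw [g_uniq G (b1 w) (mem_rz_iff.2 ⟨t, ht', hc'⟩) ((b2 w).trans h1.symm) ((b3 w).trans h2.symm)]
      exact hc'
  have hinj : Set.InjOn φ (rz (cp G'.faces)) := fun a ha b hb e =>
    g_uniq G' ha hb (by rw [← s1, e, s1]) (by rw [← s2, e, s2])
  have himg : φ '' rz (cp G'.faces) = rz (cp G.faces) := by
    ext y; constructor
    · rintro ⟨c, hc, rfl⟩; exact hm c hc
    · intro hy
      by_cases h0 : ∑ v, y v = 0
      · refine ⟨0, mem_rz_iff.2 ⟨∅, Or.inl rfl, fun _ => le_rfl, fun _ _ => rfl⟩, ?_⟩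
        rw [map_zero, fc_zero hy.1 h0]
      · set r := ∑ v, y v with hr
        have hrp : 0 ≤ r := sum_nonneg fun w _ => hy.1 w
        have hx : ∑ v, (r⁻¹ • y) v • v.1 ∈ G.carrier := by
          obtain ⟨t, ht, hyt⟩ := mem_rz_iff.1 hy
          have htne : t ≠ ∅ := by rintro rfl; exact h0 (sum_eq_zero fun w _ => hyt.2 w (by simp))
          simp only [GComplex.carrier, Set.mem_iUnion]
          refine ⟨_, ht.resolve_left htne, mem_hull.2 ⟨r⁻¹ • y, ⟨fun v => mul_nonneg (inv_nonneg.2 hrp) (hyt.1 v),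
            fun v hv => by simp [hyt.2 v hv]⟩, by rw [smul_sum1, ← hr, inv_mul_cancel₀ h0], rfl⟩⟩
        rw [← hcar] at hx
        obtain ⟨c, hc, c1, c2⟩ := hcoord G' _ hx
        have hrc : r • c ∈ rz (cp G'.faces) := rz_smul hc hrp
        refine ⟨r • c, hrc, g_uniq G (hm _ hrc) hy ?_ ?_⟩
        · rw [s1, smul_sum1, c1, mul_one, hr]
        · rw [s2]; simp only [Pi.smul_apply, smul_assoc, ← smul_sum] at c2 ⊢
          rw [c2, smul_inv_smul₀ h0]
  obtain ⟨g, hg⟩ := linbij φ hinj himg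
  exact ⟨_, g, hg⟩

theorem iso_of_real {V : Type*} [DecidableEq V] {K : Finset (Finset V)} {G : GComplex} (h : Realizes G K) : Iso K G.faces := h

theorem comb_ple {V W : Type*} [DecidableEq V] [DecidableEq W] {K : Finset (Finset V)} {L : Finset (Finset W)} (h : CombEquiv K L)
    {ι κ : Type*} [Fintype ι] [Fintype κ] [DecidableEq ι] [DecidableEq κ] {K0 : Set (Finset ι)} {lab : ι → V} (hK : Lab K K0 lab)
    {L0 : Set (Finset κ)} {lab' : κ → W} (hL : Lab L L0 lab') : ∃ f g, PLE (rz K0) (rz L0) f g := by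
  obtain ⟨G1, G1', G2, G2', r1, r2, h1, h2, hI⟩ := h
  obtain ⟨_, _, p1⟩ := lab_ple hK (Lab.sub G1.faces) (iso_of_real r1)
  obtain ⟨_, _, p2⟩ := sub_ple h1
  obtain ⟨_, _, p3⟩ := lab_ple (Lab.sub G1'.faces) (Lab.sub G2'.faces) hI
  obtain ⟨_, _, p4⟩ := sub_ple h2
  obtain ⟨_, _, p5⟩ := lab_ple hL (Lab.sub G2.faces) (iso_of_real r2)
  exact ⟨_, _, (((p1.trans p2.symm).trans p3).trans p4).trans p5.symm⟩

/-- the labelled standard sphere -/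
theorem lab_std {d : ℕ} {A : Finset ℕ} (hA : A.card = d + 2) : Lab (stdSphere A) {s : Finset {x // x ∈ A} | s ⊂ univ} Subtype.val where
  inj := Subtype.val_injective
  emp := by
    rw [Set.mem_ofPred_eq, empty_ssubset]
    have : Nonempty {x // x ∈ A} := (card_pos.1 (by omega : 0 < A.card)).to_subtype
    exact univ_nonempty
  iff := fun s hs => by
    have e : s.image Subtype.val = A ↔ s = univ := by
      have : univ.image (Subtype.val : {x // x ∈ A} → ℕ) = A := by ext; simp
      rw [← image_injective Subtype.val_injective |>.eq_iff, this]
    have h2 : s.image Subtype.val ⊆ A := fun x hx => by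
      obtain ⟨y, _, rfl⟩ := mem_image.1 hx; exact y.2
    rw [Set.mem_ofPred_eq, ssubset_univ_iff]
    simp only [stdSphere, mem_erase, mem_powerset, ne_eq, e, h2, image_eq_empty, hs.ne_empty, not_false_eq_true, and_true]
  cov := fun t ht => by
    simp only [stdSphere, mem_erase, mem_powerset] at ht
    refine ⟨t.subtype _, ?_⟩
    ext x; simp only [mem_image, mem_subtype, Subtype.exists, exists_and_left, exists_prop, exists_eq_right_right]
    exact ⟨fun h => h.1, fun h => ⟨h, ht.2.2 h⟩⟩

theorem sph_of_comb {V : Type*} [DecidableEq V] {K : Finset (Finset V)} {d : ℕ} (h : IsCombSphere d K)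
    {ι : Type*} [Fintype ι] [DecidableEq ι] {K0 : Set (Finset ι)} {lab : ι → V} (hK : Lab K K0 lab) : Sph (d + 1) K0 := by
  obtain ⟨A, hA, h⟩ := h
  obtain ⟨_, _, p⟩ := comb_ple h hK (lab_std hA)
  obtain ⟨_, _, q⟩ := sph_bd (A := (univ : Finset {x // x ∈ A})) (n := d + 1) (by simp [hA])
  exact ⟨_, _, p.trans q⟩

end CE2

section CE3
open Classical
variable {W : Type*} [Fintype W] [DecidableEq W] {N : ℕ}

/-- extension by zero -/
noncomputable def ez (N : ℕ) : (Fin N → ℝ) →ₗ[ℝ] (ℕ → ℝ) where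
  toFun := fun y k => if h : k < N then y ⟨k, h⟩ else 0
  map_add' := fun a b => by ext k; simp only [Pi.add_apply]; split_ifs <;> simp
  map_smul' := fun r a => by ext k; simp only [Pi.smul_apply, smul_eq_mul, RingHom.id_apply]; split_ifs <;> simp

theorem ez_inj : Function.Injective (ez N) := fun a b e => by
  ext k
  have := congrFun e k
  simpa [ez] using this

noncomputable def sm (θ : (W → ℝ) →ₗ[ℝ] (Fin N → ℝ)) (w : W) : ℝ := ∑ k, θ (eb w) k
noncomputable def gp (θ : (W → ℝ) →ₗ[ℝ] (Fin N → ℝ)) (w : W) : ℕ → ℝ := ez N ((sm θ w)⁻¹ • θ (eb w))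

theorem sm_sum (θ : (W → ℝ) →ₗ[ℝ] (Fin N → ℝ)) (c : W → ℝ) : ∑ k, θ c k = ∑ w, c w * sm θ w := by
  rw [lin_eb θ c]; simp only [Finset.sum_apply, Pi.smul_apply, smul_eq_mul, sm, mul_sum]
  exact sum_comm

theorem gp_sum (θ : (W → ℝ) →ₗ[ℝ] (Fin N → ℝ)) (c : W → ℝ) : ∑ w, c w • gp θ w = ez N (θ fun w => c w * (sm θ w)⁻¹) := by
  rw [lin_eb θ fun w => c w * (sm θ w)⁻¹, map_sum]
  refine sum_congr rfl fun w _ => ?_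
  rw [gp, map_smul, map_smul, mul_smul]

/-- the finite family of nonempty faces -/
noncomputable def fam (U : Set (Finset W)) : Finset (Finset W) := univ.filter fun s => s ∈ U ∧ s.Nonempty

theorem mem_fam {U : Set (Finset W)} {s : Finset W} : s ∈ fam U ↔ s ∈ U ∧ s.Nonempty := by simp [fam]

structure Emb (U : Set (Finset W)) (θ : (W → ℝ) →ₗ[ℝ] (Fin N → ℝ)) : Prop where
  cx : CX U
  inj : Set.InjOn θ (rz U)
  nn : ∀ c ∈ rz U, ∀ k, 0 ≤ θ c k

theorem Emb.pos {U : Set (Finset W)} {θ : (W → ℝ) →ₗ[ℝ] (Fin N → ℝ)} (h : Emb U θ) {w : W} (hw : {w} ∈ U) : 0 < sm θ w := by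
  refine lt_of_le_of_ne (sum_nonneg fun k _ => h.nn _ (eb_mem hw) k) fun e => eb_ne w ?_
  refine h.inj (eb_mem hw) (rz_zero h.cx) ?_
  rw [map_zero, fc_zero (h.nn _ (eb_mem hw)) e.symm]

theorem Emb.vmem {U : Set (Finset W)} {θ : (W → ℝ) →ₗ[ℝ] (Fin N → ℝ)} (h : Emb U θ) {s : Finset W} (hs : s ∈ U) {w : W}
    (hw : w ∈ s) : {w} ∈ U := h.cx.down _ hs _ (singleton_subset_iff.2 hw)

theorem Emb.pinj {U : Set (Finset W)} {θ : (W → ℝ) →ₗ[ℝ] (Fin N → ℝ)} (h : Emb U θ) : Set.InjOn (gp θ) {w | {w} ∈ U} := by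
  intro w hw w' hw' e
  have e1 := ez_inj e
  rw [← map_smul, ← map_smul] at e1
  have e2 := h.inj (rz_smul (eb_mem hw) (inv_nonneg.2 (h.pos hw).le)) (rz_smul (eb_mem hw') (inv_nonneg.2 (h.pos hw').le)) e1
  by_contra hne
  have := congrFun e2 w
  simp [eb, Pi.single_apply, hne, (h.pos hw).ne'] at this

theorem Emb.hull {U : Set (Finset W)} {θ : (W → ℝ) →ₗ[ℝ] (Fin N → ℝ)} (h : Emb U θ) {s : Finset W} (hs : s ∈ U) {x : ℕ → ℝ} :
    x ∈ convexHull ℝ ((s.image (gp θ) : Finset (ℕ → ℝ)) : Set (ℕ → ℝ)) ↔ ∃ c ∈ fcone s, ∑ k, θ c k = 1 ∧ ez N (θ c) = x := by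
  rw [mem_hull]
  constructor
  · rintro ⟨c, hc, h1, rfl⟩
    refine ⟨fun w => c w * (sm θ w)⁻¹, ⟨fun v => ?_, fun v hv => by simp [hc.2 v hv]⟩, ?_, (gp_sum θ c).symm⟩
    · by_cases hv : v ∈ s
      · exact mul_nonneg (hc.1 v) (inv_nonneg.2 (h.pos (h.vmem hs hv)).le)
      · simp [hc.2 v hv]
    · rw [sm_sum, ← h1]
      refine sum_congr rfl fun w _ => ?_
      by_cases hv : w ∈ s
      · exact inv_mul_cancel_right₀ (h.pos (h.vmem hs hv)).ne' _
      · simp [hc.2 w hv]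
  · rintro ⟨c, hc, h1, rfl⟩
    refine ⟨fun w => c w * sm θ w, ⟨fun v => ?_, fun v hv => by simp [hc.2 v hv]⟩, by rw [← h1, sm_sum], ?_⟩
    · by_cases hv : v ∈ s
      · exact mul_nonneg (hc.1 v) (h.pos (h.vmem hs hv)).le
      · simp [hc.2 v hv]
    · rw [gp_sum]; congr 2; ext w
      by_cases hv : w ∈ s
      · exact mul_inv_cancel_right₀ (h.pos (h.vmem hs hv)).ne' _
      · simp [hc.2 w hv]

theorem Emb.gc {U : Set (Finset W)} {θ : (W → ℝ) →ₗ[ℝ] (Fin N → ℝ)} (h : Emb U θ) (hne : ∃ w, {w} ∈ U) :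
    ∃ G : GComplex, G.faces = (fam U).image (Finset.image (gp θ)) ∧
      G.carrier = {x | ∃ y ∈ θ '' rz U, ∑ k, y k = 1 ∧ ez N y = x} := by
  have hsub : ∀ s ∈ U, (s : Set W) ⊆ {w | {w} ∈ U} := fun s hs w hw => h.vmem hs hw
  refine ⟨⟨(fam U).image (Finset.image (gp θ)), ?_, ?_, ?_, ?_, ?_⟩, rfl, ?_⟩
  · obtain ⟨w, hw⟩ := hne
    exact ⟨_, mem_image_of_mem _ (mem_fam.2 ⟨hw, by simp⟩)⟩
  · intro hm
    obtain ⟨s, hs, e⟩ := mem_image.1 hm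
    exact (mem_fam.1 hs).2.ne_empty (image_eq_empty.1 e)
  · intro a ha t ht hn
    obtain ⟨s, hs, rfl⟩ := mem_image.1 ha
    obtain ⟨t, hts, rfl⟩ := subset_image_iff.1 ht
    exact mem_image_of_mem _ (mem_fam.2 ⟨h.cx.down _ (mem_fam.1 hs).1 _ hts, image_nonempty.1 hn⟩)
  · intro a ha
    obtain ⟨s, hs, rfl⟩ := mem_image.1 ha
    have hs := (mem_fam.1 hs).1
    refine (aff_iff (h.pinj.mono (hsub s hs))).2 fun c hc _ h0 => ?_
    rw [gp_sum] at h0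
    have h1 : θ (fun w => c w * (sm θ w)⁻¹) = 0 := ez_inj (by rw [h0, map_zero])
    obtain ⟨G, hG⟩ := face_inv θ s (h.inj.mono fun c hc => mem_rz_iff.2 ⟨s, hs, hc⟩)
    have h2 := hG (fun w => c w * (sm θ w)⁻¹) (fun v hv => by simp [hc v hv])
    rw [h1, map_zero] at h2
    ext w
    by_cases hw : w ∈ s
    · have := congrFun h2 w
      simp only [Pi.zero_apply] at this
      rcases mul_eq_zero.1 this.symm with h3 | h3
      · exact h3
      · exact absurd (inv_eq_zero.1 h3) (h.pos (h.vmem hs hw)).ne'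
    · exact hc w hw
  · intro a ha b hb
    obtain ⟨s, hs, rfl⟩ := mem_image.1 ha
    obtain ⟨t, ht, rfl⟩ := mem_image.1 hb
    have hs := (mem_fam.1 hs).1
    have ht := (mem_fam.1 ht).1
    have hst : s ∩ t ∈ U := h.cx.down _ hs _ inter_subset_left
    have e : s.image (gp θ) ∩ t.image (gp θ) = (s ∩ t).image (gp θ) := by
      refine (image_inter_of_injOn _ _ (h.pinj.mono ?_)).symm
      exact Set.union_subset (hsub s hs) (hsub t ht)
    rw [e]
    ext x
    rw [Set.mem_inter_iff, h.hull hs, h.hull ht, h.hull hst]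
    constructor
    · rintro ⟨⟨c, hc, h1, rfl⟩, c', hc', h1', e'⟩
      have : c = c' := h.inj (mem_rz_iff.2 ⟨s, hs, hc⟩) (mem_rz_iff.2 ⟨t, ht, hc'⟩) (ez_inj e'.symm)
      subst this
      refine ⟨c, ⟨hc.1, fun v hv => ?_⟩, h1, rfl⟩
      by_cases hv1 : v ∈ s
      · exact hc'.2 v fun hv2 => hv (mem_inter.2 ⟨hv1, hv2⟩)
      · exact hc.2 v hv1
    · rintro ⟨c, hc, h1, rfl⟩
      exact ⟨⟨c, ⟨hc.1, fun v hv => hc.2 v (by simp [hv])⟩, h1, rfl⟩, ⟨c, ⟨hc.1, fun v hv => hc.2 v (by simp [hv])⟩, h1, rfl⟩⟩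
  · ext x
    simp only [GComplex.carrier, Set.mem_iUnion, Set.mem_ofPred_eq]
    constructor
    · rintro ⟨a, ha, hx⟩
      obtain ⟨s, hs, rfl⟩ := mem_image.1 ha
      have hs := (mem_fam.1 hs).1
      obtain ⟨c, hc, h1, h2⟩ := (h.hull hs).1 hx
      exact ⟨θ c, ⟨c, mem_rz_iff.2 ⟨s, hs, hc⟩, rfl⟩, h1, h2⟩
    · rintro ⟨_, ⟨c, hc, rfl⟩, h1, h2⟩
      obtain ⟨s, hs, hc⟩ := mem_rz_iff.1 hc
      have hsn : s.Nonempty := by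
        rw [nonempty_iff_ne_empty]; rintro rfl
        have : c = 0 := by ext w; exact hc.2 w (by simp)
        rw [this] at h1; simp at h1
      exact ⟨_, mem_image_of_mem _ (mem_fam.2 ⟨hs, hsn⟩), (h.hull hs).2 ⟨c, hc, h1, h2⟩⟩

theorem emb_sub {U : Set (Finset W)} {K0 : Set (Finset (Fin N))} {φ : (W → ℝ) →ₗ[ℝ] (Fin N → ℝ)} (hU : CX U) (hK : CX K0)
    (hinj : Set.InjOn φ (rz U)) (himg : φ '' rz U = rz K0) (hne : ∃ w, {w} ∈ U) (hne' : ∃ w, {w} ∈ K0) :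
    ∃ G' G : GComplex, Subdivides G' G ∧ G'.faces = (fam U).image (Finset.image (gp φ)) ∧ Set.InjOn (gp φ) {w | {w} ∈ U} ∧
     ∃ p : Fin N → ℕ → ℝ, Set.InjOn p {w | {w} ∈ K0} ∧ G.faces = (fam K0).image (Finset.image p) := by
  have hm : ∀ c ∈ rz U, φ c ∈ rz K0 := fun c hc => himg ▸ ⟨c, hc, rfl⟩
  have h1 : Emb U φ := ⟨hU, hinj, fun c hc => (hm c hc).1⟩
  have h2 : Emb K0 (LinearMap.id : (Fin N → ℝ) →ₗ[ℝ] (Fin N → ℝ)) := ⟨hK, fun a _ b _ e => e, fun c hc => hc.1⟩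
  obtain ⟨G', f1, c1⟩ := h1.gc hne
  obtain ⟨G, f2, c2⟩ := h2.gc hne'
  refine ⟨G', G, ⟨?_, ?_⟩, f1, h1.pinj, _, h2.pinj, f2⟩
  · rw [c1, c2, himg]; simp
  · rw [f1, f2]
    intro a ha
    obtain ⟨s, hs, rfl⟩ := mem_image.1 ha
    obtain ⟨hs, hsn⟩ := mem_fam.1 hs
    obtain ⟨t, ht, hst⟩ := face_to hK hU hm hs
    have htn : t.Nonempty := by
      rw [nonempty_iff_ne_empty]; rintro rfl
      obtain ⟨w, hw⟩ := hsn
      refine eb_ne w (hinj (eb_mem (h1.vmem hs hw)) (rz_zero hU) ?_)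
      rw [map_zero]; ext k; exact (hst w hw).2 k (by simp)
    refine ⟨_, mem_image_of_mem _ (mem_fam.2 ⟨ht, htn⟩), fun x hx => ?_⟩
    obtain ⟨c, hc, e1, e2⟩ := (h1.hull hs).1 hx
    exact (h2.hull ht).2 ⟨φ c, fcone_lin hst hc, e1, e2⟩

theorem iso_fam {α β : Type*} [DecidableEq α] [DecidableEq β] {U : Set (Finset W)} (hU : CX U) (hne : ∃ w, {w} ∈ U) {a : W → α} {b : W → β}
    (ha : Set.InjOn a {w | {w} ∈ U}) (hb : Set.InjOn b {w | {w} ∈ U}) :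
    Iso ((fam U).image (Finset.image a)) ((fam U).image (Finset.image b)) := by
  obtain ⟨w0, hw0⟩ := hne
  let f : α → β := fun x => if h : ∃ w, {w} ∈ U ∧ a w = x then b h.choose else b w0
  have hf : ∀ w, {w} ∈ U → f (a w) = b w := fun w hw => by
    have h : ∃ w', {w'} ∈ U ∧ a w' = a w := ⟨w, hw, rfl⟩
    simp only [f, h, dif_pos]
    exact congrArg b (ha h.choose_spec.1 hw h.choose_spec.2)
  have hv : ∀ s ∈ U, ∀ w ∈ s, {w} ∈ U := fun s hs w hw => hU.down _ hs _ (singleton_subset_iff.2 hw)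
  refine ⟨f, ?_, ?_⟩
  · have hvv : ∀ x ∈ verts ((fam U).image (Finset.image a)), ∃ w, {w} ∈ U ∧ a w = x := fun x hx => by
      obtain ⟨t, ht, hxt⟩ := mem_verts.1 hx
      obtain ⟨s, hs, rfl⟩ := mem_image.1 ht
      obtain ⟨w, hw, rfl⟩ := mem_image.1 hxt
      exact ⟨w, hv s (mem_fam.1 hs).1 w hw, rfl⟩
    intro x hx y hy e
    obtain ⟨w, hw, rfl⟩ := hvv x hx
    obtain ⟨w', hw', rfl⟩ := hvv y hy
    rw [hf w hw, hf w' hw'] at e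
    rw [hb hw hw' e]
  · rw [image_image]
    refine image_congr fun s hs => ?_
    simp only [Function.comp, image_image]
    exact image_congr fun w hw => (hf w (hv s (mem_fam.1 hs).1 w hw)).symm

theorem lab_fam {V : Type*} [DecidableEq V] {K : Finset (Finset V)} {K0 : Set (Finset W)} {lab : W → V} (h : Lab K K0 lab)
    (he : ∅ ∉ K) : K = (fam K0).image (Finset.image lab) := by
  ext t; constructor
  · intro ht
    obtain ⟨s, rfl⟩ := h.cov t ht
    have : s.Nonempty := by rw [nonempty_iff_ne_empty]; rintro rfl; exact he (by simpa using ht)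
    exact mem_image_of_mem _ (mem_fam.2 ⟨(h.iff s this).2 ht, this⟩)
  · intro ht
    obtain ⟨s, hs, rfl⟩ := mem_image.1 ht
    exact (h.iff s (mem_fam.1 hs).2).1 (mem_fam.1 hs).1

theorem comb_of_ple {V V' : Type*} [DecidableEq V] [DecidableEq V'] {K : Finset (Finset V)} {L : Finset (Finset V')}
    (heK : ∅ ∉ K) (heL : ∅ ∉ L) {n m : ℕ} {K0 : Set (Finset (Fin n))} {L0 : Set (Finset (Fin m))} {lab : Fin n → V} {lab' : Fin m → V'}
    (hK : Lab K K0 lab) (hL : Lab L L0 lab') (cK : CX K0) (cL : CX L0) (hne : ∃ w, {w} ∈ K0) (hne' : ∃ w, {w} ∈ L0)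
    {f g} (h : PLE (rz K0) (rz L0) f g) : CombEquiv K L := by
  obtain ⟨D, ψ, i, e, _⟩ := common cK h
  have hU : ∃ w, {w} ∈ D.U := by
    obtain ⟨w, hw⟩ := hne
    have := eb_mem hw
    rw [← D.es.img] at this
    obtain ⟨c, hc, e⟩ := this
    obtain ⟨s, hs, hcs⟩ := mem_rz_iff.1 hc
    rcases s.eq_empty_or_nonempty with rfl | ⟨u, hu⟩
    · refine absurd ?_ (eb_ne w)
      have : c = 0 := by ext v; exact hcs.2 v (by simp)
      rw [← e, this, map_zero]
    · exact ⟨u, D.es.cx.down _ hs _ (singleton_subset_iff.2 hu)⟩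
  obtain ⟨G1', G1, h1, f1, i1, p1, j1, r1⟩ := emb_sub D.es.cx cK D.es.inj D.es.img hU hne
  obtain ⟨G2', G2, h2, f2, i2, p2, j2, r2⟩ := emb_sub D.es.cx cL i e hU hne'
  refine ⟨G1, G1', G2, G2', ?_, ?_, h1, h2, ?_⟩
  · have := iso_fam cK hne hK.inj.injOn j1
    rw [← lab_fam hK heK, ← r1] at this
    exact this
  · have := iso_fam cL hne' hL.inj.injOn j2
    rw [← lab_fam hL heL, ← r2] at this
    exact this
  · rw [f1, f2]; exact iso_fam D.es.cx hU i1 i2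

theorem comb_of_sph {V : Type*} [DecidableEq V] {K : Finset (Finset V)} (he : ∅ ∉ K) {n d : ℕ} {K0 : Set (Finset (Fin n))} {lab : Fin n → V}
    (hK : Lab K K0 lab) (cK : CX K0) (hne : ∃ w, {w} ∈ K0) (h : Sph (d + 1) K0) : IsCombSphere d K := by
  obtain ⟨_, _, p⟩ := h
  obtain ⟨_, _, q⟩ := sph_bd (A := (univ : Finset (Fin (d + 2)))) (n := d + 1) (by simp)
  have hv : ∀ x : Fin (d + 2), ({x} : Finset (Fin (d + 2))) ⊂ univ := fun x => by
    rw [ssubset_univ_iff]; intro e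
    have := congrArg Finset.card e
    simp at this
  refine ⟨Finset.range (d + 2), by simp, comb_of_ple he (by simp [stdSphere]) hK
    (L0 := {s : Finset (Fin (d + 2)) | s ⊂ univ}) (lab' := fun k => k.1) ⟨?_, ?_, ?_, ?_⟩ cK ⟨?_, ?_⟩ hne ⟨0, hv 0⟩ (p.trans q.symm)⟩
  · exact Fin.val_injective
  · exact (empty_subset _).trans_ssubset (hv 0)
  · intro s hs
    have e0 : univ.image (fun k : Fin (d + 2) => k.1) = Finset.range (d + 2) := by
      ext x; simp only [mem_image, mem_univ, true_and, mem_range]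
      exact ⟨fun ⟨k, hk⟩ => hk ▸ k.2, fun h => ⟨⟨x, h⟩, rfl⟩⟩
    have e : s.image (fun k : Fin (d + 2) => k.1) = Finset.range (d + 2) ↔ s = univ := by
      rw [← image_injective Fin.val_injective |>.eq_iff, ← e0]
    have h2 : s.image (fun k : Fin (d + 2) => k.1) ⊆ Finset.range (d + 2) := by
      rw [← e0]; exact image_subset_image (subset_univ _)
    rw [Set.mem_ofPred_eq, ssubset_univ_iff]
    simp only [stdSphere, mem_erase, mem_powerset, ne_eq, e, h2, image_eq_empty, hs.ne_empty, not_false_eq_true, and_true]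
  · intro t ht
    simp only [stdSphere, mem_erase, mem_powerset] at ht
    refine ⟨univ.filter fun k => k.1 ∈ t, ?_⟩
    ext x; simp only [mem_image, mem_filter, mem_univ, true_and]
    exact ⟨fun ⟨k, hk, e⟩ => e ▸ hk, fun h => ⟨⟨x, mem_range.1 (ht.2.2 h)⟩, h, rfl⟩⟩
  · exact (empty_subset _).trans_ssubset (hv 0)
  · exact fun s hs t hts => hts.trans_ssubset hs

end CE3

section ZT
variable {V : Type*} [DecidableEq V] {n : ℕ} {M : Finset (Finset V)} {lab : Fin n → V} {K0 : Set (Finset (Fin n))}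

/-- pull back an ordered chain along a labelling -/
def pl (lab : Fin n → V) {m : ℕ} (c : (Fin m → V) → ℤ) : Zt (Fin n) m := fun x => c (lab ∘ x)

open Classical in
/-- push an ordered chain forward -/
noncomputable def ps (lab : Fin n → V) {m : ℕ} (c : Zt (Fin n) m) : (Fin m → V) → ℤ := fun y =>
  if h : ∃ x, lab ∘ x = y then c h.choose else 0

theorem pl_ps (hl : Function.Injective lab) {m : ℕ} (c : Zt (Fin n) m) : pl lab (ps lab c) = c := by
  ext x
  have h : ∃ x', lab ∘ x' = lab ∘ x := ⟨x, rfl⟩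
  simp only [pl, ps, h, dif_pos]
  exact congrArg c (hl.comp_left h.choose_spec)

theorem ps_nr {m : ℕ} {c : Zt (Fin n) m} {y : Fin m → V} (h : ¬ ∃ x, lab ∘ x = y) : ps lab c y = 0 := by
  simp only [ps, h, dif_neg, not_false_eq_true]

theorem ins_comp {m : ℕ} (i : Fin (m + 1)) (v : Fin n) (y : Fin m → Fin n) :
    lab ∘ (i.insertNth v y : Fin (m + 1) → Fin n) = (i.insertNth (lab v) (lab ∘ y) : Fin (m + 1) → V) := by
  ext k
  by_cases hk : k = i
  · subst hk; simp
  · obtain ⟨k', rfl⟩ := Fin.exists_succAbove_eq hk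
    simp

theorem pl_zb (hl : Function.Injective lab) (hv : univ.image lab = verts M) {m : ℕ} (c : (Fin (m + 1) → V) → ℤ) :
    zb (pl lab c) = pl lab (zbdry M c) := by
  ext y
  rw [zb_apply]
  simp only [pl, zbdry, ins_comp]
  refine sum_congr rfl fun i _ => ?_
  rw [← hv, sum_image hl.injOn]

theorem ps_zb (hl : Function.Injective lab) (hv : univ.image lab = verts M) {m : ℕ} (c : Zt (Fin n) (m + 1)) :
    zbdry M (ps lab c) = ps lab (zb c) := by
  have e := pl_zb hl hv (ps lab c)
  rw [pl_ps hl, ← pl_ps hl (zb c)] at e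
  ext y
  by_cases hy : ∃ x, lab ∘ x = y
  · obtain ⟨x, rfl⟩ := hy
    exact (congrFun e x).symm
  · rw [ps_nr hy, zbdry]
    refine sum_eq_zero fun i _ => ?_
    rw [sum_eq_zero, mul_zero]
    intro v _
    refine ps_nr ?_
    rintro ⟨x, hx⟩
    refine hy ⟨x ∘ i.succAbove, ?_⟩
    ext j
    have := congrFun hx (i.succAbove j)
    simpa using this

theorem pl_on (h : Lab M K0 lab) {m : ℕ} {c : (Fin m → V) → ℤ} (hc : zchainOK M c) : zOn K0 (pl lab c) := by
  intro x hx
  rcases (univ.image x).eq_empty_or_nonempty with e | hne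
  · rw [e]; exact h.emp
  · rw [h.iff _ hne, image_image]
    rcases hc _ hx with h1 | h1
    · exact h1
    · subst h1; simp at hne

theorem ps_on (h : Lab M K0 lab) {m : ℕ} {c : Zt (Fin n) m} (hc : zOn K0 c) : zchainOK M (ps lab c) := by
  intro y hy
  by_cases hr : ∃ x, lab ∘ x = y
  · obtain ⟨x, rfl⟩ := hr
    have h1 : c x ≠ 0 := by
      have := congrFun (pl_ps h.inj c) x
      rw [← this]; exact hy
    rcases m with _ | m
    · exact Or.inr rfl
    · left
      have := (h.iff _ (univ_nonempty.image x)).1 (hc x h1)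
      rwa [image_image] at this
  · exact absurd (ps_nr hr) hy

theorem ps_pl (h : Lab M K0 lab) {m : ℕ} {c : (Fin m → V) → ℤ} (hc : zchainOK M c) : ps lab (pl lab c) = c := by
  ext y
  by_cases hr : ∃ x, lab ∘ x = y
  · obtain ⟨x, rfl⟩ := hr
    exact congrFun (pl_ps h.inj (pl lab c)) x
  · rw [ps_nr hr]
    by_contra h0
    apply hr
    rcases hc y (Ne.symm h0) with h1 | h1
    · obtain ⟨s, hs⟩ := h.cov _ h1
      have : ∀ j, ∃ i, lab i = y j := fun j => by
        have : y j ∈ s.image lab := by rw [hs]; exact mem_image_of_mem _ (mem_univ j)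
        obtain ⟨i, _, hi⟩ := mem_image.1 this
        exact ⟨i, hi⟩
      choose x hx using this
      exact ⟨x, funext hx⟩
    · subst h1; exact ⟨Fin.elim0, funext fun j => j.elim0⟩

theorem zs_of (h : Lab M K0 lab) (hv : univ.image lab = verts M) {d : ℕ} (hZ : ZHomologySphere d M) : ZS d K0 := by
  have hl := h.inj
  obtain ⟨h0, h1, z, z1, z2, z3⟩ := hZ
  have p0 : ∀ m, ps lab (0 : Zt (Fin n) m) = 0 := fun m => by
    ext y; by_cases hy : ∃ x, lab ∘ x = y
    · obtain ⟨x, rfl⟩ := hy; exact congrFun (pl_ps hl (0 : Zt (Fin n) m)) x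
    · exact ps_nr hy
  refine ⟨fun c => ?_, fun m c hm hc hb => ?_, pl lab z, pl_on h z1, ?_, fun z' hz' hb => ?_, ?_⟩
  · obtain ⟨c', a, b⟩ := h0 (ps lab c)
    exact ⟨pl lab c', pl_on h a, by rw [pl_zb hl hv, b, pl_ps hl]⟩
  · obtain ⟨c', a, b⟩ := h1 m (ps lab c) hm (ps_on h hc) (by rw [ps_zb hl hv, hb, p0])
    exact ⟨pl lab c', pl_on h a, by rw [pl_zb hl hv, b, pl_ps hl]⟩
  · rw [pl_zb hl hv, z2]; rfl
  · obtain ⟨k, ⟨c, a, b⟩, _⟩ := z3 (ps lab z') (ps_on h hz') (by rw [ps_zb hl hv, hb, p0])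
    refine ⟨k, pl lab c, pl_on h a, ?_⟩
    rw [pl_zb hl hv, b]
    have e := pl_ps hl z'
    ext x
    have := congrFun e x
    simp only [pl, Pi.sub_apply, Pi.smul_apply] at this ⊢
    rw [this]
  · rintro k ⟨c, a, b⟩
    obtain ⟨k0, _, u⟩ := z3 0 (fun x hx => absurd rfl hx) (by ext y; simp [zbdry])
    have u0 := u 0 ⟨0, fun x hx => absurd rfl hx, by ext y; simp [zbdry]⟩
    have u1 := u (-k) ⟨ps lab c, ps_on h a, by
      rw [ps_zb hl hv, b]
      have : k • pl lab z = pl lab (k • z) := rfl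
      rw [this, ps_pl h]
      · simp
      · intro x hx; exact z1 x fun e => hx (by simp [e])⟩
    have : -k = 0 := u1.trans u0.symm
    omega

end ZT

section AS

theorem exists_e {n : ℕ} (W : Finset (Fin n)) (h : W.card ≤ 7) : ∃ e : Fin n → Fin 7, Set.InjOn e W := by
  refine ⟨fun v => if hv : v ∈ W then ⟨(W.equivFin ⟨v, hv⟩).1, (W.equivFin ⟨v, hv⟩).2.trans_le h⟩ else 0, ?_⟩
  intro a ha b hb e
  have ha' : a ∈ W := ha
  have hb' : b ∈ W := hb
  simp only [ha', hb', dif_pos, Fin.mk.injEq] at e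
  have := W.equivFin.injective (Fin.ext e)
  exact congrArg Subtype.val this

open Classical in
theorem core {n d : ℕ} {K : Set (Finset (Fin n))} (hK : CX K) (hZ : ZS d K) (hd : 1 ≤ d) (hM : Mfd d K) (hne : ∃ b, {b} ∈ K)
    {A : Finset (Fin n)} {x : Fin n} (hA : ConeOn K A x) (hn : n ≤ A.card + 7) : Sph (d + 1) K := by
  have hg : HG (d + 1) K := hg_step hK hne (zs_O2 hK hZ) (fun b hb => sph_hg (hK.lk hb) (hM b hb)) (fun h => by omega)
  have hac := cone_acy (d + 1) hK hg hA
  obtain ⟨e, he⟩ := exists_e Aᶜ (by rw [card_compl, Fintype.card_fin]; omega)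
  let F : Finset (Finset (Fin n)) := univ.filter fun s => s ∈ K ∧ Disjoint s A
  have hF : (F : Set (Finset (Fin n))) = {s | s ∈ K ∧ Disjoint s A} := by ext s; simp [F]
  have hcx : CX (F : Set (Finset (Fin n))) := by
    rw [hF]
    exact ⟨⟨hK.emp, by simp⟩, fun s hs t hts => ⟨hK.down s hs.1 t hts, disjoint_of_subset_left hts hs.2⟩⟩
  obtain ⟨y, hy⟩ := coll_acy he F.card F rfl hcx (fun s hs => by
    have : Disjoint s A := (by simpa [F] using hs : s ∈ K ∧ Disjoint s A).2
    exact subset_compl_iff_disjoint_right.2 this) (hF ▸ hac)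
  refine U_thm hK hM hA hy fun ρ => ?_
  simp only [mem_erase, F, mem_filter, mem_univ, true_and, nonempty_iff_ne_empty]
  tauto

theorem dim_pos {n d : ℕ} {K : Set (Finset (Fin n))} (hK : CX K) (hZ : ZS d K) (hM : ∀ b, {b} ∈ K → Sph (d - 1 + 1) (Lk K b))
    (hne : ∃ b, {b} ∈ K) : 1 ≤ d := by
  by_contra h
  obtain rfl : d = 0 := by omega
  obtain ⟨b, hb⟩ := hne
  have hg : ∀ b, {b} ∈ K → HG 1 (Lk K b) := fun b hb => sph_hg (hK.lk hb) (hM b hb)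
  refine FF_not (hg b hb) (graded_bd hK hZ (m := 2) (by omega) ⟨FF_on _ _, FF_cyc hK hg⟩ fun s hs => ?_)
  by_contra h2
  exact hs (by simp [FF, h2])

theorem facet_ex {n d : ℕ} {K : Set (Finset (Fin n))} (hK : CX K) (hM : Mfd d K) (hne : ∃ b, {b} ∈ K) : ∃ s ∈ K, s.card = d + 1 := by
  obtain ⟨b, hb⟩ := hne
  by_contra hcon
  push Not at hcon
  refine FF_not (sph_hg (hK.lk hb) (hM b hb)) ?_
  have : FF (d + 1) K = 0 := by
    ext s; simp only [FF, Pi.zero_apply]; rw [if_neg]; exact fun h => hcon s h.1 h.2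
  rw [this]
  exact ⟨0, fun s hs => absurd rfl hs, map_zero _⟩

variable {V : Type*} [DecidableEq V]

theorem lab_link {n : ℕ} {M : Finset (Finset V)} {lab : Fin n → V} {K0 : Set (Finset (Fin n))} (hM : IsComplex M) (h : Lab M K0 lab)
    {b : Fin n} (hb : {b} ∈ K0) : Lab (link M {lab b}) (Lk K0 b) lab where
  inj := h.inj
  emp := ⟨by simp, by simpa using hb⟩
  iff := fun s hs => by
    have e : (insert b s).image lab = s.image lab ∪ {lab b} := by
      rw [image_insert, insert_eq, union_comm]
    have e2 : lab b ∈ s.image lab ↔ b ∈ s := by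
      rw [mem_image]; exact ⟨fun ⟨a, ha, e⟩ => h.inj e ▸ ha, fun h => ⟨b, h, rfl⟩⟩
    simp only [Lk, link, mem_filter, disjoint_singleton_right, Set.mem_ofPred_eq, e2]
    rw [h.iff _ (insert_nonempty _ _), e]
    exact ⟨fun ⟨h1, h2⟩ => ⟨hM.2.2 _ h2 _ subset_union_left (hs.image _), h1, h2⟩, fun h => h.2⟩
  cov := fun t ht => h.cov t (mem_filter.1 ht).1

theorem main_thm (d n : ℕ) (M : Finset (Finset V))
    (hM : IsCombManifold d M) (hn : (verts M).card = n)
    (hsph : ZHomologySphere d M) :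
    (n ≤ d + 8 → IsCombSphere d M) ∧
    (n = d + 9 → ¬ IsCombSphere d M →
      ∀ i < d, ¬ ∃ A : Finset V, BistellarIMove d i M A) := by
  obtain ⟨hC, hL⟩ := hM
  let eq : {x // x ∈ verts M} ≃ Fin n := (verts M).equivFin.trans (finCongr hn)
  let lab : Fin n → V := fun k => (eq.symm k).1
  have hl : Function.Injective lab := Subtype.val_injective.comp eq.symm.injective
  have hr : ∀ v ∈ verts M, ∃ k, lab k = v := fun v hv => ⟨eq ⟨v, hv⟩, by simp [lab]⟩
  have hm : ∀ k, lab k ∈ verts M := fun k => (eq.symm k).2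
  have hv : univ.image lab = verts M := by
    ext v; simp only [mem_image, mem_univ, true_and]
    exact ⟨fun ⟨k, hk⟩ => hk ▸ hm k, hr v⟩
  let K0 : Set (Finset (Fin n)) := {s | s = ∅ ∨ s.image lab ∈ M}
  have hlab : Lab M K0 lab := ⟨hl, Or.inl rfl, fun s hs => ⟨fun h => h.resolve_left hs.ne_empty, Or.inr⟩, fun t ht =>
    ⟨univ.filter fun k => lab k ∈ t, by
      ext v; simp only [mem_image, mem_filter, mem_univ, true_and]
      exact ⟨fun ⟨k, hk, e⟩ => e ▸ hk, fun h => by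
        obtain ⟨k, rfl⟩ := hr v (mem_verts.2 ⟨t, ht, h⟩); exact ⟨k, h, rfl⟩⟩⟩⟩
  have hK : CX K0 := ⟨Or.inl rfl, fun s hs t hts => by
    rcases t.eq_empty_or_nonempty with rfl | hne
    · exact Or.inl rfl
    · have hsn : s ≠ ∅ := by rintro rfl; exact hne.ne_empty (subset_empty.1 hts)
      exact Or.inr (hC.2.2 _ (hs.resolve_left hsn) _ (image_subset_image hts) (hne.image _))⟩
  have hvt : ∀ k, {k} ∈ K0 := fun k => by
    obtain ⟨t, ht, hk⟩ := mem_verts.1 (hm k)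
    exact Or.inr (hC.2.2 _ ht _ (by simpa using hk) (by simp))
  have hne : ∃ b, {b} ∈ K0 := by
    obtain ⟨t, ht⟩ := hC.1
    have : t.Nonempty := by rw [nonempty_iff_ne_empty]; rintro rfl; exact hC.2.1 ht
    obtain ⟨v, hv⟩ := this
    obtain ⟨k, _⟩ := hr v (mem_verts.2 ⟨t, ht, hv⟩)
    exact ⟨k, hvt k⟩
  have hZ : ZS d K0 := zs_of hlab hv hsph
  have hS : ∀ b, {b} ∈ K0 → Sph (d - 1 + 1) (Lk K0 b) := fun b hb =>
    sph_of_comb (hL (lab b) (hm b)) (lab_link hC hlab hb)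
  have hd : 1 ≤ d := dim_pos hK hZ hS hne
  have hMf : Mfd d K0 := by
    have e : d - 1 + 1 = d := by omega
    rw [e] at hS; exact hS
  have fin : Sph (d + 1) K0 → IsCombSphere d M := fun h => comb_of_sph hC.2.1 hlab hK hne h
  constructor
  · intro hn8
    obtain ⟨s, hs, hsc⟩ := facet_ex hK hMf hne
    obtain ⟨x, hx⟩ := card_pos.1 (by omega : 0 < s.card)
    refine fin (core hK hZ hd hMf hne (A := s) (x := x) ⟨hx, fun t _ hts => hK.down s hs _ ?_⟩ (by omega))
    exact insert_subset hx hts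
  · rintro hn9 hns i hi ⟨A, hA, -, -, hβ, hα, hαc, -⟩
    apply hns
    have hβA : bcore M A ⊆ A := filter_subset _ _
    have hcard : (bcore M A).card + (i + 1) = d + 2 := by
      rw [← hαc, ← hA, add_comm]; exact card_sdiff_add_card_eq_card hβA
    have hβm : ∀ y ∈ bcore M A, A.erase y ∈ M := fun y hy => (mem_filter.1 hy).2
    have hAv : ∀ v ∈ A, v ∈ verts M := fun v hv => by
      obtain ⟨y, hy, hyv⟩ := exists_mem_ne (by omega : 1 < (bcore M A).card) v
      exact mem_verts.2 ⟨_, hβm y hy, mem_erase.2 ⟨hyv.symm, hv⟩⟩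
    let A0 : Finset (Fin n) := univ.filter fun k => lab k ∈ A
    have hA0 : A0.image lab = A := by
      ext v; simp only [A0, mem_image, mem_filter, mem_univ, true_and]
      exact ⟨fun ⟨k, hk, e⟩ => e ▸ hk, fun h => by obtain ⟨k, rfl⟩ := hr v (hAv v h); exact ⟨k, h, rfl⟩⟩
    have hA0c : A0.card = d + 2 := by rw [← hA, ← hA0, card_image_of_injective _ hl]
    obtain ⟨v, hvα⟩ := card_pos.1 (by omega : 0 < (A \ bcore M A).card)
    obtain ⟨hvA, hvβ⟩ := mem_sdiff.1 hvα
    obtain ⟨x, rfl⟩ := hr v (hAv v hvA)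
    refine fin (core hK hZ hd hMf hne (A := A0) (x := x) ⟨by simpa [A0] using hvA, fun s hs hsA => ?_⟩ (by omega))
    have hsA' : s.image lab ⊆ A := hA0 ▸ image_subset_image hsA
    by_cases hsub : bcore M A ⊆ s.image lab
    · exfalso
      have hbn : (bcore M A).Nonempty := card_pos.1 (by omega)
      have hsn : s ≠ ∅ := by rintro rfl; exact hbn.ne_empty (subset_empty.1 (by simpa using hsub))
      exact hβ (hC.2.2 _ (hs.resolve_left hsn) _ hsub hbn)
    · obtain ⟨y, hy, hys⟩ := not_subset.1 hsub
      refine Or.inr (hC.2.2 _ (hβm y hy) _ ?_ ((insert_nonempty _ _).image _))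
      rw [image_insert]
      refine insert_subset (mem_erase.2 ⟨fun e => hvβ (e ▸ hy), hvA⟩) fun w hw =>
        mem_erase.2 ⟨fun e => hys (e ▸ hw), hsA' hw⟩

end AS

end HS

noncomputable section

attribute [local instance] Classical.propDecidable

namespace HomologySpheres

variable {V : Type*} [DecidableEq V] {W : Type*} [DecidableEq W]

/-- Corollary 5: for an `n`-vertex combinatorial triangulation `M`
of an integral homology `d`-sphere: (a) if `n ≤ d + 8` then `M` is a
combinatorial sphere; (b) if `n = d + 9` and `M` is not a combinatorial sphere
then `M` admits no bistellar `i`-move for `i < d`. -/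
theorem integral_homology_sphere_recognition {V : Type*} [DecidableEq V]
    (d n : ℕ) (M : Finset (Finset V))
    (hM : IsCombManifold d M) (hn : (verts M).card = n)
    (hsph : ZHomologySphere d M) :
    (n ≤ d + 8 → IsCombSphere d M) ∧
    (n = d + 9 → ¬ IsCombSphere d M →
      ∀ i < d, ¬ ∃ A : Finset V, BistellarIMove d i M A) := by
  exact HS.main_thm d n M hM hn hsph

end HomologySpheres

end
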